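/- Let G be a finite group such that the rational group algebra ℚG has no exceptional components of type (II), i.e. there is no surjective ℚ-algebra homomorphism from ℚG onto a 2×2 matrix algebra M₂(D) where D is a finite-dimensional division ℚ-algebra containing an order with finite unit group (this hypothesis holds, for example, when the order of G is odd). Then the following are equivalent: (1) the unit group of ℤG has property FAb, i.e. every finite-index subgroup of (ℤG)ˣ has finite abelianization; (2) the abelianization of (ℤG)ˣ is finite; (3) G is a cut group. -/

import Mathlib

namespace FAbCut
open scoped ComplexConjugate
open WeakDual

/-- The first coordinate on the two-torus, as a complex valued function. -/
def coordOne : C(Circle × Circle, ℂ) := ⟨fun z => (z.1 : ℂ), by fun_prop⟩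
/-- The second coordinate on the two-torus, as a complex valued function. -/
def coordTwo : C(Circle × Circle, ℂ) := ⟨fun z => (z.2 : ℂ), by fun_prop⟩

section
variable {A : Type*} [CStarAlgebra A]

theorem exists_torus_calculus (u v : A) (hu : star u * u = 1) (hu' : u * star u = 1)
    (hv : star v * v = 1) (hv' : v * star v = 1) (huv : u * v = v * u) :
    ∃ Φ : C(Circle × Circle, ℂ) →⋆ₐ[ℂ] A, Φ coordOne = u ∧ Φ coordTwo = v := by
  have key : u * star v = star v * u := by
    calc u * star v = (star v * v) * (u * star v) := by rw [hv, one_mul]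
      _ = star v * (u * v) * star v := by rw [huv]; simp only [mul_assoc]
      _ = star v * u := by simp only [mul_assoc, hv', mul_one]
  have key' : v * star u = star u * v := by
    have := congrArg star key; simpa using this
  have hcomm : ∀ a ∈ ({u, v} : Set A), ∀ b ∈ ({u, v} : Set A), a * b = b * a := by
    rintro a (rfl | rfl) b (rfl | rfl) <;> simp [huv]
  have hcomm' : ∀ a ∈ ({u, v} : Set A), ∀ b ∈ ({u, v} : Set A), a * star b = star b * a := by
    rintro a (rfl | rfl) b (rfl | rfl)
    · rw [hu, hu']
    · exact key
    · exact key'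
    · rw [hv, hv']
  let S₀ := StarAlgebra.adjoin ℂ ({u, v} : Set A)
  have hS₀ : ∀ x y : S₀, x * y = y * x :=
    (StarAlgebra.isMulCommutative_adjoin ℂ hcomm hcomm').is_comm.comm
  let S := S₀.topologicalClosure
  have hcl : IsClosed (S : Set A) := S₀.isClosed_topologicalClosure
  have hS : ∀ x y : S, x * y = y * x :=
    (S₀.commRingTopologicalClosure hS₀).mul_comm
  let _ : CommCStarAlgebra S :=
    { StarSubalgebra.cstarAlgebra S (h_closed := hcl) with mul_comm := hS }
  have hle : S₀ ≤ S := S₀.le_topologicalClosure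
  let U : S := ⟨u, hle (StarAlgebra.subset_adjoin ℂ _ (by simp))⟩
  let V : S := ⟨v, hle (StarAlgebra.subset_adjoin ℂ _ (by simp))⟩
  have hU : star U * U = 1 := Subtype.ext hu
  have hV : star V * V = 1 := Subtype.ext hv
  have mem (W : S) (hW : star W * W = 1) (φ : characterSpace ℂ S) :
      gelfandStarTransform S W φ ∈ Submonoid.unitSphere ℂ := by
    have h := congrArg (fun f => f φ) (congrArg (gelfandStarTransform S) hW)
    simp only [map_mul, map_star, map_one, ContinuousMap.mul_apply, ContinuousMap.star_apply,
      ContinuousMap.one_apply] at h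
    have h2 : ‖gelfandStarTransform S W φ‖ * ‖gelfandStarTransform S W φ‖ = 1 := by
      simpa using congrArg norm h
    have h3 : ‖gelfandStarTransform S W φ‖ = 1 := by
      nlinarith [norm_nonneg (gelfandStarTransform S W φ)]
    simpa [Submonoid.unitSphere] using h3
  let z : C(characterSpace ℂ S, Circle × Circle) :=
    ⟨fun φ => (⟨gelfandStarTransform S U φ, mem U hU φ⟩, ⟨gelfandStarTransform S V φ, mem V hV φ⟩),
      by
        refine Continuous.prodMk ?_ ?_
        · exact Continuous.subtype_mk (map_continuous _) _
        · exact Continuous.subtype_mk (map_continuous _) _⟩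
  refine ⟨S.subtype.comp (((gelfandStarTransform S).symm : _ →⋆ₐ[ℂ] S).comp
    (z.compStarAlgHom' ℂ ℂ)), ?_, ?_⟩
  · have : z.compStarAlgHom' ℂ ℂ coordOne = gelfandStarTransform S U := by
      ext φ; rfl
    simp [StarAlgHom.comp_apply, this, U]
  · have : z.compStarAlgHom' ℂ ℂ coordTwo = gelfandStarTransform S V := by
      ext φ; rfl
    simp [StarAlgHom.comp_apply, this, V]

theorem torus_starAlgHom_ext {Φ Ψ : C(Circle × Circle, ℂ) →⋆ₐ[ℂ] A}
    (h1 : Φ coordOne = Ψ coordOne) (h2 : Φ coordTwo = Ψ coordTwo) : Φ = Ψ := by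
  let S : StarSubalgebra ℂ C(Circle × Circle, ℂ) := StarAlgebra.adjoin ℂ {coordOne, coordTwo}
  have hsep : S.SeparatesPoints := by
    rintro ⟨a, b⟩ ⟨c, d⟩ hne
    by_cases hac : a = c
    · refine ⟨_, ⟨coordTwo, StarAlgebra.subset_adjoin ℂ _ (by simp), rfl⟩, ?_⟩
      intro h
      exact hne (Prod.ext hac (Circle.ext h))
    · refine ⟨_, ⟨coordOne, StarAlgebra.subset_adjoin ℂ _ (by simp), rfl⟩, ?_⟩
      intro h
      exact hac (Circle.ext h)
  have htop := ContinuousMap.starSubalgebra_topologicalClosure_eq_top_of_separatesPoints S hsep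
  have hΦ : Continuous Φ :=
    AddMonoidHomClass.continuous_of_bound Φ 1 fun f => by
      simpa using NonUnitalStarAlgHom.norm_apply_le Φ f
  have hΨ : Continuous Ψ :=
    AddMonoidHomClass.continuous_of_bound Ψ 1 fun f => by
      simpa using NonUnitalStarAlgHom.norm_apply_le Ψ f
  have hS : ∀ f ∈ S, Φ f = Ψ f := by
    intro f hf
    have : S ≤ StarAlgHom.equalizer Φ Ψ := by
      refine StarAlgebra.adjoin_le ?_
      rintro f (rfl | rfl)
      · exact h1
      · exact h2
    exact this hf
  have hd : Dense (S : Set C(Circle × Circle, ℂ)) := by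
    rw [dense_iff_closure_eq, ← StarSubalgebra.topologicalClosure_coe, htop]; rfl
  have := Continuous.ext_on hd hΦ hΨ hS
  exact DFunLike.coe_injective this
end
end FAbCut

namespace FAbCut
open MeasureTheory Filter Topology CompactlySupported

noncomputable instance : MeasurableSpace (Circle × Circle) := borel _
instance : BorelSpace (Circle × Circle) := ⟨rfl⟩

section
variable {E : Type*} [NormedAddCommGroup E] [InnerProductSpace ℂ E] [CompleteSpace E]

/-- A real continuous function, regarded as a complex valued one. -/
def complexify {X : Type*} [TopologicalSpace X] (f : C(X, ℝ)) : C(X, ℂ) :=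
  ⟨fun x => (f x : ℂ), by fun_prop⟩

theorem inner_torus_calculus (Φ : C(Circle × Circle, ℂ) →⋆ₐ[ℂ] (E →L[ℂ] E)) (v : E)
    (g : C(Circle × Circle, ℂ)) :
    inner ℂ v (Φ (star g * g) v) = ((‖Φ g v‖ ^ 2 : ℝ) : ℂ) := by
  rw [map_mul, map_star, ContinuousLinearMap.star_eq_adjoint, mul_apply_eq_comp,
    ContinuousLinearMap.adjoint_inner_right, inner_self_eq_norm_sq_to_K]
  simp

theorem exists_spectral_measure (Φ : C(Circle × Circle, ℂ) →⋆ₐ[ℂ] (E →L[ℂ] E)) (v : E) :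
    ∃ μ : Measure (Circle × Circle), IsFiniteMeasure μ ∧
      ∀ g : C(Circle × Circle, ℂ), ∫ z, ‖g z‖ ^ 2 ∂μ = ‖Φ g v‖ ^ 2 := by
  let L : C_c(Circle × Circle, ℝ) →ₗ[ℝ] ℝ :=
    { toFun := fun f => (inner ℂ v (Φ (complexify (f : C(Circle × Circle, ℝ))) v)).re
      map_add' := fun f g => by
        have : complexify ((f + g : C_c(Circle × Circle, ℝ)) : C(Circle × Circle, ℝ)) =
            complexify (f : C(Circle × Circle, ℝ)) + complexify (g : C(Circle × Circle, ℝ)) := by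
          ext x; simp [complexify]
        rw [this]; simp
      map_smul' := fun c f => by
        have : complexify ((c • f : C_c(Circle × Circle, ℝ)) : C(Circle × Circle, ℝ)) =
            (c : ℂ) • complexify (f : C(Circle × Circle, ℝ)) := by
          ext x; simp [complexify]
        rw [this, map_smul Φ, smul_apply, inner_smul_right]; simp }
  have hL : ∀ f : C_c(Circle × Circle, ℝ), 0 ≤ f → 0 ≤ L f := by
    intro f hf
    have hf' : ∀ x, 0 ≤ f x := hf
    let g : C(Circle × Circle, ℂ) := complexify ⟨fun x => √(f x), by fun_prop⟩
    have : complexify (f : C(Circle × Circle, ℝ)) = star g * g := by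
      ext x
      simp only [complexify, g, ContinuousMap.coe_mk, ContinuousMap.mul_apply,
        ContinuousMap.star_apply, RCLike.star_def, Complex.conj_ofReal]
      rw [← Complex.ofReal_mul, Real.mul_self_sqrt (hf' x)]
    change 0 ≤ (inner ℂ v (Φ (complexify (f : C(Circle × Circle, ℝ))) v)).re
    rw [this, inner_torus_calculus, Complex.ofReal_re]
    positivity
  let Λ : C_c(Circle × Circle, ℝ) →ₚ[ℝ] ℝ :=
    { L with
      monotone' := fun f g hfg => by
        have h := hL (g - f) (sub_nonneg.2 hfg)
        rw [map_sub] at h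
        exact sub_nonneg.1 h }
  refine ⟨RealRMK.rieszMeasure Λ, ?_, fun g => ?_⟩
  · constructor
    exact isCompact_univ.measure_lt_top
  · let f : C_c(Circle × Circle, ℝ) := CompactlySupportedContinuousMap.continuousMapEquiv
      ⟨fun z => ‖g z‖ ^ 2, by fun_prop⟩
    have := RealRMK.integral_rieszMeasure Λ f
    have h2 : complexify (f : C(Circle × Circle, ℝ)) = star g * g := by
      ext x
      change ((‖g x‖ ^ 2 : ℝ) : ℂ) = star (g x) * g x
      rw [RCLike.star_def, RCLike.conj_mul]; simp
    change ∫ z, f z ∂_ = _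
    rw [this]
    change (inner ℂ v (Φ (complexify (f : C(Circle × Circle, ℝ))) v)).re = _
    rw [h2, inner_torus_calculus, Complex.ofReal_re]

/-- Two finite measures whose integrals of squares of norms are close are close on Borel sets. -/
theorem measureReal_le_of_integral_sq_le {μ ν : Measure (Circle × Circle)} [IsFiniteMeasure μ]
    [IsFiniteMeasure ν] {ε : ℝ}
    (h : ∀ g : C(Circle × Circle, ℂ), (∀ z, ‖g z‖ ≤ 1) →
      ∫ z, ‖g z‖ ^ 2 ∂μ ≤ ∫ z, ‖g z‖ ^ 2 ∂ν + ε)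
    {S : Set (Circle × Circle)} (hS : MeasurableSet S) : μ.real S ≤ ν.real S + ε := by
  have closed : ∀ F : Set (Circle × Circle), IsClosed F → μ.real F ≤ ν.real F + ε := by
    intro F hF
    let δ : ℕ → ℝ := fun n => 1 / ((n : ℝ) + 1)
    have hδ : ∀ n, 0 < δ n := fun n => by positivity
    have hδ0 : Tendsto δ atTop (𝓝 0) := tendsto_one_div_add_atTop_nhds_zero_nat
    have hlim := thickenedIndicator_tendsto_indicator_closure hδ hδ0 F
    rw [hF.closure_eq, tendsto_pi_nhds] at hlim
    let g : ℕ → C(Circle × Circle, ℂ) := fun n =>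
      ⟨fun z => ((thickenedIndicator (hδ n) F z : ℝ) : ℂ), by fun_prop⟩
    have hg : ∀ n z, ‖g n z‖ = (thickenedIndicator (hδ n) F z : ℝ) := fun n z => by
      simp [g]
    have hg1 : ∀ n z, ‖g n z‖ ≤ 1 := fun n z => by
      rw [hg]; exact_mod_cast thickenedIndicator_le_one (hδ n) F z
    have conv : ∀ (m : Measure (Circle × Circle)) [IsFiniteMeasure m],
        Tendsto (fun n => ∫ z, ‖g n z‖ ^ 2 ∂m) atTop (𝓝 (m.real F)) := by
      intro m _
      have : m.real F = ∫ z, F.indicator (fun _ => (1 : ℝ)) z ∂m := by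
        rw [integral_indicator hF.measurableSet]; simp
      rw [this]
      refine tendsto_integral_of_dominated_convergence (fun _ => (1 : ℝ)) (fun n => ?_)
        (integrable_const _) (fun n => ?_) ?_
      · exact (by fun_prop : Continuous fun z => ‖g n z‖ ^ 2).aestronglyMeasurable
      · refine Eventually.of_forall fun z => ?_
        rw [norm_pow, norm_norm]
        exact pow_le_one₀ (norm_nonneg _) (hg1 n z)
      · refine Eventually.of_forall fun z => ?_
        have h1 := (NNReal.tendsto_coe.2 (hlim z)).pow 2
        simp only [hg]
        convert h1 using 2
        by_cases hz : z ∈ F <;> simp [hz]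
    exact le_of_tendsto_of_tendsto' (conv μ) ((conv ν).add_const ε) fun n => h _ (hg1 n)
  refine le_of_forall_pos_le_add fun η hη => ?_
  obtain ⟨F, hFS, hF, hlt⟩ := hS.exists_isClosed_lt_add (μ := μ) (measure_ne_top _ _)
    (ε := ENNReal.ofReal η) (by simpa using hη)
  have h1 : μ.real S ≤ μ.real F + η := by
    have := ENNReal.toReal_mono (by finiteness) hlt.le
    rwa [ENNReal.toReal_add (by finiteness) (by finiteness), ENNReal.toReal_ofReal hη.le] at this
  have h2 := closed F hF
  have h3 : ν.real F ≤ ν.real S := measureReal_mono hFS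
  linarith
end
end FAbCut

namespace FAbCut
open MeasureTheory Filter Topology

/-- If two shears move the mass of a measure only slightly, then the mass of the closed quadrants
`0 ≤ x y`, off the axis `x = 0`, is small. -/
theorem measureReal_sector_le {X : Type*} [MeasurableSpace X] (m : Measure X) [IsFiniteMeasure m]
    {x y : X → ℝ} (hx : Measurable x) (hy : Measurable y) {P Q : X → X} {c a η : ℝ}
    (hP : ∀ S, MeasurableSet S → m.real (P ⁻¹' S) ≤ m.real S + a)
    (hQ : ∀ S, MeasurableSet S → m.real (Q ⁻¹' S) ≤ m.real S + a)
    (hPx : ∀ t, |x t| ≤ c → |y t| ≤ c → x (P t) = x t ∧ y (P t) = x t + y t)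
    (hQx : ∀ t, |x t| ≤ c → |y t| ≤ c → x (Q t) = x t + y t ∧ y (Q t) = y t)
    (hη : m.real {t | |x t| ≤ c ∧ |y t| ≤ c}ᶜ ≤ η) :
    m.real {t | x t ≠ 0 ∧ 0 ≤ x t * y t ∧ |x t| ≤ c ∧ |y t| ≤ c} ≤ 2 * a + η := by
  set S := {t | x t ≠ 0 ∧ 0 ≤ x t * y t ∧ |x t| ≤ c ∧ |y t| ≤ c} with hS
  let SP := {t | (x t ≠ 0 ∧ 0 ≤ x t * y t) ∧ |x t| ≤ |y t|}
  let SQ := {t | (x t ≠ 0 ∧ 0 ≤ x t * y t) ∧ |y t| < |x t|}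
  have m0 : MeasurableSet {t | x t ≠ 0 ∧ 0 ≤ x t * y t} :=
    (measurableSet_eq_fun hx measurable_const).compl.inter
      (measurableSet_le measurable_const (hx.mul hy))
  have mSP : MeasurableSet SP := m0.inter (measurableSet_le hx.abs hy.abs)
  have mSQ : MeasurableSet SQ := m0.inter (measurableSet_lt hy.abs hx.abs)
  have h1 : m.real S ≤ m.real SP + a := by
    refine (measureReal_mono ?_).trans (hP SP mSP)
    rintro t ⟨h0, h1, h2, h3⟩
    obtain ⟨e1, e2⟩ := hPx t h2 h3
    refine ⟨⟨by rwa [e1], ?_⟩, ?_⟩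
    · rw [e1, e2]; nlinarith [sq_nonneg (x t)]
    · rw [e1, e2]; apply sq_le_sq.1; nlinarith [sq_nonneg (x t)]
  have h2 : m.real S ≤ m.real SQ + a := by
    refine (measureReal_mono ?_).trans (hQ SQ mSQ)
    rintro t ⟨h0, h1, h2, h3⟩
    obtain ⟨e1, e2⟩ := hQx t h2 h3
    have h4 : 0 < x t ^ 2 := by positivity
    refine ⟨⟨?_, ?_⟩, ?_⟩
    · rw [e1]; intro h; nlinarith [sq_nonneg (x t + y t), sq_nonneg (y t)]
    · rw [e1, e2]; nlinarith [sq_nonneg (y t)]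
    · rw [e1, e2]; apply sq_lt_sq.1; nlinarith
  have h3 : m.real SP + m.real SQ ≤ m.real S + η := by
    rw [← measureReal_union _ mSQ]
    · refine (measureReal_mono (s₂ := S ∪ {t | |x t| ≤ c ∧ |y t| ≤ c}ᶜ) ?_).trans
        ((measureReal_union_le _ _).trans (by gcongr))
      rintro t (⟨h, -⟩ | ⟨h, -⟩) <;>
      · by_cases ht : |x t| ≤ c ∧ |y t| ≤ c
        · exact Or.inl ⟨h.1, h.2, ht⟩
        · exact Or.inr ht
    · rw [Set.disjoint_left]
      rintro t ⟨-, h⟩ ⟨-, h'⟩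
      exact absurd h (not_le.2 h')
  linarith

section
variable {E : Type*} [NormedAddCommGroup E] [InnerProductSpace ℂ E] [CompleteSpace E]

theorem conj_torus_calculus (Φ : C(Circle × Circle, ℂ) →⋆ₐ[ℂ] (E →L[ℂ] E))
    (p : unitary (E →L[ℂ] E)) (T : C(Circle × Circle, Circle × Circle))
    (h1 : (p : E →L[ℂ] E) * Φ coordOne = Φ (coordOne.comp T) * p)
    (h2 : (p : E →L[ℂ] E) * Φ coordTwo = Φ (coordTwo.comp T) * p)
    (f : C(Circle × Circle, ℂ)) :
    (p : E →L[ℂ] E) * Φ f = Φ (f.comp T) * p := by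
  have key : ∀ f, (Unitary.conjStarAlgAut ℂ (E →L[ℂ] E) p : _ →⋆ₐ[ℂ] _).comp Φ f =
      (p : E →L[ℂ] E) * Φ f * star (p : E →L[ℂ] E) := fun f => rfl
  have e : (Unitary.conjStarAlgAut ℂ (E →L[ℂ] E) p : _ →⋆ₐ[ℂ] _).comp Φ =
      Φ.comp (T.compStarAlgHom' ℂ ℂ) := by
    refine torus_starAlgHom_ext ?_ ?_
    · rw [key, h1, mul_assoc, Unitary.mul_star_self_of_mem p.2, mul_one]; rfl
    · rw [key, h2, mul_assoc, Unitary.mul_star_self_of_mem p.2, mul_one]; rfl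
  have := key f
  rw [e] at this
  change Φ (f.comp T) = _ at this
  rw [this, mul_assoc, Unitary.star_mul_self_of_mem p.2, mul_one]

theorem measureReal_preimage_le {Φ : C(Circle × Circle, ℂ) →⋆ₐ[ℂ] (E →L[ℂ] E)}
    {v : E} (hv : ‖v‖ = 1) {μ : Measure (Circle × Circle)} [IsFiniteMeasure μ]
    (hμ : ∀ g : C(Circle × Circle, ℂ), ∫ z, ‖g z‖ ^ 2 ∂μ = ‖Φ g v‖ ^ 2)
    (p : unitary (E →L[ℂ] E)) (T : C(Circle × Circle, Circle × Circle))
    (h1 : (p : E →L[ℂ] E) * Φ coordOne = Φ (coordOne.comp T) * p)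
    (h2 : (p : E →L[ℂ] E) * Φ coordTwo = Φ (coordTwo.comp T) * p) {ε : ℝ}
    (hp : ‖(p : E →L[ℂ] E) v - v‖ ≤ ε) (S : Set (Circle × Circle)) (hS : MeasurableSet S) :
    μ.real (T ⁻¹' S) ≤ μ.real S + 2 * ε := by
  have hT : Measurable T := T.continuous.measurable
  rw [← map_measureReal_apply hT hS]
  refine measureReal_le_of_integral_sq_le (fun g hg => ?_) hS
  rw [hμ, integral_map hT.aemeasurable (by fun_prop)]
  have e1 := hμ (g.comp T)
  simp only [ContinuousMap.comp_apply] at e1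
  rw [e1]
  set w : E := star (p : E →L[ℂ] E) v with hw
  have hpw : (p : E →L[ℂ] E) w = v := by
    rw [hw, ← mul_apply_eq_comp, Unitary.mul_star_self_of_mem p.2]; rfl
  have iso : ∀ x, ‖(p : E →L[ℂ] E) x‖ = ‖x‖ := fun x =>
    (Unitary.linearIsometryEquiv p).norm_map x
  have e2 : ‖Φ (g.comp T) v‖ = ‖Φ g w‖ := by
    rw [← iso (Φ g w), ← mul_apply_eq_comp, conj_torus_calculus Φ p T h1 h2, mul_apply_eq_comp,
      hpw]
  have hwn : ‖w‖ = 1 := by rw [← iso w, hpw, hv]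
  have hwv : ‖w - v‖ ≤ ε := by
    rw [← iso, map_sub, hpw, norm_sub_rev]; exact hp
  have hΦ : ∀ x, ‖Φ g x‖ ≤ ‖x‖ := fun x => by
    have h3 : ‖Φ g‖ ≤ 1 := (NonUnitalStarAlgHom.norm_apply_le Φ g).trans
      ((ContinuousMap.norm_le _ zero_le_one).2 hg)
    exact ((Φ g).le_opNorm x).trans (mul_le_of_le_one_left (norm_nonneg _) h3)
  rw [e2]
  have h4 : ‖Φ g w‖ ≤ ‖Φ g v‖ + ε := by
    calc ‖Φ g w‖ = ‖Φ g v + Φ g (w - v)‖ := by rw [map_sub]; simp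
      _ ≤ ‖Φ g v‖ + ‖Φ g (w - v)‖ := norm_add_le _ _
      _ ≤ _ := by gcongr; exact (hΦ _).trans hwv
  have h5 := hΦ v
  have h6 := hΦ w
  have h7 := norm_nonneg (Φ g v)
  have h8 := norm_nonneg (Φ g w)
  have h9 : 0 ≤ ε := (norm_nonneg _).trans hwv
  nlinarith

theorem measureReal_preimage_one_eq_zero {Φ : C(Circle × Circle, ℂ) →⋆ₐ[ℂ] (E →L[ℂ] E)}
    {v : E} {μ : Measure (Circle × Circle)} [IsFiniteMeasure μ]
    (hμ : ∀ g : C(Circle × Circle, ℂ), ∫ z, ‖g z‖ ^ 2 ∂μ = ‖Φ g v‖ ^ 2)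
    (u : unitary (E →L[ℂ] E)) (hu : Φ coordOne = u)
    (hfix : ∀ w, (u : E →L[ℂ] E) w = w → w = 0) :
    μ.real {z | z.1 = 1} = 0 := by
  have hm : MeasurableSet {z : Circle × Circle | z.1 = 1} :=
    (isClosed_eq continuous_fst continuous_const).measurableSet
  have iso : ∀ x, ‖(u : E →L[ℂ] E) x‖ = ‖x‖ := fun x =>
    (Unitary.linearIsometryEquiv u).norm_map x
  have hlim := (u : E →L[ℂ] E).tendsto_birkhoffAverage_orthogonalProjection
    (ContinuousLinearMap.opNorm_le_bound _ zero_le_one fun x => by rw [iso, one_mul]) v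
  have h0 : (((u : E →L[ℂ] E).eqLocus (1 : E →L[ℂ] E)).orthogonalProjectionOnto v : E) = 0 :=
    hfix _ (((u : E →L[ℂ] E).eqLocus (1 : E →L[ℂ] E)).orthogonalProjectionOnto v).2
  rw [h0] at hlim
  let g : ℕ → C(Circle × Circle, ℂ) := fun N => (N : ℂ)⁻¹ • ∑ k ∈ Finset.range N, coordOne ^ k
  have hg : ∀ N, Φ (g N) v = birkhoffAverage ℂ (u : E →L[ℂ] E) _root_.id N v := by
    intro N
    simp only [g, map_smul, map_sum, map_pow, hu, smul_apply, birkhoffAverage, birkhoffSum,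
      sum_apply]
    congr 1
    refine Finset.sum_congr rfl fun k _ => ?_
    rw [FunLike.coe_pow_eq_iterate]; rfl
  have hle : ∀ N : ℕ, N ≠ 0 → μ.real {z | z.1 = 1} ≤
      ‖birkhoffAverage ℂ (u : E →L[ℂ] E) _root_.id N v‖ ^ 2 := by
    intro N hN
    rw [← hg, ← hμ]
    have hone : ∀ z ∈ {z : Circle × Circle | z.1 = 1}, ‖g N z‖ ^ 2 = (1 : ℝ) := by
      rintro ⟨a, b⟩ (rfl : a = 1)
      have : (N : ℂ) ≠ 0 := by exact_mod_cast hN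
      simp [g, coordOne, this]
    have h1 : μ.real {z | z.1 = 1} = ∫ z in {z | z.1 = 1}, ‖g N z‖ ^ 2 ∂μ := by
      rw [setIntegral_congr_fun hm hone]; simp
    rw [h1]
    have hc : Continuous fun z => ‖g N z‖ ^ 2 := by fun_prop
    refine setIntegral_le_integral ?_ (Eventually.of_forall fun z => by positivity)
    exact hc.integrable_of_hasCompactSupport (HasCompactSupport.of_compactSpace _)
  have h2 : μ.real {z | z.1 = 1} ≤ 0 := by
    have h3 : Tendsto (fun N : ℕ => ‖birkhoffAverage ℂ (u : E →L[ℂ] E) _root_.id N v‖ ^ 2)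
        atTop (𝓝 0) := by simpa using hlim.norm.pow 2
    exact ge_of_tendsto h3 ((eventually_ne_atTop 0).mono hle)
  exact le_antisymm h2 measureReal_nonneg

theorem measureReal_arg_gt_le {Φ : C(Circle × Circle, ℂ) →⋆ₐ[ℂ] (E →L[ℂ] E)}
    {v : E} {μ : Measure (Circle × Circle)} [IsFiniteMeasure μ]
    (hμ : ∀ g : C(Circle × Circle, ℂ), ∫ z, ‖g z‖ ^ 2 ∂μ = ‖Φ g v‖ ^ 2)
    (f : C(Circle × Circle, ℂ)) (hf : ∀ z, ‖f z‖ = 1) {ε : ℝ} (h : ‖Φ f v - v‖ ≤ ε) :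
    μ.real {z | |(f z).arg| ≤ Real.pi / 4}ᶜ ≤ 2 * ε ^ 2 := by
  have e : ∫ z, ‖(f - 1) z‖ ^ 2 ∂μ ≤ ε ^ 2 := by
    rw [hμ, map_sub, map_one]
    exact pow_le_pow_left₀ (norm_nonneg _) (by simpa using h) 2
  have hc : Continuous fun z => ‖(f - 1) z‖ ^ 2 := by fun_prop
  have hi : Integrable (fun z => ‖(f - 1) z‖ ^ 2) μ :=
    hc.integrable_of_hasCompactSupport (HasCompactSupport.of_compactSpace _)
  have hmk := mul_meas_ge_le_integral_of_nonneg (Eventually.of_forall fun z => by positivity) hi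
    (1 / 2 : ℝ)
  have hsub : μ.real {z | |(f z).arg| ≤ Real.pi / 4}ᶜ ≤ μ.real {z | 1 / 2 ≤ ‖(f - 1) z‖ ^ 2} := by
    refine measureReal_mono fun z hz => ?_
    have hz' : Real.pi / 4 < |(f z).arg| := not_le.1 hz
    have h1 : (f z).re = Real.cos |(f z).arg| := by
      rw [Real.cos_abs, ← Complex.norm_mul_cos_arg (f z), hf, one_mul]
    have h2 : Real.cos |(f z).arg| ≤ Real.cos (Real.pi / 4) :=
      Real.cos_le_cos_of_nonneg_of_le_pi (by positivity) (Complex.abs_arg_le_pi _) hz'.le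
    have h3 : √2 / 2 ≤ 3 / 4 := by
      have : √2 ≤ 3 / 2 := Real.sqrt_le_iff.2 ⟨by norm_num, by norm_num⟩
      linarith
    have h4 : ‖(f - 1) z‖ ^ 2 = 2 - 2 * (f z).re := by
      have h5 := Complex.sq_norm (f z)
      rw [hf, Complex.normSq_apply] at h5
      have : (f - 1) z = f z - 1 := rfl
      rw [this, Complex.sq_norm, Complex.normSq_apply]
      simp only [Complex.sub_re, Complex.one_re, Complex.sub_im, Complex.one_im]
      nlinarith
    have h6 := Real.cos_pi_div_four
    change 1 / 2 ≤ ‖(f - 1) z‖ ^ 2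
    rw [h4]; linarith
  linarith

/-- A form of Shalom's spectral argument for the pair `(SL₂(ℤ) ⋉ ℤ², ℤ²)`: almost invariant vectors
force an honest invariant vector of the first coordinate translation. -/
theorem exists_fixed_vector (u₁ u₂ p q : unitary (E →L[ℂ] E)) (h12 : u₁ * u₂ = u₂ * u₁)
    (hp1 : p * u₁ = u₁ * p) (hp2 : p * u₂ = u₁ * u₂ * p) (hq1 : q * u₁ = u₁ * u₂ * q)
    (hq2 : q * u₂ = u₂ * q) {v : E} (hv : ‖v‖ = 1)
    (hu₁ : ‖(u₁ : E →L[ℂ] E) v - v‖ ≤ 1 / 100) (hu₂ : ‖(u₂ : E →L[ℂ] E) v - v‖ ≤ 1 / 100)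
    (hp : ‖(p : E →L[ℂ] E) v - v‖ ≤ 1 / 100) (hq : ‖(q : E →L[ℂ] E) v - v‖ ≤ 1 / 100) :
    ∃ w : E, w ≠ 0 ∧ (u₁ : E →L[ℂ] E) w = w := by
  by_contra! hfix
  replace hfix : ∀ w, (u₁ : E →L[ℂ] E) w = w → w = 0 := fun w hw => by
    by_contra h; exact hfix w h hw
  obtain ⟨Φ, hΦ1, hΦ2⟩ := exists_torus_calculus (u₁ : E →L[ℂ] E) u₂
    (Unitary.star_mul_self_of_mem u₁.2) (Unitary.mul_star_self_of_mem u₁.2)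
    (Unitary.star_mul_self_of_mem u₂.2) (Unitary.mul_star_self_of_mem u₂.2)
    (congrArg Subtype.val h12)
  obtain ⟨μ, hfin, hμ⟩ := exists_spectral_measure Φ v
  let Tp : C(Circle × Circle, Circle × Circle) := ⟨fun z => (z.1, z.1 * z.2), by fun_prop⟩
  let Tq : C(Circle × Circle, Circle × Circle) := ⟨fun z => (z.1 * z.2, z.2), by fun_prop⟩
  let Rp : C(Circle × Circle, Circle × Circle) := ⟨fun z => (z.1, z.1⁻¹ * z.2), by fun_prop⟩
  let Rq : C(Circle × Circle, Circle × Circle) := ⟨fun z => (z.1 * z.2⁻¹, z.2), by fun_prop⟩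
  have eTp : coordTwo.comp Tp = coordOne * coordTwo := by ext z; simp [coordOne, coordTwo, Tp]
  have eTq : coordOne.comp Tq = coordOne * coordTwo := by ext z; simp [coordOne, coordTwo, Tq]
  have eRp : coordTwo.comp Rp = star coordOne * coordTwo := by
    ext z; simp [coordOne, coordTwo, Rp, ← Circle.coe_inv_eq_conj]
  have eRq : coordOne.comp Rq = coordOne * star coordTwo := by
    ext z; simp [coordOne, coordTwo, Rq, ← Circle.coe_inv_eq_conj]
  have bTp := measureReal_preimage_le hv hμ p Tp
    (by change _ = Φ coordOne * _; rw [hΦ1]; exact congrArg Subtype.val hp1)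
    (by rw [eTp, map_mul, hΦ1, hΦ2]; exact congrArg Subtype.val hp2) hp
  have bTq := measureReal_preimage_le hv hμ q Tq
    (by rw [eTq, map_mul, hΦ1, hΦ2]; exact congrArg Subtype.val hq1)
    (by change _ = Φ coordTwo * _; rw [hΦ2]; exact congrArg Subtype.val hq2) hq
  have inv_le : ∀ r : unitary (E →L[ℂ] E), ‖(r : E →L[ℂ] E) v - v‖ ≤ 1 / 100 →
      ‖((r⁻¹ : unitary (E →L[ℂ] E)) : E →L[ℂ] E) v - v‖ ≤ 1 / 100 := by
    intro r hr
    have iso : ∀ x, ‖(r : E →L[ℂ] E) x‖ = ‖x‖ := fun x =>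
      (Unitary.linearIsometryEquiv r).norm_map x
    rw [← iso, map_sub, ← mul_apply_eq_comp, ← Submonoid.coe_mul, mul_inv_cancel, norm_sub_rev]
    exact hr
  have bRp := measureReal_preimage_le hv hμ p⁻¹ Rp
    (by
      change _ = Φ coordOne * _; rw [hΦ1]
      have : p⁻¹ * u₁ = u₁ * p⁻¹ := by
        rw [inv_mul_eq_iff_eq_mul, ← mul_assoc, hp1, mul_assoc, mul_inv_cancel, mul_one]
      exact congrArg Subtype.val this)
    (by
      rw [eRp, map_mul, map_star, hΦ1, hΦ2]
      have : p⁻¹ * u₂ = u₁⁻¹ * u₂ * p⁻¹ := by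
        have h1 : p * u₁⁻¹ = u₁⁻¹ * p := by
          rw [mul_inv_eq_iff_eq_mul, mul_assoc, hp1, inv_mul_cancel_left]
        rw [inv_mul_eq_iff_eq_mul, ← mul_assoc, ← mul_assoc, h1, mul_assoc u₁⁻¹, hp2]; group
      exact congrArg Subtype.val this) (inv_le p hp)
  have bRq := measureReal_preimage_le hv hμ q⁻¹ Rq
    (by
      rw [eRq, map_mul, map_star, hΦ1, hΦ2]
      have : q⁻¹ * u₁ = u₁ * u₂⁻¹ * q⁻¹ := by
        have h1 : q * u₂⁻¹ = u₂⁻¹ * q := by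
          rw [mul_inv_eq_iff_eq_mul, mul_assoc, hq2, inv_mul_cancel_left]
        rw [inv_mul_eq_iff_eq_mul, ← mul_assoc, ← mul_assoc, hq1, mul_assoc _ q, h1]; group
      exact congrArg Subtype.val this)
    (by
      change _ = Φ coordTwo * _; rw [hΦ2]
      have : q⁻¹ * u₂ = u₂ * q⁻¹ := by
        rw [inv_mul_eq_iff_eq_mul, ← mul_assoc, hq2, mul_assoc, mul_inv_cancel, mul_one]
      exact congrArg Subtype.val this) (inv_le q hq)
  have hx0 := measureReal_preimage_one_eq_zero hμ u₁ hΦ1 hfix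
  have hQ1 := measureReal_arg_gt_le hμ coordOne (fun z => Circle.norm_coe _)
    (ε := 1 / 100) (by rw [hΦ1]; exact hu₁)
  have hQ2 := measureReal_arg_gt_le hμ coordTwo (fun z => Circle.norm_coe _)
    (ε := 1 / 100) (by rw [hΦ2]; exact hu₂)
  let x : Circle × Circle → ℝ := fun z => (z.1 : ℂ).arg
  let y : Circle × Circle → ℝ := fun z => (z.2 : ℂ).arg
  have hx : Measurable x := Complex.measurable_arg.comp coordOne.continuous.measurable
  have hy : Measurable y := Complex.measurable_arg.comp coordTwo.continuous.measurable
  have hQ : μ.real {z | |x z| ≤ Real.pi / 4 ∧ |y z| ≤ Real.pi / 4}ᶜ ≤ 4 * (1 / 100) ^ 2 := by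
    have : {z | |x z| ≤ Real.pi / 4 ∧ |y z| ≤ Real.pi / 4}ᶜ ⊆
        {z | |(coordOne z).arg| ≤ Real.pi / 4}ᶜ ∪ {z | |(coordTwo z).arg| ≤ Real.pi / 4}ᶜ := by
      rw [← Set.compl_inter]; exact subset_rfl
    refine (measureReal_mono this).trans ((measureReal_union_le _ _).trans ?_)
    linarith
  have arg_mul : ∀ a b : Circle, |(a : ℂ).arg| ≤ Real.pi / 4 → |(b : ℂ).arg| ≤ Real.pi / 4 →
      ((a * b : Circle) : ℂ).arg = (a : ℂ).arg + (b : ℂ).arg := by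
    intro a b ha hb
    have h1 := abs_le.1 ha
    have h2 := abs_le.1 hb
    rw [Circle.coe_mul, Complex.arg_mul_eq_add_arg_iff (Circle.coe_ne_zero a) (Circle.coe_ne_zero b)]
    constructor <;> linarith [Real.pi_pos]
  have arg_inv : ∀ a : Circle, |(a : ℂ).arg| ≤ Real.pi / 4 →
      ((a⁻¹ : Circle) : ℂ).arg = -(a : ℂ).arg := by
    intro a ha
    have h1 := abs_le.1 ha
    rw [Circle.coe_inv, Complex.arg_inv, if_neg]
    intro h; linarith [Real.pi_pos]
  have arg_inv' : ∀ a : Circle, |(a : ℂ).arg| ≤ Real.pi / 4 →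
      |((a⁻¹ : Circle) : ℂ).arg| ≤ Real.pi / 4 := by
    intro a ha; rw [arg_inv a ha, abs_neg]; exact ha
  have s1 := measureReal_sector_le μ hx hy (P := Tp) (Q := Tq) bTp bTq
    (fun t h1 h2 => ⟨rfl, arg_mul _ _ h1 h2⟩) (fun t h1 h2 => ⟨arg_mul _ _ h1 h2, rfl⟩) hQ
  have s2 := measureReal_sector_le μ hx hy.neg (P := Rp) (Q := Rq) (c := Real.pi / 4) bRp bRq
    (fun t h1 h2 => by
      rw [Pi.neg_apply, abs_neg] at h2
      refine ⟨rfl, ?_⟩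
      have : y (Rp t) = -x t + y t := by
        change ((t.1⁻¹ * t.2 : Circle) : ℂ).arg = _
        rw [arg_mul _ _ (arg_inv' _ h1) h2, arg_inv _ h1]
      rw [Pi.neg_apply, Pi.neg_apply, this]; ring)
    (fun t h1 h2 => by
      rw [Pi.neg_apply, abs_neg] at h2
      refine ⟨?_, rfl⟩
      change ((t.1 * t.2⁻¹ : Circle) : ℂ).arg = _
      rw [arg_mul _ _ h1 (arg_inv' _ h2), arg_inv _ h2]; rfl)
    (by simpa using hQ)
  have htot : μ.real Set.univ = 1 := by
    have := hμ 1
    simpa [hv] using this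
  have hcover : (Set.univ : Set (Circle × Circle)) ⊆
      (({z | z.1 = 1} ∪ {z | |x z| ≤ Real.pi / 4 ∧ |y z| ≤ Real.pi / 4}ᶜ) ∪
        {z | x z ≠ 0 ∧ 0 ≤ x z * y z ∧ |x z| ≤ Real.pi / 4 ∧ |y z| ≤ Real.pi / 4}) ∪
        {z | x z ≠ 0 ∧ 0 ≤ x z * (-y) z ∧ |x z| ≤ Real.pi / 4 ∧ |(-y) z| ≤ Real.pi / 4} := by
    intro z _
    by_cases h1 : z.1 = 1
    · exact Or.inl (Or.inl (Or.inl h1))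
    by_cases h2 : |x z| ≤ Real.pi / 4 ∧ |y z| ≤ Real.pi / 4
    · have h3 : x z ≠ 0 := by
        intro h3
        refine h1 ?_
        rw [← Circle.exp_arg z.1]
        change Circle.exp (x z) = 1
        rw [h3, Circle.exp_zero]
      rcases le_total 0 (x z * y z) with h4 | h4
      · exact Or.inl (Or.inr ⟨h3, h4, h2⟩)
      · refine Or.inr ⟨h3, ?_, h2.1, ?_⟩
        · rw [Pi.neg_apply]; linarith
        · rw [Pi.neg_apply, abs_neg]; exact h2.2
    · exact Or.inl (Or.inl (Or.inr h2))
  have hle := measureReal_mono (μ := μ) hcover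
  have h1 := hle.trans ((measureReal_union_le _ _).trans (add_le_add ((measureReal_union_le _ _).trans
    (add_le_add (measureReal_union_le _ _) le_rfl)) le_rfl))
  rw [htot, hx0] at h1
  norm_num at h1 s1 s2 hQ
  linarith

end
end FAbCut

namespace FAbCut
open Filter Topology

/-- A system of matrix units in a ring. -/
structure MatrixUnits (ι R : Type*) [DecidableEq ι] [Fintype ι] [Ring R] where
  /-- The matrix units. -/
  e : ι → ι → R
  mul_eq : ∀ i j k l, e i j * e k l = if j = k then e i l else 0
  sum_eq : ∑ i, e i i = 1

namespace MatrixUnits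
variable {ι R : Type*} [DecidableEq ι] [Fintype ι] [Ring R] (U : MatrixUnits ι R)

@[simp] theorem mul_same (i j l : ι) : U.e i j * U.e j l = U.e i l := by simp [U.mul_eq]

theorem mul_ne {j k : ι} (h : j ≠ k) (i l : ι) : U.e i j * U.e k l = 0 := by simp [U.mul_eq, h]

theorem block_sq {i j : ι} (h : i ≠ j) (r s : R) :
    U.e i i * r * U.e j j * (U.e i i * s * U.e j j) = 0 := by
  have : U.e i i * r * U.e j j * (U.e i i * s * U.e j j) =
      U.e i i * r * (U.e j j * U.e i i) * s * U.e j j := by simp only [mul_assoc]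
  rw [this, U.mul_ne h.symm]; simp

/-- The elementary unit `1 + e i i * r * e j j`. -/
def elem {i j : ι} (h : i ≠ j) (r : R) : Rˣ where
  val := 1 + U.e i i * r * U.e j j
  inv := 1 - U.e i i * r * U.e j j
  val_inv := by
    rw [add_mul, mul_sub, one_mul, mul_sub, U.block_sq h]; simp
  inv_val := by
    rw [sub_mul, mul_add, one_mul, mul_add, U.block_sq h]; simp

@[simp] theorem val_elem {i j : ι} (h : i ≠ j) (r : R) :
    (U.elem h r : R) = 1 + U.e i i * r * U.e j j := rfl

/-- The subgroup generated by elementary units. -/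
def elemSubgroup : Subgroup Rˣ :=
  Subgroup.closure {x | ∃ (i j : ι) (h : i ≠ j) (r : R), x = U.elem h r}

theorem elem_mem {i j : ι} (h : i ≠ j) (r : R) : U.elem h r ∈ U.elemSubgroup :=
  Subgroup.subset_closure ⟨i, j, h, r, rfl⟩

theorem elem_add {i j : ι} (h : i ≠ j) (r s : R) : U.elem h (r + s) = U.elem h r * U.elem h s := by
  ext
  simp only [val_elem, Units.val_mul, mul_add, add_mul, one_mul, mul_one, U.block_sq h]
  abel

theorem elem_commutator {i j k : ι} (hij : i ≠ j) (hjk : j ≠ k) (hik : i ≠ k) (r : R) :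
    U.elem hik r = U.elem hij (r * U.e k j) * U.elem hjk (U.e j k) *
      (U.elem hij (r * U.e k j))⁻¹ * (U.elem hjk (U.e j k))⁻¹ := by
  rw [eq_mul_inv_iff_mul_eq, eq_mul_inv_iff_mul_eq]
  ext
  simp only [val_elem, Units.val_mul]
  have h1 : U.e i i * (r * U.e k j) * U.e j j = U.e i i * r * U.e k j := by
    simp only [mul_assoc, mul_same]
  have h2 : U.e j j * U.e j k * U.e k k = U.e j k := by simp
  rw [h1, h2]
  have a1 : U.e j k * (U.e i i * r * U.e k j) = 0 := by
    simp only [← mul_assoc, U.mul_ne hik.symm, zero_mul]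
  have a2 : U.e i i * r * U.e k k * U.e j k = 0 := by
    simp only [mul_assoc, U.mul_ne hjk.symm, mul_zero]
  have a3 : U.e i i * r * U.e k k * (U.e i i * r * U.e k j) = 0 := by
    rw [mul_assoc (U.e i i * r), ← mul_assoc (U.e k k), ← mul_assoc (U.e k k), U.mul_ne hik.symm]
    simp
  have a4 : U.e i i * r * U.e k j * U.e j k = U.e i i * r * U.e k k := by
    rw [mul_assoc, mul_same]
  simp only [mul_add, add_mul, one_mul, mul_one, a1, a2, a3, a4, zero_mul, add_zero]
  abel

section
variable [Algebra ℝ R]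

/-- The copy of a real two by two matrix in the coordinates `i`, `j`. -/
noncomputable def plane (i j : ι) (a b c d : ℝ) : R :=
  1 + (a - 1) • U.e i i + b • U.e i j + c • U.e j i + (d - 1) • U.e j j

theorem plane_mul {i j : ι} (h : i ≠ j) (a b c d a' b' c' d' : ℝ) :
    U.plane i j a b c d * U.plane i j a' b' c' d' =
      U.plane i j (a * a' + b * c') (a * b' + b * d') (c * a' + d * c') (c * b' + d * d') := by
  simp only [plane, mul_add, add_mul, one_mul, mul_one, smul_mul_smul_comm, mul_same,
    U.mul_ne h, U.mul_ne h.symm, smul_zero]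
  module

theorem elem_smul_eq_plane {i j : ι} (h : i ≠ j) (t : ℝ) :
    (U.elem h (t • U.e i j) : R) = U.plane i j 1 t 0 1 := by
  simp [plane]

theorem elem_smul_eq_plane' {i j : ι} (h : i ≠ j) (t : ℝ) :
    (U.elem h.symm (t • U.e j i) : R) = U.plane i j 1 0 t 1 := by
  simp [plane]

/-- The unit with entries `2`, `1/2` in coordinates `i`, `j`. -/
noncomputable def torusUnit {i j : ι} (h : i ≠ j) : Rˣ :=
  U.elem h ((1 : ℝ) • U.e i j) * U.elem h.symm ((1 : ℝ) • U.e j i) *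
    U.elem h ((-1 / 2 : ℝ) • U.e i j) * U.elem h.symm ((-2 : ℝ) • U.e j i)

theorem torusUnit_mem {i j : ι} (h : i ≠ j) : U.torusUnit h ∈ U.elemSubgroup :=
  mul_mem (mul_mem (mul_mem (U.elem_mem _ _) (U.elem_mem _ _)) (U.elem_mem _ _)) (U.elem_mem _ _)

theorem val_torusUnit {i j : ι} (h : i ≠ j) : (U.torusUnit h : R) = U.plane i j 2 0 0 (1 / 2) := by
  simp only [torusUnit, Units.val_mul, U.elem_smul_eq_plane h, U.elem_smul_eq_plane' h, U.plane_mul h]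
  norm_num

theorem val_torusUnit_pow {i j : ι} (h : i ≠ j) (n : ℕ) :
    ((U.torusUnit h ^ n : Rˣ) : R) = U.plane i j (2 ^ n) 0 0 ((1 / 2) ^ n) := by
  induction n with
  | zero => simp [plane]
  | succ n ih => rw [pow_succ, Units.val_mul, ih, val_torusUnit, U.plane_mul h]; simp [pow_succ]

theorem val_torusUnit_pow_inv {i j : ι} (h : i ≠ j) (n : ℕ) :
    (((U.torusUnit h ^ n)⁻¹ : Rˣ) : R) = U.plane i j ((1 / 2) ^ n) 0 0 (2 ^ n) := by
  rw [Units.inv_eq_of_mul_eq_one_right]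
  rw [val_torusUnit_pow, U.plane_mul h]
  have : (2 : ℝ) ^ n * (1 / 2) ^ n = 1 := by rw [← mul_pow]; norm_num
  simp [plane, this, mul_comm ((1 / 2 : ℝ) ^ n)]

theorem mautner_identity {i j : ι} (h : i ≠ j) {t : ℝ} (ht : t ≠ 0) :
    U.elem h ((2 * t) • U.e i j) * U.elem h.symm ((1 / (2 * t)) • U.e j i) *
      U.elem h ((-t) • U.e i j) = U.torusUnit h * U.elem h.symm ((1 / t) • U.e j i) := by
  ext
  simp only [Units.val_mul, val_torusUnit, U.elem_smul_eq_plane h, U.elem_smul_eq_plane' h, U.plane_mul h]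
  congr 1 <;> field_simp <;> ring

end

section
variable [Algebra ℝ R]

theorem plane_mul_e {i j : ι} (h : i ≠ j) (a d : ℝ) (k l : ι) :
    U.plane i j a 0 0 d * U.e k l = (if k = i then a else if k = j then d else 1) • U.e k l := by
  simp only [plane, add_mul, one_mul, zero_smul, add_zero, smul_mul_assoc, U.mul_eq]
  split_ifs with h1 h2 h3 h4 h5 <;> first | (subst_vars; simp_all; done) | skip
  all_goals subst_vars
  all_goals simp_all
  all_goals module

theorem e_mul_plane {i j : ι} (h : i ≠ j) (a d : ℝ) (k l : ι) :
    U.e k l * U.plane i j a 0 0 d = (if l = i then a else if l = j then d else 1) • U.e k l := by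
  simp only [plane, mul_add, mul_one, zero_smul, add_zero, mul_smul_comm, U.mul_eq]
  split_ifs with h1 h2 h3 h4 h5 <;> first | (subst_vars; simp_all; done) | skip
  all_goals subst_vars
  all_goals simp_all
  all_goals module

theorem conj_elem {i j : ι} (h : i ≠ j) (r : R) (u : Rˣ) (s t : ℝ)
    (hs : (u : R) * U.e i i = s • U.e i i) (ht : U.e j j * (u⁻¹ : Rˣ) = t • U.e j j) :
    ((u * U.elem h r * u⁻¹ : Rˣ) : R) = 1 + (s * t) • (U.e i i * r * U.e j j) := by
  have : (u : R) * (U.e i i * r * U.e j j) * (u⁻¹ : Rˣ) =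
      ((u : R) * U.e i i) * r * (U.e j j * (u⁻¹ : Rˣ)) := by simp only [mul_assoc]
  rw [Units.val_mul, Units.val_mul, val_elem, mul_add, add_mul, mul_one, Units.mul_inv, this,
    hs, ht]
  simp [smul_smul, mul_comm]

end

section mautner
variable {R : Type*} [NormedRing R] [NormedAlgebra ℝ R] (U : MatrixUnits ι R)
  {H : Type*} [NormedAddCommGroup H] [InnerProductSpace ℂ H]
  (π : U.elemSubgroup →* (H ≃ₗᵢ[ℂ] H))

theorem map_mul_apply (g h : U.elemSubgroup) (v : H) : π (g * h) v = π g (π h v) := by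
  rw [map_mul]; rfl

/-- The subgroup of elements fixing a vector. -/
def fixer (F : H) : Subgroup U.elemSubgroup where
  carrier := {g | π g F = F}
  mul_mem' {a b} ha hb := by
    simp only [Set.mem_ofPred_eq] at *
    rw [map_mul_apply, hb, ha]
  one_mem' := by simp
  inv_mem' {a} ha := by
    simp only [Set.mem_ofPred_eq] at *
    conv_lhs => rw [← ha]
    rw [← map_mul_apply]
    simp

theorem mem_fixer {F : H} {g : U.elemSubgroup} : g ∈ U.fixer π F ↔ π g F = F := Iff.rfl

variable {U π}
variable (hcont : ∀ g : ℕ → U.elemSubgroup, Tendsto (fun n => ((g n : Rˣ) : R)) atTop (𝓝 1) →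
    ∀ v, Tendsto (fun n => π (g n) v) atTop (𝓝 v))
include hcont

theorem mem_fixer_of_conj_tendsto {F : H} {x : U.elemSubgroup} {b : ℕ → U.elemSubgroup}
    (hb : ∀ n, b n ∈ U.fixer π F)
    (h : Tendsto (fun n => (((b n * x * (b n)⁻¹ : U.elemSubgroup) : Rˣ) : R)) atTop (𝓝 1)) :
    x ∈ U.fixer π F := by
  have h1 := hcont _ h F
  have h2 : ∀ n, ‖π (b n * x * (b n)⁻¹) F - F‖ = ‖π x F - F‖ := fun n => by
    have e1 : π (b n)⁻¹ F = F := inv_mem (hb n)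
    have e2 : π (b n) F = F := hb n
    rw [map_mul_apply, map_mul_apply, e1]
    nth_rewrite 2 [← e2]
    rw [← map_sub, LinearIsometryEquiv.norm_map]
  have h3 := (h1.sub_const F).norm
  simp only [h2, sub_self, norm_zero] at h3
  rw [mem_fixer, ← sub_eq_zero, ← norm_eq_zero]
  exact tendsto_nhds_unique tendsto_const_nhds h3

theorem elem_mem_fixer_of_torus {F : H} {i j : ι} (h : i ≠ j)
    (ha : ⟨U.torusUnit h, U.torusUnit_mem h⟩ ∈ U.fixer π F) {k : ι} (hk : i ≠ k) (r : R) :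
    ⟨U.elem hk r, U.elem_mem hk r⟩ ∈ U.fixer π F ∧
      ⟨U.elem hk.symm r, U.elem_mem hk.symm r⟩ ∈ U.fixer π F := by
  set a : U.elemSubgroup := ⟨U.torusUnit h, U.torusUnit_mem h⟩ with ha_def
  have hpow : Tendsto (fun n : ℕ => (1 / 2 : ℝ) ^ n) atTop (𝓝 0) :=
    tendsto_pow_atTop_nhds_zero_of_lt_one (by norm_num) (by norm_num)
  have hlim : ∀ y : R, Tendsto (fun n : ℕ => 1 +
      ((1 / 2 : ℝ) ^ n * (if k = i then 2 ^ n else if k = j then (1 / 2 : ℝ) ^ n else 1)) • y)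
      atTop (𝓝 1) := fun y => by
    have h0 : Tendsto (fun n : ℕ =>
      ((1 / 2 : ℝ) ^ n * (if k = i then 2 ^ n else if k = j then (1 / 2 : ℝ) ^ n else 1)))
      atTop (𝓝 0) := by
      simp only [hk.symm, if_false]
      split_ifs
      · simpa using hpow.mul hpow
      · simpa using hpow
    simpa using (h0.smul_const y).const_add (1 : R)
  constructor
  · refine mem_fixer_of_conj_tendsto hcont (b := fun n => (a ^ n)⁻¹)
      (fun n => inv_mem (pow_mem ha n)) ?_
    refine (hlim (U.e i i * r * U.e k k)).congr fun n => ?_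
    have := U.conj_elem hk r ((U.torusUnit h ^ n)⁻¹) ((1 / 2) ^ n)
      (if k = i then 2 ^ n else if k = j then (1 / 2 : ℝ) ^ n else 1)
      (by rw [val_torusUnit_pow_inv, U.plane_mul_e h, if_pos rfl])
      (by rw [inv_inv, val_torusUnit_pow, U.e_mul_plane h])
    rw [← this]
    rfl
  · refine mem_fixer_of_conj_tendsto hcont (b := fun n => (a ^ n))
      (fun n => (pow_mem ha n)) ?_
    refine (hlim (U.e k k * r * U.e i i)).congr fun n => ?_
    have := U.conj_elem hk.symm r (U.torusUnit h ^ n)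
      (if k = i then 2 ^ n else if k = j then (1 / 2 : ℝ) ^ n else 1) ((1 / 2) ^ n)
      (by rw [val_torusUnit_pow, U.plane_mul_e h])
      (by rw [val_torusUnit_pow_inv, U.e_mul_plane h, if_pos rfl])
    rw [mul_comm ((1 / 2 : ℝ) ^ n), ← this]
    rfl

theorem fixer_eq_top_of_torus {F : H} {i j : ι} (h : i ≠ j)
    (ha : ⟨U.torusUnit h, U.torusUnit_mem h⟩ ∈ U.fixer π F) : U.fixer π F = ⊤ := by
  have key : ∀ {k l : ι} (hkl : k ≠ l) (r : R),
      ⟨U.elem hkl r, U.elem_mem hkl r⟩ ∈ U.fixer π F := by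
    intro k l hkl r
    by_cases hk : k = i
    · subst hk; exact (elem_mem_fixer_of_torus hcont h ha hkl r).1
    by_cases hl : l = i
    · subst hl; exact (elem_mem_fixer_of_torus hcont h ha hkl.symm r).2
    have h1 := fun s => (elem_mem_fixer_of_torus hcont h ha (Ne.symm hk) s).2
    have h2 := fun s => (elem_mem_fixer_of_torus hcont h ha (Ne.symm hl) s).1
    have := mul_mem (mul_mem (mul_mem (h1 (r * U.e l i)) (h2 (U.e i l)))
      (inv_mem (h1 (r * U.e l i)))) (inv_mem (h2 (U.e i l)))
    convert this using 1
    exact Subtype.ext (U.elem_commutator hk (Ne.symm hl) hkl r)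
  have hle : U.elemSubgroup ≤ (U.fixer π F).map U.elemSubgroup.subtype := by
    refine (Subgroup.closure_le _).2 ?_
    rintro _ ⟨k, l, hkl, r, rfl⟩
    exact ⟨⟨U.elem hkl r, U.elem_mem hkl r⟩, key hkl r, rfl⟩
  rw [eq_top_iff]
  intro g _
  obtain ⟨g', hg', he⟩ := hle g.2
  have : g' = g := Subtype.ext he
  exact this ▸ hg'

theorem torus_mem_fixer {F : H} {i j : ι} (h : i ≠ j)
    (h1 : ∀ n : ℕ, ⟨U.elem h ((n : ℝ) • U.e i j), U.elem_mem h _⟩ ∈ U.fixer π F) :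
    ⟨U.torusUnit h, U.torusUnit_mem h⟩ ∈ U.fixer π F := by
  set a : U.elemSubgroup := ⟨U.torusUnit h, U.torusUnit_mem h⟩ with ha_def
  let x : ℝ → U.elemSubgroup := fun t => ⟨U.elem h (t • U.e i j), U.elem_mem h _⟩
  let y : ℝ → U.elemSubgroup := fun t => ⟨U.elem h.symm (t • U.e j i), U.elem_mem h.symm _⟩
  have hx : ∀ n : ℕ, π (x n) F = F := h1
  have hxn : ∀ n : ℕ, π (x (-n)) F = F := fun n => by
    have : x (-n) = (x n)⁻¹ := by
      rw [eq_inv_iff_mul_eq_one]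
      refine Subtype.ext ?_
      change U.elem h ((-n : ℝ) • U.e i j) * U.elem h ((n : ℝ) • U.e i j) = 1
      rw [← U.elem_add h]
      ext; simp
    rw [this]
    exact inv_mem (show x n ∈ U.fixer π F from hx n)
  have hy : ∀ c : ℝ, Tendsto (fun n : ℕ => π (y (c * (1 / ((n : ℝ) + 1)))) F) atTop (𝓝 F) := fun c => by
    refine hcont _ ?_ F
    have h0 := ((tendsto_one_div_add_atTop_nhds_zero_nat (𝕜 := ℝ)).const_mul c).smul_const (U.e j i)
    have := h0.const_add (1 : R)
    simp only [mul_zero, zero_smul, add_zero] at this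
    refine this.congr fun n => ?_
    simp [y]
  have hid : ∀ n : ℕ, x ((2 * (n + 1) : ℕ)) * y (1 / 2 * (1 / ((n : ℝ) + 1))) * x (-((n + 1 : ℕ) : ℝ)) =
      a * y (1 * (1 / ((n : ℝ) + 1))) := fun n => by
    have hn : ((n : ℝ) + 1) ≠ 0 := by positivity
    have := U.mautner_identity h hn
    refine Subtype.ext ?_
    simp only [x, y, a, Subgroup.coe_mul]
    rw [one_mul, ← this]
    push_cast
    rw [← one_div_mul_one_div]
  have e1 : ∀ n : ℕ, ‖π a (π (y (1 * (1 / ((n : ℝ) + 1)))) F) - F‖ =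
      ‖π (y (1 / 2 * (1 / ((n : ℝ) + 1)))) F - F‖ := fun n => by
    rw [← map_mul_apply, ← hid n, map_mul_apply, map_mul_apply, hxn]
    conv_lhs => enter [1, 2]; rw [← hx (2 * (n + 1))]
    rw [← map_sub, LinearIsometryEquiv.norm_map]
  have l1 := ((((π a).continuous.tendsto F).comp (hy 1)).sub_const F).norm
  have l2 := ((hy (1 / 2)).sub_const F).norm
  simp only [Function.comp_def, e1] at l1
  have := tendsto_nhds_unique l1 l2
  rw [sub_self, norm_zero, norm_eq_zero, sub_eq_zero] at this
  exact this

/-- Property (T) for the elementary group, in the form of an explicit Kazhdan set. -/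
theorem exists_invariant_vector [CompleteSpace H] {i j k : ι} (hij : i ≠ j) (hjk : j ≠ k)
    (hik : i ≠ k) {v : H} (hv : ‖v‖ = 1)
    (h1 : ‖π ⟨U.elem hik (U.e i k), U.elem_mem _ _⟩ v - v‖ ≤ 1 / 100)
    (h2 : ‖π ⟨U.elem hjk (U.e j k), U.elem_mem _ _⟩ v - v‖ ≤ 1 / 100)
    (h3 : ‖π ⟨U.elem hij (U.e i j), U.elem_mem _ _⟩ v - v‖ ≤ 1 / 100)
    (h4 : ‖π ⟨U.elem hij.symm (U.e j i), U.elem_mem _ _⟩ v - v‖ ≤ 1 / 100) :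
    ∃ w ≠ 0, ∀ g, π g w = w := by
  let ρ : U.elemSubgroup →* unitary (H →L[ℂ] H) :=
    (Unitary.linearIsometryEquiv.symm.toMonoidHom).comp π
  have hρ : ∀ g v, (ρ g : H →L[ℂ] H) v = π g v := fun g v => rfl
  let u₁ : U.elemSubgroup := ⟨U.elem hik (U.e i k), U.elem_mem _ _⟩
  let u₂ : U.elemSubgroup := ⟨U.elem hjk (U.e j k), U.elem_mem _ _⟩
  let p : U.elemSubgroup := ⟨U.elem hij (U.e i j), U.elem_mem _ _⟩
  let q : U.elemSubgroup := ⟨U.elem hij.symm (U.e j i), U.elem_mem _ _⟩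
  have m1 := U.mul_ne hij
  have m2 := U.mul_ne hij.symm
  have m3 := U.mul_ne hjk
  have m4 := U.mul_ne hjk.symm
  have m5 := U.mul_ne hik
  have m6 := U.mul_ne hik.symm
  obtain ⟨w, hw0, hw⟩ := exists_fixed_vector (ρ u₁) (ρ u₂) (ρ p) (ρ q)
    (by
      rw [← map_mul, ← map_mul]; congr 1; ext
      simp [u₁, u₂, mul_add, add_mul, m1, m2, m3, m4, m5, m6]; abel)
    (by
      rw [← map_mul, ← map_mul]; congr 1; ext
      simp [u₁, p, mul_add, add_mul, m1, m2, m3, m4, m5, m6]; abel)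
    (by
      rw [← map_mul, ← map_mul, ← map_mul]; congr 1; ext
      simp [u₁, u₂, p, mul_add, add_mul, m1, m2, m3, m4, m5, m6]; abel)
    (by
      rw [← map_mul, ← map_mul, ← map_mul]; congr 1; ext
      simp [u₁, u₂, q, mul_add, add_mul, m1, m2, m3, m4, m5, m6]; abel)
    (by
      rw [← map_mul, ← map_mul]; congr 1; ext
      simp [u₂, q, mul_add, add_mul, m1, m2, m3, m4, m5, m6]; abel)
    hv h1 h2 h3 h4
  rw [hρ] at hw
  refine ⟨w, hw0, fun g => ?_⟩
  have hn : ∀ n : ℕ, ⟨U.elem hik ((n : ℝ) • U.e i k), U.elem_mem hik _⟩ ∈ U.fixer π w := by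
    intro n
    have : (⟨U.elem hik ((n : ℝ) • U.e i k), U.elem_mem hik _⟩ : U.elemSubgroup) = u₁ ^ n := by
      refine Subtype.ext ?_
      rw [Subgroup.coe_pow]
      induction n with
      | zero => ext; simp
      | succ n ih =>
        rw [pow_succ, ← ih]
        simp only [u₁]
        rw [← U.elem_add]
        congr 1; push_cast; rw [add_smul, one_smul]
    rw [this]
    exact pow_mem hw n
  have := fixer_eq_top_of_torus hcont hik (torus_mem_fixer hcont hik hn)
  have hg : g ∈ U.fixer π w := this ▸ Subgroup.mem_top g
  exact hg

end mautner
end MatrixUnits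
end FAbCut

namespace FAbCut

/-- The inclusion of the rational circle into the real one. -/
noncomputable def ratAddCircle : AddCircle (1 : ℚ) →+ AddCircle (1 : ℝ) :=
  QuotientAddGroup.map _ _ (Rat.castHom ℝ).toAddMonoidHom (by
    rintro _ ⟨n, rfl⟩
    exact ⟨n, by simp⟩)

theorem ratAddCircle_injective : Function.Injective ratAddCircle := by
  rw [injective_iff_map_eq_zero]
  intro x hx
  induction x using QuotientAddGroup.induction_on with
  | H q =>
    have h : ((q : ℝ) : AddCircle (1 : ℝ)) = 0 := hx
    rw [AddCircle.coe_eq_zero_iff] at h ⊢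
    obtain ⟨n, hn⟩ := h
    exact ⟨n, by simp only [zsmul_eq_mul, mul_one] at *; exact_mod_cast hn⟩

theorem infinite_characterModule (A : Type*) [AddCommGroup A] [Infinite A] :
    Infinite (CharacterModule A) := by
  by_contra hfin
  rw [not_infinite_iff_finite] at hfin
  set m := Nat.card (CharacterModule A)
  have hm : 0 < m := Nat.card_pos
  have htor : ∀ (c : CharacterModule A) a, m • c a = 0 := fun c a => by
    have : m • c = 0 := card_nsmul_eq_zero'
    exact DFunLike.congr_fun this a
  have hf : Finite {u : AddCircle (1 : ℚ) // m • u = 0} :=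
    (AddCircle.finite_torsion (1 : ℚ) hm).to_subtype
  let Φ : A → CharacterModule A → {u : AddCircle (1 : ℚ) // m • u = 0} := fun a c =>
    ⟨c a, htor c a⟩
  have hΦ : Function.Injective Φ := fun a b hab => by
    by_contra hne
    obtain ⟨c, hc⟩ := CharacterModule.exists_character_apply_ne_zero_of_ne_zero (sub_ne_zero.2 hne)
    refine hc ?_
    have := congrArg Subtype.val (congrFun hab c)
    rw [map_sub, sub_eq_zero]
    exact this
  exact not_finite_iff_infinite.2 ‹_› (Finite.of_injective Φ hΦ)

/-- The circle-valued character of a character module element. -/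
noncomputable def charHom {A : Type*} [CommGroup A] (c : CharacterModule (Additive A)) :
    A →* Circle where
  toFun a := AddCircle.toCircle (ratAddCircle (c (Additive.ofMul a)))
  map_one' := by simp
  map_mul' a b := by simp [AddCircle.toCircle_add]

theorem charHom_injective {A : Type*} [CommGroup A] :
    Function.Injective (charHom (A := A)) := fun c d h => by
  ext a
  exact ratAddCircle_injective (AddCircle.injective_toCircle one_ne_zero
    (DFunLike.congr_fun h (Additive.toMul a)))

/-- An infinite abelian group has nontrivial characters arbitrarily close to `1`. -/
theorem exists_char_near_one (A : Type*) [CommGroup A] [Infinite A] (s : Finset A) {ε : ℝ}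
    (hε : 0 < ε) : ∃ χ : A →* Circle, χ ≠ 1 ∧ ∀ a ∈ s, ‖(χ a : ℂ) - 1‖ < ε := by
  have : Infinite (CharacterModule (Additive A)) := infinite_characterModule _
  let Φ : CharacterModule (Additive A) → (s → Circle) := fun c a => charHom c a
  obtain ⟨t, -, htf, hcov⟩ := (isCompact_univ (X := s → Circle)).finite_cover_balls (half_pos hε)
  have : Finite t := htf
  have hex : ∀ c, ∃ y : t, Φ c ∈ Metric.ball (y : s → Circle) (ε / 2) := fun c => by
    have := hcov (Set.mem_univ (Φ c))
    simp only [Set.mem_iUnion, exists_prop] at this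
    obtain ⟨y, hy, h⟩ := this
    exact ⟨⟨y, hy⟩, h⟩
  choose y hy using hex
  obtain ⟨c, d, hne, hcd⟩ := Finite.exists_ne_map_eq_of_infinite y
  refine ⟨charHom c / charHom d, fun h => hne (charHom_injective (div_eq_one.1 h)), fun a ha => ?_⟩
  have h1 := hy c
  have h2 := hy d
  rw [← hcd] at h2
  have h3 : dist (Φ c) (Φ d) < ε := by
    have := dist_triangle_right (Φ c) (Φ d) (y c)
    rw [Metric.mem_ball] at h1 h2
    linarith
  have h4 := (dist_le_pi_dist (Φ c) (Φ d) ⟨a, ha⟩).trans_lt h3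
  have h5 : dist (charHom c a : ℂ) (charHom d a) < ε := h4
  rw [MonoidHom.div_apply, Circle.coe_div, div_sub_one (Circle.coe_ne_zero _), norm_div,
    Circle.norm_coe, div_one, ← dist_eq_norm]
  exact h5
end FAbCut

namespace FAbCut
open Filter Topology MeasureTheory
open scoped ENNReal

theorem tendsto_eLpNorm_comp_sub {X : Type*} [TopologicalSpace X] [T2Space X]
    [LocallyCompactSpace X] [MeasurableSpace X] [BorelSpace X] {μ : Measure X}
    [μ.InnerRegularCompactLTTop] [IsLocallyFiniteMeasure μ] {V : Set X} (hV : IsOpen V)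
    {f : X → ℂ} (hf : ∀ K ⊆ V, IsCompact K → MemLp f 2 (μ.restrict K))
    {T : ℕ → C(X, X)} (hT : Tendsto T atTop (𝓝 (ContinuousMap.id X)))
    (hmp : ∀ n, MeasurePreserving (T n) μ μ) {K : Set X} (hK : IsCompact K) (hKV : K ⊆ V) :
    Tendsto (fun n => eLpNorm (fun x => f (T n x) - f x) 2 (μ.restrict K)) atTop (𝓝 0) := by
  obtain ⟨K', hK'c, hKK', hK'V⟩ := exists_compact_between hK hV hKV
  have hf' : MemLp (K'.indicator f) 2 μ :=
    (memLp_indicator_iff_restrict hK'c.measurableSet).2 (hf K' hK'V hK'c)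
  set F0 : Lp ℂ 2 μ := hf'.toLp _ with hF0
  have h1 := Filter.Tendsto.compMeasurePreservingLp (tendsto_const_nhds (x := F0) (f := atTop))
    hT hmp (MeasurePreserving.id μ) (by simp)
  have h2 : Lp.compMeasurePreserving (ContinuousMap.id X) (MeasurePreserving.id μ) F0 = F0 := by
    refine Lp.ext ?_
    exact (Lp.coeFn_compMeasurePreserving F0 (MeasurePreserving.id μ))
  rw [h2, tendsto_iff_edist_tendsto_0] at h1
  have hev : ∀ᶠ n in atTop, Set.MapsTo (T n) K (interior K') :=
    hT (ContinuousMap.eventually_mapsTo hK isOpen_interior fun x hx => hKK' hx)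
  refine tendsto_of_tendsto_of_tendsto_of_le_of_le' tendsto_const_nhds h1
    (Eventually.of_forall fun _ => zero_le) ?_
  filter_upwards [hev] with n hn
  rw [Lp.edist_def]
  have hae : (⇑(Lp.compMeasurePreserving (T n) (hmp n) F0) - ⇑F0) =ᵐ[μ]
      fun x => K'.indicator f (T n x) - K'.indicator f x := by
    have a1 := Lp.coeFn_compMeasurePreserving F0 (hmp n)
    have a2 : F0 =ᵐ[μ] K'.indicator f := hf'.coeFn_toLp
    have a3 := (hmp n).quasiMeasurePreserving.ae_eq_comp a2
    filter_upwards [a1, a2, a3] with x b1 b2 b3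
    simp only [Function.comp_apply] at b1 b3
    rw [Pi.sub_apply, b1, b2, b3]
  rw [eLpNorm_congr_ae hae]
  refine le_trans (le_of_eq ?_) (eLpNorm_mono_measure _ (Measure.restrict_le_self (s := K)))
  refine eLpNorm_congr_ae ?_
  filter_upwards [ae_restrict_mem hK.measurableSet] with x hx
  rw [Set.indicator_of_mem (interior_subset (hn hx)), Set.indicator_of_mem
    (interior_subset (hKK' hx))]

section
variable {R : Type*} [NormedRing R] [NormedAlgebra ℝ R]

/-- Left multiplication as a continuous function. -/
def leftMulMap (a : R) : C(R, R) := ⟨fun x => a * x, by fun_prop⟩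

/-- Right multiplication as a continuous function. -/
def rightMulMap (a : R) : C(R, R) := ⟨fun x => x * a, by fun_prop⟩

omit [NormedAlgebra ℝ R] in
theorem continuous_leftMulMap : Continuous (leftMulMap (R := R)) :=
  ContinuousMap.continuous_of_continuous_uncurry _ (by
    change Continuous fun p : R × R => p.1 * p.2
    fun_prop)

omit [NormedAlgebra ℝ R] in
theorem continuous_rightMulMap : Continuous (rightMulMap (R := R)) :=
  ContinuousMap.continuous_of_continuous_uncurry _ (by
    change Continuous fun p : R × R => p.2 * p.1
    fun_prop)

variable [FiniteDimensional ℝ R] [MeasurableSpace R] [BorelSpace R] {μ : Measure R}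
  [μ.IsAddHaarMeasure]

omit [FiniteDimensional ℝ R] in
theorem measurePreserving_linear [FiniteDimensional ℝ R] (L : R →ₗ[ℝ] R)
    (hL : |LinearMap.det L| = 1) : MeasurePreserving L μ μ := by
  refine ⟨(LinearMap.continuous_of_finiteDimensional L).measurable, ?_⟩
  have h0 : LinearMap.det L ≠ 0 := fun h => by simp [h] at hL
  rw [Measure.map_linearMap_addHaar_eq_smul_addHaar μ h0, abs_inv, hL]
  simp

theorem quasiMeasurePreserving_linear (L : R →ₗ[ℝ] R)
    (h0 : LinearMap.det L ≠ 0) : Measure.QuasiMeasurePreserving L μ μ := by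
  refine ⟨(LinearMap.continuous_of_finiteDimensional L).measurable, ?_⟩
  rw [Measure.map_linearMap_addHaar_eq_smul_addHaar μ h0]
  exact Measure.smul_absolutelyContinuous

/-- The determinant of right multiplication. -/
noncomputable def rnorm : R →* ℝ where
  toFun x := LinearMap.det (LinearMap.mulRight ℝ x)
  map_one' := by rw [LinearMap.mulRight_one]; simp
  map_mul' x y := by
    rw [mul_comm, ← map_mul]; congr 1; ext z; simp [mul_assoc]

omit [MeasurableSpace R] [BorelSpace R] in
theorem continuous_rnorm : Continuous (rnorm : R → ℝ) := by
  have : (rnorm : R → ℝ) = fun x => (LinearMap.toMatrix (Module.finBasis ℝ R) (Module.finBasis ℝ R)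
      ((LinearMap.mul ℝ R).flip x)).det := by
    ext x
    rw [LinearMap.det_toMatrix]
    rfl
  rw [this]
  refine Continuous.matrix_det ?_
  exact LinearMap.continuous_of_finiteDimensional
    ((LinearMap.toMatrix (Module.finBasis ℝ R) (Module.finBasis ℝ R)).toLinearMap ∘ₗ
      (LinearMap.mul ℝ R).flip)

omit [MeasurableSpace R] [BorelSpace R] in
theorem isUnit_of_rnorm_ne_zero {x : R} (h : rnorm x ≠ 0) : IsUnit x := by
  have h1 : IsUnit (LinearMap.mulRight ℝ x) :=
    (LinearMap.isUnit_iff_isUnit_det _).2 (isUnit_iff_ne_zero.2 h)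
  obtain ⟨y, hy⟩ := ((Module.End.isUnit_iff _).1 h1).2 1
  have : IsArtinianRing R := isArtinian_of_tower ℝ inferInstance
  rw [LinearMap.mulRight_apply] at hy
  exact IsUnit.of_mul_eq_one_right y hy

omit [MeasurableSpace R] [BorelSpace R] [FiniteDimensional ℝ R] in
theorem rnorm_algebraMap (r : ℝ) : rnorm (algebraMap ℝ R r) = r ^ Module.finrank ℝ R := by
  have : LinearMap.mulRight ℝ (algebraMap ℝ R r) = r • LinearMap.id := by
    ext z; simp [← Algebra.commutes, Algebra.smul_def]
  change LinearMap.det (LinearMap.mulRight ℝ (algebraMap ℝ R r)) = _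
  rw [this, LinearMap.det_smul, LinearMap.det_id, mul_one]

end
end FAbCut

namespace FAbCut
open Filter Topology MeasureTheory
open scoped ENNReal NNReal ComplexConjugate

theorem eLpNorm_two_sq {X : Type*} [MeasurableSpace X] (ν : Measure X) (f : X → ℂ) :
    eLpNorm f 2 ν ^ 2 = ∫⁻ x, ‖f x‖ₑ ^ 2 ∂ν := by
  have := eLpNorm_nnreal_pow_eq_lintegral (f := f) (μ := ν) (p := 2) (by norm_num)
  simpa using this

section
variable {X : Type*} [MeasurableSpace X] {Γ : Type*} [Group Γ] [MulAction Γ X]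
  {m : Measure X}

/-- A positive weight whose sum over orbits is one. -/
structure OrbitWeight (Γ : Type*) [Group Γ] [MulAction Γ X] (m : Measure X) where
  /-- The weight function. -/
  w : X → ℝ≥0
  measurable : Measurable w
  pos : ∀ᵐ x ∂m, 0 < w x
  sum : ∀ᵐ x ∂m, ∑' γ : Γ, (w (γ • x) : ℝ≥0∞) = 1

/-- The weighted measure. -/
noncomputable def OrbitWeight.ν (W : OrbitWeight Γ m) : Measure X :=
  m.withDensity fun x => (W.w x : ℝ≥0∞)

theorem OrbitWeight.ν_ac (W : OrbitWeight Γ m) : W.ν ≪ m := withDensity_absolutelyContinuous _ _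

theorem OrbitWeight.ac_ν (W : OrbitWeight Γ m) : m ≪ W.ν :=
  withDensity_absolutelyContinuous' W.measurable.coe_nnreal_ennreal.aemeasurable
    (W.pos.mono fun x hx => by simpa using hx.ne')

theorem OrbitWeight.lintegral_ν (W : OrbitWeight Γ m) {f : X → ℝ≥0∞} (hf : Measurable f) :
    ∫⁻ x, f x ∂W.ν = ∫⁻ x, f x * W.w x ∂m := by
  rw [OrbitWeight.ν, lintegral_withDensity_eq_lintegral_mul _ W.measurable.coe_nnreal_ennreal hf]
  simp [mul_comm]

variable [Countable Γ] [MeasurableConstSMul Γ X] [SMulInvariantMeasure Γ X m]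

theorem lintegral_unfold {a b : X → ℝ≥0∞} (ha : Measurable a) (hb : Measurable b) :
    ∫⁻ x, a x * ∑' γ : Γ, b (γ • x) ∂m = ∫⁻ x, (∑' γ : Γ, a (γ • x)) * b x ∂m := by
  simp_rw [← ENNReal.tsum_mul_left, ← ENNReal.tsum_mul_right]
  rw [lintegral_tsum, lintegral_tsum]
  · rw [← (Equiv.inv Γ).tsum_eq]
    refine tsum_congr fun γ => ?_
    rw [← (measurePreserving_smul γ m).lintegral_comp_emb (measurableEmbedding_const_smul γ)]
    simp
  · intro γ
    exact ((ha.comp (measurable_const_smul γ)).mul hb).aemeasurable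
  · intro γ
    exact (ha.mul (hb.comp (measurable_const_smul γ))).aemeasurable

/-- A function equivariant under a unitary character. -/
def IsEquivariant (m : Measure X) (χ : Γ →* Circle) (f : X → ℂ) : Prop :=
  ∀ γ : Γ, ∀ᵐ x ∂m, f (γ • x) = χ γ * f x

omit [Countable Γ] in
theorem IsEquivariant.congr {χ : Γ →* Circle} {f g : X → ℂ} (hf : IsEquivariant m χ f)
    (h : f =ᵐ[m] g) : IsEquivariant m χ g := fun γ => by
  filter_upwards [hf γ, h, (measurePreserving_smul γ m).quasiMeasurePreserving.ae_eq_comp h]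
    with x h1 h2 h3
  simp only [Function.comp_apply] at h3
  rw [← h3, h1, h2]

theorem OrbitWeight.lintegral_le (W : OrbitWeight Γ m) {s : Set X} (hs : MeasurableSet s)
    (h : ∀ᵐ x ∂m, ∃ γ : Γ, γ • x ∈ s) : W.ν Set.univ ≤ m s := by
  have h1 : W.ν Set.univ ≤ ∫⁻ x, (W.w x : ℝ≥0∞) * ∑' γ : Γ, s.indicator 1 (γ • x) ∂m := by
    rw [← lintegral_one, W.lintegral_ν measurable_const]
    refine lintegral_mono_ae ?_
    filter_upwards [h] with x ⟨γ, hγ⟩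
    rw [mul_comm]
    gcongr
    refine le_trans ?_ (ENNReal.le_tsum γ)
    simp [hγ]
  refine h1.trans ?_
  rw [lintegral_unfold W.measurable.coe_nnreal_ennreal (measurable_one.indicator hs)]
  rw [lintegral_congr_ae (g := s.indicator 1)]
  · rw [lintegral_indicator_one hs]
  · filter_upwards [W.sum] with x hx
    rw [hx, one_mul]

/-- Composition with a commuting measure preserving map preserves the weighted norm. -/
theorem OrbitWeight.lintegral_comp (W : OrbitWeight Γ m) {T : X → X}
    (hT : MeasurePreserving T m m) (hc : ∀ (γ : Γ) x, T (γ • x) = γ • T x)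
    {f : X → ℝ≥0∞} (hf : Measurable f) (hinv : ∀ γ : Γ, ∀ᵐ x ∂m, f (γ • x) = f x) :
    ∫⁻ x, f (T x) ∂W.ν = ∫⁻ x, f x ∂W.ν := by
  have hw := W.measurable.coe_nnreal_ennreal
  rw [W.lintegral_ν (f := fun x => f (T x)) (hf.comp hT.measurable), W.lintegral_ν hf]
  calc ∫⁻ x, f (T x) * W.w x ∂m
      = ∫⁻ x, f (T x) * W.w x * ∑' γ : Γ, (W.w (T (γ • x)) : ℝ≥0∞) ∂m := by
        refine lintegral_congr_ae ?_
        filter_upwards [hT.quasiMeasurePreserving.ae W.sum] with x hx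
        simp only [hc, hx, mul_one]
    _ = ∫⁻ x, (∑' γ : Γ, f (T (γ • x)) * W.w (γ • x)) * W.w (T x) ∂m :=
        lintegral_unfold ((hf.comp hT.measurable).mul hw) (hw.comp hT.measurable)
    _ = ∫⁻ x, f (T x) * W.w (T x) ∂m := by
        refine lintegral_congr_ae ?_
        have h1 : ∀ᵐ x ∂m, ∀ γ : Γ, f (γ • T x) = f (T x) :=
          ae_all_iff.2 fun γ => hT.quasiMeasurePreserving.ae (hinv γ)
        filter_upwards [h1, W.sum] with x h1 h2
        simp only [hc, h1]
        rw [ENNReal.tsum_mul_left, h2, mul_one]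
    _ = ∫⁻ x, f x * W.w x ∂m := hT.lintegral_comp (hf.mul hw)

theorem OrbitWeight.eLpNorm_comp (W : OrbitWeight Γ m) {T : X → X}
    (hT : MeasurePreserving T m m) (hc : ∀ (γ : Γ) x, T (γ • x) = γ • T x)
    {χ : Γ →* Circle} {f : X → ℂ} (hf : StronglyMeasurable f) (hinv : IsEquivariant m χ f) :
    eLpNorm (fun x => f (T x)) 2 W.ν = eLpNorm f 2 W.ν := by
  have h := W.lintegral_comp hT hc (f := fun x => ‖f x‖ₑ ^ 2) (hf.enorm.pow_const 2)
    fun γ => (hinv γ).mono fun x hx => by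
      rw [hx, enorm_mul, show ‖(χ γ : ℂ)‖ₑ = 1 by rw [← ofReal_norm, Circle.norm_coe, ENNReal.ofReal_one], one_mul]
  rw [← eLpNorm_two_sq, ← eLpNorm_two_sq] at h
  exact (ENNReal.pow_right_strictMono two_ne_zero).injective h

omit [Countable Γ] in
theorem IsEquivariant.comp {T : X → X}
    (hT : MeasurePreserving T m m) (hc : ∀ (γ : Γ) x, T (γ • x) = γ • T x)
    {χ : Γ →* Circle} {f : X → ℂ} (hinv : IsEquivariant m χ f) :
    IsEquivariant m χ (fun x => f (T x)) := fun γ => by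
  filter_upwards [hT.quasiMeasurePreserving.ae (hinv γ)] with x hx
  rw [hc, hx]

/-- The Hilbert space of square integrable equivariant functions. -/
def OrbitWeight.space (W : OrbitWeight Γ m) (χ : Γ →* Circle) : Submodule ℂ (Lp ℂ 2 W.ν) where
  carrier := {F | IsEquivariant m χ F}
  zero_mem' := IsEquivariant.congr (f := 0) (fun γ => by simp)
    (W.ac_ν.ae_eq (Lp.coeFn_zero ℂ 2 W.ν).symm)
  add_mem' {F G} hF hG := by
    refine IsEquivariant.congr (f := (F : X → ℂ) + (G : X → ℂ)) (fun γ => ?_) (W.ac_ν.ae_eq (Lp.coeFn_add F G).symm)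
    filter_upwards [hF γ, hG γ] with x h1 h2
    simp only [Pi.add_apply, h1, h2, mul_add]
  smul_mem' c F hF := by
    refine IsEquivariant.congr (f := c • (F : X → ℂ)) (fun γ => ?_) (W.ac_ν.ae_eq (Lp.coeFn_smul c F).symm)
    filter_upwards [hF γ] with x h1
    simp only [Pi.smul_apply, h1, smul_eq_mul]
    ring

theorem OrbitWeight.isClosed_space (W : OrbitWeight Γ m) (χ : Γ →* Circle) :
    IsClosed (W.space χ : Set (Lp ℂ 2 W.ν)) := by
  refine isClosed_of_closure_subset fun F hF => ?_
  obtain ⟨Fn, hFn, hlim⟩ := mem_closure_iff_seq_limit.1 hF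
  obtain ⟨ns, -, hns⟩ := (tendstoInMeasure_of_tendsto_Lp hlim).exists_seq_tendsto_ae
  have h1 := W.ac_ν.ae_le hns
  intro γ
  have h2 : ∀ᵐ x ∂m, ∀ n, Fn n (γ • x) = χ γ * Fn n x := ae_all_iff.2 fun n => hFn n γ
  filter_upwards [h1, (measurePreserving_smul γ m).quasiMeasurePreserving.ae h1, h2] with x a b c
  refine tendsto_nhds_unique b ?_
  simp only [c]
  exact a.const_mul _

instance (W : OrbitWeight Γ m) (χ : Γ →* Circle) : CompleteSpace (W.space χ) :=
  (W.isClosed_space χ).completeSpace_coe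

theorem OrbitWeight.memLp_comp (W : OrbitWeight Γ m) {χ : Γ →* Circle} {T : X → X}
    (hT : MeasurePreserving T m m) (hc : ∀ (γ : Γ) x, T (γ • x) = γ • T x)
    (F : W.space χ) : MemLp (fun x => (F : Lp ℂ 2 W.ν) (T x)) 2 W.ν :=
  ⟨((Lp.stronglyMeasurable (F : Lp ℂ 2 W.ν)).comp_measurable hT.measurable).aestronglyMeasurable,
    by rw [W.eLpNorm_comp hT hc (Lp.stronglyMeasurable _) F.2]; exact Lp.eLpNorm_lt_top _⟩

/-- The composition of an equivariant function with a commuting measure preserving map. -/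
noncomputable def OrbitWeight.compMap (W : OrbitWeight Γ m) (χ : Γ →* Circle) {T : X → X}
    (hT : MeasurePreserving T m m) (hc : ∀ (γ : Γ) x, T (γ • x) = γ • T x)
    (F : W.space χ) : W.space χ :=
  ⟨(W.memLp_comp hT hc F).toLp _,
    (F.2.comp hT hc).congr (W.ac_ν.ae_eq (W.memLp_comp hT hc F).coeFn_toLp.symm)⟩

theorem OrbitWeight.coeFn_compMap (W : OrbitWeight Γ m) (χ : Γ →* Circle) {T : X → X}
    (hT : MeasurePreserving T m m) (hc : ∀ (γ : Γ) x, T (γ • x) = γ • T x)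
    (F : W.space χ) : ((W.compMap χ hT hc F : Lp ℂ 2 W.ν) : X → ℂ) =ᵐ[m]
      fun x => (F : Lp ℂ 2 W.ν) (T x) :=
  W.ac_ν.ae_eq (W.memLp_comp hT hc F).coeFn_toLp

theorem OrbitWeight.space_ext (W : OrbitWeight Γ m) {χ : Γ →* Circle} {F G : W.space χ}
    (h : ((F : Lp ℂ 2 W.ν) : X → ℂ) =ᵐ[m] (G : Lp ℂ 2 W.ν)) : F = G :=
  Subtype.ext (Lp.ext (W.ν_ac.ae_eq h))

theorem OrbitWeight.norm_compMap (W : OrbitWeight Γ m) (χ : Γ →* Circle) {T : X → X}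
    (hT : MeasurePreserving T m m) (hc : ∀ (γ : Γ) x, T (γ • x) = γ • T x)
    (F : W.space χ) : ‖W.compMap χ hT hc F‖ = ‖F‖ := by
  change ‖(W.compMap χ hT hc F : Lp ℂ 2 W.ν)‖ = ‖(F : Lp ℂ 2 W.ν)‖
  rw [Lp.norm_def, Lp.norm_def,
    eLpNorm_congr_ae (W.ν_ac.ae_eq (W.coeFn_compMap χ hT hc F)),
    W.eLpNorm_comp hT hc (Lp.stronglyMeasurable _) F.2]

theorem OrbitWeight.coeFn_add (W : OrbitWeight Γ m) {χ : Γ →* Circle} (F G : W.space χ) :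
    (((F + G : W.space χ) : Lp ℂ 2 W.ν) : X → ℂ) =ᵐ[m]
      fun x => (F : Lp ℂ 2 W.ν) x + (G : Lp ℂ 2 W.ν) x :=
  W.ac_ν.ae_eq (Lp.coeFn_add (F : Lp ℂ 2 W.ν) (G : Lp ℂ 2 W.ν))

theorem OrbitWeight.coeFn_smul (W : OrbitWeight Γ m) {χ : Γ →* Circle} (c : ℂ) (F : W.space χ) :
    (((c • F : W.space χ) : Lp ℂ 2 W.ν) : X → ℂ) =ᵐ[m] fun x => c * (F : Lp ℂ 2 W.ν) x :=
  W.ac_ν.ae_eq (Lp.coeFn_smul c (F : Lp ℂ 2 W.ν))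

variable {E : Type*} [Group E]

/-- A measure preserving right action commuting with `Γ`. -/
structure CommutingAction (Γ E : Type*) [Group Γ] [Group E] [MulAction Γ X] (m : Measure X) where
  /-- The action. -/
  T : E → X → X
  mp : ∀ g, MeasurePreserving (T g) m m
  comm : ∀ g (γ : Γ) x, T g (γ • x) = γ • T g x
  one : ∀ x, T 1 x = x
  mul : ∀ g h x, T (g * h) x = T h (T g x)

/-- The unitary representation on equivariant functions. -/
noncomputable def OrbitWeight.rep (W : OrbitWeight Γ m) (χ : Γ →* Circle)
    (A : CommutingAction Γ E m) : E →* (W.space χ ≃ₗᵢ[ℂ] W.space χ) :=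
  have hmul : ∀ (g h : E) (F : W.space χ), W.compMap χ (A.mp (g * h)) (A.comm (g * h)) F =
      W.compMap χ (A.mp g) (A.comm g) (W.compMap χ (A.mp h) (A.comm h) F) := fun g h F => by
    refine W.space_ext ?_
    filter_upwards [W.coeFn_compMap χ (A.mp (g * h)) (A.comm (g * h)) F,
      W.coeFn_compMap χ (A.mp g) (A.comm g) (W.compMap χ (A.mp h) (A.comm h) F),
      (A.mp g).quasiMeasurePreserving.ae_eq_comp (W.coeFn_compMap χ (A.mp h) (A.comm h) F)]
      with x h1 h2 h3
    simp only [Function.comp_apply] at h3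
    rw [h1, h2, h3, A.mul]
  have hone : ∀ (F : W.space χ), W.compMap χ (A.mp 1) (A.comm 1) F = F := fun F => by
    refine W.space_ext ?_
    filter_upwards [W.coeFn_compMap χ (A.mp 1) (A.comm 1) F] with x h1
    rw [h1, A.one]
  { toFun := fun g =>
    { toFun := W.compMap χ (A.mp g) (A.comm g)
      invFun := W.compMap χ (A.mp g⁻¹) (A.comm g⁻¹)
      map_add' := fun F G => by
        refine W.space_ext ?_
        filter_upwards [W.coeFn_compMap χ (A.mp g) (A.comm g) (F + G),
          W.coeFn_add (W.compMap χ (A.mp g) (A.comm g) F) (W.compMap χ (A.mp g) (A.comm g) G),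
          W.coeFn_compMap χ (A.mp g) (A.comm g) F, W.coeFn_compMap χ (A.mp g) (A.comm g) G,
          (A.mp g).quasiMeasurePreserving.ae_eq_comp (W.coeFn_add F G)] with x h1 h2 h3 h4 h5
        simp only [Function.comp_apply] at h5
        rw [h1, h2, h3, h4, h5]
      map_smul' := fun c F => by
        refine W.space_ext ?_
        filter_upwards [W.coeFn_compMap χ (A.mp g) (A.comm g) (c • F),
          W.coeFn_smul c (W.compMap χ (A.mp g) (A.comm g) F),
          W.coeFn_compMap χ (A.mp g) (A.comm g) F,
          (A.mp g).quasiMeasurePreserving.ae_eq_comp (W.coeFn_smul c F)] with x h1 h2 h3 h5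
        simp only [Function.comp_apply] at h5
        rw [RingHom.id_apply, h1, h2, h3, h5]
      left_inv := fun F => by rw [← hmul, inv_mul_cancel, hone]
      right_inv := fun F => by rw [← hmul, mul_inv_cancel, hone]
      norm_map' := fun F => W.norm_compMap χ (A.mp g) (A.comm g) F }
    map_one' := LinearIsometryEquiv.ext hone
    map_mul' := fun g h => LinearIsometryEquiv.ext (hmul g h) }

theorem OrbitWeight.coeFn_rep (W : OrbitWeight Γ m) (χ : Γ →* Circle)
    (A : CommutingAction Γ E m) (g : E) (F : W.space χ) :
    ((W.rep χ A g F : Lp ℂ 2 W.ν) : X → ℂ) =ᵐ[m] fun x => (F : Lp ℂ 2 W.ν) (A.T g x) :=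
  W.coeFn_compMap χ (A.mp g) (A.comm g) F

end
end FAbCut

namespace FAbCut
open Filter Topology MeasureTheory
open scoped ENNReal NNReal ComplexConjugate

theorem toReal_eLpNorm_sq_add_compl {X : Type*} [MeasurableSpace X] {ν : Measure X} {f : X → ℂ}
    (hf : MemLp f 2 ν) {K : Set X} (hK : MeasurableSet K) :
    (eLpNorm f 2 ν).toReal ^ 2 = (eLpNorm f 2 (ν.restrict K)).toReal ^ 2 +
      (eLpNorm f 2 (ν.restrict Kᶜ)).toReal ^ 2 := by
  have h : eLpNorm f 2 ν ^ 2 = eLpNorm f 2 (ν.restrict K) ^ 2 + eLpNorm f 2 (ν.restrict Kᶜ) ^ 2 := by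
    simp only [eLpNorm_two_sq]
    rw [lintegral_add_compl _ hK]
  have h1 := (hf.restrict K).2.ne
  have h2 := (hf.restrict Kᶜ).2.ne
  rw [← ENNReal.toReal_pow, h, ENNReal.toReal_add (by finiteness) (by finiteness),
    ENNReal.toReal_pow, ENNReal.toReal_pow]

theorem le_of_sq_bounds {N k c kn cn d e D : ℝ} (hN : 0 ≤ N) (hk : 0 ≤ k) (hc : 0 ≤ c)
    (hkn : 0 ≤ kn) (hcn : 0 ≤ cn) (hd : 0 ≤ d) (he : 0 ≤ e) (h1 : N ^ 2 = k ^ 2 + c ^ 2)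
    (h2 : N ^ 2 = kn ^ 2 + cn ^ 2) (h3 : k ≤ kn + d) (h4 : e ≤ cn + c)
    (h5 : D ^ 2 = d ^ 2 + e ^ 2) : D ≤ d + c + √(c ^ 2 + 2 * N * d) := by
  have hkN : k ≤ N := abs_le_of_sq_le_sq' (by nlinarith) hN |>.2
  have hcn2 : cn ^ 2 ≤ c ^ 2 + 2 * N * d := by
    by_cases hkd : d ≤ k
    · have : (k - d) ^ 2 ≤ kn ^ 2 := by
        apply pow_le_pow_left₀ <;> linarith
      nlinarith [sq_nonneg d]
    · nlinarith [sq_nonneg kn]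
  have hcn3 : cn ≤ √(c ^ 2 + 2 * N * d) := Real.le_sqrt_of_sq_le hcn2
  have : D ≤ d + e := abs_le_of_sq_le_sq' (by nlinarith) (by linarith) |>.2
  linarith

section
variable {X : Type*} [MeasurableSpace X] {Γ : Type*} [Group Γ] [MulAction Γ X]
  {m : Measure X} [Countable Γ] [MeasurableConstSMul Γ X] [SMulInvariantMeasure Γ X m]
  {E : Type*} [Group E]

theorem OrbitWeight.tendsto_rep (W : OrbitWeight Γ m) (χ : Γ →* Circle)
    (A : CommutingAction Γ E m) (g : ℕ → E) (F : W.space χ)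
    (hloc : ∀ ε > 0, ∃ K, MeasurableSet K ∧
      eLpNorm ((F : Lp ℂ 2 W.ν) : X → ℂ) 2 (W.ν.restrict Kᶜ) ≤ ENNReal.ofReal ε ∧
      Tendsto (fun n => eLpNorm (fun x => (F : Lp ℂ 2 W.ν) (A.T (g n) x) - (F : Lp ℂ 2 W.ν) x) 2
        (W.ν.restrict K)) atTop (𝓝 0)) :
    Tendsto (fun n => W.rep χ A (g n) F) atTop (𝓝 F) := by
  rw [tendsto_iff_norm_sub_tendsto_zero]
  rw [Metric.tendsto_atTop]
  intro ε hε
  obtain ⟨K, hKm, hKc, hK⟩ := hloc (ε / 4) (by positivity)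
  set f : X → ℂ := ((F : Lp ℂ 2 W.ν) : X → ℂ) with hf
  have hfm : MemLp f 2 W.ν := Lp.memLp _
  set N := (eLpNorm f 2 W.ν).toReal with hN
  set c := (eLpNorm f 2 (W.ν.restrict Kᶜ)).toReal with hc
  set d : ℕ → ℝ := fun n => (eLpNorm (fun x => f (A.T (g n) x) - f x) 2 (W.ν.restrict K)).toReal
    with hd
  have hcε : c ≤ ε / 4 := ENNReal.toReal_le_of_le_ofReal (by positivity) hKc
  have hd0 : Tendsto d atTop (𝓝 0) := by
    exact (ENNReal.tendsto_toReal ENNReal.zero_ne_top).comp hK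
  have hlim : Tendsto (fun n => d n + c + √(c ^ 2 + 2 * N * d n)) atTop
      (𝓝 (0 + c + √(c ^ 2 + 2 * N * 0))) :=
    (hd0.add_const c).add ((hd0.const_mul (2 * N)).const_add (c ^ 2)).sqrt
  have hc0 : 0 ≤ c := ENNReal.toReal_nonneg
  have hlt : 0 + c + √(c ^ 2 + 2 * N * 0) < ε := by
    rw [mul_zero, add_zero, Real.sqrt_sq hc0]; linarith
  obtain ⟨n₀, hn₀⟩ := eventually_atTop.1 (hlim.eventually_lt_const hlt)
  refine ⟨n₀, fun n hn => ?_⟩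
  rw [dist_zero_right, norm_norm]
  refine lt_of_le_of_lt ?_ (hn₀ n hn)
  have hgm : MemLp (fun x => f (A.T (g n) x)) 2 W.ν := W.memLp_comp (A.mp _) (A.comm _) F
  have hsub : MemLp (fun x => f (A.T (g n) x) - f x) 2 W.ν := hgm.sub hfm
  have hD : ‖W.rep χ A (g n) F - F‖ = (eLpNorm (fun x => f (A.T (g n) x) - f x) 2 W.ν).toReal := by
    change ‖((W.rep χ A (g n) F : Lp ℂ 2 W.ν) - (F : Lp ℂ 2 W.ν))‖ = _
    rw [Lp.norm_def]
    congr 1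
    refine eLpNorm_congr_ae ?_
    filter_upwards [Lp.coeFn_sub (W.rep χ A (g n) F : Lp ℂ 2 W.ν) (F : Lp ℂ 2 W.ν),
      W.ν_ac.ae_eq (W.coeFn_rep χ A (g n) F)] with x h1 h2
    rw [h1, Pi.sub_apply, h2]
  rw [hD]
  refine le_of_sq_bounds (N := N) (k := (eLpNorm f 2 (W.ν.restrict K)).toReal)
    (kn := (eLpNorm (fun x => f (A.T (g n) x)) 2 (W.ν.restrict K)).toReal)
    (cn := (eLpNorm (fun x => f (A.T (g n) x)) 2 (W.ν.restrict Kᶜ)).toReal)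
    (e := (eLpNorm (fun x => f (A.T (g n) x) - f x) 2 (W.ν.restrict Kᶜ)).toReal)
    ENNReal.toReal_nonneg ENNReal.toReal_nonneg hc0 ENNReal.toReal_nonneg ENNReal.toReal_nonneg
    ENNReal.toReal_nonneg ENNReal.toReal_nonneg (toReal_eLpNorm_sq_add_compl hfm hKm) ?_ ?_ ?_
    (toReal_eLpNorm_sq_add_compl hsub hKm)
  · rw [← toReal_eLpNorm_sq_add_compl hgm hKm, hN]
    congr 2
    exact (W.eLpNorm_comp (A.mp _) (A.comm _) (Lp.stronglyMeasurable _) F.2).symm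
  · rw [← ENNReal.toReal_add (hgm.restrict K).2.ne (hsub.restrict K).2.ne]
    refine ENNReal.toReal_mono (ENNReal.add_ne_top.2 ⟨(hgm.restrict K).2.ne, (hsub.restrict K).2.ne⟩) ?_
    have := eLpNorm_sub_le (μ := W.ν.restrict K) (p := 2) (hgm.restrict K).1 (hsub.restrict K).1
      (by norm_num)
    refine le_trans (le_of_eq ?_) this
    congr 1
    ext x
    simp
  · rw [← ENNReal.toReal_add (hgm.restrict _).2.ne (hfm.restrict _).2.ne]
    refine ENNReal.toReal_mono (ENNReal.add_ne_top.2 ⟨(hgm.restrict _).2.ne, (hfm.restrict _).2.ne⟩) ?_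
    exact eLpNorm_sub_le (hgm.restrict _).1 (hfm.restrict _).1 (by norm_num)

/-- The averaged character. -/
noncomputable def OrbitWeight.theta (W : OrbitWeight Γ m) (χ : Γ →* Circle) (x : X) : ℂ :=
  ∑' γ : Γ, conj (χ γ : ℂ) * ((W.w (γ • x) : ℝ) : ℂ)

theorem OrbitWeight.measurable_theta (W : OrbitWeight Γ m) (χ : Γ →* Circle) :
    Measurable (W.theta χ) :=
  Measurable.tsum fun γ => (measurable_const.mul (Complex.measurable_ofReal.comp
    (W.measurable.comp (measurable_const_smul γ)).coe_nnreal_real))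

theorem OrbitWeight.hasSum (W : OrbitWeight Γ m) :
    ∀ᵐ x ∂m, HasSum (fun γ : Γ => (W.w (γ • x) : ℝ)) 1 := by
  filter_upwards [W.sum] with x hx
  have h1 : HasSum (fun γ : Γ => W.w (γ • x)) 1 := by
    rw [← ENNReal.hasSum_coe]
    have := ENNReal.summable.hasSum (f := fun γ : Γ => (W.w (γ • x) : ℝ≥0∞))
    rwa [hx] at this
  exact NNReal.hasSum_coe.2 h1

theorem OrbitWeight.norm_theta_le (W : OrbitWeight Γ m) (χ : Γ →* Circle) :
    ∀ᵐ x ∂m, ‖W.theta χ x‖ ≤ 1 := by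
  filter_upwards [W.hasSum] with x hx
  refine tsum_of_norm_bounded hx fun γ => ?_
  simp [Circle.norm_coe]

theorem OrbitWeight.isEquivariant_theta (W : OrbitWeight Γ m) (χ : Γ →* Circle) :
    IsEquivariant m χ (W.theta χ) := fun δ => by
  refine Eventually.of_forall fun x => ?_
  rw [OrbitWeight.theta, OrbitWeight.theta, ← tsum_mul_left, ← (Equiv.mulRight δ⁻¹).tsum_eq]
  refine tsum_congr fun γ => ?_
  have : conj (χ δ⁻¹ : ℂ) = χ δ := by rw [map_inv, Circle.coe_inv_eq_conj, Complex.conj_conj]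
  simp only [Equiv.coe_mulRight, smul_smul, inv_mul_cancel_right, map_mul, Circle.coe_mul, this]
  ring

theorem OrbitWeight.tendsto_theta (W : OrbitWeight Γ m) {χ : ℕ → Γ →* Circle}
    (hχ : ∀ γ, Tendsto (fun n => (χ n γ : ℂ)) atTop (𝓝 1)) :
    ∀ᵐ x ∂m, Tendsto (fun n => W.theta (χ n) x) atTop (𝓝 1) := by
  filter_upwards [W.hasSum] with x hx
  have h1 : ∑' γ : Γ, ((W.w (γ • x) : ℝ) : ℂ) = 1 := by
    have := (Complex.hasSum_ofReal.2 hx).tsum_eq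
    simpa using this
  rw [← h1]
  refine tendsto_tsum_of_dominated_convergence hx.summable (fun γ => ?_)
    (Eventually.of_forall fun n γ => by simp [Circle.norm_coe])
  have := ((Complex.continuous_conj.tendsto _).comp (hχ γ)).mul_const ((W.w (γ • x) : ℝ) : ℂ)
  simpa using this

theorem OrbitWeight.memLp_theta (W : OrbitWeight Γ m) [IsFiniteMeasure W.ν] (χ : Γ →* Circle) :
    MemLp (W.theta χ) 2 W.ν :=
  MemLp.of_bound (W.measurable_theta χ).aestronglyMeasurable 1 (W.ν_ac.ae_le (W.norm_theta_le χ))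

/-- The averaged character as an equivariant vector. -/
noncomputable def OrbitWeight.thetaVec (W : OrbitWeight Γ m) [IsFiniteMeasure W.ν]
    (χ : Γ →* Circle) : W.space χ :=
  ⟨(W.memLp_theta χ).toLp _,
    (W.isEquivariant_theta χ).congr (W.ac_ν.ae_eq (W.memLp_theta χ).coeFn_toLp.symm)⟩

theorem OrbitWeight.coeFn_thetaVec (W : OrbitWeight Γ m) [IsFiniteMeasure W.ν]
    (χ : Γ →* Circle) : ((W.thetaVec χ : Lp ℂ 2 W.ν) : X → ℂ) =ᵐ[m] W.theta χ :=
  W.ac_ν.ae_eq (W.memLp_theta χ).coeFn_toLp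

theorem OrbitWeight.tendsto_eLpNorm_theta (W : OrbitWeight Γ m) [IsFiniteMeasure W.ν]
    {χ : ℕ → Γ →* Circle} (hχ : ∀ γ, Tendsto (fun n => (χ n γ : ℂ)) atTop (𝓝 1))
    {T : X → X} (hT : MeasurePreserving T m m) :
    Tendsto (fun n => eLpNorm (fun x => W.theta (χ n) (T x) - 1) 2 W.ν) atTop (𝓝 0) := by
  have h : Tendsto (fun n => ∫⁻ x, ‖W.theta (χ n) (T x) - 1‖ₑ ^ 2 ∂W.ν) atTop
      (𝓝 (∫⁻ _, 0 ∂W.ν)) := by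
    refine tendsto_lintegral_of_dominated_convergence (fun _ => 4) (fun n => ?_) (fun n => ?_)
      (by simp [ENNReal.mul_eq_top]) ?_
    · exact (((W.measurable_theta _).comp hT.measurable).sub_const 1).enorm.pow_const 2
    · filter_upwards [W.ν_ac.ae_le (hT.quasiMeasurePreserving.ae (W.norm_theta_le (χ n)))] with x hx
      have h1 : ‖W.theta (χ n) (T x) - 1‖ₑ ≤ 2 := by
        rw [← ofReal_norm]
        refine ENNReal.ofReal_le_of_le_toReal ?_
        refine (norm_sub_le _ _).trans ?_
        norm_num
        linarith
      calc _ ≤ (2 : ℝ≥0∞) ^ 2 := by gcongr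
        _ = 4 := by norm_num
    · filter_upwards [W.ν_ac.ae_le (hT.quasiMeasurePreserving.ae (W.tendsto_theta hχ))] with x hx
      have := (ENNReal.continuous_pow 2).tendsto _ |>.comp (hx.sub_const 1).enorm
      simpa [Function.comp_def] using this
  rw [lintegral_zero] at h
  have h2 := (ENNReal.continuous_rpow_const (y := (1 / 2 : ℝ))).tendsto 0 |>.comp h
  rw [ENNReal.zero_rpow_of_pos (by norm_num)] at h2
  refine h2.congr fun n => ?_
  rw [Function.comp_apply, ← eLpNorm_two_sq, ← ENNReal.rpow_natCast, ← ENNReal.rpow_mul]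
  norm_num

theorem OrbitWeight.exists_almost_invariant (W : OrbitWeight Γ m) [IsFiniteMeasure W.ν]
    (hν : W.ν ≠ 0) (A : CommutingAction Γ E m) {χ : ℕ → Γ →* Circle}
    (hχ : ∀ γ, Tendsto (fun n => (χ n γ : ℂ)) atTop (𝓝 1)) (s : Finset E) {ε : ℝ} (hε : 0 < ε) :
    ∃ n, ∃ v : W.space (χ n), ‖v‖ = 1 ∧ ∀ g ∈ s, ‖W.rep (χ n) A g v - v‖ ≤ ε := by
  set a : E → ℕ → ℝ := fun g n =>
    (eLpNorm (fun x => W.theta (χ n) (A.T g x) - 1) 2 W.ν).toReal with ha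
  have ha0 : ∀ g, Tendsto (a g) atTop (𝓝 0) := fun g =>
    (ENNReal.tendsto_toReal ENNReal.zero_ne_top).comp
      (W.tendsto_eLpNorm_theta hχ (A.mp g))
  have hone : MemLp (fun _ : X => (1 : ℂ)) 2 W.ν := memLp_const 1
  have hmem : ∀ g n, MemLp (fun x => W.theta (χ n) (A.T g x)) 2 W.ν := fun g n =>
    MemLp.of_bound ((W.measurable_theta _).comp (A.mp g).measurable).aestronglyMeasurable 1
      (W.ν_ac.ae_le ((A.mp g).quasiMeasurePreserving.ae (W.norm_theta_le _)))
  have hmem1 : ∀ g n, MemLp (fun x => W.theta (χ n) (A.T g x) - 1) 2 W.ν := fun g n =>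
    (hmem g n).sub hone
  set c := (eLpNorm (fun _ : X => (1 : ℂ)) 2 W.ν).toReal with hc
  have hc0 : 0 < c := by
    refine ENNReal.toReal_pos ?_ hone.2.ne
    rw [Ne, eLpNorm_eq_zero_iff hone.1 (by norm_num)]
    intro h
    refine hν (ae_eq_bot.1 ?_)
    rw [← Filter.empty_mem_iff_bot]
    filter_upwards [h] with x hx
    simp at hx
  have hnorm : ∀ n, ‖W.thetaVec (χ n)‖ = (eLpNorm (W.theta (χ n)) 2 W.ν).toReal := fun n => by
    change ‖(W.thetaVec (χ n) : Lp ℂ 2 W.ν)‖ = _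
    rw [Lp.norm_def, eLpNorm_congr_ae (W.ν_ac.ae_eq (W.coeFn_thetaVec (χ n)))]
  have hlow : ∀ n, c - a 1 n ≤ ‖W.thetaVec (χ n)‖ := fun n => by
    rw [sub_le_iff_le_add, hnorm, hc, ha]
    simp only [A.one]
    have h1 := W.memLp_theta (χ n)
    have h2 : MemLp (fun x => W.theta (χ n) x - 1) 2 W.ν := h1.sub hone
    rw [← ENNReal.toReal_add h1.2.ne h2.2.ne]
    refine ENNReal.toReal_mono (ENNReal.add_ne_top.2 ⟨h1.2.ne, h2.2.ne⟩) ?_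
    refine le_trans (le_of_eq ?_) (eLpNorm_sub_le h1.1 h2.1 (by norm_num))
    congr 1
    ext x
    simp
  have hup : ∀ g n, ‖W.rep (χ n) A g (W.thetaVec (χ n)) - W.thetaVec (χ n)‖ ≤ a g n + a 1 n :=
    fun g n => by
    change ‖(W.rep (χ n) A g (W.thetaVec (χ n)) : Lp ℂ 2 W.ν) -
      (W.thetaVec (χ n) : Lp ℂ 2 W.ν)‖ ≤ _
    rw [Lp.norm_def, ha]
    simp only [A.one]
    have h1 := hmem1 g n
    have h2 : MemLp (fun x => W.theta (χ n) x - 1) 2 W.ν := (W.memLp_theta (χ n)).sub hone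
    rw [← ENNReal.toReal_add h1.2.ne h2.2.ne]
    refine ENNReal.toReal_mono (ENNReal.add_ne_top.2 ⟨h1.2.ne, h2.2.ne⟩) ?_
    refine le_trans (le_of_eq ?_) (eLpNorm_sub_le h1.1 h2.1 (by norm_num))
    refine eLpNorm_congr_ae ?_
    filter_upwards [Lp.coeFn_sub (W.rep (χ n) A g (W.thetaVec (χ n)) : Lp ℂ 2 W.ν)
      (W.thetaVec (χ n) : Lp ℂ 2 W.ν), W.ν_ac.ae_eq (W.coeFn_rep (χ n) A g (W.thetaVec (χ n))),
      W.ν_ac.ae_eq (W.coeFn_thetaVec (χ n)),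
      W.ν_ac.ae_eq ((A.mp g).quasiMeasurePreserving.ae_eq_comp (W.coeFn_thetaVec (χ n)))]
      with x e1 e2 e3 e4
    simp only [Function.comp_apply] at e4
    rw [e1, Pi.sub_apply, e2, e3, e4, Pi.sub_apply]
    ring
  have hev : ∀ᶠ n in atTop, a 1 n < c / 2 ∧ ∀ g ∈ s, a g n + a 1 n < ε * (c / 2) := by
    refine ((ha0 1).eventually_lt_const (by positivity)).and ?_
    rw [Finset.eventually_all]
    intro g _
    have := (ha0 g).add (ha0 1)
    rw [add_zero] at this
    exact this.eventually_lt_const (by positivity)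
  obtain ⟨n, hn1, hn2⟩ := hev.exists
  have hpos : c / 2 ≤ ‖W.thetaVec (χ n)‖ := by linarith [hlow n]
  have hpos' : 0 < ‖W.thetaVec (χ n)‖ := by linarith
  refine ⟨n, ((‖W.thetaVec (χ n)‖⁻¹ : ℝ) : ℂ) • W.thetaVec (χ n), ?_, fun g hg => ?_⟩
  · rw [norm_smul, Complex.norm_real, norm_inv, norm_norm, inv_mul_cancel₀ hpos'.ne']
  · rw [map_smul, ← smul_sub, norm_smul, Complex.norm_real, norm_inv, norm_norm,
      inv_mul_le_iff₀ hpos', mul_comm]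
    exact (hup g n).trans ((hn2 g hg).le.trans (by gcongr))

end
end FAbCut

namespace FAbCut
open Filter Topology MeasureTheory
open scoped ENNReal NNReal ComplexConjugate

theorem MatrixUnits.map_eq_one_of_mem {ι R A : Type*} [DecidableEq ι] [Fintype ι] [Ring R]
    [CommGroup A] (U : MatrixUnits ι R) (hι : 3 ≤ Fintype.card ι) (f : Rˣ →* A) {g : Rˣ}
    (hg : g ∈ U.elemSubgroup) : f g = 1 := by
  have : U.elemSubgroup ≤ f.ker := by
    rw [MatrixUnits.elemSubgroup, Subgroup.closure_le]
    rintro _ ⟨i, k, hik, r, rfl⟩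
    obtain ⟨j, -, hj⟩ : ∃ j ∈ (Finset.univ : Finset ι), j ∉ ({i, k} : Finset ι) :=
      Finset.exists_mem_notMem_of_card_lt_card
        (lt_of_le_of_lt Finset.card_le_two (by rw [Finset.card_univ]; omega))
    simp only [Finset.mem_insert, Finset.mem_singleton, not_or] at hj
    rw [SetLike.mem_coe, MonoidHom.mem_ker,
      U.elem_commutator (Ne.symm hj.1) hj.2 hik r, map_mul, map_mul, map_mul, map_inv, map_inv,
      mul_inv_cancel_comm, mul_inv_cancel]
  exact this hg

section
variable {R : Type*} [NormedRing R] [NormedAlgebra ℝ R]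

/-- Elements acting by volume preserving maps on both sides. -/
def IsUnimodular (E : Subgroup Rˣ) : Prop :=
  ∀ g ∈ E, |Algebra.norm ℝ (g : R)| = 1 ∧ |rnorm (g : R)| = 1

variable (R) in
/-- The elements of norm at most one. -/
def normBall : Set R := {x | 0 < |rnorm x| ∧ |rnorm x| ≤ 1}

theorem IsUnimodular.smul_mem {E : Subgroup Rˣ} (hE : IsUnimodular E) {g : Rˣ} (hg : g ∈ E)
    {x : R} : (g : R) * x ∈ normBall R ↔ x ∈ normBall R := by
  simp only [normBall, Set.mem_ofPred_eq, map_mul, abs_mul, (hE g hg).2, one_mul, mul_one]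

theorem IsUnimodular.mul_mem {E : Subgroup Rˣ} (hE : IsUnimodular E) {g : Rˣ} (hg : g ∈ E)
    {x : R} : x * (g : R) ∈ normBall R ↔ x ∈ normBall R := by
  simp only [normBall, Set.mem_ofPred_eq, map_mul, abs_mul, (hE g hg).2, one_mul, mul_one]

theorem IsUnimodular.mono {E Γ : Subgroup Rˣ} (hE : IsUnimodular E) (h : Γ ≤ E) :
    IsUnimodular Γ := fun g hg => hE g (h hg)

variable [FiniteDimensional ℝ R] [MeasurableSpace R] [BorelSpace R]

theorem isUnit_of_mem_normBall {x : R} (hx : x ∈ normBall R) : IsUnit x :=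
  isUnit_of_rnorm_ne_zero fun h => by simp [normBall, h] at hx

theorem measurableSet_normBall : MeasurableSet (normBall R) :=
  (measurableSet_lt measurable_const continuous_rnorm.abs.measurable).inter
    (measurableSet_le continuous_rnorm.abs.measurable measurable_const)

instance (Γ : Subgroup Rˣ) : MeasurableConstSMul Γ R :=
  ⟨fun γ => (continuous_const.mul continuous_id : Continuous fun x : R => ((γ : Rˣ) : R) * x).measurable⟩

variable {μ : Measure R} [μ.IsAddHaarMeasure]

theorem IsUnimodular.measurePreserving_left {E : Subgroup Rˣ} (hE : IsUnimodular E) {g : Rˣ}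
    (hg : g ∈ E) : MeasurePreserving (fun x : R => (g : R) * x) μ μ :=
  measurePreserving_linear (LinearMap.mulLeft ℝ (g : R)) (hE g hg).1

theorem IsUnimodular.measurePreserving_right {E : Subgroup Rˣ} (hE : IsUnimodular E) {g : Rˣ}
    (hg : g ∈ E) : MeasurePreserving (fun x : R => x * (g : R)) μ μ :=
  measurePreserving_linear (LinearMap.mulRight ℝ (g : R)) (hE g hg).2

theorem IsUnimodular.measurePreserving_left_normBall {E : Subgroup Rˣ} (hE : IsUnimodular E)
    {g : Rˣ} (hg : g ∈ E) : MeasurePreserving (fun x : R => (g : R) * x)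
      (μ.restrict (normBall R)) (μ.restrict (normBall R)) := by
  have := (hE.measurePreserving_left (μ := μ) hg).restrict_preimage
    (measurableSet_normBall (R := R))
  convert this using 2
  ext x
  exact (hE.smul_mem hg).symm

theorem IsUnimodular.measurePreserving_right_normBall {E : Subgroup Rˣ} (hE : IsUnimodular E)
    {g : Rˣ} (hg : g ∈ E) : MeasurePreserving (fun x : R => x * (g : R))
      (μ.restrict (normBall R)) (μ.restrict (normBall R)) := by
  have := (hE.measurePreserving_right (μ := μ) hg).restrict_preimage
    (measurableSet_normBall (R := R))
  convert this using 2
  ext x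
  exact (hE.mul_mem hg).symm

theorem IsUnimodular.smulInvariant {Γ : Subgroup Rˣ} (hΓ : IsUnimodular Γ) :
    SMulInvariantMeasure Γ R (μ.restrict (normBall R)) :=
  ⟨fun γ _ hs => (hΓ.measurePreserving_left_normBall (μ := μ) γ.2).measure_preimage hs.nullMeasurableSet⟩

/-- The right translation action. -/
def IsUnimodular.action {Γ E : Subgroup Rˣ} (hE : IsUnimodular E) :
    CommutingAction Γ E (μ.restrict (normBall R)) where
  T g x := x * ((g : Rˣ) : R)
  mp g := hE.measurePreserving_right_normBall g.2
  comm g γ x := mul_assoc _ _ _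
  one x := by simp
  mul g h x := by simp [mul_assoc]

/-- The polynomially decaying weight. -/
noncomputable def preWeight (M : ℕ) (x : R) : ℝ≥0 := ((1 + ‖x‖₊) ^ M)⁻¹

omit [FiniteDimensional ℝ R] [MeasurableSpace R] [BorelSpace R] [NormedAlgebra ℝ R] in
theorem continuous_preWeight (M : ℕ) : Continuous (preWeight (R := R) M) :=
  Continuous.inv₀ (by fun_prop) fun x => by positivity

omit [FiniteDimensional ℝ R] [MeasurableSpace R] [BorelSpace R] [NormedAlgebra ℝ R] in
theorem preWeight_pos (M : ℕ) (x : R) : 0 < preWeight M x := by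
  unfold preWeight; positivity

omit [FiniteDimensional ℝ R] [MeasurableSpace R] [BorelSpace R] [NormedAlgebra ℝ R] in
theorem preWeight_mul_le (M : ℕ) (g x y : R) (h : x * y = 1) :
    preWeight M (g * x) ≤ (1 + ‖y‖₊) ^ M * preWeight M g := by
  unfold preWeight
  rw [← div_eq_mul_inv, le_div_iff₀ (by positivity), inv_mul_le_iff₀ (by positivity), ← mul_pow]
  gcongr
  have : ‖g‖₊ ≤ ‖g * x‖₊ * ‖y‖₊ := by
    conv_lhs => rw [← mul_one g, ← h, ← mul_assoc]
    exact nnnorm_mul_le _ _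
  calc 1 + ‖g‖₊ ≤ 1 + ‖g * x‖₊ * ‖y‖₊ := by gcongr
    _ ≤ 1 + ‖g * x‖₊ * ‖y‖₊ + (‖g * x‖₊ + ‖y‖₊) := le_self_add
    _ = _ := by ring

/-- The orbit sum of the weight. -/
noncomputable def orbitSum (Γ : Subgroup Rˣ) (M : ℕ) (x : R) : ℝ≥0∞ :=
  ∑' γ : Γ, (preWeight M (γ • x) : ℝ≥0∞)

variable {Γ : Subgroup Rˣ} {M : ℕ}

omit [FiniteDimensional ℝ R] [MeasurableSpace R] [BorelSpace R] [NormedAlgebra ℝ R] in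
theorem orbitSum_smul (γ : Γ) (x : R) : orbitSum Γ M (γ • x) = orbitSum Γ M x := by
  unfold orbitSum
  rw [← (Equiv.mulRight γ).tsum_eq (fun δ : Γ => (preWeight M (δ • x) : ℝ≥0∞))]
  simp [mul_smul]

omit [FiniteDimensional ℝ R] [MeasurableSpace R] [BorelSpace R] [NormedAlgebra ℝ R] in
theorem preWeight_le_orbitSum (x : R) : (preWeight M x : ℝ≥0∞) ≤ orbitSum Γ M x := by
  have := ENNReal.le_tsum (f := fun γ : Γ => (preWeight M (γ • x) : ℝ≥0∞)) 1
  rwa [one_smul] at this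

omit [FiniteDimensional ℝ R] [MeasurableSpace R] [BorelSpace R] [NormedAlgebra ℝ R] in
theorem orbitSum_le {x y : R} (h : x * y = 1) :
    orbitSum Γ M x ≤ ((1 + ‖y‖₊) ^ M : ℝ≥0) * ∑' γ : Γ, (preWeight M ((γ : Rˣ) : R) : ℝ≥0∞) := by
  rw [← ENNReal.tsum_mul_left]
  refine ENNReal.tsum_le_tsum fun γ => ?_
  rw [← ENNReal.coe_mul, ENNReal.coe_le_coe]
  exact preWeight_mul_le M _ x y h

/-- The normalised weight. -/
noncomputable def normWeight (Γ : Subgroup Rˣ) (M : ℕ) (x : R) : ℝ≥0 :=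
  preWeight M x / (orbitSum Γ M x).toNNReal

theorem measurable_normWeight [Countable Γ] : Measurable (normWeight Γ M) := by
  unfold normWeight orbitSum
  refine (continuous_preWeight M).measurable.div (Measurable.ennreal_toNNReal ?_)
  exact Measurable.tsum fun γ =>
    ((continuous_preWeight M).measurable.comp (measurable_const_smul γ)).coe_nnreal_ennreal

omit [FiniteDimensional ℝ R] [MeasurableSpace R] [BorelSpace R] [NormedAlgebra ℝ R] in
theorem orbitSum_ne_top (hM : Summable fun γ : Γ => preWeight M ((γ : Rˣ) : R)) {x : R}
    (hx : IsUnit x) : orbitSum Γ M x ≠ ⊤ := by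
  obtain ⟨u, rfl⟩ := hx
  refine ne_top_of_le_ne_top ?_ (orbitSum_le (u.mul_inv))
  exact ENNReal.mul_ne_top ENNReal.coe_ne_top (ENNReal.tsum_coe_ne_top_iff_summable.2 hM)

omit [FiniteDimensional ℝ R] [MeasurableSpace R] [BorelSpace R] [NormedAlgebra ℝ R] in
theorem orbitSum_ne_zero (x : R) : orbitSum Γ M x ≠ 0 := fun h => by
  have := preWeight_le_orbitSum (Γ := Γ) (M := M) x
  rw [h] at this
  exact (preWeight_pos M x).ne' (by simpa using this)

omit [FiniteDimensional ℝ R] [MeasurableSpace R] [BorelSpace R] [NormedAlgebra ℝ R] in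
theorem coe_normWeight (hM : Summable fun γ : Γ => preWeight M ((γ : Rˣ) : R)) {x : R}
    (hx : IsUnit x) : (normWeight Γ M x : ℝ≥0∞) = preWeight M x / orbitSum Γ M x := by
  rw [normWeight, ENNReal.coe_div, ENNReal.coe_toNNReal (orbitSum_ne_top hM hx)]
  rw [Ne, ENNReal.toNNReal_eq_zero_iff]
  simp [orbitSum_ne_zero, orbitSum_ne_top hM hx]

/-- The orbit weight on the elements of norm at most one. -/
noncomputable def orbitWeight [Countable Γ]
    (hM : Summable fun γ : Γ => preWeight M ((γ : Rˣ) : R)) :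
    OrbitWeight Γ (μ.restrict (normBall R)) where
  w := normWeight Γ M
  measurable := measurable_normWeight
  pos := by
    filter_upwards [ae_restrict_mem measurableSet_normBall] with x hx
    have hu := isUnit_of_mem_normBall hx
    exact div_pos (preWeight_pos M x)
      (ENNReal.toNNReal_pos (orbitSum_ne_zero x) (orbitSum_ne_top hM hu))
  sum := by
    filter_upwards [ae_restrict_mem measurableSet_normBall] with x hx
    have hu := isUnit_of_mem_normBall hx
    have h (γ : Γ) : (normWeight Γ M (γ • x) : ℝ≥0∞) =
        preWeight M (γ • x) / orbitSum Γ M x := by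
      rw [coe_normWeight hM, orbitSum_smul]
      exact (γ : Rˣ).isUnit.mul hu
    simp_rw [h, div_eq_mul_inv]
    rw [ENNReal.tsum_mul_right]
    exact ENNReal.mul_inv_cancel (orbitSum_ne_zero x) (orbitSum_ne_top hM hu)

omit [FiniteDimensional ℝ R] [MeasurableSpace R] [BorelSpace R] [NormedAlgebra ℝ R] in
theorem normWeight_le_one (hM : Summable fun γ : Γ => preWeight M ((γ : Rˣ) : R)) {x : R}
    (hx : IsUnit x) : (normWeight Γ M x : ℝ≥0∞) ≤ 1 := by
  rw [coe_normWeight hM hx]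
  exact ENNReal.div_le_of_le_mul (by rw [one_mul]; exact preWeight_le_orbitSum x)

omit [FiniteDimensional ℝ R] [MeasurableSpace R] [BorelSpace R] [NormedAlgebra ℝ R] in
theorem exists_le_normWeight [CompleteSpace R]
    (hM : Summable fun γ : Γ => preWeight M ((γ : Rˣ) : R)) {K : Set R}
    (hK : IsCompact K) (hKu : ∀ x ∈ K, IsUnit x) :
    ∃ c : ℝ≥0, 0 < c ∧ ∀ x ∈ K, c ≤ normWeight Γ M x := by
  have hcont : ContinuousOn (fun x : R => ‖Ring.inverse x‖) K := fun x hx => by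
    obtain ⟨u, rfl⟩ := hKu x hx
    exact (NormedRing.inverse_continuousAt u).norm.continuousWithinAt
  obtain ⟨b, hb⟩ := hK.bddAbove_image hcont
  obtain ⟨a, ha⟩ := hK.bddAbove_image (continuous_norm (E := R)).continuousOn
  set C : ℝ≥0 := ∑' γ : Γ, preWeight M ((γ : Rˣ) : R) with hC
  have hC0 : 0 < C := lt_of_lt_of_le (preWeight_pos M _) (hM.le_tsum (1 : Γ) fun _ _ => zero_le)
  refine ⟨((1 + a.toNNReal) ^ M)⁻¹ / ((1 + b.toNNReal) ^ M * C), by positivity, fun x hx => ?_⟩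
  have hu := hKu x hx
  unfold normWeight
  have hb' : ‖Ring.inverse x‖₊ ≤ b.toNNReal := by
    rw [← NNReal.coe_le_coe]
    exact (hb ⟨x, hx, rfl⟩).trans (Real.le_coe_toNNReal b)
  have ha' : ‖x‖₊ ≤ a.toNNReal := by
    rw [← NNReal.coe_le_coe]
    exact (ha ⟨x, hx, rfl⟩).trans (Real.le_coe_toNNReal a)
  have h1 : (orbitSum Γ M x).toNNReal ≤ (1 + b.toNNReal) ^ M * C := by
    rw [← ENNReal.coe_le_coe, ENNReal.coe_toNNReal (orbitSum_ne_top hM hu)]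
    refine (orbitSum_le (Ring.mul_inverse_cancel x hu)).trans ?_
    rw [← ENNReal.coe_tsum hM, ← ENNReal.coe_mul]
    gcongr
  refine div_le_div₀ zero_le ?_ (ENNReal.toNNReal_pos (orbitSum_ne_zero x) (orbitSum_ne_top hM hu)) h1
  unfold preWeight
  gcongr

end
end FAbCut

namespace FAbCut
open Filter Topology MeasureTheory
open scoped ENNReal NNReal ComplexConjugate

section
variable {R : Type*} [NormedRing R] [NormedAlgebra ℝ R]

variable (R) in
/-- A compact exhaustion of the units. -/
def exhaust (n : ℕ) : Set R := {x | ‖x‖ ≤ n ∧ 1 / ((n : ℝ) + 1) ≤ |rnorm x|}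

theorem exhaust_mono : Monotone (exhaust R) := fun m n h x hx => by
  refine ⟨hx.1.trans (by exact_mod_cast h), le_trans ?_ hx.2⟩
  have : (m : ℝ) ≤ n := by exact_mod_cast h
  gcongr

theorem exists_mem_exhaust {x : R} (hx : x ∈ normBall R) : ∃ n, x ∈ exhaust R n := by
  obtain ⟨a, ha⟩ := exists_nat_ge ‖x‖
  obtain ⟨b, hb⟩ := exists_nat_one_div_lt hx.1
  refine ⟨max a b, ha.trans (by exact_mod_cast le_max_left a b), le_trans ?_ hb.le⟩
  have : (b : ℝ) ≤ (max a b : ℕ) := by exact_mod_cast le_max_right a b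
  gcongr

variable [FiniteDimensional ℝ R] [MeasurableSpace R] [BorelSpace R]

theorem isCompact_exhaust (n : ℕ) : IsCompact (exhaust R n) := by
  have : ProperSpace R := FiniteDimensional.proper ℝ R
  have h1 : IsCompact {x : R | ‖x‖ ≤ n} := by
    have := isCompact_closedBall (0 : R) (n : ℝ)
    convert this using 1
    ext x
    simp
  exact h1.inter_right (isClosed_le continuous_const continuous_rnorm.abs)

variable {μ : Measure R} [μ.IsAddHaarMeasure] {Γ : Subgroup Rˣ} {M : ℕ} [Countable Γ]

theorem memLp_indicator_local (hM : Summable fun γ : Γ => preWeight M ((γ : Rˣ) : R))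
    (F : Lp ℂ 2 (orbitWeight (μ := μ) hM).ν) {K : Set R} (hK : IsCompact K)
    (hKu : ∀ x ∈ K, IsUnit x) :
    MemLp ((normBall R).indicator (F : R → ℂ)) 2 (μ.restrict K) := by
  have : CompleteSpace R := FiniteDimensional.complete ℝ R
  obtain ⟨c, hc, hcK⟩ := exists_le_normWeight hM hK hKu
  rw [memLp_indicator_iff_restrict measurableSet_normBall,
    Measure.restrict_comm measurableSet_normBall]
  have hle : (μ.restrict (normBall R)).restrict K ≤ (c⁻¹ : ℝ≥0∞) • (orbitWeight (μ := μ) hM).ν := by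
    refine Measure.le_iff.2 fun s hs => ?_
    rw [Measure.smul_apply, smul_eq_mul, OrbitWeight.ν, withDensity_apply _ hs,
      Measure.restrict_apply hs, ← ENNReal.mul_le_iff_le_inv, ]
    · calc (c : ℝ≥0∞) * (μ.restrict (normBall R)) (s ∩ K)
          = ∫⁻ x in s ∩ K, c ∂(μ.restrict (normBall R)) := by
            rw [setLIntegral_const]
        _ ≤ ∫⁻ x in s ∩ K, ((orbitWeight (μ := μ) hM).w x : ℝ≥0∞) ∂(μ.restrict (normBall R)) :=
            setLIntegral_mono' (hs.inter hK.measurableSet) fun x hx => by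
              exact_mod_cast hcK x hx.2
        _ ≤ _ := lintegral_mono_set Set.inter_subset_left
    · simpa using hc.ne'
    · simp
  exact ((Lp.memLp F).smul_measure (by simpa using hc.ne')).mono_measure hle

theorem tendsto_rep_of_tendsto {E : Subgroup Rˣ} (hE : IsUnimodular E) (hΓ : Γ ≤ E)
    [SMulInvariantMeasure Γ R (μ.restrict (normBall R))]
    (hM : Summable fun γ : Γ => preWeight M ((γ : Rˣ) : R)) (χ : Γ →* Circle)
    (g : ℕ → E) (hg : Tendsto (fun n => ((g n : Rˣ) : R)) atTop (𝓝 1))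
    (F : (orbitWeight (μ := μ) hM).space χ) :
    Tendsto (fun n => (orbitWeight (μ := μ) hM).rep χ hE.action (g n) F) atTop (𝓝 F) := by
  have : ProperSpace R := FiniteDimensional.proper ℝ R
  refine (orbitWeight (μ := μ) hM).tendsto_rep χ _ g F fun ε hε => ?_
  have hνm : ∀ᵐ x ∂(orbitWeight (μ := μ) hM).ν, x ∈ normBall R := (orbitWeight (μ := μ) hM).ν_ac.ae_le (ae_restrict_mem measurableSet_normBall)
  have hKm (n : ℕ) : MeasurableSet (exhaust R n) := (isCompact_exhaust n).measurableSet
  have hlim : Tendsto (fun n => eLpNorm ((F : Lp ℂ 2 (orbitWeight (μ := μ) hM).ν) : R → ℂ) 2 ((orbitWeight (μ := μ) hM).ν.restrict (exhaust R n)ᶜ))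
      atTop (𝓝 0) := by
    have h1 : Tendsto (fun n => ∫⁻ x in (exhaust R n)ᶜ, ‖(F : Lp ℂ 2 (orbitWeight (μ := μ) hM).ν) x‖ₑ ^ 2 ∂(orbitWeight (μ := μ) hM).ν) atTop
        (𝓝 0) := by
      have h2 : Tendsto (fun n => ∫⁻ x, (exhaust R n)ᶜ.indicator
          (fun x => ‖(F : Lp ℂ 2 (orbitWeight (μ := μ) hM).ν) x‖ₑ ^ 2) x ∂(orbitWeight (μ := μ) hM).ν) atTop (𝓝 (∫⁻ _, 0 ∂(orbitWeight (μ := μ) hM).ν)) := by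
        refine tendsto_lintegral_of_dominated_convergence (fun x => ‖(F : Lp ℂ 2 (orbitWeight (μ := μ) hM).ν) x‖ₑ ^ 2)
          (fun n => ?_) (fun n => ?_) ?_ ?_
        · exact ((Lp.stronglyMeasurable _).enorm.pow_const 2).indicator (hKm n).compl
        · exact Eventually.of_forall fun x => Set.indicator_le_self _ _ _
        · rw [← eLpNorm_two_sq]
          exact ENNReal.pow_ne_top (Lp.eLpNorm_ne_top _)
        · filter_upwards [hνm] with x hx
          obtain ⟨n₀, hn₀⟩ := exists_mem_exhaust hx
          refine tendsto_const_nhds.congr' ?_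
          filter_upwards [eventually_ge_atTop n₀] with n hn
          rw [Set.indicator_of_notMem]
          simpa using exhaust_mono hn hn₀
      rw [lintegral_zero] at h2
      refine h2.congr fun n => ?_
      rw [lintegral_indicator (hKm n).compl]
    have h2 := (ENNReal.continuous_rpow_const (y := (1 / 2 : ℝ))).tendsto 0 |>.comp h1
    rw [ENNReal.zero_rpow_of_pos (by norm_num)] at h2
    refine h2.congr fun n => ?_
    rw [Function.comp_apply, ← eLpNorm_two_sq, ← ENNReal.rpow_natCast, ← ENNReal.rpow_mul]
    norm_num
  obtain ⟨n, hn⟩ := (hlim.eventually_le_const (ENNReal.ofReal_pos.2 hε)).exists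
  refine ⟨exhaust R n, hKm n, hn, ?_⟩
  have hT : Tendsto (fun n => rightMulMap ((g n : Rˣ) : R)) atTop (𝓝 (ContinuousMap.id R)) := by
    have h := (continuous_rightMulMap (R := R)).tendsto 1 |>.comp hg
    have h1 : rightMulMap (1 : R) = ContinuousMap.id R := by ext x; simp [rightMulMap]
    rwa [h1] at h
  have hV : IsOpen {x : R | rnorm x ≠ 0} := isOpen_ne_fun continuous_rnorm continuous_const
  have hmain := tendsto_eLpNorm_comp_sub (μ := μ) (f := (normBall R).indicator (F : Lp ℂ 2 (orbitWeight (μ := μ) hM).ν)) hV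
    (fun K hKV hK => memLp_indicator_local hM (F : Lp ℂ 2 (orbitWeight (μ := μ) hM).ν) hK fun x hx =>
      isUnit_of_rnorm_ne_zero (hKV hx)) hT
    (fun n => hE.measurePreserving_right (g n).2) (isCompact_exhaust n) (fun x hx h => by
      have := hx.2
      rw [h, abs_zero] at this
      exact absurd this (not_le.2 (by positivity)))
  refine tendsto_of_tendsto_of_tendsto_of_le_of_le tendsto_const_nhds hmain (fun _ => zero_le) fun k => ?_
  have hle : (orbitWeight (μ := μ) hM).ν.restrict (exhaust R n) ≤ (μ.restrict (exhaust R n)).restrict (normBall R) := by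
    rw [Measure.restrict_comm measurableSet_normBall]
    refine Measure.restrict_mono_measure ?_ _
    refine Measure.le_iff.2 fun s hs => ?_
    rw [OrbitWeight.ν, withDensity_apply _ hs, ← setLIntegral_one]
    refine lintegral_mono_ae ?_
    filter_upwards [ae_restrict_of_ae (ae_restrict_mem measurableSet_normBall)] with x hx
    exact normWeight_le_one hM (isUnit_of_mem_normBall hx)
  refine (eLpNorm_mono_measure _ hle).trans ?_
  refine le_trans (le_of_eq ?_) (eLpNorm_mono_measure _ (Measure.restrict_le_self (s := normBall R)))
  refine eLpNorm_congr_ae ?_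
  filter_upwards [ae_restrict_mem measurableSet_normBall] with x hx
  have hx' : x * ((g k : Rˣ) : R) ∈ normBall R := (hE.mul_mem (g k).2).2 hx
  simp only [rightMulMap, ContinuousMap.coe_mk]
  rw [Set.indicator_of_mem hx, Set.indicator_of_mem hx']
  rfl

end
end FAbCut

namespace FAbCut
open Filter Topology MeasureTheory
open scoped ENNReal NNReal ComplexConjugate

section
variable {R : Type*} [NormedRing R] [NormedAlgebra ℝ R] [FiniteDimensional ℝ R] [MeasurableSpace R] [BorelSpace R]
  {μ : Measure R} [μ.IsAddHaarMeasure] {Γ E : Subgroup Rˣ}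

theorem exists_units_tendsto_one {p : R → Prop} (hp : ∀ᵐ h ∂μ, p h) :
    ∃ h : ℕ → Rˣ, (∀ n, p (h n)) ∧ Tendsto (fun n => (h n : R)) atTop (𝓝 1) ∧
      Tendsto (fun n => (((h n)⁻¹ : Rˣ) : R)) atTop (𝓝 1) := by
  have : CompleteSpace R := FiniteDimensional.complete ℝ R
  have hd : Dense {x | p x} := Measure.dense_of_ae hp
  have h1 : (1 : R) ∈ closure ({x : R | IsUnit x} ∩ {x | p x}) :=
    hd.open_subset_closure_inter Units.isOpen isUnit_one
  obtain ⟨x, hx, hlim⟩ := mem_closure_iff_seq_limit.1 h1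
  choose u hu using fun n => (hx n).1
  refine ⟨u, fun n => by rw [hu]; exact (hx n).2, by simpa only [hu] using hlim, ?_⟩
  have := (NormedRing.inverse_continuousAt (1 : Rˣ)).tendsto.comp (by simpa using hlim)
  simp only [Units.val_one, Ring.inverse_one] at this
  refine this.congr fun n => ?_
  rw [Function.comp_apply, ← hu, Ring.inverse_unit]

theorem ae_eq_zero_of_right_invariant (hE : IsUnimodular E) (hΓ : Γ ≤ E) [hn : E.Normal]
    {χ : Γ →* Circle} (hχ : χ ≠ 1) {f : R → ℂ} (hf : Measurable f)
    (hf0 : ∀ x, x ∉ normBall R → f x = 0)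
    (hloc : ∀ K ⊆ {x : R | rnorm x ≠ 0}, IsCompact K → MemLp f 2 (μ.restrict K))
    (hr : ∀ g ∈ E, ∀ᵐ x ∂μ, f (x * (g : R)) = f x)
    (hl : ∀ γ : Γ, ∀ᵐ x ∂μ, f (((γ : Rˣ) : R) * x) = χ γ * f x) : f =ᵐ[μ] 0 := by
  have : ProperSpace R := FiniteDimensional.proper ℝ R
  obtain ⟨γ, hγ⟩ : ∃ γ, χ γ ≠ 1 := by
    by_contra! h
    exact hχ (MonoidHom.ext h)
  have h1 : ∀ x : R, ∀ᵐ h ∂μ, f (h * ((γ : Rˣ) : R) * x) = f (h * x) := fun x => by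
    by_cases hx : rnorm x = 0
    · refine Eventually.of_forall fun h => ?_
      rw [hf0, hf0] <;> simp [normBall, hx]
    · obtain ⟨u, rfl⟩ := isUnit_of_rnorm_ne_zero hx
      have hg : u⁻¹ * (γ : Rˣ) * u⁻¹⁻¹ ∈ E := hn.conj_mem _ (hΓ γ.2) u⁻¹
      have hq : Measure.QuasiMeasurePreserving (LinearMap.mulRight ℝ (u : R)) μ μ := by
        refine quasiMeasurePreserving_linear _ ?_
        exact ((u.map (rnorm (R := R))).isUnit).ne_zero
      filter_upwards [hq.ae (hr _ hg)] with h hh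
      rw [LinearMap.mulRight_apply] at hh
      rw [← hh]
      congr 1
      simp [mul_assoc]
  have h2 : ∀ᵐ h ∂μ, ∀ᵐ x ∂μ, f (h * ((γ : Rˣ) : R) * x) = f (h * x) := by
    rw [Measure.ae_ae_comm]
    · exact Eventually.of_forall h1
    · refine measurableSet_eq_fun ?_ ?_
      · exact hf.comp (by fun_prop : Continuous fun p : R × R => p.1 * ((γ : Rˣ) : R) * p.2).measurable
      · exact hf.comp (by fun_prop : Continuous fun p : R × R => p.1 * p.2).measurable
  obtain ⟨h, hh, hl1, hl2⟩ := exists_units_tendsto_one h2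
  set s : ℕ → Rˣ := fun n => h n * (γ : Rˣ) * (h n)⁻¹ * (γ : Rˣ)⁻¹ with hs
  have hsE : ∀ n, s n ∈ E := fun n => E.mul_mem (hn.conj_mem _ (hΓ γ.2) _) (E.inv_mem (hΓ γ.2))
  have hslim : Tendsto (fun n => (s n : R)) atTop (𝓝 1) := by
    have := ((hl1.mul_const ((γ : Rˣ) : R)).mul hl2).mul_const (((γ : Rˣ)⁻¹ : Rˣ) : R)
    simpa [hs] using this
  have hsf : ∀ n, ∀ᵐ y ∂μ, f ((s n : R) * y) = (χ γ⁻¹ : ℂ) * f y := fun n => by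
    have hq : Measure.QuasiMeasurePreserving
        (LinearMap.mulLeft ℝ ((((h n)⁻¹ * (γ : Rˣ)⁻¹ : Rˣ)) : R)) μ μ := by
      refine quasiMeasurePreserving_linear _ ?_
      exact ((((h n)⁻¹ * (γ : Rˣ)⁻¹ : Rˣ).map (Algebra.norm ℝ : R →* ℝ)).isUnit).ne_zero
    filter_upwards [hq.ae (hh n), hl γ⁻¹] with y h1 h2
    rw [LinearMap.mulLeft_apply] at h1
    rw [← h2]
    calc f ((s n : R) * y) = _ := by
          congr 1
          simp only [hs, Units.val_mul, mul_assoc]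
      _ = _ := h1
      _ = _ := by
          congr 1
          simp [mul_assoc]
  have hT : Tendsto (fun n => leftMulMap (s n : R)) atTop (𝓝 (ContinuousMap.id R)) := by
    have h := (continuous_leftMulMap (R := R)).tendsto 1 |>.comp hslim
    have h1 : leftMulMap (1 : R) = ContinuousMap.id R := by ext x; simp [leftMulMap]
    rwa [h1] at h
  have hV : IsOpen {x : R | rnorm x ≠ 0} := isOpen_ne_fun continuous_rnorm continuous_const
  have hK : ∀ n, ∀ᵐ x ∂μ, x ∈ exhaust R n → f x = 0 := fun n => by
    have hsub : exhaust R n ⊆ {x : R | rnorm x ≠ 0} := fun x hx h => by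
      have := hx.2
      rw [h, abs_zero] at this
      exact absurd this (not_le.2 (by positivity))
    have hmain := tendsto_eLpNorm_comp_sub (μ := μ) hV hloc hT
      (fun n => hE.measurePreserving_left (hsE n)) (isCompact_exhaust n) hsub
    have hconst : ∀ k, eLpNorm (fun x => f (leftMulMap (s k : R) x) - f x) 2 (μ.restrict (exhaust R n)) =
        eLpNorm (fun x => ((χ γ⁻¹ : ℂ) - 1) * f x) 2 (μ.restrict (exhaust R n)) := fun k => by
      refine eLpNorm_congr_ae ?_
      filter_upwards [ae_restrict_of_ae (hsf k)] with x hx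
      simp only [leftMulMap, ContinuousMap.coe_mk]
      rw [hx]; ring
    simp only [hconst] at hmain
    have h0 := tendsto_nhds_unique tendsto_const_nhds hmain
    rw [eLpNorm_eq_zero_iff (by fun_prop) (by norm_num)] at h0
    rw [← ae_restrict_iff' (isCompact_exhaust n).measurableSet]
    filter_upwards [h0] with x hx
    refine (mul_eq_zero.1 hx).resolve_left ?_
    rw [sub_eq_zero, Circle.coe_eq_one, map_inv, inv_eq_one]
    exact hγ
  filter_upwards [ae_all_iff.2 hK] with x hx
  by_cases hxb : x ∈ normBall R
  · obtain ⟨n, hn⟩ := exists_mem_exhaust hxb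
    exact hx n hn
  · exact hf0 x hxb

theorem char_eq_one_of_invariant [Countable Γ] {M : ℕ} (hE : IsUnimodular E) (hΓ : Γ ≤ E)
    [hn : E.Normal] [SMulInvariantMeasure Γ R (μ.restrict (normBall R))]
    (hM : Summable fun γ : Γ => preWeight M ((γ : Rˣ) : R)) {χ : Γ →* Circle}
    {F : (orbitWeight (μ := μ) hM).space χ} (hF0 : F ≠ 0)
    (hF : ∀ g, (orbitWeight (μ := μ) hM).rep χ hE.action g F = F) : χ = 1 := by
  by_contra hχ
  refine hF0 ((orbitWeight (μ := μ) hM).space_ext ?_)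
  set f : R → ℂ := (normBall R).indicator (F : Lp ℂ 2 (orbitWeight (μ := μ) hM).ν) with hf
  have hae : ∀ {p : R → Prop}, (∀ᵐ x ∂(μ.restrict (normBall R)), p x) →
      ∀ᵐ x ∂μ, x ∈ normBall R → p x := fun h =>
    (ae_restrict_iff' measurableSet_normBall).1 h
  have h0 : f =ᵐ[μ] 0 := by
    refine ae_eq_zero_of_right_invariant hE hΓ hχ
      ((Lp.stronglyMeasurable _).measurable.indicator measurableSet_normBall)
      (fun x hx => Set.indicator_of_notMem hx _)
      (fun K hKV hK => memLp_indicator_local hM _ hK fun x hx =>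
        isUnit_of_rnorm_ne_zero (hKV hx)) (fun g hg => ?_) (fun γ => ?_)
    · have h1 := (orbitWeight (μ := μ) hM).coeFn_rep χ hE.action ⟨g, hg⟩ F
      rw [hF] at h1
      filter_upwards [hae h1] with x hx
      by_cases hxb : x ∈ normBall R
      · rw [hf, Set.indicator_of_mem hxb, Set.indicator_of_mem ((hE.mul_mem hg).2 hxb), hx hxb]
        rfl
      · rw [hf, Set.indicator_of_notMem hxb, Set.indicator_of_notMem fun h => hxb ((hE.mul_mem hg).1 h)]
    · filter_upwards [hae (F.2 γ)] with x hx
      by_cases hxb : x ∈ normBall R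
      · rw [hf, Set.indicator_of_mem hxb, Set.indicator_of_mem ((hE.smul_mem (hΓ γ.2)).2 hxb)]
        exact hx hxb
      · rw [hf, Set.indicator_of_notMem hxb,
          Set.indicator_of_notMem fun h => hxb ((hE.smul_mem (hΓ γ.2)).1 h), mul_zero]
  filter_upwards [ae_restrict_of_ae h0, ae_restrict_mem measurableSet_normBall,
    (orbitWeight (μ := μ) hM).ac_ν.ae_eq (Lp.coeFn_zero ℂ 2 (orbitWeight (μ := μ) hM).ν)] with x h1 h2 h3
  rw [hf, Set.indicator_of_mem h2] at h1
  rw [h1]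
  exact h3.symm

theorem volume_normBall_ne_zero [Nontrivial R] : μ (normBall R) ≠ 0 := by
  have hopen : IsOpen {x : R | 0 < |rnorm x| ∧ |rnorm x| < 1} :=
    (isOpen_lt continuous_const continuous_rnorm.abs).inter
      (isOpen_lt continuous_rnorm.abs continuous_const)
  have hne : (algebraMap ℝ R (1 / 2)) ∈ {x : R | 0 < |rnorm x| ∧ |rnorm x| < 1} := by
    have hfr : 0 < Module.finrank ℝ R := Module.finrank_pos
    rw [Set.mem_ofPred_eq, rnorm_algebraMap, abs_pow]
    refine ⟨by positivity, pow_lt_one₀ (by positivity) (by norm_num [abs_lt]) hfr.ne'⟩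
  have := hopen.measure_pos μ ⟨_, hne⟩
  refine (lt_of_lt_of_le this (measure_mono fun x hx => ?_)).ne'
  exact ⟨hx.1, hx.2.le⟩

theorem exists_char_seq (A : Type*) [Group A] [Countable A] (hinf : Infinite (Abelianization A)) :
    ∃ χ : ℕ → A →* Circle, (∀ n, χ n ≠ 1) ∧
      ∀ a, Tendsto (fun n => (χ n a : ℂ)) atTop (𝓝 1) := by
  classical
  have : Nonempty A := ⟨1⟩
  obtain ⟨en, hen⟩ := exists_surjective_nat A
  choose χ hχ1 hχ2 using fun n : ℕ => exists_char_near_one (Abelianization A)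
    ((Finset.range n).image fun i => Abelianization.of (en i)) (Nat.one_div_pos_of_nat (α := ℝ) (n := n))
  refine ⟨fun n => (χ n).comp Abelianization.of, fun n h => hχ1 n ?_, fun a => ?_⟩
  · ext x : 2
    exact DFunLike.congr_fun h x
  · obtain ⟨i, rfl⟩ := hen a
    rw [tendsto_iff_norm_sub_tendsto_zero]
    refine squeeze_zero' (Eventually.of_forall fun _ => norm_nonneg _) ?_ tendsto_one_div_add_atTop_nhds_zero_nat
    filter_upwards [eventually_gt_atTop i] with n hn
    exact (hχ2 n _ (Finset.mem_image_of_mem _ (Finset.mem_range.2 hn))).le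

/-- A lattice-like subgroup of the elementary group has finite abelianization. -/
theorem MatrixUnits.finite_abelianization {ι : Type*} [DecidableEq ι] [Fintype ι] [Nontrivial R]
    (U : MatrixUnits ι R) (hι : 3 ≤ Fintype.card ι) (hn : U.elemSubgroup.Normal)
    (hΓ : Γ ≤ U.elemSubgroup) {M : ℕ} (hM : Summable fun γ : Γ => preWeight M ((γ : Rˣ) : R))
    {S : Set R} (hS : MeasurableSet S) (hSμ : μ S < ⊤)
    (hcov : ∀ᵐ x ∂μ, x ∈ normBall R → ∃ γ ∈ Γ, (γ : R) * x ∈ S) : Finite (Abelianization Γ) := by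
  classical
  have : CompleteSpace R := FiniteDimensional.complete ℝ R
  have : Countable Γ := by
    have h1 := Summable.countable_support_ennreal (ENNReal.tsum_coe_ne_top_iff_summable.2 hM)
    have h2 : (Function.support fun γ : Γ => (preWeight M ((γ : Rˣ) : R) : ℝ≥0∞)) = Set.univ :=
      Set.eq_univ_of_forall fun γ => ENNReal.coe_ne_zero.2 (preWeight_pos M ((γ : Rˣ) : R)).ne'
    rwa [h2, Set.countable_univ_iff] at h1
  by_contra hfin
  rw [not_finite_iff_infinite] at hfin
  obtain ⟨χ, hχ1, hχ⟩ := exists_char_seq Γ hfin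
  have hE : IsUnimodular U.elemSubgroup := fun g hg => by
    constructor
    · have := U.map_eq_one_of_mem hι (Units.map (Algebra.norm ℝ : R →* ℝ)) hg
      have := congrArg Units.val this
      simp only [Units.coe_map, Units.val_one] at this
      simp [this]
    · have := U.map_eq_one_of_mem hι (Units.map (rnorm (R := R))) hg
      have := congrArg Units.val this
      simp only [Units.coe_map, Units.val_one] at this
      simp [this]
  have : SMulInvariantMeasure Γ R (μ.restrict (normBall R)) := (hE.mono hΓ).smulInvariant
  set W := orbitWeight (μ := μ) hM with hW
  have hle : W.ν Set.univ ≤ (μ.restrict (normBall R)) S := by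
    refine W.lintegral_le hS ?_
    rw [ae_restrict_iff' measurableSet_normBall]
    filter_upwards [hcov] with x hx hxb
    obtain ⟨γ, hγ, h⟩ := hx hxb
    exact ⟨⟨γ, hγ⟩, h⟩
  have : IsFiniteMeasure W.ν :=
    ⟨hle.trans_lt ((Measure.restrict_apply_le _ _).trans_lt hSμ)⟩
  have hν : W.ν ≠ 0 := fun h => by
    have h1 := W.ac_ν (s := Set.univ) (by simp [h])
    rw [Measure.restrict_apply_univ] at h1
    exact volume_normBall_ne_zero h1
  obtain ⟨i, j, k, hij, hik, hjk⟩ := Fintype.two_lt_card_iff.1 hι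
  obtain ⟨n, v, hv, hvs⟩ := W.exists_almost_invariant hν hE.action hχ
    {⟨_, U.elem_mem hik (U.e i k)⟩, ⟨_, U.elem_mem hjk (U.e j k)⟩, ⟨_, U.elem_mem hij (U.e i j)⟩,
      ⟨_, U.elem_mem hij.symm (U.e j i)⟩} (ε := 1 / 100) (by norm_num)
  obtain ⟨w, hw0, hw⟩ := MatrixUnits.exists_invariant_vector (U := U) (π := W.rep (χ n) hE.action)
    (fun g hg v => tendsto_rep_of_tendsto hE hΓ hM (χ n) g hg v) hij hjk hik hv
    (hvs _ (by simp)) (hvs _ (by simp)) (hvs _ (by simp)) (hvs _ (by simp))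
  exact hχ1 n (char_eq_one_of_invariant hE hΓ hM hw0 hw)

end
end FAbCut

namespace FAbCut
open Filter Topology MeasureTheory
open scoped ENNReal

section
variable {E : Type*} [NormedAddCommGroup E] [NormedSpace ℝ E] [FiniteDimensional ℝ E]
  [MeasurableSpace E] [BorelSpace E] (μ : Measure E) [μ.IsAddHaarMeasure]

theorem measurable_measure_ball_norm : Measurable fun z : E => μ (Metric.ball 0 ‖z‖) := by
  have : Monotone fun r : ℝ => μ (Metric.ball (0 : E) r) := fun r s h =>
    measure_mono (Metric.ball_subset_ball h)
  exact this.measurable.comp measurable_norm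

theorem measure_setOf_measure_ball_norm_le [Nontrivial E] (T : ℝ≥0∞) :
    μ {z : E | μ (Metric.ball 0 ‖z‖) ≤ T} ≤ T := by
  rcases eq_or_ne T ⊤ with rfl | hT
  · exact le_top
  have hv0 : μ (Metric.ball (0 : E) 1) ≠ 0 := (Metric.measure_ball_pos μ _ one_pos).ne'
  have hvt : μ (Metric.ball (0 : E) 1) ≠ ⊤ := measure_ball_lt_top.ne
  set D := Module.finrank ℝ E with hD
  have hD0 : D ≠ 0 := Module.finrank_pos.ne'
  set c := (μ (Metric.ball (0 : E) 1)).toReal with hc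
  have hcp : 0 < c := ENNReal.toReal_pos hv0 hvt
  set ρ : ℝ := (T.toReal / c) ^ ((D : ℝ)⁻¹) with hρ
  have hρ0 : 0 ≤ ρ := Real.rpow_nonneg (by positivity) _
  have hρD : ρ ^ D = T.toReal / c := Real.rpow_inv_natCast_pow (by positivity) hD0
  have hball : ∀ r : ℝ, 0 ≤ r → μ (Metric.ball (0 : E) r) = ENNReal.ofReal (r ^ D * c) := by
    intro r hr
    rw [Measure.addHaar_ball μ _ hr, ENNReal.ofReal_mul (by positivity), hc,
      ENNReal.ofReal_toReal hvt]
  have hsub : {z : E | μ (Metric.ball 0 ‖z‖) ≤ T} ⊆ Metric.closedBall 0 ρ := by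
    intro z hz
    rw [Set.mem_ofPred_eq, hball _ (norm_nonneg z), ENNReal.ofReal_le_iff_le_toReal hT] at hz
    rw [mem_closedBall_zero_iff]
    refine le_of_pow_le_pow_left₀ hD0 hρ0 ?_
    rw [hρD, le_div_iff₀ hcp]
    exact hz
  refine (measure_mono hsub).trans ?_
  rw [Measure.addHaar_closedBall μ _ hρ0, ← ENNReal.ofReal_toReal hvt, ← hD, ← hc,
    ← ENNReal.ofReal_mul (by positivity), hρD, div_mul_cancel₀ _ hcp.ne', ENNReal.ofReal_toReal hT]

end

section
variable {B : Type*} [NormedRing B] [NormedAlgebra ℝ B] [FiniteDimensional ℝ B] [Nontrivial B]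
  [MeasureSpace B] [BorelSpace B] [(volume : Measure B).IsAddHaarMeasure]

omit [Nontrivial B] [(volume : Measure B).IsAddHaarMeasure] in
theorem measurable_ring_inverse : Measurable (Ring.inverse : B → B) := by
  classical
  have : CompleteSpace B := FiniteDimensional.complete ℝ B
  have hm : MeasurableSet {x : B | IsUnit x} := Units.isOpen.measurableSet
  have : (Ring.inverse : B → B) = {x : B | IsUnit x}.piecewise Ring.inverse (fun _ => 0) := by
    ext x
    by_cases hx : IsUnit x
    · exact (Set.piecewise_eq_of_mem {x : B | IsUnit x} Ring.inverse (fun _ => 0) hx).symm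
    · rw [Ring.inverse_non_unit _ hx]
      exact (Set.piecewise_eq_of_notMem {x : B | IsUnit x} Ring.inverse (fun _ => 0) hx).symm
  rw [this]
  refine ContinuousOn.measurable_piecewise ?_ continuousOn_const hm
  rintro _ ⟨u, rfl⟩
  exact (NormedRing.inverse_continuousAt u).continuousWithinAt

/-- The data set of reduced matrices, depending on a bound for the covolume. -/
def siegel (P : Set B) : (n : ℕ) → Set (ℝ≥0∞ × (Fin n → Fin n → B))
  | 0 => Set.univ
  | n + 1 => {p | volume (Metric.ball (0 : Fin (n + 1) → B) ‖p.2 0‖) ≤ p.1 ∧ IsUnit (p.2 0 0) ∧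
      (∀ i : Fin n, p.2 i.succ 0 * Ring.inverse (p.2 0 0) ∈ P) ∧
      ((p.1 / (volume (Metric.ball (0 : B) 1) * ENNReal.ofReal |rnorm (p.2 0 0)|),
        fun i j => p.2 i.succ j.succ - p.2 i.succ 0 * Ring.inverse (p.2 0 0) * p.2 0 j.succ) :
        ℝ≥0∞ × (Fin n → Fin n → B)) ∈ siegel P n}

omit [Nontrivial B] in
theorem measurableSet_siegel {P : Set B} (hP : MeasurableSet P) (n : ℕ) :
    MeasurableSet (siegel P n) := by
  have : CompleteSpace B := FiniteDimensional.complete ℝ B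
  have : ProperSpace B := FiniteDimensional.proper ℝ B
  have : SecondCountableTopology B := secondCountable_of_proper
  induction n with
  | zero => exact MeasurableSet.univ
  | succ n ih =>
    have he : ∀ i j, Measurable fun p : ℝ≥0∞ × (Fin (n + 1) → Fin (n + 1) → B) => p.2 i j :=
      fun i j => (measurable_pi_apply j).comp ((measurable_pi_apply i).comp measurable_snd)
    have hr : Measurable fun p : ℝ≥0∞ × (Fin (n + 1) → Fin (n + 1) → B) => p.2 0 :=
      (measurable_pi_apply 0).comp measurable_snd
    have hi : Measurable fun p : ℝ≥0∞ × (Fin (n + 1) → Fin (n + 1) → B) =>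
      Ring.inverse (p.2 0 0) := measurable_ring_inverse.comp (he 0 0)
    refine MeasurableSet.inter (measurableSet_le ((measurable_measure_ball_norm _).comp hr)
      measurable_fst) (MeasurableSet.inter ?_ (MeasurableSet.inter ?_ ?_))
    · exact (he 0 0) (Units.isOpen (R := B)).measurableSet
    · have := MeasurableSet.iInter fun i : Fin n => ((he i.succ 0).mul hi) hP
      refine (congrArg MeasurableSet ?_).mpr this
      ext p
      exact (Set.mem_iInter (x := p) (s := fun b : Fin n => ((fun p : ℝ≥0∞ × (Fin (n + 1) → Fin (n + 1) → B) =>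
        p.2 b.succ 0) * fun p => Ring.inverse (p.2 0 0)) ⁻¹' P)).symm
    · refine Measurable.prodMk ?_ ?_ ih
      · exact measurable_fst.div (measurable_const.mul
          (continuous_rnorm.measurable.comp (he 0 0)).norm.ennreal_ofReal)
      · refine measurable_pi_iff.2 fun i => measurable_pi_iff.2 fun j => ?_
        exact (he i.succ j.succ).sub (((he i.succ 0).mul hi).mul (he 0 j.succ))


omit [Nontrivial B] in
theorem volume_setOf_mul_inverse_mem {P : Set B} {a : B} (ha : IsUnit a) {n : ℕ} :
    volume {c : Fin n → B | ∀ i, c i * Ring.inverse a ∈ P} =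
      (ENNReal.ofReal |rnorm a| * volume P) ^ n := by
  have : ProperSpace B := FiniteDimensional.proper ℝ B
  have : SecondCountableTopology B := secondCountable_of_proper
  have h0 : {c : Fin n → B | ∀ i, c i * Ring.inverse a ∈ P} =
      Set.univ.pi fun _ => (LinearMap.mulRight ℝ (Ring.inverse a)) ⁻¹' P := by
    ext c; simp
  have h1 : rnorm a * rnorm (Ring.inverse a) = 1 := by
    rw [← map_mul, Ring.mul_inverse_cancel _ ha, map_one]
  have h2 : LinearMap.det (LinearMap.mulRight ℝ (Ring.inverse a)) ≠ 0 :=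
    right_ne_zero_of_mul (a := rnorm a) (by rw [show LinearMap.det (LinearMap.mulRight ℝ (Ring.inverse a)) = rnorm (Ring.inverse a) from rfl, h1]; exact one_ne_zero)
  rw [h0, volume_pi_pi]
  simp only [Finset.prod_const, Finset.card_univ, Fintype.card_fin]
  rw [Measure.addHaar_preimage_linearMap _ h2]
  congr 3
  exact congrArg abs (inv_eq_of_mul_eq_one_left h1)

/-- Splitting off the first row and column. -/
noncomputable def splitMatrix (B : Type*) [NormedRing B] [NormedAlgebra ℝ B] (n : ℕ) :
    (Fin (n + 1) → Fin (n + 1) → B) ≃ₗ[ℝ] (Fin (n + 1) → B) × ((Fin n → B) × (Fin n → Fin n → B)) where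
  toFun y := (y 0, (fun i => y i.succ 0, fun i j => y i.succ j.succ))
  invFun p := Fin.cons p.1 fun i => Fin.cons (p.2.1 i) (p.2.2 i)
  map_add' _ _ := rfl
  map_smul' _ _ := rfl
  left_inv y := by
    refine funext fun i => ?_
    refine Fin.cases rfl (fun i => ?_) i
    refine funext fun j => Fin.cases rfl (fun j => rfl) j
  right_inv p := rfl

theorem exists_volume_siegel_le {P : Set B} (hPm : MeasurableSet P)
    (hPv : volume P ≠ ⊤) (n : ℕ) :
    ∃ K : ℝ≥0∞, K ≠ ⊤ ∧ ∀ T : ℝ≥0∞, volume {y | (T, y) ∈ siegel P n} ≤ K * T ^ n := by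
  have : CompleteSpace B := FiniteDimensional.complete ℝ B
  have : ProperSpace B := FiniteDimensional.proper ℝ B
  have : SecondCountableTopology B := secondCountable_of_proper
  induction n with
  | zero => exact ⟨volume (Set.univ : Set (Fin 0 → Fin 0 → B)), by
      rw [volume_pi, Measure.pi_univ]; simp, fun T => by
        rw [pow_zero, mul_one]; exact measure_mono (Set.subset_univ _)⟩
  | succ n ih =>
    obtain ⟨K, hK, ih⟩ := ih
    set v : ℝ≥0∞ := volume (Metric.ball (0 : B) 1) with hv
    have hv0 : v ≠ 0 := (Metric.measure_ball_pos _ _ one_pos).ne'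
    have hvt : v ≠ ⊤ := measure_ball_lt_top.ne
    set e := (splitMatrix B n).toContinuousLinearEquiv with he
    set ν : Measure ((Fin (n + 1) → B) × ((Fin n → B) × (Fin n → Fin n → B))) :=
      (volume : Measure (Fin (n + 1) → B)).prod
        ((volume : Measure (Fin n → B)).prod (volume : Measure (Fin n → Fin n → B))) with hν
    have i0 : (volume : Measure (Fin n → B)).IsAddHaarMeasure := inferInstance
    have i1 : (volume : Measure (Fin n → Fin n → B)).IsAddHaarMeasure :=
      Measure.pi.isAddHaarMeasure fun _ : Fin n => (volume : Measure (Fin n → B))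
    have i4 : (volume : Measure (Fin (n + 1) → Fin (n + 1) → B)).IsAddHaarMeasure :=
      Measure.pi.isAddHaarMeasure fun _ : Fin (n + 1) => (volume : Measure (Fin (n + 1) → B))
    have i2 : ((volume : Measure (Fin n → B)).prod
      (volume : Measure (Fin n → Fin n → B))).IsAddHaarMeasure :=
      Measure.prod.instIsAddHaarMeasure _ _
    have i3 : ν.IsAddHaarMeasure := Measure.prod.instIsAddHaarMeasure _ _
    have i5 : (Measure.map e volume).IsAddHaarMeasure := e.isAddHaarMeasure_map volume
    have hmap := Measure.isAddLeftInvariant_eq_smul (Measure.map e volume) ν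
    set k := Measure.addHaarScalarFactor (Measure.map e volume) ν with hk
    refine ⟨k * (volume P ^ n * v⁻¹ ^ n * K), by finiteness, fun T => ?_⟩
    set S : Set ((Fin (n + 1) → B) × ((Fin n → B) × (Fin n → Fin n → B))) :=
      {p | (T, e.symm p) ∈ siegel P (n + 1)} with hS
    have hSm : MeasurableSet S :=
      (measurable_const.prodMk e.symm.continuous.measurable) (measurableSet_siegel hPm (n + 1))
    have h1 : {y | (T, y) ∈ siegel P (n + 1)} = e ⁻¹' S := by
      ext y; simp [hS]
    rw [h1, ← Measure.map_apply e.continuous.measurable hSm, hmap, Measure.smul_apply, hν,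
      Measure.prod_apply hSm]
    have hbound : ∀ a : Fin (n + 1) → B,
        ((volume : Measure (Fin n → B)).prod (volume : Measure (Fin n → Fin n → B)))
          (Prod.mk a ⁻¹' S) ≤ {z : Fin (n + 1) → B | volume (Metric.ball (0 : Fin (n + 1) → B) ‖z‖) ≤ T}.indicator
            (fun _ => volume P ^ n * v⁻¹ ^ n * K * T ^ n) a := by
      intro a
      by_cases ha : volume (Metric.ball (0 : Fin (n + 1) → B) ‖a‖) ≤ T ∧ IsUnit (a 0)
      swap
      · have : Prod.mk a ⁻¹' S = ∅ := by
          ext p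
          simp only [Set.mem_preimage, hS, Set.mem_empty_iff_false, iff_false]
          exact fun h => ha ⟨h.1, h.2.1⟩
        rw [this, measure_empty]; exact zero_le
      rw [Set.indicator_of_mem (show a ∈ {z : Fin (n + 1) → B | volume (Metric.ball (0 : Fin (n + 1) → B) ‖z‖) ≤ T}
        from ha.1)]
      set N := ENNReal.ofReal |rnorm (a 0)| with hN
      have hN0 : N ≠ 0 := by
        have := (ha.2.map (rnorm : B →* ℝ)).ne_zero
        rw [hN, Ne, ENNReal.ofReal_eq_zero, not_le]
        exact abs_pos.2 this
      have hNt : N ≠ ⊤ := ENNReal.ofReal_ne_top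
      rw [Measure.prod_apply (measurable_prodMk_left hSm)]
      have hc : ∀ c : Fin n → B, volume (Prod.mk c ⁻¹' (Prod.mk a ⁻¹' S)) ≤
          {c : Fin n → B | ∀ i, c i * Ring.inverse (a 0) ∈ P}.indicator
            (fun _ => K * (T / (v * N)) ^ n) c := by
        intro c
        by_cases hcP : ∀ i, c i * Ring.inverse (a 0) ∈ P
        swap
        · have : Prod.mk c ⁻¹' (Prod.mk a ⁻¹' S) = ∅ := by
            ext p
            simp only [Set.mem_preimage, hS, Set.mem_empty_iff_false, iff_false]
            exact fun h => hcP h.2.2.1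
          rw [this, measure_empty]; exact zero_le
        rw [Set.indicator_of_mem (show c ∈ {c : Fin n → B | ∀ i, c i * Ring.inverse (a 0) ∈ P} from hcP)]
        refine le_trans ?_ (ih (T / (v * N)))
        set D : Fin n → Fin n → B := fun i j => c i * Ring.inverse (a 0) * a j.succ with hD
        rw [← measure_preimage_add_right volume (-D) {y | (T / (v * N), y) ∈ siegel P n}]
        refine measure_mono fun d hd => ?_
        rw [Set.mem_preimage, ← sub_eq_add_neg]
        exact hd.2.2.2
      refine (lintegral_mono hc).trans ?_
      rw [lintegral_indicator_const]
      · rw [volume_setOf_mul_inverse_mem ha.2, ← hN]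
        rw [div_eq_mul_inv, mul_pow, mul_pow, ENNReal.mul_inv (Or.inl hv0) (Or.inl hvt), mul_pow]
        have : N ^ n * N⁻¹ ^ n = 1 := by
          rw [← mul_pow, ENNReal.mul_inv_cancel hN0 hNt, one_pow]
        calc K * (T ^ n * (v⁻¹ ^ n * N⁻¹ ^ n)) * (N ^ n * volume P ^ n)
            = (volume P ^ n * v⁻¹ ^ n * K * T ^ n) * (N ^ n * N⁻¹ ^ n) := by ring
          _ ≤ _ := by rw [this, mul_one]
      · exact MeasurableSet.congr (MeasurableSet.iInter fun i : Fin n =>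
          (((measurable_pi_apply i).mul_const (Ring.inverse (a 0))) hPm)) (by ext c; simp)
    have hm1 : MeasurableSet {z : Fin (n + 1) → B | volume (Metric.ball (0 : Fin (n + 1) → B) ‖z‖) ≤ T} :=
      measurableSet_le (measurable_measure_ball_norm _) measurable_const
    have h2 := (lintegral_mono (μ := (volume : Measure (Fin (n + 1) → B))) hbound).trans (lintegral_indicator_const hm1 _).le
    have h3 : volume {z : Fin (n + 1) → B | volume (Metric.ball (0 : Fin (n + 1) → B) ‖z‖) ≤ T} ≤ T :=
      measure_setOf_measure_ball_norm_le _ T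
    calc _ ≤ (k : ℝ≥0∞) * ((volume P ^ n * v⁻¹ ^ n * K * T ^ n) * T) := by
          rw [ENNReal.smul_def, smul_eq_mul]
          gcongr
          exact h2.trans (by gcongr)
      _ = _ := by ring

end
end FAbCut

namespace FAbCut
open Filter Topology MeasureTheory
open scoped ENNReal

section
variable {B : Type*} [NormedRing B] [NormedAlgebra ℝ B] [FiniteDimensional ℝ B]
  {D : Type*} [DivisionRing D] (ι : D →+* B) (O : Subring D)

theorem isUnit_of_forall_mul_eq_zero {a : B} (h : ∀ u : B, u * a = 0 → u = 0) : IsUnit a := by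
  have h1 : Function.Injective (LinearMap.mulRight ℝ a) :=
    (injective_iff_map_eq_zero _).2 h
  obtain ⟨y, hy⟩ := LinearMap.injective_iff_surjective.1 h1 1
  have : IsArtinianRing B := isArtinian_of_tower ℝ inferInstance
  exact IsUnit.of_mul_eq_one_right y hy

variable {ι O} in
theorem exists_multiplier_mem {P : Set B} (hPb : Bornology.IsBounded P)
    (hPO : ∀ b : B, ∃ o ∈ O, b - ι o ∈ P) :
    ∃ N : ℕ, N ≠ 0 ∧ ∀ J : AddSubgroup B, (∀ o ∈ O, ι o ∈ J) → (∀ j ∈ J, j ≠ 0 → 1 ≤ ‖j‖) →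
      ∀ j ∈ J, ∃ o ∈ O, (N : B) * j = ι o := by
  classical
  have : ProperSpace B := FiniteDimensional.proper ℝ B
  obtain ⟨t, htf, ht⟩ := Metric.totallyBounded_iff.1 (hPb.isCompact_closure.totallyBounded.subset subset_closure) (1 / 2) (by norm_num)
  set C := htf.toFinset.card with hC
  refine ⟨C.factorial, C.factorial_ne_zero, fun J hJO hJ j hj => ?_⟩
  have h1 : ∀ k : ℕ, ∃ o ∈ O, ∃ s ∈ htf.toFinset, (k : B) * j - ι o ∈ Metric.ball s (1 / 2) := by
    intro k
    obtain ⟨o, ho, hk⟩ := hPO ((k : B) * j)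
    obtain ⟨s, hs, hks⟩ := Set.mem_iUnion₂.1 (ht hk)
    exact ⟨o, ho, s, htf.mem_toFinset.2 hs, hks⟩
  choose o ho s hs hks using h1
  obtain ⟨k, hk, k', hk', hne, heq⟩ := Finset.exists_ne_map_eq_of_card_lt_of_maps_to
    (s := Finset.range (C + 1)) (t := htf.toFinset) (by simp [hC]) (f := s) (fun k _ => hs k)
  wlog hlt : k < k' generalizing k k'
  · exact this k' hk' k hk hne.symm heq.symm (by omega)
  set w := ((k' : B) * j - ι (o k')) - ((k : B) * j - ι (o k)) with hw
  have hwJ : w ∈ J := by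
    refine J.sub_mem (J.sub_mem ?_ (hJO _ (ho _))) (J.sub_mem ?_ (hJO _ (ho _)))
    · rw [← nsmul_eq_mul]; exact J.nsmul_mem hj _
    · rw [← nsmul_eq_mul]; exact J.nsmul_mem hj _
  have hwn : ‖w‖ < 1 := by
    rw [hw, ← dist_eq_norm]
    have a1 := hks k'
    have a2 := hks k
    rw [heq] at a2
    rw [Metric.mem_ball] at a1 a2
    linarith [dist_triangle_right ((k' : B) * j - ι (o k')) ((k : B) * j - ι (o k)) (s k')]
  have hw0 : w = 0 := by
    by_contra h
    exact absurd (hJ w hwJ h) (not_le.2 hwn)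
  have h2 : ((k' - k : ℕ) : B) * j = ι (o k' - o k) := by
    rw [Nat.cast_sub hlt.le, map_sub, sub_mul]
    have : w = ((k' : B) * j - (k : B) * j) - (ι (o k') - ι (o k)) := by rw [hw]; abel
    rw [this] at hw0
    exact sub_eq_zero.1 hw0
  obtain ⟨q, hq⟩ := Nat.dvd_factorial (show 0 < k' - k by omega)
    (show k' - k ≤ C by rw [Finset.mem_range] at hk'; omega)
  refine ⟨(q : D) * (o k' - o k), O.mul_mem (natCast_mem O q) (O.sub_mem (ho _) (ho _)), ?_⟩
  rw [hq, mul_comm, Nat.cast_mul, mul_assoc, h2, map_mul, map_natCast]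

/-- Independent vectors of `M` over `D` stay independent over `B` after truncation. -/
def IsGeneric {n : ℕ} (M : AddSubgroup (Fin n → B)) : Prop :=
  ∀ r ≤ n, ∀ z : Fin r → Fin n → B, (∀ i, z i ∈ M) →
    (∀ d : Fin r → D, ∑ i, ι (d i) • z i = 0 → d = 0) →
    ∀ u : Fin r → B, (∀ k : Fin n, (k : ℕ) < r → ∑ i, u i * z i k = 0) → u = 0

/-- Row elimination along the vector `y`. -/
noncomputable def elimRow {n : ℕ} (y : Fin (n + 1) → B) : (Fin (n + 1) → B) →ₗ[ℝ] (Fin n → B) where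
  toFun z j := z j.succ - z 0 * Ring.inverse (y 0) * y j.succ
  map_add' z w := by ext j; simp only [Pi.add_apply, add_mul]; abel
  map_smul' c z := by ext j; simp [smul_sub]

omit [FiniteDimensional ℝ B] in
theorem elimRow_apply {n : ℕ} (y z : Fin (n + 1) → B) (j : Fin n) :
    elimRow y z j = z j.succ - z 0 * Ring.inverse (y 0) * y j.succ := rfl

omit [FiniteDimensional ℝ B] in
theorem elimRow_smul {n : ℕ} (y z : Fin (n + 1) → B) (u : B) :
    elimRow y (u • z) = u • elimRow y z := by
  ext j; simp [elimRow_apply, mul_sub, mul_assoc]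

omit [FiniteDimensional ℝ B] in
theorem elimRow_self {n : ℕ} {y : Fin (n + 1) → B} (hy : IsUnit (y 0)) : elimRow y y = 0 := by
  ext j; simp [elimRow_apply, Ring.mul_inverse_cancel _ hy]

omit [FiniteDimensional ℝ B] in
theorem eq_of_elimRow {n : ℕ} {y z : Fin (n + 1) → B} (hy : IsUnit (y 0)) :
    z = (z 0 * Ring.inverse (y 0)) • y + Fin.cons 0 (elimRow y z) := by
  refine funext fun k => Fin.cases ?_ (fun j => ?_) k
  · simp [mul_assoc, Ring.inverse_mul_cancel _ hy]
  · simp [elimRow_apply]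

variable {ι} in
theorem IsGeneric.isUnit {n : ℕ} {M : AddSubgroup (Fin (n + 1) → B)} (hM : IsGeneric ι M)
    {y : Fin (n + 1) → B} (hy : y ∈ M) (h0 : y ≠ 0) : IsUnit (y 0) := by
  refine isUnit_of_forall_mul_eq_zero fun u hu => ?_
  have := hM 1 (by omega) (fun _ => y) (fun _ => hy) ?_ (fun _ => u) ?_
  · exact congrFun this 0
  · intro d hd
    rw [Fin.sum_univ_one] at hd
    ext i
    rw [Subsingleton.elim i 0]
    by_contra hne
    apply h0
    have : ι (d 0)⁻¹ • ι (d 0) • y = 0 := by rw [hd, smul_zero]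
    rwa [smul_smul, ← map_mul, inv_mul_cancel₀ hne, map_one, one_smul] at this
  · intro k hk
    have : k = 0 := by ext; simpa using hk
    rw [Fin.sum_univ_one, this, hu]

variable {ι} in
theorem IsGeneric.map_elimRow {n : ℕ} {M : AddSubgroup (Fin (n + 1) → B)} (hM : IsGeneric ι M)
    {y : Fin (n + 1) → B} (hy : y ∈ M) (h0 : y ≠ 0) :
    IsGeneric ι (M.map (elimRow y).toAddMonoidHom) := by
  have hu := hM.isUnit hy h0
  intro r hr w hw hind u hsum
  choose z hz hzw using hw
  have hzw' : ∀ i, elimRow y (z i) = w i := hzw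
  have key := hM (r + 1) (by omega) (Fin.cons y z) (fun i => Fin.cases hy hz i) ?_
    (Fin.cons (-∑ i, u i * (z i 0 * Ring.inverse (y 0))) u) ?_
  · ext i
    simpa using congrFun key i.succ
  · intro d hd
    rw [Fin.sum_univ_succ] at hd
    simp only [Fin.cons_zero, Fin.cons_succ] at hd
    have h1 := congrArg (elimRow y) hd
    simp only [map_add, map_sum, elimRow_smul, elimRow_self hu, hzw', smul_zero, zero_add, map_zero] at h1
    have h2 := hind _ h1
    have h3 : ∀ i : Fin r, d i.succ = 0 := fun i => congrFun h2 i
    simp only [h3, map_zero, zero_smul, Finset.sum_const_zero, add_zero] at hd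
    refine funext fun i => Fin.cases ?_ h3 i
    by_contra hne
    apply h0
    have : ι (d 0)⁻¹ • ι (d 0) • y = 0 := by rw [hd, smul_zero]
    rwa [smul_smul, ← map_mul, inv_mul_cancel₀ hne, map_one, one_smul] at this
  · intro k hk
    rw [Fin.sum_univ_succ]
    simp only [Fin.cons_zero, Fin.cons_succ]
    revert hk
    refine Fin.cases (fun _ => ?_) (fun j hk => ?_) k
    · rw [neg_mul, Finset.sum_mul, neg_add_eq_zero]
      refine Finset.sum_congr rfl fun i _ => ?_
      rw [mul_assoc, mul_assoc, Ring.inverse_mul_cancel _ hu, mul_one]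
    · have := hsum j (by simpa using hk)
      simp only [← hzw', elimRow_apply, mul_sub, Finset.sum_sub_distrib] at this
      rw [neg_mul, Finset.sum_mul, neg_add_eq_sub]
      simpa [mul_assoc] using this

end
end FAbCut

namespace FAbCut
open Filter Topology MeasureTheory
open scoped ENNReal

section
variable {B : Type*} [NormedRing B] [NormedAlgebra ℝ B] [FiniteDimensional ℝ B]
  [MeasureSpace B] [BorelSpace B] [(volume : Measure B).IsAddHaarMeasure]

omit [FiniteDimensional ℝ B] [BorelSpace B] [(volume : Measure B).IsAddHaarMeasure] in
/-- Every symmetric convex body of volume larger than `T` meets `M` nontrivially. -/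
def HasMinkowski {n : ℕ} (M : AddSubgroup (Fin n → B)) (T : ℝ≥0∞) : Prop :=
  ∀ S : Set (Fin n → B), MeasurableSet S → Convex ℝ S → (∀ x ∈ S, -x ∈ S) → T < volume S →
    ∃ z ∈ M, z ≠ 0 ∧ z ∈ S

theorem volume_elimRow_preimage {n : ℕ} {y : Fin (n + 1) → B} (hy : IsUnit (y 0))
    {S : Set (Fin n → B)} (hS : MeasurableSet S) :
    volume {z : Fin (n + 1) → B | z 0 * Ring.inverse (y 0) ∈ Metric.ball (0 : B) 1 ∧
      elimRow y z ∈ S} =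
      volume (Metric.ball (0 : B) 1) * ENNReal.ofReal |rnorm (y 0)| * volume S := by
  have : ProperSpace B := FiniteDimensional.proper ℝ B
  have : SecondCountableTopology B := secondCountable_of_proper
  set S2 : Set (B × (Fin n → B)) := {p | p.1 * Ring.inverse (y 0) ∈ Metric.ball (0 : B) 1 ∧
    (fun j => p.2 j - p.1 * Ring.inverse (y 0) * y j.succ) ∈ S} with hS2
  have hm0 : Measurable fun c : B => c * Ring.inverse (y 0) := measurable_id.mul_const _
  have hS2m : MeasurableSet S2 := by
    refine MeasurableSet.inter ((hm0.comp measurable_fst) measurableSet_ball) ?_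
    have : Measurable fun p : B × (Fin n → B) =>
        fun j => p.2 j - p.1 * Ring.inverse (y 0) * y j.succ := measurable_pi_iff.2 fun j =>
      ((measurable_pi_apply j).comp measurable_snd).sub ((hm0.comp measurable_fst).mul_const _)
    exact this hS
  have h1 := (volume_preserving_piFinSuccAbove (fun _ : Fin (n + 1) => B) 0).measure_preimage
    hS2m.nullMeasurableSet
  have h2 : {z : Fin (n + 1) → B | z 0 * Ring.inverse (y 0) ∈ Metric.ball (0 : B) 1 ∧
      elimRow y z ∈ S} = (MeasurableEquiv.piFinSuccAbove (fun _ : Fin (n + 1) => B) 0) ⁻¹' S2 := by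
    ext z; rfl
  rw [h2, h1]
  change ((volume : Measure B).prod (volume : Measure (Fin n → B))) S2 = _
  rw [Measure.prod_apply hS2m]
  have h3 : ∀ c : B, volume (Prod.mk c ⁻¹' S2) =
      {c : B | c * Ring.inverse (y 0) ∈ Metric.ball (0 : B) 1}.indicator (fun _ => volume S) c := by
    intro c
    by_cases hc : c * Ring.inverse (y 0) ∈ Metric.ball (0 : B) 1
    · rw [Set.indicator_of_mem (show c ∈ {c : B | c * Ring.inverse (y 0) ∈ Metric.ball (0 : B) 1}
        from hc)]
      rw [← measure_preimage_add_right volume (-fun j => c * Ring.inverse (y 0) * y j.succ) S]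
      congr 1
      ext d
      simp only [hS2, Set.mem_preimage, Set.mem_ofPred_eq, hc, true_and, ← sub_eq_add_neg]
      rfl
    · rw [Set.indicator_of_notMem (show c ∉ {c : B | c * Ring.inverse (y 0) ∈
        Metric.ball (0 : B) 1} from hc)]
      have : Prod.mk c ⁻¹' S2 = ∅ := by
        ext p
        simp only [Set.mem_preimage, Set.mem_empty_iff_false, iff_false]
        exact fun h => hc h.1
      rw [this, measure_empty]
  simp_rw [h3]
  have hm1 : MeasurableSet {c : B | c * Ring.inverse (y 0) ∈ Metric.ball (0 : B) 1} :=
    hm0 measurableSet_ball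
  have h4 := volume_setOf_mul_inverse_mem (P := Metric.ball (0 : B) 1) hy (n := 1)
  have h5 : volume {c : B | c * Ring.inverse (y 0) ∈ Metric.ball (0 : B) 1} =
      ENNReal.ofReal |rnorm (y 0)| * volume (Metric.ball (0 : B) 1) := by
    rw [← (pow_one (ENNReal.ofReal |rnorm (y 0)| * volume (Metric.ball (0 : B) 1))), ← h4]
    rw [← (volume_preserving_funUnique (Fin 1) B).measure_preimage hm1.nullMeasurableSet]
    congr 1
    ext c
    simp
  rw [lintegral_indicator_const hm1, h5]
  ring

theorem HasMinkowski.map_elimRow {n : ℕ} [Nontrivial B] {M : AddSubgroup (Fin (n + 1) → B)} {T : ℝ≥0∞}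
    (hM : HasMinkowski M T) {y : Fin (n + 1) → B} (hy : IsUnit (y 0))
    (hmin : ∀ z ∈ M, z ≠ 0 → ‖y‖ ≤ ‖z‖) :
    HasMinkowski (M.map (elimRow y).toAddMonoidHom)
      (T / (volume (Metric.ball (0 : B) 1) * ENNReal.ofReal |rnorm (y 0)|)) := by
  have : ProperSpace B := FiniteDimensional.proper ℝ B
  have : SecondCountableTopology B := secondCountable_of_proper
  intro S hSm hSc hSs hT
  set f : (Fin (n + 1) → B) →ₗ[ℝ] B :=
    (LinearMap.mulRight ℝ (Ring.inverse (y 0))) ∘ₗ LinearMap.proj 0 with hf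
  have hfa : ∀ z, f z = z 0 * Ring.inverse (y 0) := fun z => rfl
  have hcf : Continuous f := LinearMap.continuous_of_finiteDimensional f
  have hce : Continuous (elimRow y) := LinearMap.continuous_of_finiteDimensional _
  obtain ⟨z, hzM, hz0, hzb, hzS⟩ := hM {z : Fin (n + 1) → B | z 0 * Ring.inverse (y 0) ∈
      Metric.ball (0 : B) 1 ∧ elimRow y z ∈ S}
    ((hcf.measurable measurableSet_ball).inter (hce.measurable hSm))
    (((convex_ball (0 : B) 1).linear_preimage f).inter (hSc.linear_preimage (elimRow y)))
    (fun x hx => ⟨by simpa using hx.1, by rw [map_neg]; exact hSs _ hx.2⟩)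
    (by
      rw [volume_elimRow_preimage hy hSm]
      have hN : ENNReal.ofReal |rnorm (y 0)| ≠ 0 := by
        have := (hy.map (rnorm : B →* ℝ)).ne_zero
        rw [Ne, ENNReal.ofReal_eq_zero, not_le]
        exact abs_pos.2 this
      have hv0 : volume (Metric.ball (0 : B) 1) ≠ 0 := (Metric.measure_ball_pos _ _ one_pos).ne'
      have hvt : volume (Metric.ball (0 : B) 1) ≠ ⊤ := measure_ball_lt_top.ne
      rw [mul_comm]
      exact (ENNReal.div_lt_iff (Or.inl (mul_ne_zero hv0 hN))
        (Or.inl (ENNReal.mul_ne_top hvt ENNReal.ofReal_ne_top))).1 hT)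
  refine ⟨elimRow y z, ⟨z, hzM, rfl⟩, fun h0 => ?_, hzS⟩
  have h1 := eq_of_elimRow (z := z) hy
  rw [h0] at h1
  have h2 : z = (z 0 * Ring.inverse (y 0)) • y := by
    rw [h1]
    refine funext fun k => Fin.cases ?_ (fun j => ?_) k <;> simp [mul_assoc, Ring.inverse_mul_cancel _ hy]
  have h3 := hmin z hzM hz0
  have hy0 : 0 < ‖y‖ := norm_pos_iff.2 fun h => hy.ne_zero (by rw [h]; rfl)
  have h4 : ‖z‖ ≤ ‖z 0 * Ring.inverse (y 0)‖ * ‖y‖ := by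
    conv_lhs => rw [h2]
    exact norm_smul_le _ _
  rw [mem_ball_zero_iff] at hzb
  nlinarith

variable {D : Type*} [DivisionRing D] {ι : D →+* B} {O : Subring D}

theorem exists_reduced [Nontrivial B] {P : Set B} (hPb : Bornology.IsBounded P)
    (hPO : ∀ b : B, ∃ o ∈ O, b - ι o ∈ P) (n : ℕ) :
    ∃ m : ℕ, m ≠ 0 ∧ ∀ T : ℝ≥0∞, T ≠ ⊤ → ∀ M : AddSubgroup (Fin n → B),
      (∀ o ∈ O, ∀ z ∈ M, ι o • z ∈ M) → (∀ ρ : ℝ, {z | z ∈ M ∧ ‖z‖ ≤ ρ}.Finite) →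
      IsGeneric ι M → HasMinkowski M T →
      ∃ y : Fin n → Fin n → B, (∀ i, y i ∈ M) ∧ (T, y) ∈ siegel P n ∧
        ∀ z ∈ M, ∃ h : Fin n → D, (∀ i, h i ∈ O) ∧ (m : B) • z = ∑ i, ι (h i) • y i := by
  classical
  have : ProperSpace B := FiniteDimensional.proper ℝ B
  induction n with
  | zero =>
    refine ⟨1, one_ne_zero, fun T _ M _ _ _ _ => ⟨fun i => i.elim0, fun i => i.elim0,
      Set.mem_univ _, fun z _ => ⟨fun i => i.elim0, fun i => i.elim0, Subsingleton.elim _ _⟩⟩⟩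
  | succ n ih =>
    obtain ⟨m, hm0, ih⟩ := ih
    obtain ⟨N, hN0, hN⟩ := exists_multiplier_mem (O := O) (ι := ι) hPb hPO
    refine ⟨N * m, mul_ne_zero hN0 hm0, fun T hT M hMO hMf hMg hMm => ?_⟩
    -- a shortest vector
    obtain ⟨w, hwM, hw0, -⟩ := hMm Set.univ MeasurableSet.univ convex_univ (fun _ _ => trivial)
      (by
        have : Nonempty (Fin (n + 1)) := inferInstance
        have : NoncompactSpace (Fin (n + 1) → B) := NormedSpace.noncompactSpace ℝ _
        rw [measure_univ_of_isAddLeftInvariant]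
        exact hT.lt_top)
    have hfin : {z | z ∈ M ∧ z ≠ 0 ∧ ‖z‖ ≤ ‖w‖}.Finite :=
      (hMf ‖w‖).subset fun z hz => ⟨hz.1, hz.2.2⟩
    obtain ⟨y, ⟨hyM, hy0, hyw⟩, hymin⟩ := Set.exists_min_image _ norm hfin ⟨w, hwM, hw0, le_rfl⟩
    have hmin : ∀ z ∈ M, z ≠ 0 → ‖y‖ ≤ ‖z‖ := fun z hz hz0 => by
      rcases le_total ‖z‖ ‖w‖ with h | h
      · exact hymin z ⟨hz, hz0, h⟩
      · exact hyw.trans h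
    have hu : IsUnit (y 0) := hMg.isUnit hyM hy0
    have hyp : 0 < ‖y‖ := norm_pos_iff.2 hy0
    have hball : volume (Metric.ball (0 : Fin (n + 1) → B) ‖y‖) ≤ T := by
      by_contra hcon
      obtain ⟨z, hzM, hz0, hzb⟩ := hMm (Metric.ball 0 ‖y‖) measurableSet_ball (convex_ball _ _)
        (fun x hx => by simpa using hx) (not_le.1 hcon)
      rw [mem_ball_zero_iff] at hzb
      exact absurd (hmin z hzM hz0) (not_le.2 hzb)
    set T' := T / (volume (Metric.ball (0 : B) 1) * ENNReal.ofReal |rnorm (y 0)|) with hT'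
    have hT't : T' ≠ ⊤ := by
      have hN : ENNReal.ofReal |rnorm (y 0)| ≠ 0 := by
        have := (hu.map (rnorm : B →* ℝ)).ne_zero
        rw [Ne, ENNReal.ofReal_eq_zero, not_le]
        exact abs_pos.2 this
      exact ENNReal.div_ne_top hT (mul_ne_zero (Metric.measure_ball_pos _ _ one_pos).ne' hN)
    -- adjusting lifts
    have hlift : ∀ z ∈ M, ∃ z' ∈ M, elimRow y z' = elimRow y z ∧ z' 0 * Ring.inverse (y 0) ∈ P := by
      intro z hz
      obtain ⟨o, ho, hoP⟩ := hPO (z 0 * Ring.inverse (y 0))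
      refine ⟨z - ι o • y, M.sub_mem hz (hMO o ho y hyM), ?_, ?_⟩
      · rw [map_sub, elimRow_smul, elimRow_self hu, smul_zero, sub_zero]
      · simpa [sub_mul, mul_assoc, Ring.mul_inverse_cancel _ hu] using hoP
    obtain ⟨β, hβ⟩ := hPb.exists_norm_le
    have hfin' : ∀ ρ : ℝ, {z | z ∈ M.map (elimRow y).toAddMonoidHom ∧ ‖z‖ ≤ ρ}.Finite := by
      intro ρ
      refine ((hMf (|β| * ‖y‖ + |ρ|)).image (elimRow y)).subset ?_
      rintro _ ⟨⟨z, hz, rfl⟩, hρ⟩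
      obtain ⟨z', hz', he, hP⟩ := hlift z hz
      refine ⟨z', ⟨hz', ?_⟩, he⟩
      rw [eq_of_elimRow (z := z') hu]
      refine (norm_add_le _ _).trans (add_le_add ((norm_smul_le _ _).trans ?_) ?_)
      · gcongr
        exact (hβ _ hP).trans (le_abs_self _)
      · rw [pi_norm_le_iff_of_nonneg (abs_nonneg _)]
        refine fun k => Fin.cases (by simp) (fun j => ?_) k
        rw [Fin.cons_succ, he]
        exact (norm_le_pi_norm _ j).trans (hρ.trans (le_abs_self _))
    obtain ⟨y', hy'M, hy'S, hy'⟩ := ih T' hT't (M.map (elimRow y).toAddMonoidHom)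
      (by
        rintro o ho _ ⟨z, hz, rfl⟩
        exact ⟨ι o • z, hMO o ho z hz, elimRow_smul _ _ _⟩)
      hfin' (hMg.map_elimRow hyM hy0) (hMm.map_elimRow hu hmin)
    have hl : ∀ i, ∃ z' ∈ M, elimRow y z' = y' i ∧ z' 0 * Ring.inverse (y 0) ∈ P := by
      intro i
      obtain ⟨z, hz, hzy⟩ := hy'M i
      obtain ⟨z', hz', he, hP⟩ := hlift z hz
      exact ⟨z', hz', he.trans hzy, hP⟩
    choose q hqM hqe hqP using hl
    refine ⟨Fin.cons y q, fun i => Fin.cases hyM hqM i, ⟨hball, hu, hqP, ?_⟩, fun z hz => ?_⟩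
    · have : y' = fun i j => q i j.succ - q i 0 * Ring.inverse (y 0) * y j.succ := by
        ext i j; rw [← hqe]; rfl
      rw [this] at hy'S
      exact hy'S
    · obtain ⟨h, hO, hh⟩ := hy' (elimRow y z) ⟨z, hz, rfl⟩
      set J : AddSubgroup B := M.comap ((LinearMap.toSpanSingleton B (Fin (n + 1) → B) y).toAddMonoidHom) with hJ
      have hJm : ∀ u : B, u ∈ J ↔ u • y ∈ M := fun u => Iff.rfl
      set d := (m : B) • z - ∑ i, ι (h i) • q i with hd
      have hdM : d ∈ M := by
        refine M.sub_mem ?_ (M.sum_mem fun i _ => hMO _ (hO i) _ (hqM i))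
        rw [Nat.cast_smul_eq_nsmul]
        exact M.nsmul_mem hz m
      have hd0 : elimRow y d = 0 := by
        rw [hd, map_sub, elimRow_smul, hh, map_sum, sub_eq_zero]
        exact Finset.sum_congr rfl fun i _ => by rw [elimRow_smul, hqe]
      have hdy : d = (d 0 * Ring.inverse (y 0)) • y := by
        have h1 := eq_of_elimRow (z := d) hu
        rw [hd0] at h1
        refine funext fun k => ?_
        rw [congrFun h1 k]
        refine Fin.cases ?_ (fun j => ?_) k <;> simp [mul_assoc, Ring.inverse_mul_cancel _ hu]
      obtain ⟨o, ho, hoe⟩ := hN J (fun o ho => hMO o ho y hyM) (fun j hj hj0 => by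
          have hne : j • y ≠ 0 := fun h0 => hj0 (by
            have := congrFun h0 0
            exact (hu.mul_left_eq_zero).1 this)
          have h1 := (hmin (j • y) hj hne).trans (norm_smul_le _ _)
          by_contra hlt
          nlinarith [not_le.1 hlt]) (d 0 * Ring.inverse (y 0)) (by rw [hJm, ← hdy]; exact hdM)
      refine ⟨Fin.cons o fun i => N * h i, fun i => Fin.cases ho
        (fun i => O.mul_mem (natCast_mem O N) (hO i)) i, ?_⟩
      rw [Fin.sum_univ_succ]
      simp only [Fin.cons_zero, Fin.cons_succ, map_mul, map_natCast, mul_smul, ← Finset.smul_sum,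
        Nat.cast_mul]
      rw [← hoe, mul_smul, ← hdy, ← smul_add, hd, sub_add_cancel]

end
end FAbCut

namespace FAbCut
open Filter Topology MeasureTheory
open scoped ENNReal

section
variable {B : Type*} [NormedRing B] [NormedAlgebra ℝ B]
  {D : Type*} [DivisionRing D] (ι : D →+* B) (O : Subring D)

/-- The lattice spanned over `O` by the rows of `x`. -/
def rowLattice {n : ℕ} (x : Fin n → Fin n → B) : AddSubgroup (Fin n → B) where
  carrier := {z | ∃ a : Fin n → D, (∀ i, a i ∈ O) ∧ z = ∑ i, ι (a i) • x i}
  zero_mem' := ⟨0, fun _ => O.zero_mem, by simp⟩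
  add_mem' := by
    rintro _ _ ⟨a, ha, rfl⟩ ⟨b, hb, rfl⟩
    exact ⟨a + b, fun i => O.add_mem (ha i) (hb i), by simp [add_smul, Finset.sum_add_distrib]⟩
  neg_mem' := by
    rintro _ ⟨a, ha, rfl⟩
    exact ⟨-a, fun i => O.neg_mem (ha i), by simp⟩

/-- The truncation of `u ↦ u w x`. -/
noncomputable def truncMul {n r : ℕ} (hr : r ≤ n) (w : Fin r → Fin n → D) :
    (Fin n → Fin n → B) →ₗ[ℝ] Module.End ℝ (Fin r → B) where
  toFun x :=
    { toFun := fun u k => ∑ i, u i * ∑ j, ι (w i j) * x j (Fin.castLE hr k)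
      map_add' := fun u v => by ext k; simp [add_mul, Finset.sum_add_distrib]
      map_smul' := fun c u => by ext k; simp [Finset.smul_sum] }
  map_add' x y := by
    ext : 1; ext u : 1; ext k
    simp [mul_add, Finset.sum_add_distrib, Pi.single_apply]
  map_smul' c x := by
    ext : 1; ext u : 1; ext k
    simp [Finset.smul_sum, Finset.mul_sum]

theorem exists_truncMul_eq_one {n r : ℕ} (hr : r ≤ n) {w : Fin r → Fin n → D}
    (hw : ∀ d : Fin r → D, (∀ j, ∑ i, d i * w i j = 0) → d = 0) :
    ∃ x, truncMul ι hr w x = 1 := by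
  classical
  set f : (Fin r → D) →ₗ[D] (Fin n → D) :=
    { toFun := fun d j => ∑ i, d i * w i j
      map_add' := fun u v => by ext k; simp [add_mul, Finset.sum_add_distrib]
      map_smul' := fun c u => by ext k; simp [Finset.mul_sum, mul_assoc] } with hf
  obtain ⟨g, hg⟩ := f.exists_leftInverse_of_injective (LinearMap.ker_eq_bot'.2 fun d hd =>
    hw d fun j => congrFun hd j)
  have hgw : ∀ i k, ∑ j, w i j * g (Pi.single j 1) k = (1 : Matrix (Fin r) (Fin r) D) i k := by
    intro i k
    have h1 : f (Pi.single i 1) = w i := by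
      ext j; simp [hf, Pi.single_apply]
    have h2 : g (w i) = Pi.single i 1 := by
      rw [← h1]; exact LinearMap.congr_fun hg _
    have h3 : w i = ∑ j, w i j • (Pi.single j 1 : Fin n → D) := by
      ext j; simp [Pi.single_apply]
    rw [h3, map_sum] at h2
    have h4 := congrFun h2 k
    simp only [map_smul, Finset.sum_apply, Pi.smul_apply, smul_eq_mul] at h4
    rw [h4, Matrix.one_apply, Pi.single_apply]
    simp [eq_comm]
  refine ⟨fun j k => if h : (k : ℕ) < r then ι (g (Pi.single j 1) ⟨k, h⟩) else 0, ?_⟩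
  refine LinearMap.ext fun u => funext fun k => ?_
  change ∑ i, u i * ∑ j, ι (w i j) * _ = u k
  have : ∀ i, ∑ j, ι (w i j) * (if h : ((Fin.castLE hr k : Fin n) : ℕ) < r then
      ι (g (Pi.single j 1) ⟨_, h⟩) else 0) = if i = k then 1 else 0 := by
    intro i
    have hk : ((Fin.castLE hr k : Fin n) : ℕ) < r := k.2
    simp only [hk, dif_pos, ← map_mul, ← map_sum]
    rw [show (⟨((Fin.castLE hr k : Fin n) : ℕ), hk⟩ : Fin r) = k from rfl, hgw, Matrix.one_apply]
    split_ifs <;> simp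
  simp only [this]
  simp

end

section
variable {B : Type*} [NormedRing B] [NormedAlgebra ℝ B] [FiniteDimensional ℝ B]
  [MeasureSpace B] [BorelSpace B] [(volume : Measure B).IsAddHaarMeasure]
  {D : Type*} [DivisionRing D] [Countable D] (ι : D →+* B) (O : Subring D)

omit [Countable D] in
theorem ae_injective_truncMul {n r : ℕ} (hr : r ≤ n) {w : Fin r → Fin n → D}
    (hw : ∀ d : Fin r → D, (∀ j, ∑ i, d i * w i j = 0) → d = 0) :
    ∀ᵐ x : Fin n → Fin n → B, ∀ u, truncMul ι hr w x u = 0 → u = 0 := by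
  classical
  have : ProperSpace B := FiniteDimensional.proper ℝ B
  have : SecondCountableTopology B := secondCountable_of_proper
  obtain ⟨x0, hx0⟩ := exists_truncMul_eq_one ι hr hw
  set L := truncMul ι hr w with hL
  have hset : ∀ x, (∀ u, L x u = 0 → u = 0) ↔ LinearMap.det (L x) ≠ 0 := by
    intro x
    rw [← LinearMap.ker_eq_bot', ← isUnit_iff_ne_zero, ← LinearMap.isUnit_iff_isUnit_det,
      LinearMap.isUnit_iff_ker_eq_bot]
  have hcont : Continuous fun x => LinearMap.det (L x) := by
    have : (fun x => LinearMap.det (L x)) = fun x => (LinearMap.toMatrix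
        (Module.finBasis ℝ (Fin r → B)) (Module.finBasis ℝ (Fin r → B)) (L x)).det := by
      ext x
      rw [LinearMap.det_toMatrix]
    rw [this]
    refine Continuous.matrix_det ?_
    exact LinearMap.continuous_of_finiteDimensional
      ((LinearMap.toMatrix (Module.finBasis ℝ (Fin r → B)) (Module.finBasis ℝ (Fin r → B))).toLinearMap ∘ₗ L)
  have hmeas : MeasurableSet {x : Fin n → Fin n → B | LinearMap.det (L x) ≠ 0} :=
    (isOpen_ne.preimage hcont).measurableSet
  have : (volume : Measure (Fin n → Fin n → B)).IsAddHaarMeasure :=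
    Measure.pi.isAddHaarMeasure fun _ : Fin n => (volume : Measure (Fin n → B))
  have := ae_mem_of_ae_add_linearMap_mem (LinearMap.toSpanSingleton ℝ (Fin n → Fin n → B) x0)
    (volume : Measure ℝ) (volume : Measure (Fin n → Fin n → B)) hmeas (fun y => ?_)
  · filter_upwards [this] with x hx
    exact (hset x).2 hx
  · have hfin : {t : ℝ | LinearMap.det (L (y + t • x0)) = 0}.Finite := by
      refine ((Module.End.finite_hasEigenvalue (L y)).preimage (neg_injective.injOn)).subset ?_
      intro t ht
      rw [Set.mem_preimage]
      rw [Set.mem_ofPred_eq, map_add, map_smul, hx0] at ht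
      have h1 : ¬ IsUnit (L y + t • (1 : Module.End ℝ (Fin r → B))) := by
        rw [LinearMap.isUnit_iff_isUnit_det, ht]; simp
      change (L y).HasEigenvalue (-t)
      rw [Module.End.hasEigenvalue_iff_mem_spectrum, spectrum.mem_iff]
      intro h2
      apply h1
      rw [← IsUnit.neg_iff]
      have h3 : -(L y + t • (1 : Module.End ℝ (Fin r → B))) = algebraMap ℝ _ (-t) - L y := by
        rw [Algebra.algebraMap_eq_smul_one, neg_smul]; abel
      rw [h3]
      exact h2
    rw [ae_iff]
    refine measure_mono_null ?_ (hfin.measure_zero _)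
    intro t ht
    simpa using ht

theorem ae_isGeneric_rowLattice (n : ℕ) :
    ∀ᵐ x : Fin n → Fin n → B, IsGeneric ι (rowLattice ι O x) := by
  have h : ∀ᵐ x : Fin n → Fin n → B, ∀ (r : Fin (n + 1)) (w : Fin (r : ℕ) → Fin n → D),
      (∀ d : Fin (r : ℕ) → D, (∀ j, ∑ i, d i * w i j = 0) → d = 0) →
      ∀ u, truncMul ι (Nat.lt_succ_iff.1 r.2) w x u = 0 → u = 0 := by
    rw [ae_all_iff]; intro r
    rw [ae_all_iff]; intro w
    by_cases hw : ∀ d : Fin (r : ℕ) → D, (∀ j, ∑ i, d i * w i j = 0) → d = 0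
    · filter_upwards [ae_injective_truncMul ι (Nat.lt_succ_iff.1 r.2) hw] with x hx _
      exact hx
    · exact Eventually.of_forall fun x h => absurd h hw
  filter_upwards [h] with x hx
  intro r hr z hz hind u hu
  choose w hwO hw using hz
  refine hx ⟨r, Nat.lt_succ_of_le hr⟩ w ?_ u ?_
  · intro d hd
    refine hind d ?_
    simp only [hw, Finset.smul_sum, smul_smul, ← map_mul]
    rw [Finset.sum_comm]
    simp only [← Finset.sum_smul, ← map_sum, hd, map_zero, zero_smul, Finset.sum_const_zero]
  · refine funext fun k => ?_
    have := hu (Fin.castLE hr k) k.2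
    simp only [hw, Finset.sum_apply, Pi.smul_apply, smul_eq_mul] at this
    exact this

end
end FAbCut

namespace FAbCut
open Filter Topology MeasureTheory
open scoped ENNReal

section
variable {B : Type*} [NormedRing B] [NormedAlgebra ℝ B]

/-- The linear map `c ↦ c x` on rows. -/
noncomputable def rowMul {n : ℕ} (x : Fin n → Fin n → B) : (Fin n → B) →ₗ[ℝ] (Fin n → B) where
  toFun c := ∑ i, c i • x i
  map_add' c d := by simp [add_smul, Finset.sum_add_distrib]
  map_smul' r c := by simp [Finset.smul_sum, smul_assoc]

theorem rowMul_apply {n : ℕ} (x : Fin n → Fin n → B) (c : Fin n → B) :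
    rowMul x c = ∑ i, c i • x i := rfl

variable {D : Type*} [DivisionRing D] {ι : D →+* B} {O : Subring D}
  {κ : Type*} [Finite κ] {b : Module.Basis κ ℝ B}

theorem mem_span_piBasis {n : ℕ} {c : Fin n → B} :
    c ∈ Submodule.span ℤ (Set.range (Pi.basis fun _ : Fin n => b)) ↔
      ∀ i, c i ∈ Submodule.span ℤ (Set.range b) := by
  cases nonempty_fintype κ
  simp only [Module.Basis.mem_span_iff_repr_mem, Pi.basis_repr]
  exact ⟨fun h i k => h ⟨i, k⟩, fun h ik => h ik.1 ik.2⟩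

theorem mem_rowLattice_iff (hb : (Submodule.span ℤ (Set.range b) : Set B) = ι '' O) {n : ℕ}
    {x : Fin n → Fin n → B} {z : Fin n → B} :
    z ∈ rowLattice ι O x ↔
      ∃ c ∈ Submodule.span ℤ (Set.range (Pi.basis fun _ : Fin n => b)), rowMul x c = z := by
  have hb' : ∀ c : B, c ∈ Submodule.span ℤ (Set.range b) ↔ ∃ o ∈ O, ι o = c := fun c => by
    rw [← SetLike.mem_coe, hb]; rfl
  constructor
  · rintro ⟨a, ha, rfl⟩
    exact ⟨fun i => ι (a i), mem_span_piBasis.2 fun i => (hb' _).2 ⟨_, ha i, rfl⟩, rfl⟩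
  · rintro ⟨c, hc, rfl⟩
    choose a ha hac using fun i => (hb' _).1 (mem_span_piBasis.1 hc i)
    exact ⟨a, ha, by simp [rowMul_apply, hac]⟩

variable [FiniteDimensional ℝ B]

theorem finite_rowLattice_inter (hb : (Submodule.span ℤ (Set.range b) : Set B) = ι '' O) {n : ℕ}
    {x : Fin n → Fin n → B} (hx : LinearMap.det (rowMul x) ≠ 0) (ρ : ℝ) :
    {z | z ∈ rowLattice ι O x ∧ ‖z‖ ≤ ρ}.Finite := by
  have : ProperSpace B := FiniteDimensional.proper ℝ B
  have hinj : Function.Injective (rowMul x) :=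
    (LinearMap.equivOfDetNeZero (rowMul x) hx).injective
  have hc : Continuous (LinearMap.equivOfDetNeZero (rowMul x) hx).symm :=
    LinearMap.continuous_of_finiteDimensional (LinearMap.equivOfDetNeZero (rowMul x) hx).symm.toLinearMap
  have hbd : Bornology.IsBounded ((LinearMap.equivOfDetNeZero (rowMul x) hx).symm ''
      Metric.closedBall (0 : Fin n → B) ρ) :=
    ((isCompact_closedBall _ _).image hc).isBounded
  refine ((ZSpan.setFinite_inter (Pi.basis fun _ : Fin n => b) hbd).image (rowMul x)).subset ?_
  rintro z ⟨hz, hzρ⟩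
  obtain ⟨c, hc, rfl⟩ := (mem_rowLattice_iff hb).1 hz
  refine ⟨c, ⟨⟨rowMul x c, by simpa using hzρ, ?_⟩, hc⟩, rfl⟩
  exact (LinearMap.equivOfDetNeZero (rowMul x) hx).symm_apply_apply c

variable [MeasureSpace B] [BorelSpace B] [(volume : Measure B).IsAddHaarMeasure]

theorem exists_hasMinkowski (hb : (Submodule.span ℤ (Set.range b) : Set B) = ι '' O) (n : ℕ) :
    ∃ T : ℝ≥0∞, T ≠ ⊤ ∧ ∀ x : Fin n → Fin n → B, LinearMap.det (rowMul x) ≠ 0 →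
      |LinearMap.det (rowMul x)| ≤ 1 → HasMinkowski (rowLattice ι O x) T := by
  have : ProperSpace B := FiniteDimensional.proper ℝ B
  have : SecondCountableTopology B := secondCountable_of_proper
  set b' := Pi.basis fun _ : Fin n => b with hb'
  refine ⟨volume (ZSpan.fundamentalDomain b') * 2 ^ Module.finrank ℝ (Fin n → B),
    ENNReal.mul_ne_top (ZSpan.fundamentalDomain_isBounded b').measure_lt_top.ne (by simp),
    fun x hx hx1 S hS hSc hSs hST => ?_⟩
  have hvol : volume S ≤ volume (rowMul x ⁻¹' S) := by
    rw [Measure.addHaar_preimage_linearMap _ hx]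
    refine le_mul_of_one_le_left' ?_
    rw [abs_inv, ENNReal.one_le_ofReal]
    exact (one_le_inv₀ (abs_pos.2 hx)).2 hx1
  have : Countable (Submodule.span ℤ (Set.range b')).toAddSubgroup :=
    inferInstanceAs (Countable (Submodule.span ℤ (Set.range b')))
  obtain ⟨⟨c, hc⟩, hc0, hcS⟩ := exists_ne_zero_mem_lattice_of_measure_mul_two_pow_lt_measure
    (ZSpan.isAddFundamentalDomain' b' volume) (s := rowMul x ⁻¹' S)
    (fun c hc => by simpa using hSs _ hc) (hSc.linear_preimage _) (hST.trans_le hvol)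
  refine ⟨rowMul x c, (mem_rowLattice_iff hb).2 ⟨c, hc, rfl⟩, ?_, hcS⟩
  intro h0
  apply hc0
  have hinj : Function.Injective (rowMul x) :=
    (LinearMap.equivOfDetNeZero (rowMul x) hx).injective
  exact Subtype.ext (hinj (by rw [h0]; simp))

end
end FAbCut

namespace FAbCut
open Filter Topology MeasureTheory
open scoped ENNReal

section
variable {D : Type*} [DivisionRing D] {O : Subring D} {n : ℕ}

/-- The group `GL_n(O)` as a subgroup of `GL_n(D)`. -/
abbrev glSubring (O : Subring D) (n : ℕ) : Subgroup (Matrix (Fin n) (Fin n) D)ˣ :=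
  (O.matrix (n := Fin n)).toSubmonoid.units

/-- Up to right multiplication by `GL_n(O)` there are finitely many divisors of `m` in `M_n(O)`. -/
theorem exists_finite_divisors [CharZero D] {m : ℕ} (hm : m ≠ 0) {t : Set D} (ht : t.Finite)
    (hO : ∀ o ∈ O, ∃ q ∈ O, o - m * q ∈ t) :
    ∃ C : Set (Matrix (Fin n) (Fin n) D), C.Finite ∧ (∀ c ∈ C, ∃ h, h * c = m) ∧
      ∀ g ∈ O.matrix (n := Fin n), ∀ h ∈ O.matrix (n := Fin n), g * h = m → h * g = m →
        ∃ c ∈ C, ∃ u ∈ glSubring O n, g = c * (u : Matrix (Fin n) (Fin n) D) := by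
  classical
  choose! q hqO hqt using hO
  set G : Set (Matrix (Fin n) (Fin n) D) :=
    {g | g ∈ O.matrix (n := Fin n) ∧ ∃ h ∈ O.matrix (n := Fin n), g * h = m ∧ h * g = m} with hG
  set f : Matrix (Fin n) (Fin n) D → Matrix (Fin n) (Fin n) D :=
    fun g => g.map fun o => o - m * q o with hf
  obtain ⟨C, hCG, hC⟩ := Set.exists_subset_bijOn G f
  have hfin : (f '' G).Finite := by
    have : (Set.pi Set.univ fun _ : Fin n => Set.pi Set.univ fun _ : Fin n => t).Finite :=
      Set.Finite.pi fun _ => Set.Finite.pi fun _ => ht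
    refine Set.Finite.subset this ?_
    rintro _ ⟨g, hg, rfl⟩ i - j -
    exact hqt _ (hg.1 i j)
  have hm' : ∀ k : Matrix (Fin n) (Fin n) D, (m : Matrix (Fin n) (Fin n) D) * k = 0 → k = 0 := by
    intro k hk
    ext i j
    have := congrFun (congrFun hk i) j
    rw [← nsmul_eq_mul] at this
    simpa [hm] using this
  refine ⟨C, hC.finite_iff_finite.2 hfin, fun c hc => ?_, fun g hg h hh hgh hhg => ?_⟩
  · obtain ⟨-, h, -, -, hh⟩ := hCG hc
    exact ⟨h, hh⟩
  obtain ⟨c, hc, hcg⟩ := hC.surjOn (⟨g, ⟨hg, h, hh, hgh, hhg⟩, rfl⟩ : f g ∈ f '' G)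
  obtain ⟨hcO, h', hh', hch', hhc'⟩ := hCG hc
  set k : Matrix (Fin n) (Fin n) D := g.map q - c.map q with hk
  have hkO : k ∈ O.matrix (n := Fin n) :=
    Subring.sub_mem _ (fun i j => hqO _ (hg i j)) (fun i j => hqO _ (hcO i j))
  have hgc : g - c = m * k := by
    ext i j
    have h1 : c i j - m * q (c i j) = g i j - m * q (g i j) := congrFun (congrFun hcg i) j
    have h2 : ((m : Matrix (Fin n) (Fin n) D) * k) i j = m * k i j := by
      rw [← nsmul_eq_mul]; simp
    rw [h2, Matrix.sub_apply, hk, Matrix.sub_apply, mul_sub, Matrix.map_apply, Matrix.map_apply]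
    rw [sub_eq_sub_iff_add_eq_add] at h1 ⊢
    rw [← h1, add_comm]
  have hgu : g = c * (1 + h' * k) := by
    rw [mul_add, ← mul_assoc, hch', ← hgc]; simp
  have hcv : c = g * (1 - h * k) := by
    rw [mul_sub, ← mul_assoc, hgh, ← hgc]; simp
  have hcan : ∀ a b : Matrix (Fin n) (Fin n) D, c * a = c * b → a = b := by
    intro a b hab
    rw [← sub_eq_zero]
    refine hm' _ ?_
    rw [← hhc', mul_assoc, mul_sub, hab, sub_self, mul_zero]
  have huv : (1 + h' * k) * (1 - h * k) = 1 := by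
    refine hcan _ _ ?_
    rw [← mul_assoc, ← hgu, ← hcv, mul_one]
  refine ⟨c, hc, ⟨1 + h' * k, 1 - h * k, huv, mul_eq_one_symm huv⟩, ?_, hgu⟩
  rw [Submonoid.mem_units_iff]
  exact ⟨Subring.add_mem _ (Subring.one_mem _) (Subring.mul_mem _ hh' hkO),
    Subring.sub_mem _ (Subring.one_mem _) (Subring.mul_mem _ hh hkO)⟩
end

section
variable {B : Type*} [NormedRing B] [NormedAlgebra ℝ B]
  {D : Type*} [DivisionRing D] (ι : D →+* B) {n : ℕ}

/-- Left multiplication by a matrix over `D` on matrices over `B`. -/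
noncomputable def matAct (g : Matrix (Fin n) (Fin n) D) :
    (Fin n → Fin n → B) →ₗ[ℝ] (Fin n → Fin n → B) where
  toFun x i := ∑ j, ι (g i j) • x j
  map_add' x y := by ext; simp [mul_add, Finset.sum_add_distrib]
  map_smul' r x := by ext; simp [Finset.smul_sum]

theorem matAct_apply (g : Matrix (Fin n) (Fin n) D) (x : Fin n → Fin n → B) (i : Fin n) :
    matAct ι g x i = ∑ j, ι (g i j) • x j := rfl

theorem matAct_mul (g h : Matrix (Fin n) (Fin n) D) (x : Fin n → Fin n → B) :
    matAct ι (g * h) x = matAct ι g (matAct ι h x) := by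
  ext1 i
  simp only [matAct_apply, Matrix.mul_apply, map_sum, map_mul, Finset.sum_smul, Finset.smul_sum,
    mul_smul]
  exact Finset.sum_comm

theorem matAct_natCast (m : ℕ) (x : Fin n → Fin n → B) :
    matAct ι (m : Matrix (Fin n) (Fin n) D) x = (m : ℝ) • x := by
  ext1 i
  rw [matAct_apply, Finset.sum_eq_single i (fun j _ hj => by
    simp [Matrix.natCast_apply, Ne.symm hj]) (by simp)]
  ext j
  simp [Matrix.natCast_apply, Nat.cast_smul_eq_nsmul]

theorem det_matAct_ne_zero {g h : Matrix (Fin n) (Fin n) D} {m : ℕ} (hm : m ≠ 0)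
    (hgh : h * g = m) [FiniteDimensional ℝ B] : LinearMap.det (matAct ι g) ≠ 0 := by
  have hinj : Function.Injective (matAct ι g) := by
    rw [injective_iff_map_eq_zero]
    intro x hx
    have := matAct_natCast ι m x
    rw [← hgh, matAct_mul, hx, map_zero, eq_comm, smul_eq_zero] at this
    exact this.resolve_left (by exact_mod_cast hm)
  exact (LinearMap.isUnit_iff_isUnit_det _).1
    ((LinearMap.isUnit_iff_ker_eq_bot _).2 (LinearMap.ker_eq_bot.2 hinj)) |>.ne_zero
end
end FAbCut

namespace FAbCut
open Filter Topology MeasureTheory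
open scoped ENNReal Pointwise

theorem exists_finite_coset_reps {X : Type*} [Group X] {Λ Γ : Subgroup X}
    (h : (Γ.subgroupOf Λ).FiniteIndex) :
    ∃ C : Set X, C.Finite ∧ ∀ u ∈ Λ, ∃ c ∈ C, ∃ γ ∈ Γ, u = c * γ := by
  have : Finite (Λ ⧸ Γ.subgroupOf Λ) := Subgroup.finite_quotient_of_finiteIndex
  refine ⟨Set.range fun c : Λ ⧸ Γ.subgroupOf Λ => ((Quotient.out c : Λ) : X), Set.finite_range _,
    fun u hu => ?_⟩
  have := QuotientGroup.eq.1 (QuotientGroup.out_eq'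
    (QuotientGroup.mk ⟨u, hu⟩ : Λ ⧸ Γ.subgroupOf Λ))
  exact ⟨_, ⟨QuotientGroup.mk ⟨u, hu⟩, rfl⟩, _, this, by simp⟩

theorem mul_eq_natCast_symm {D : Type*} [DivisionRing D] [CharZero D] {n : ℕ} {m : ℕ} (hm : m ≠ 0)
    {g h : Matrix (Fin n) (Fin n) D} (hhg : h * g = m) : g * h = m := by
  have hm' : (m : D) ≠ 0 := by exact_mod_cast hm
  have hw : (m : Matrix (Fin n) (Fin n) D) * Matrix.scalar (Fin n) ((m : D)⁻¹) = 1 := by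
    rw [← map_natCast (Matrix.scalar (Fin n)) m, ← map_mul, mul_inv_cancel₀ hm', map_one]
  have h1 : g * (Matrix.scalar (Fin n) ((m : D)⁻¹) * h) = 1 := by
    apply mul_eq_one_symm
    rw [mul_assoc, hhg]
    exact mul_eq_one_symm hw
  calc g * h = g * (m * Matrix.scalar (Fin n) ((m : D)⁻¹) * h) := by rw [hw, one_mul]
    _ = m * (g * (Matrix.scalar (Fin n) ((m : D)⁻¹) * h)) := by
      rw [mul_assoc (m : Matrix (Fin n) (Fin n) D), ← mul_assoc g, ← mul_assoc (m : Matrix (Fin n) (Fin n) D), Nat.cast_comm]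
    _ = m := by rw [h1, mul_one]

section
variable {B : Type*} [NormedRing B] [NormedAlgebra ℝ B] [FiniteDimensional ℝ B] [Nontrivial B]
  [MeasureSpace B] [BorelSpace B] [(volume : Measure B).IsAddHaarMeasure]
  {D : Type*} [DivisionRing D] [CharZero D] [Countable D] {ι : D →+* B} {O : Subring D}
  {κ : Type*} [Finite κ] {b : Module.Basis κ ℝ B}

set_option maxHeartbeats 1000000 in
theorem exists_siegel_set (hb : (Submodule.span ℤ (Set.range b) : Set B) = ι '' O) (n : ℕ)
    {Γ : Subgroup (Matrix (Fin n) (Fin n) D)ˣ}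
    (hfin : (Γ.subgroupOf (glSubring O n)).FiniteIndex) :
    ∃ S : Set (Fin n → Fin n → B), MeasurableSet S ∧ volume S < ⊤ ∧
      ∀ᵐ x : Fin n → Fin n → B, LinearMap.det (rowMul x) ≠ 0 → |LinearMap.det (rowMul x)| ≤ 1 →
        ∃ γ ∈ Γ, matAct ι γ x ∈ S := by
  have : ProperSpace B := FiniteDimensional.proper ℝ B
  have : SecondCountableTopology B := secondCountable_of_proper
  have : (volume : Measure (Fin n → Fin n → B)).IsAddHaarMeasure :=
    Measure.pi.isAddHaarMeasure fun _ : Fin n => (volume : Measure (Fin n → B))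
  have hι : Function.Injective ι := ι.injective
  cases nonempty_fintype κ
  set P := ZSpan.fundamentalDomain b with hP
  have hPb : Bornology.IsBounded P := ZSpan.fundamentalDomain_isBounded b
  have hPm : MeasurableSet P := ZSpan.fundamentalDomain_measurableSet b
  have hPO : ∀ c : B, ∃ o ∈ O, c - ι o ∈ P := by
    intro c
    have : ((ZSpan.floor b c : Submodule.span ℤ (Set.range b)) : B) ∈ ι '' O := by
      rw [← hb]; exact (ZSpan.floor b c).2
    obtain ⟨o, ho, hoc⟩ := this
    exact ⟨o, ho, by rw [hoc]; exact ZSpan.fract_mem_fundamentalDomain b c⟩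
  obtain ⟨m, hm, hred⟩ := exists_reduced hPb hPO n
  obtain ⟨T, hT, hMink⟩ := exists_hasMinkowski (ι := ι) hb n
  obtain ⟨K, hK, hvol⟩ := exists_volume_siegel_le hPm hPb.measure_lt_top.ne n
  set S₀ : Set (Fin n → Fin n → B) := {y | (T, y) ∈ siegel P n} with hS₀
  have hS₀m : MeasurableSet S₀ := measurable_prodMk_left (measurableSet_siegel hPm n)
  have hS₀v : volume S₀ < ⊤ := (hvol T).trans_lt (ENNReal.mul_lt_top hK.lt_top (by finiteness))
  -- finitely many divisors of `m`
  have hmB : ((m : ℝ)) ≠ 0 := by exact_mod_cast hm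
  have ht : {o : D | o ∈ O ∧ ι o ∈ (m : ℝ) • P}.Finite := by
    refine Set.Finite.of_finite_image ((ZSpan.setFinite_inter b (hPb.smul₀ (m : ℝ))).subset ?_)
      hι.injOn
    rintro _ ⟨o, ⟨ho, hoP⟩, rfl⟩
    exact ⟨hoP, by rw [hb]; exact ⟨o, ho, rfl⟩⟩
  obtain ⟨C, hC, hCh, hCd⟩ := exists_finite_divisors (O := O) (n := n) hm ht (by
    intro o ho
    obtain ⟨q, hq, hqP⟩ := hPO ((m : ℝ)⁻¹ • ι o)
    refine ⟨q, hq, O.sub_mem ho (O.mul_mem (natCast_mem O m) hq), _, hqP, ?_⟩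
    simp [smul_sub, smul_smul, hmB, Nat.cast_smul_eq_nsmul])
  -- coset representatives
  obtain ⟨Q, hQ, hrepu⟩ := exists_finite_coset_reps hfin
  have : Finite Q := hQ
  have : Finite C := hC
  refine ⟨⋃ p : C × Q, matAct ι ((p.1 : Matrix (Fin n) (Fin n) D) * ((p.2 : (Matrix (Fin n) (Fin n) D)ˣ) :
      Matrix (Fin n) (Fin n) D)) ⁻¹' S₀,
    MeasurableSet.iUnion fun p =>
      (LinearMap.continuous_of_finiteDimensional _).measurable hS₀m, ?_, ?_⟩
  · refine (measure_iUnion_le _).trans_lt ?_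
    have := Fintype.ofFinite (C × Q)
    rw [tsum_fintype]
    refine ENNReal.sum_lt_top.2 fun p _ => ?_
    obtain ⟨h₁, h₁c⟩ := hCh p.1 p.1.2
    rw [Measure.addHaar_preimage_linearMap _ (det_matAct_ne_zero ι hm (h := (p.2 : (Matrix (Fin n) (Fin n) D)ˣ)⁻¹.1 * h₁) (by
      rw [mul_assoc, ← mul_assoc h₁, h₁c, Nat.cast_comm, ← mul_assoc, Units.inv_mul, one_mul]))]
    finiteness
  · filter_upwards [ae_isGeneric_rowLattice ι O n] with x hgen hx0 hx1
    have hinj : Function.Injective (rowMul x) :=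
      (LinearMap.equivOfDetNeZero (rowMul x) hx0).injective
    obtain ⟨y, hyM, hyS, hyz⟩ := hred T hT (rowLattice ι O x) (by
      rintro o ho _ ⟨a, ha, rfl⟩
      exact ⟨fun i => o * a i, fun i => O.mul_mem ho (ha i), by
        simp [Finset.smul_sum, mul_smul]⟩) (finite_rowLattice_inter hb hx0) hgen (hMink x hx0 hx1)
    choose g hgO hgy using hyM
    have hxM : ∀ j, x j ∈ rowLattice ι O x := fun j =>
      ⟨Pi.single j 1, fun i => by
        by_cases h : i = j
        · subst h; simp [O.one_mem]
        · simp [h, O.zero_mem], by simp [Pi.single_apply, apply_ite ι]⟩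
    choose h hhO hhy using fun j => hyz _ (hxM j)
    have hy : y = matAct ι (Matrix.of g) x := funext hgy
    have hmx : matAct ι (Matrix.of h * Matrix.of g) x = matAct ι (m : Matrix (Fin n) (Fin n) D) x := by
      rw [matAct_mul, ← hy, matAct_natCast]
      funext j
      rw [Pi.smul_apply, Nat.cast_smul_eq_nsmul]
      have := hhy j
      ext k
      simpa [matAct_apply, Nat.cast_smul_eq_nsmul] using (congrFun this k).symm
    have hhg : Matrix.of h * Matrix.of g = m := by
      ext i j
      exact hι (congrFun (hinj (a₁ := fun j => ι ((Matrix.of h * Matrix.of g) i j))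
        (a₂ := fun j => ι ((m : Matrix (Fin n) (Fin n) D) i j)) (congrFun hmx i)) j)
    have hgh : Matrix.of g * Matrix.of h = m := mul_eq_natCast_symm hm hhg
    have hgO' : Matrix.of g ∈ O.matrix := hgO
    have hhO' : Matrix.of h ∈ O.matrix := hhO
    obtain ⟨c, hc, u, hu, hcu⟩ := hCd _ hgO' _ hhO' hgh hhg
    obtain ⟨d, hd, γ, hγ, rfl⟩ := hrepu u hu
    have hmem : matAct ι (c * (d : Matrix (Fin n) (Fin n) D)) (matAct ι γ x) ∈ S₀ := by
      rw [← matAct_mul, mul_assoc, ← Units.val_mul, ← hcu, ← hy]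
      exact hyS
    exact ⟨γ, hγ, Set.mem_iUnion_of_mem ((⟨c, hc⟩, ⟨d, hd⟩) : C × Q) hmem⟩
end
end FAbCut

namespace FAbCut
open Filter Topology MeasureTheory
open scoped ENNReal NNReal

theorem summable_preWeight_of_lattice {R : Type*} [NormedRing R] [NormedAlgebra ℝ R]
    [FiniteDimensional ℝ R] [Nontrivial R] {κ : Type*} [Finite κ] (b : Module.Basis κ ℝ R)
    {Γ : Subgroup Rˣ} (hΓ : ∀ γ ∈ Γ, (γ : R) ∈ Submodule.span ℤ (Set.range b)) :
    ∃ M : ℕ, Summable fun γ : Γ => preWeight M ((γ : Rˣ) : R) := by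
  set L := Submodule.span ℤ (Set.range b)
  refine ⟨Module.finrank ℤ L + 1, ?_⟩
  have h := ZLattice.summable_norm_pow_inv L _ (Nat.lt_succ_self _)
  let f : Γ → L := fun γ => ⟨((γ : Rˣ) : R), hΓ γ γ.2⟩
  have hf : Function.Injective f := fun γ γ' h => by
    have := congrArg Subtype.val h
    exact Subtype.ext (Units.ext this)
  rw [← NNReal.summable_coe]
  refine (h.comp_injective hf).of_nonneg_of_le (fun γ => NNReal.coe_nonneg _) fun γ => ?_
  have h0 : 0 < ‖((γ : Rˣ) : R)‖ := norm_pos_iff.2 (Units.ne_zero _)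
  simp only [preWeight, Function.comp_apply, f]
  push_cast
  rw [inv_pow]
  gcongr
  exact le_add_of_nonneg_left zero_le_one

theorem MatrixUnits.finite_abelianization_of_equiv {R : Type*} [NormedRing R] [NormedAlgebra ℝ R]
    [FiniteDimensional ℝ R] [Nontrivial R] {X : Type*} [NormedAddCommGroup X] [NormedSpace ℝ X]
    [MeasureSpace X] [BorelSpace X] [(volume : Measure X).IsAddHaarMeasure] (e : X ≃ₗ[ℝ] R)
    {ι : Type*} [DecidableEq ι] [Fintype ι]
    (U : MatrixUnits ι R) (hι : 3 ≤ Fintype.card ι) (hn : U.elemSubgroup.Normal)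
    {Γ : Subgroup Rˣ} (hΓ : Γ ≤ U.elemSubgroup) {M : ℕ}
    (hM : Summable fun γ : Γ => preWeight M ((γ : Rˣ) : R))
    {S : Set X} (hS : MeasurableSet S) (hSv : volume S < ⊤)
    (hcov : ∀ᵐ x : X, e x ∈ normBall R → ∃ γ ∈ Γ, e.symm ((γ : R) * e x) ∈ S) :
    Finite (Abelianization Γ) := by
  have : FiniteDimensional ℝ X := e.symm.finiteDimensional
  letI : MeasurableSpace R := borel _
  have : BorelSpace R := ⟨rfl⟩
  let e' : X ≃L[ℝ] R := e.toContinuousLinearEquiv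
  have : (Measure.map e' volume).IsAddHaarMeasure := e'.isAddHaarMeasure_map volume
  have hem : Measurable e' := e'.continuous.measurable
  have hesm : Measurable e'.symm := e'.symm.continuous.measurable
  refine U.finite_abelianization (μ := Measure.map e' volume) hι hn hΓ hM (S := e'.symm ⁻¹' S)
    (hesm hS) ?_ ?_
  · rw [Measure.map_apply hem (hesm hS)]
    convert hSv
    ext x; simp
  · have hq : Measure.QuasiMeasurePreserving e'.symm (Measure.map e' volume) volume := by
      refine ⟨hesm, ?_⟩
      rw [Measure.map_map hesm hem]
      simp [Measure.AbsolutelyContinuous.rfl]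
    filter_upwards [hq.ae hcov] with x hx hxn
    have hx' : e (e'.symm x) = x := e'.apply_symm_apply x
    rw [hx'] at hx
    exact hx hxn

/-- Base change of general linear groups. -/
def glMap {D B : Type*} [Ring D] [Ring B] (ι : D →+* B) (n : ℕ) :
    (Matrix (Fin n) (Fin n) D)ˣ →* (Matrix (Fin n) (Fin n) B)ˣ :=
  Units.map (ι.mapMatrix (m := Fin n) : Matrix (Fin n) (Fin n) D →* Matrix (Fin n) (Fin n) B)

theorem glMap_apply {D B : Type*} [Ring D] [Ring B] (ι : D →+* B) (n : ℕ)
    (g : (Matrix (Fin n) (Fin n) D)ˣ) (i j : Fin n) :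
    (glMap ι n g : Matrix (Fin n) (Fin n) B) i j = ι ((g : Matrix (Fin n) (Fin n) D) i j) := rfl

theorem glMap_injective {D B : Type*} [Ring D] [Ring B] {ι : D →+* B} (hι : Function.Injective ι)
    (n : ℕ) : Function.Injective (glMap ι n) :=
  Units.map_injective (Matrix.map_injective hι)

section
open scoped Matrix.Norms.Operator
variable {B : Type*} [NormedRing B] [NormedAlgebra ℝ B] [FiniteDimensional ℝ B]

theorem rnorm_matrix {n : ℕ} (x : Fin n → Fin n → B) :
    rnorm (Matrix.of x) = LinearMap.det (rowMul x) ^ n := by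
  have h : LinearMap.mulRight ℝ (Matrix.of x) = (Matrix.ofLinearEquiv ℝ).toLinearMap ∘ₗ
      (LinearMap.pi fun i : Fin n => rowMul x ∘ₗ LinearMap.proj i) ∘ₗ
      (Matrix.ofLinearEquiv ℝ).symm.toLinearMap := by
    ext y i j
    simp [Matrix.mul_apply, rowMul_apply]
  show LinearMap.det (LinearMap.mulRight ℝ (Matrix.of x)) = _
  rw [h, LinearMap.det_conj, LinearMap.det_pi]
  simp

variable [Nontrivial B] [MeasureSpace B] [BorelSpace B] [(volume : Measure B).IsAddHaarMeasure]
  {D : Type*} [DivisionRing D] [CharZero D] [Countable D] {ι : D →+* B} {O : Subring D}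
  {κ : Type*} [Finite κ] {b : Module.Basis κ ℝ B} {n : ℕ} [NeZero n]

theorem finite_abelianization_gl_of_normed
    (hb : (Submodule.span ℤ (Set.range b) : Set B) = ι '' O)
    {κ' : Type*} [DecidableEq κ'] [Fintype κ'] (U : MatrixUnits κ' (Matrix (Fin n) (Fin n) B))
    (hκ' : 3 ≤ Fintype.card κ') (hn : U.elemSubgroup.Normal)
    {Γ : Subgroup (Matrix (Fin n) (Fin n) D)ˣ} (hΓO : Γ ≤ glSubring O n)
    (hfin : (Γ.subgroupOf (glSubring O n)).FiniteIndex)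
    (hΓU : Γ.map (glMap ι n) ≤ U.elemSubgroup) : Finite (Abelianization Γ) := by
  have : ProperSpace B := FiniteDimensional.proper ℝ B
  have : SecondCountableTopology B := secondCountable_of_proper
  have : (volume : Measure (Fin n → Fin n → B)).IsAddHaarMeasure :=
    Measure.pi.isAddHaarMeasure fun _ : Fin n => (volume : Measure (Fin n → B))
  obtain ⟨M, hM⟩ := summable_preWeight_of_lattice (b.matrix (Fin n) (Fin n))
    (Γ := Γ.map (glMap ι n)) (by
    rintro _ ⟨γ, hγ, rfl⟩
    have h := hΓO hγ
    rw [Submonoid.mem_units_iff] at h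
    have hO : ∀ i j, ι ((γ : Matrix (Fin n) (Fin n) D) i j) ∈ Submodule.span ℤ (Set.range b) :=
      fun i j => by rw [← SetLike.mem_coe, hb]; exact ⟨_, h.1 i j, rfl⟩
    rw [Module.Basis.mem_span_iff_repr_mem]
    rintro ⟨i, j, k⟩
    exact (Module.Basis.mem_span_iff_repr_mem ℤ b _).1 (hO i j) k)
  obtain ⟨S, hSm, hSv, hS⟩ := exists_siegel_set hb n hfin
  have hfinite := U.finite_abelianization_of_equiv (Matrix.ofLinearEquiv ℝ) hκ' hn hΓU hM hSm hSv
    (by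
      filter_upwards [hS] with x hx hxn
      have hr := rnorm_matrix x
      rw [normBall, Set.mem_ofPred_eq] at hxn
      erw [hr, abs_pow] at hxn
      obtain ⟨γ, hγ, hγS⟩ := hx (fun h => by simp [h, NeZero.ne n] at hxn)
        ((pow_le_one_iff_of_nonneg (abs_nonneg _) (NeZero.ne n)).1 hxn.2)
      have hact : (Matrix.ofLinearEquiv ℝ).symm (((glMap ι n γ : (Matrix (Fin n) (Fin n) B)ˣ) :
          Matrix (Fin n) (Fin n) B) * Matrix.ofLinearEquiv ℝ x) = matAct ι γ x := by
        ext i j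
        simp [matAct_apply, Matrix.mul_apply, glMap_apply]
      refine ⟨_, ⟨γ, hγ, rfl⟩, ?_⟩
      rw [hact]
      exact hγS)
  have := hfinite
  have e' := (Γ.equivMapOfInjective _ (glMap_injective ι.injective n)).abelianizationCongr
  exact Finite.of_equiv _ e'.symm.toEquiv

end
end FAbCut

namespace FAbCut
open MeasureTheory

variable {B : Type*} [Ring B] [Algebra ℝ B] [FiniteDimensional ℝ B] [Nontrivial B]
  {D : Type*} [DivisionRing D] [CharZero D] [Countable D] {ι : D →+* B} {O : Subring D}
  {κ : Type*} [Finite κ] {b : Module.Basis κ ℝ B} {n : ℕ} [NeZero n]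

theorem finite_abelianization_gl
    (hb : (Submodule.span ℤ (Set.range b) : Set B) = ι '' O)
    {κ' : Type*} [DecidableEq κ'] [Fintype κ'] (U : MatrixUnits κ' (Matrix (Fin n) (Fin n) B))
    (hκ' : 3 ≤ Fintype.card κ') (hn : U.elemSubgroup.Normal)
    {Γ : Subgroup (Matrix (Fin n) (Fin n) D)ˣ} (hΓO : Γ ≤ glSubring O n)
    (hfin : (Γ.subgroupOf (glSubring O n)).FiniteIndex)
    (hΓU : Γ.map (glMap ι n) ≤ U.elemSubgroup) : Finite (Abelianization Γ) := by
  letI := Matrix.linftyOpNormedRing (n := Fin (Module.finrank ℝ B)) (α := ℝ)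
  letI := Matrix.linftyOpNormedAlgebra (R := ℝ) (n := Fin (Module.finrank ℝ B)) (α := ℝ)
  let f := Algebra.leftMulMatrix (Module.finBasis ℝ B)
  letI : NormedRing B := NormedRing.induced B _ f (Algebra.leftMulMatrix_injective _)
  letI : NormedAlgebra ℝ B := NormedAlgebra.induced ℝ B _ f
  letI : MeasurableSpace B := borel B
  have : BorelSpace B := ⟨rfl⟩
  have : ProperSpace B := FiniteDimensional.proper ℝ B
  letI : MeasureSpace B := ⟨Measure.addHaar⟩
  have : (volume : Measure B).IsAddHaarMeasure := inferInstanceAs (Measure.addHaar.IsAddHaarMeasure)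
  exact finite_abelianization_gl_of_normed hb U hκ' hn hΓO hfin hΓU

end FAbCut

namespace FAbCut
open Matrix

section Elementary
variable {κ E : Type*} [Fintype κ] [DecidableEq κ] [DivisionRing E]

variable (κ E) in
/-- The standard matrix units. -/
def stdUnits : MatrixUnits κ (Matrix κ κ E) where
  e i j := single i j 1
  mul_eq i j k l := by
    split_ifs with h
    · subst h; simp
    · rw [single_mul_single_of_ne (c := (1 : E)) i j k h]
  sum_eq := sum_single_one

theorem val_stdUnits_elem {i j : κ} (h : i ≠ j) (r : Matrix κ κ E) :
    ((stdUnits κ E).elem h r : Matrix κ κ E) = 1 + single i j (r i j) := by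
  simp [stdUnits, single_mul_mul_single]

theorem exists_mem_elemSubgroup_column (j : κ) (c : κ → E) (hc : c j = 0) :
    ∃ x ∈ (stdUnits κ E).elemSubgroup,
      (x : Matrix κ κ E) = 1 + vecMulVec c (Pi.single j 1) := by
  have key : ∀ s : Finset κ, ∃ x ∈ (stdUnits κ E).elemSubgroup,
      (x : Matrix κ κ E) = 1 + vecMulVec (∑ i ∈ s, Pi.single i (c i)) (Pi.single j 1) := by
    intro s
    induction s using Finset.induction_on with
    | empty => exact ⟨1, one_mem _, by simp⟩
    | insert i s his ih =>
      obtain ⟨x, hx, hx1⟩ := ih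
      rcases eq_or_ne i j with rfl | hij
      · exact ⟨x, hx, by rw [hx1, Finset.sum_insert his, hc]; simp⟩
      · refine ⟨(stdUnits κ E).elem hij (single i j (c i)) * x,
          mul_mem (MatrixUnits.elem_mem _ _ _) hx, ?_⟩
        rw [Units.val_mul, val_stdUnits_elem, hx1, Finset.sum_insert his, add_vecMulVec]
        have h1 : (single i j (single i j (c i) i j) : Matrix κ κ E) =
            vecMulVec (Pi.single i (c i)) (Pi.single j 1) := by
          rw [single_apply_same]
          ext a b
          simp [single, vecMulVec_apply, Pi.single_apply]
          grind
        have h2 : (Pi.single j (1 : E) : κ → E) ⬝ᵥ (∑ i ∈ s, Pi.single i (c i)) = 0 := by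
          rw [single_dotProduct, one_mul, Finset.sum_apply]
          refine Finset.sum_eq_zero fun k _ ↦ ?_
          rcases eq_or_ne k j with rfl | hk
          · simp [hc]
          · simp [hk.symm]
        have h3 : vecMulVec (Pi.single i (c i)) (Pi.single j 1) *
            vecMulVec (∑ i ∈ s, Pi.single i (c i)) (Pi.single j 1) = (0 : Matrix κ κ E) := by
          rw [vecMulVec_mul_vecMulVec, h2]; simp
        rw [h1, add_mul, mul_add, mul_add, h3]
        simp only [one_mul, mul_one, add_zero]
        abel
  obtain ⟨x, hx, h⟩ := key Finset.univ
  refine ⟨x, hx, ?_⟩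
  rw [h, Finset.univ_sum_single]

theorem column_mul_apply (c : κ → E) (j : κ) (g : Matrix κ κ E) (i l : κ) :
    ((1 + vecMulVec c (Pi.single j 1)) * g) i l = g i l + c i * g j l := by
  rw [add_mul, one_mul, vecMulVec_mul, Matrix.add_apply, vecMulVec_apply, single_one_vecMul, row_apply]

/-- A column of a unit is not supported on the already cleared columns. -/
theorem exists_ne_zero_of_columns (g : (Matrix κ κ E)ˣ) {s : Finset κ} {k : κ} (hk : k ∉ s)
    (hs : ∀ j ∈ s, ∀ i, (g : Matrix κ κ E) i j = (1 : Matrix κ κ E) i j) :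
    ∃ i ∉ s, (g : Matrix κ κ E) i k ≠ 0 := by
  by_contra! h
  set w : κ → E := Pi.single k 1 - fun i ↦ if i ∈ s then (g : Matrix κ κ E) i k else 0 with hw
  have h0 : (g : Matrix κ κ E) *ᵥ w = 0 := by
    rw [hw, mulVec_sub, mulVec_single_one]
    ext i
    have : ((g : Matrix κ κ E) *ᵥ fun i ↦ if i ∈ s then (g : Matrix κ κ E) i k else 0) i =
        (g : Matrix κ κ E) i k := by
      rw [mulVec, dotProduct]
      have h2 : ∀ j, (g : Matrix κ κ E) i j * (if j ∈ s then (g : Matrix κ κ E) j k else 0) =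
          if j = i then (g : Matrix κ κ E) i k else 0 := by
        intro j
        by_cases hj : j ∈ s
        · rw [if_pos hj, hs j hj, one_apply]
          by_cases hij : j = i
          · simp [hij]
          · simp [hij, Ne.symm hij]
        · by_cases hij : j = i
          · subst hij; simp [hj, h j hj]
          · simp [hj, hij]
      simp [h2]
    simp [this]
  have h1 : w = 0 := by
    have := congrArg (fun v ↦ ((g⁻¹ : (Matrix κ κ E)ˣ) : Matrix κ κ E) *ᵥ v) h0
    simpa [mulVec_mulVec] using this
  have := congrFun h1 k
  simp [hw, hk] at this

theorem exists_clear_columns {k₀ : κ} (g : (Matrix κ κ E)ˣ) (s : Finset κ) (hs : k₀ ∉ s) :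
    ∃ x ∈ (stdUnits κ E).elemSubgroup, ∀ j ∈ s, ∀ i,
      ((x * g : (Matrix κ κ E)ˣ) : Matrix κ κ E) i j = (1 : Matrix κ κ E) i j := by
  induction s using Finset.induction_on with
  | empty => exact ⟨1, one_mem _, by simp⟩
  | insert k s hks ih =>
    rw [Finset.mem_insert, not_or] at hs
    have step : ∀ (x : (Matrix κ κ E)ˣ) (j : κ) (c : κ → E), c j = 0 →
        x ∈ (stdUnits κ E).elemSubgroup → j ∉ s → (∀ j ∈ s, ∀ i,
        ((x * g : (Matrix κ κ E)ˣ) : Matrix κ κ E) i j = (1 : Matrix κ κ E) i j) →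
        ∃ y ∈ (stdUnits κ E).elemSubgroup, (∀ j ∈ s, ∀ i,
        ((y * g : (Matrix κ κ E)ˣ) : Matrix κ κ E) i j = (1 : Matrix κ κ E) i j) ∧
        ∀ i l, ((y * g : (Matrix κ κ E)ˣ) : Matrix κ κ E) i l =
          ((x * g : (Matrix κ κ E)ˣ) : Matrix κ κ E) i l +
            c i * ((x * g : (Matrix κ κ E)ˣ) : Matrix κ κ E) j l := by
      intro x j c hc hx hj h
      obtain ⟨z, hz, hz1⟩ := exists_mem_elemSubgroup_column j c hc
      have h2 : ∀ i l, ((z * x * g : (Matrix κ κ E)ˣ) : Matrix κ κ E) i l =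
          ((x * g : (Matrix κ κ E)ˣ) : Matrix κ κ E) i l +
            c i * ((x * g : (Matrix κ κ E)ˣ) : Matrix κ κ E) j l := by
        intro i l
        rw [mul_assoc, Units.val_mul z, hz1, column_mul_apply]
      refine ⟨z * x, mul_mem hz hx, fun l hl i ↦ ?_, h2⟩
      have : j ≠ l := fun h ↦ hj (h ▸ hl)
      rw [h2, h l hl, h l hl, one_apply_ne this, mul_zero, add_zero]
    obtain ⟨x, hx, hx1⟩ := ih hs.2
    obtain ⟨x, i₂, hx, hx1, hi₂, hik, hne⟩ : ∃ (x : (Matrix κ κ E)ˣ) (i₂ : κ),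
        x ∈ (stdUnits κ E).elemSubgroup ∧ (∀ j ∈ s, ∀ i,
        ((x * g : (Matrix κ κ E)ˣ) : Matrix κ κ E) i j = (1 : Matrix κ κ E) i j) ∧ i₂ ∉ s ∧
        i₂ ≠ k ∧ ((x * g : (Matrix κ κ E)ˣ) : Matrix κ κ E) i₂ k ≠ 0 := by
      obtain ⟨i, his, hi⟩ := exists_ne_zero_of_columns (x * g) hks hx1
      by_cases hik : i = k
      · subst hik
        by_cases h0 : ((x * g : (Matrix κ κ E)ˣ) : Matrix κ κ E) k₀ i = 0
        · obtain ⟨y, hy, hy1, hy2⟩ := step x i (Pi.single k₀ 1)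
            (by simp [Ne.symm hs.1]) hx hks hx1
          exact ⟨y, k₀, hy, hy1, hs.2, hs.1, by rw [hy2, h0]; simpa using hi⟩
        · exact ⟨x, k₀, hx, hx1, hs.2, hs.1, h0⟩
      · exact ⟨x, i, hx, hx1, his, hik, hi⟩
    set a := ((x * g : (Matrix κ κ E)ˣ) : Matrix κ κ E) i₂ k with ha
    obtain ⟨y, hy, hy1, hy2⟩ := step x i₂
      (Pi.single k ((1 - ((x * g : (Matrix κ κ E)ˣ) : Matrix κ κ E) k k) * a⁻¹))
      (by simp [hik]) hx hi₂ hx1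
    have hyk : ((y * g : (Matrix κ κ E)ˣ) : Matrix κ κ E) k k = 1 := by
      rw [hy2, ← ha]; simp [mul_assoc, hne]
    obtain ⟨z, hz, hz1, hz2⟩ := step y k
      (fun i ↦ if i = k then 0 else -((y * g : (Matrix κ κ E)ˣ) : Matrix κ κ E) i k)
      (by simp) hy hks hy1
    refine ⟨z, hz, fun j hj i ↦ ?_⟩
    rcases Finset.mem_insert.1 hj with rfl | hj
    · rw [hz2, hyk]
      by_cases hij : i = j
      · subst hij; simp [hyk]
      · simp [hij]
    · exact hz1 j hj i

/-- The diagonal unit with a single non-trivial entry. -/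
def diagUnit (k : κ) : Eˣ →* (Matrix κ κ E)ˣ :=
  (Units.map (diagonalRingHom κ E : (κ → E) →* Matrix κ κ E)).comp
    (Units.map (MonoidHom.mulSingle (fun _ : κ ↦ E) k))

theorem val_diagUnit (k : κ) (d : Eˣ) :
    (diagUnit k d : Matrix κ κ E) = diagonal (Pi.mulSingle k (d : E)) := rfl

theorem exists_eq_diagUnit (k₀ : κ) (g : (Matrix κ κ E)ˣ) :
    ∃ x ∈ (stdUnits κ E).elemSubgroup, ∃ d : Eˣ, g = x * diagUnit k₀ d := by
  obtain ⟨x, hx, hx1⟩ := exists_clear_columns (k₀ := k₀) g (Finset.univ.erase k₀) (by simp)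
  obtain ⟨i, his, hi⟩ := exists_ne_zero_of_columns (k := k₀) (x * g) (by simp) hx1
  obtain rfl : i = k₀ := by simpa using his
  set a := ((x * g : (Matrix κ κ E)ˣ) : Matrix κ κ E) i i with ha
  obtain ⟨z, hz, hz1⟩ := exists_mem_elemSubgroup_column i
    (fun l ↦ if l = i then 0 else -((x * g : (Matrix κ κ E)ˣ) : Matrix κ κ E) l i * a⁻¹) (by simp)
  refine ⟨(z * x)⁻¹, inv_mem (mul_mem hz hx), Units.mk0 a hi, ?_⟩
  rw [eq_inv_mul_iff_mul_eq]
  ext l m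
  rw [mul_assoc, Units.val_mul, hz1, column_mul_apply, val_diagUnit, Units.val_mk0]
  by_cases hm : m = i
  · subst hm
    by_cases hl : l = m
    · subst hl; simp [ha]
    · rw [← ha]; simp [hl, hi, mul_assoc]
  · rw [hx1 m (by simp [hm]), hx1 m (by simp [hm]), one_apply_ne (Ne.symm hm)]
    by_cases hl : l = m
    · subst hl; simp [hm]
    · simp [hl]

end Elementary
end FAbCut

namespace FAbCut
open Matrix

section Elementary
variable {κ E : Type*} [Fintype κ] [DecidableEq κ] [DivisionRing E]

theorem diagUnit_conj_mem (k : κ) (d : Eˣ) {x : (Matrix κ κ E)ˣ}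
    (hx : x ∈ (stdUnits κ E).elemSubgroup) :
    diagUnit k d * x * (diagUnit k d)⁻¹ ∈ (stdUnits κ E).elemSubgroup := by
  induction hx using Subgroup.closure_induction with
  | mem x hx =>
    obtain ⟨i, j, h, r, rfl⟩ := hx
    convert MatrixUnits.elem_mem (stdUnits κ E) h
      (single i j (Pi.mulSingle (M := fun _ ↦ E) k (d : E) i * r i j *
        Pi.mulSingle (M := fun _ ↦ E) k ((d⁻¹ : Eˣ) : E) j)) using 1
    ext1
    rw [Units.val_mul, Units.val_mul, ← map_inv, val_diagUnit, val_diagUnit,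
      val_stdUnits_elem, val_stdUnits_elem, single_apply_same, mul_add, add_mul, mul_one,
      diagonal_mul_diagonal]
    congr 1
    · rw [← diagonal_one]
      congr 1
      ext l
      by_cases h : l = k
      · subst h; simp
      · simp [h]
    · ext l m
      rw [mul_diagonal, diagonal_mul]
      by_cases h : i = l ∧ j = m
      · obtain ⟨rfl, rfl⟩ := h
        simp
      · simp [single_apply_of_ne (h := h)]
  | one => simp [one_mem]
  | mul x y _ _ hx hy =>
    have := mul_mem hx hy
    convert this using 1
    group
  | inv x _ hx =>
    have := inv_mem hx
    convert this using 1
    group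

theorem stdUnits_normal : (stdUnits κ E).elemSubgroup.Normal := by
  rcases isEmpty_or_nonempty κ with h | ⟨⟨k₀⟩⟩
  · have : Subsingleton (Matrix κ κ E)ˣ := inferInstance
    exact ⟨fun x hx g ↦ by rwa [Subsingleton.elim (g * x * g⁻¹) x]⟩
  · refine ⟨fun x hx g ↦ ?_⟩
    obtain ⟨y, hy, d, rfl⟩ := exists_eq_diagUnit k₀ g
    have := mul_mem (mul_mem hy (diagUnit_conj_mem k₀ d hx)) (inv_mem hy)
    convert this using 1
    group

theorem exists_weyl {i j : κ} (h : i ≠ j) (d : Eˣ) : ∃ w ∈ (stdUnits κ E).elemSubgroup,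
    w * diagUnit i d = diagUnit j d * w := by
  refine ⟨(stdUnits κ E).elem h (single i j 1) * (stdUnits κ E).elem h.symm (single j i (-1)) *
    (stdUnits κ E).elem h (single i j 1), mul_mem (mul_mem (MatrixUnits.elem_mem _ _ _)
      (MatrixUnits.elem_mem _ _ _)) (MatrixUnits.elem_mem _ _ _), ?_⟩
  have hd : ∀ k : κ, (diagUnit k d : Matrix κ κ E) = 1 + single k k ((d : E) - 1) := by
    intro k
    rw [val_diagUnit]
    ext l m
    by_cases hl : l = m
    · subst hl
      by_cases hk : l = k
      · subst hk; simp
      · simp [hk, single_apply_of_ne, Ne.symm hk]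
    · rw [diagonal_apply_ne _ hl, Matrix.add_apply, one_apply_ne hl,
        single_apply_of_ne (h := by grind), add_zero]
  ext1
  simp only [Units.val_mul, hd, val_stdUnits_elem, single_apply_same]
  have hn : (single j i (-1) : Matrix κ κ E) = -single j i 1 := by
    ext l m
    by_cases hl : j = l ∧ i = m
    · obtain ⟨rfl, rfl⟩ := hl
      simp
    · simp [single_apply_of_ne (h := hl)]
  simp only [hn, mul_add, add_mul, mul_one, one_mul, single_mul_single_same, add_zero, zero_add,
    single_mul_single_of_ne _ _ _ _ h, single_mul_single_of_ne _ _ _ _ h.symm, mul_neg, neg_mul]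
  abel

theorem diagUnit_commutator_mem [Nontrivial κ] (k : κ) (a b : Eˣ) :
    diagUnit k (a * b * a⁻¹ * b⁻¹) ∈ (stdUnits κ E).elemSubgroup := by
  have := stdUnits_normal (κ := κ) (E := E)
  obtain ⟨j, hj⟩ := exists_ne k
  obtain ⟨w, hw, h⟩ := exists_weyl hj.symm a
  set q := QuotientGroup.mk' (stdUnits κ E).elemSubgroup with hq
  have h1 : q (diagUnit k a) = q (diagUnit j a) := by
    have hw1 : q w = 1 := (QuotientGroup.eq_one_iff w).2 hw
    have := congrArg q h
    simpa only [map_mul, hw1, one_mul, mul_one] using this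
  have h2 : Commute (diagUnit j a : (Matrix κ κ E)ˣ) (diagUnit k b) := by
    rw [Commute, SemiconjBy]
    ext1
    rw [Units.val_mul, Units.val_mul, val_diagUnit, val_diagUnit, diagonal_mul_diagonal,
      diagonal_mul_diagonal]
    congr 1
    ext l
    by_cases hl : l = j
    · subst hl; simp [hj]
    · simp [hl]
  have h3 : q (diagUnit k (a * b * a⁻¹ * b⁻¹)) = 1 := by
    simp only [map_mul, map_inv, h1]
    rw [(h2.map q).eq]
    group
  exact (QuotientGroup.eq_one_iff _).1 h3

end Elementary

namespace MatrixUnits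
variable {κ R S : Type*} [DecidableEq κ] [Fintype κ] [Ring R] [Ring S]

/-- Transport of matrix units along a ring isomorphism. -/
def mapEquiv (U : MatrixUnits κ R) (f : R ≃+* S) : MatrixUnits κ S where
  e i j := f (U.e i j)
  mul_eq i j k l := by rw [← map_mul, U.mul_eq]; split_ifs <;> simp
  sum_eq := by rw [← map_sum, U.sum_eq, map_one]

theorem elemSubgroup_mapEquiv (U : MatrixUnits κ R) (f : R ≃+* S) :
    (U.mapEquiv f).elemSubgroup =
      U.elemSubgroup.map (Units.mapEquiv f.toMulEquiv).toMonoidHom := by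
  rw [elemSubgroup, elemSubgroup, MonoidHom.map_closure]
  congr 1
  ext x
  constructor
  · rintro ⟨i, j, h, r, rfl⟩
    refine ⟨U.elem h (f.symm r), ⟨i, j, h, _, rfl⟩, ?_⟩
    ext1
    simp [mapEquiv]
  · rintro ⟨_, ⟨i, j, h, r, rfl⟩, rfl⟩
    refine ⟨i, j, h, f r, ?_⟩
    ext1
    simp [mapEquiv]

theorem mem_elemSubgroup_mapEquiv (U : MatrixUnits κ R) (f : R ≃+* S) (x : Sˣ) :
    x ∈ (U.mapEquiv f).elemSubgroup ↔
      Units.mapEquiv f.symm.toMulEquiv x ∈ U.elemSubgroup := by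
  rw [elemSubgroup_mapEquiv, Subgroup.mem_map]
  constructor
  · rintro ⟨y, hy, rfl⟩
    convert hy
    ext1
    simp
  · intro h
    refine ⟨_, h, ?_⟩
    ext1
    simp

theorem normal_mapEquiv (U : MatrixUnits κ R) (f : R ≃+* S) (h : U.elemSubgroup.Normal) :
    (U.mapEquiv f).elemSubgroup.Normal := by
  rw [elemSubgroup_mapEquiv]
  exact h.map _ (Units.mapEquiv f.toMulEquiv).surjective

end MatrixUnits
end FAbCut

namespace FAbCut
open TensorProduct

section Central
variable {F D : Type*} [Field F] [DivisionRing D] [Algebra F D] [FiniteDimensional F D]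
  [Algebra.IsCentral F D]

variable (F D) in
theorem mulLeftRight_surjective :
    Function.Surjective (AlgHom.mulLeftRight F D) := by
  set T := (AlgHom.mulLeftRight F D).range with hT
  have hl : ∀ a : D, LinearMap.mulLeft F a ∈ T := fun a ↦
    ⟨a ⊗ₜ 1, by ext x; simp⟩
  have hr : ∀ a : D, LinearMap.mulRight F a ∈ T := fun a ↦
    ⟨1 ⊗ₜ MulOpposite.op a, by ext x; simp⟩
  have hsimple : IsSimpleModule T D := by
    rw [isSimpleModule_iff]
    refine { exists_pair_ne := ⟨⊥, ⊤, fun h ↦ ?_⟩, eq_bot_or_eq_top := fun N ↦ ?_ }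
    · have : (1 : D) ∈ (⊥ : Submodule T D) := h ▸ trivial
      exact one_ne_zero ((Submodule.mem_bot T).1 this)
    · rw [or_iff_not_imp_left]
      intro hN
      obtain ⟨x, hx, hx0⟩ := (Submodule.ne_bot_iff N).1 hN
      refine (Submodule.eq_top_iff').2 fun y ↦ ?_
      have := N.smul_mem (⟨_, hl (y * x⁻¹)⟩ : T) hx
      have h2 : (⟨_, hl (y * x⁻¹)⟩ : T) • x = y := by
        change y * x⁻¹ * x = y
        rw [mul_assoc, inv_mul_cancel₀ hx0, mul_one]
      rwa [h2] at this
  intro f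
  have hscalar : ∀ φ : Module.End T D, ∃ c : F, ∀ x, φ x = c • x := by
    intro φ
    have h1 : ∀ a x : D, φ (a * x) = a * φ x := fun a x ↦ φ.map_smul (⟨_, hl a⟩ : T) x
    have h2 : ∀ a x : D, φ (x * a) = φ x * a := fun a x ↦ φ.map_smul (⟨_, hr a⟩ : T) x
    have : φ 1 ∈ Subalgebra.center F D := by
      rw [Subalgebra.mem_center_iff]
      intro b
      rw [← h1, ← h2, mul_one, one_mul]
    obtain ⟨c, hc⟩ := Algebra.IsCentral.out this
    refine ⟨c, fun x ↦ ?_⟩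
    have hc' : algebraMap F D c = φ 1 := hc
    rw [Algebra.smul_def, hc', ← h2, one_mul]
  let g : Module.End (Module.End T D) D :=
    { toFun := f
      map_add' := map_add f
      map_smul' := fun φ x ↦ by
        obtain ⟨c, hc⟩ := hscalar φ
        simp [hc] }
  let b := Module.finBasis F D
  classical
  obtain ⟨r, hr⟩ := jacobson_density (R := T) (M := D) g (Finset.univ.image b)
  obtain ⟨t, ht⟩ := r.2
  refine ⟨t, b.ext fun i ↦ ?_⟩
  have := hr (b i) (by simp)
  rw [show AlgHom.mulLeftRight F D t = (r : Module.End F D) from ht]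
  exact this.symm

variable {K : Type*} [Field K] [Algebra F K]

/-- Applying an endomorphism to the right factor of `K ⊗ D` by two-sided multiplications. -/
theorem exists_lTensor_eq (f : D →ₗ[F] D) : ∃ (n : ℕ) (a b : Fin n → D), ∀ x : K ⊗[F] D,
    LinearMap.lTensor K f x = ∑ i, (1 ⊗ₜ[F] a i) * x * (1 ⊗ₜ[F] b i) := by
  obtain ⟨t, rfl⟩ := mulLeftRight_surjective F D f
  have key : ∃ s : List (D × D), ∀ x : K ⊗[F] D,
      LinearMap.lTensor K (AlgHom.mulLeftRight F D t) x =
        (s.map fun p ↦ (1 ⊗ₜ[F] p.1) * x * (1 ⊗ₜ[F] p.2)).sum := by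
    induction t using TensorProduct.induction_on with
    | zero => exact ⟨[], fun x ↦ by simp⟩
    | tmul a b =>
      refine ⟨[(a, b.unop)], fun x ↦ ?_⟩
      induction x using TensorProduct.induction_on with
      | zero => simp
      | tmul c d => simp
      | add x y hx hy => rw [map_add, hx, hy]; simp [mul_add, add_mul]
    | add s t hs ht =>
      obtain ⟨l, hl⟩ := hs
      obtain ⟨m, hm⟩ := ht
      refine ⟨l ++ m, fun x ↦ ?_⟩
      rw [map_add, LinearMap.lTensor_add, LinearMap.add_apply, hl, hm]
      simp
  obtain ⟨s, hs⟩ := key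
  refine ⟨s.length, fun i ↦ (s.get i).1, fun i ↦ (s.get i).2, fun x ↦ ?_⟩
  rw [hs]
  simp [← List.sum_ofFn, List.ofFn_getElem_eq_map s (fun p ↦ (1 ⊗ₜ[F] p.1) * x * (1 ⊗ₜ[F] p.2))]

variable (F D K)

theorem exists_proj_one : ∃ φ : D →ₗ[F] F, φ 1 = 1 := by
  obtain ⟨φ, hφ⟩ := Module.Projective.exists_dual_ne_zero F (one_ne_zero : (1 : D) ≠ 0)
  exact ⟨(φ 1)⁻¹ • φ, by simp [hφ]⟩

instance isSimpleRing_tensor : IsSimpleRing (K ⊗[F] D) := by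
  have : Nontrivial (TwoSidedIdeal (K ⊗[F] D)) := by
    have : Nontrivial (K ⊗[F] D) := inferInstance
    exact inferInstance
  refine ⟨{ eq_bot_or_eq_top := fun I ↦ ?_ }⟩
  rw [or_iff_not_imp_left]
  intro hI
  obtain ⟨x, hxI, hx0⟩ : ∃ x ∈ I, x ≠ 0 := by
    by_contra! h
    refine hI (TwoSidedIdeal.ext fun x ↦ ⟨fun hx ↦ ?_, fun hx ↦ ?_⟩)
    · exact (TwoSidedIdeal.mem_bot _).2 (h x hx)
    · rw [(TwoSidedIdeal.mem_bot _).1 hx]; exact I.zero_mem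
  let b := Module.finBasis F D
  have hx : ∃ i, ∃ c : K, c ≠ 0 ∧ LinearMap.lTensor K ((b.coord i).smulRight (1 : D)) x = c ⊗ₜ 1 := by
    by_contra! h
    refine hx0 ?_
    let B := Algebra.TensorProduct.basis K b
    refine B.ext_elem fun i ↦ ?_
    have h1 : LinearMap.lTensor K ((b.coord i).smulRight (1 : D)) x = (B.repr x i) ⊗ₜ 1 := by
      clear * -
      induction x using TensorProduct.induction_on with
      | zero => simp
      | tmul c d =>
        rw [LinearMap.lTensor_tmul, Algebra.TensorProduct.basis_repr_tmul, Finsupp.smul_apply,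
          Finsupp.mapRange_apply, LinearMap.smulRight_apply, ← TensorProduct.smul_tmul,
          Algebra.smul_def, smul_eq_mul, mul_comm]
        rfl
      | add x y hx hy => rw [map_add, hx, hy]; simp [TensorProduct.add_tmul]
    by_contra h2
    exact h i _ (by simpa using h2) h1
  obtain ⟨i, c, hc, h⟩ := hx
  obtain ⟨n, u, v, huv⟩ := exists_lTensor_eq (K := K) ((b.coord i).smulRight (1 : D))
  have hmem : (c ⊗ₜ[F] (1 : D)) ∈ I := by
    rw [← h, huv]
    exact sum_mem fun j _ ↦ I.mul_mem_right _ _ (I.mul_mem_left _ _ hxI)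
  have h1 : (1 : K ⊗[F] D) ∈ I := by
    have := I.mul_mem_left (c⁻¹ ⊗ₜ[F] (1 : D)) _ hmem
    rwa [Algebra.TensorProduct.tmul_mul_tmul, inv_mul_cancel₀ hc, mul_one] at this
  exact (TwoSidedIdeal.one_mem_iff I).1 h1

instance isCentral_tensor : Algebra.IsCentral K (K ⊗[F] D) := by
  refine ⟨fun x hx ↦ ?_⟩
  obtain ⟨φ, hφ⟩ := exists_proj_one F D
  obtain ⟨n, u, v, huv⟩ := exists_lTensor_eq (K := K) (φ.smulRight (1 : D))
  have h1 : LinearMap.lTensor K (φ.smulRight (1 : D)) x = x := by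
    have h2 := huv 1
    rw [Algebra.TensorProduct.one_def, LinearMap.lTensor_tmul] at h2
    simp only [LinearMap.smulRight_apply, hφ, one_smul, Algebra.TensorProduct.tmul_mul_tmul,
      mul_one] at h2
    rw [huv]
    have h3 : ∀ i, (1 ⊗ₜ[F] u i) * x * (1 ⊗ₜ[F] v i) = x * ((1 : K) ⊗ₜ[F] (u i * v i)) := by
      intro i
      rw [Subalgebra.mem_center_iff] at hx
      rw [hx, mul_assoc, Algebra.TensorProduct.tmul_mul_tmul, mul_one]
    simp only [h3, ← Finset.mul_sum, ← h2]
    rw [← Algebra.TensorProduct.one_def, mul_one]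
  have h2 : ∀ y : K ⊗[F] D, ∃ c : K, LinearMap.lTensor K (φ.smulRight (1 : D)) y = c ⊗ₜ 1 := by
    intro y
    induction y using TensorProduct.induction_on with
    | zero => exact ⟨0, by simp⟩
    | tmul c d => exact ⟨φ d • c, by simp [TensorProduct.smul_tmul']⟩
    | add x y hx hy =>
      obtain ⟨c, hc⟩ := hx
      obtain ⟨d, hd⟩ := hy
      exact ⟨c + d, by rw [map_add, hc, hd, TensorProduct.add_tmul]⟩
  obtain ⟨c, hc⟩ := h2 x
  exact ⟨c, by rw [← h1, hc]; rfl⟩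

end Central
end FAbCut

namespace FAbCut
open TensorProduct

theorem exists_int_basis {D : Type*} [DivisionRing D] [Algebra ℚ D] [FiniteDimensional ℚ D]
    (O : Subring D) [Module.Finite ℤ O] (hO : Submodule.span ℚ (O : Set D) = ⊤) :
    ∃ (b : Module.Basis (Fin (Module.finrank ℚ D)) ℤ O), True := by
  have : CharZero D := algebraRat.charZero D
  have : Module.Free ℤ O := inferInstance
  let b := Module.Free.chooseBasis ℤ O
  have : Fintype (Module.Free.ChooseBasisIndex ℤ O) := Module.Free.ChooseBasisIndex.fintype ℤ O
  have hli : LinearIndependent ℤ fun i ↦ ((b i : O) : D) := by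
    have := b.linearIndependent.map' (O.subtype.toAddMonoidHom.toIntLinearMap)
      (LinearMap.ker_eq_bot.2 Subtype.coe_injective)
    exact this
  have hli' : LinearIndependent ℚ fun i ↦ ((b i : O) : D) :=
    (LinearIndependent.iff_fractionRing ℤ ℚ).1 hli
  have hsp : ⊤ ≤ Submodule.span ℚ (Set.range fun i ↦ ((b i : O) : D)) := by
    rw [← hO, Submodule.span_le]
    intro x hx
    have h1 := b.sum_repr ⟨x, hx⟩
    have h2 : x = ∑ i, (b.repr ⟨x, hx⟩ i : ℚ) • ((b i : O) : D) := by
      have := congrArg (O.subtype) h1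
      rw [map_sum] at this
      simp only [map_zsmul, Subring.subtype_apply] at this
      refine this.symm.trans ?_
      exact Finset.sum_congr rfl fun i _ ↦ (Int.cast_smul_eq_zsmul ℚ _ _).symm
    rw [h2]
    exact sum_mem fun i _ ↦ Submodule.smul_mem _ _ (Submodule.subset_span ⟨i, rfl⟩)
  have hcard := Module.finrank_eq_card_basis (Module.Basis.mk hli' hsp)
  exact ⟨b.reindex (Fintype.equivFinOfCardEq hcard.symm), trivial⟩

section
variable {F D K : Type*} [Field F] [DivisionRing D] [Algebra F D] [FiniteDimensional F D]
  [NumberField F] [Algebra ℚ D] [Field K] [Algebra F K] [Algebra ℝ K] [FiniteDimensional ℝ K]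

theorem exists_real_basis (O : Subring D) [Module.Finite ℤ O]
    (hO : Submodule.span ℚ (O : Set D) = ⊤)
    (hK : Submodule.span ℝ (Set.range (algebraMap F K)) = ⊤)
    (hKF : Module.finrank ℝ K = Module.finrank ℚ F) :
    ∃ b : Module.Basis (Fin (Module.finrank ℚ D)) ℝ (K ⊗[F] D),
      (Submodule.span ℤ (Set.range b) : Set (K ⊗[F] D)) =
        (Algebra.TensorProduct.includeRight : D →ₐ[F] K ⊗[F] D) '' O := by
  have : CharZero D := algebraRat.charZero D
  have : IsScalarTower ℚ F D := inferInstance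
  have : FiniteDimensional ℚ D := Module.Finite.trans F D
  obtain ⟨b, -⟩ := exists_int_basis O hO
  have hbO : (Submodule.span ℤ (Set.range fun i ↦ ((b i : O) : D)) : Set D) = O := by
    ext x
    constructor
    · intro hx
      have : Submodule.span ℤ (Set.range fun i ↦ ((b i : O) : D)) ≤
          O.toAddSubgroup.toIntSubmodule := by
        rw [Submodule.span_le]
        rintro _ ⟨i, rfl⟩
        exact (b i).2
      exact this hx
    · intro hx
      have h1 := b.sum_repr ⟨x, hx⟩
      have := congrArg (O.subtype) h1
      rw [map_sum] at this
      simp only [map_zsmul, Subring.subtype_apply] at this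
      rw [SetLike.mem_coe, ← this]
      exact sum_mem fun i _ ↦ Submodule.smul_mem _ _ (Submodule.subset_span ⟨i, rfl⟩)
  set ι : D →ₐ[F] K ⊗[F] D := Algebra.TensorProduct.includeRight with hι
  set v : Fin (Module.finrank ℚ D) → K ⊗[F] D := fun i ↦ ι (b i : O) with hv
  have hZ : (Submodule.span ℤ (Set.range v) : Set (K ⊗[F] D)) = ι '' O := by
    have h1 : Set.range v = ι.toAddMonoidHom.toIntLinearMap '' (Set.range fun i ↦ ((b i : O) : D)) := by
      rw [← Set.range_comp]; rfl
    rw [h1, ← Submodule.map_span, Submodule.map_coe, hbO]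
    rfl
  have hιD : ∀ d : D, ι d ∈ Submodule.span ℝ (Set.range v) := by
    intro d
    have hd : d ∈ Submodule.span ℚ (O : Set D) := hO ▸ trivial
    induction hd using Submodule.span_induction with
    | mem x hx =>
      have : ι x ∈ (Submodule.span ℤ (Set.range v) : Set (K ⊗[F] D)) := by
        rw [hZ]; exact ⟨x, hx, rfl⟩
      exact Submodule.span_subset_span ℤ ℝ _ this
    | zero => simp
    | add x y _ _ hx hy => rw [map_add]; exact add_mem hx hy
    | smul q x _ hx =>
      have : ι (q • x) = (q : ℝ) • ι x := by
        simpa using map_ratCast_smul ι ℚ ℝ q x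
      rw [this]
      exact Submodule.smul_mem _ _ hx
  have htop : ⊤ ≤ Submodule.span ℝ (Set.range v) := by
    rintro x -
    induction x using TensorProduct.induction_on with
    | zero => simp
    | add x y hx hy => exact add_mem (hx) (hy)
    | tmul c d =>
      have hc : c ∈ Submodule.span ℝ (Set.range (algebraMap F K)) := hK ▸ trivial
      induction hc using Submodule.span_induction with
      | mem c hc =>
        obtain ⟨f, rfl⟩ := hc
        have : (algebraMap F K f) ⊗ₜ[F] d = ι (f • d) := by
          rw [hι, Algebra.TensorProduct.includeRight_apply, ← TensorProduct.smul_tmul,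
            Algebra.smul_def, mul_one]
        rw [this]
        exact hιD _
      | zero => simp
      | add x y _ _ hx hy => rw [TensorProduct.add_tmul]; exact add_mem hx hy
      | smul r c _ hc =>
        rw [← TensorProduct.smul_tmul']
        exact Submodule.smul_mem _ _ hc
  have hcard : Fintype.card (Fin (Module.finrank ℚ D)) = Module.finrank ℝ (K ⊗[F] D) := by
    rw [Fintype.card_fin, ← Module.finrank_mul_finrank ℝ K (K ⊗[F] D),
      ← Module.finrank_mul_finrank ℚ F D, hKF, Module.finrank_baseChange]
  refine ⟨basisOfTopLeSpanOfCardEqFinrank v htop hcard, ?_⟩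
  rw [coe_basisOfTopLeSpanOfCardEqFinrank, hZ]

end
end FAbCut

namespace FAbCut

/-- Up to commutators, there are finitely many elements whose norm is a root of unity. -/
def HasFiniteNormKernel (K E : Type*) [Field K] [DivisionRing E] [Algebra K E] : Prop :=
  ∀ k : ℕ, k ≠ 0 → ∃ T : Set Eˣ, T.Finite ∧
    ∀ d : Eˣ, Algebra.norm K (d : E) ^ k = 1 → ∃ t ∈ T, t⁻¹ * d ∈ commutator Eˣ

section
variable {K E : Type*} [Field K] [DivisionRing E] [Algebra K E] [FiniteDimensional K E]

theorem hasFiniteNormKernel_of_surjective (h : Function.Surjective (algebraMap K E)) :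
    HasFiniteNormKernel K E := by
  intro k hk
  set m := Module.finrank K E * k with hm
  have hm0 : 0 < m := Nat.mul_pos Module.finrank_pos (Nat.pos_of_ne_zero hk)
  refine ⟨{t | (t : E) ∈ algebraMap K E '' {c | c ^ m = 1}}, ?_, fun d hd ↦ ⟨d, ?_, by simp [one_mem]⟩⟩
  · refine Set.Finite.preimage (Units.val_injective.injOn) (Set.Finite.image _ ?_)
    classical
    refine (Polynomial.nthRoots m (1 : K)).toFinset.finite_toSet.subset fun c hc ↦ ?_
    rw [Finset.mem_coe, Multiset.mem_toFinset, Polynomial.mem_nthRoots hm0]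
    exact hc
  · obtain ⟨c, hc⟩ := h (d : E)
    rw [← hc, Algebra.norm_algebraMap, ← pow_mul] at hd
    exact ⟨c, hd, hc⟩

end

section Real
variable {E : Type*} [DivisionRing E] [Algebra ℝ E] [FiniteDimensional ℝ E]

theorem exists_imaginary (x : E) (hx : x ∉ Set.range (algebraMap ℝ E)) :
    ∃ i : E, i * i = -1 ∧ ∃ a b : ℝ, x = algebraMap ℝ E a + algebraMap ℝ E b * i := by
  have hinteg : IsIntegral ℝ x := Algebra.IsIntegral.isIntegral x
  set p := minpoly ℝ x with hp
  have hp2 := (minpoly.irreducible hinteg).degree_le_two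
  have hq := Polynomial.eq_quadratic_of_degree_le_two hp2
  have h0 := minpoly.aeval ℝ x
  rw [hq] at h0
  simp only [map_add, map_mul, Polynomial.aeval_C, map_pow, Polynomial.aeval_X] at h0
  have hcomm : ∀ (r : ℝ) (y : E), algebraMap ℝ E r * y = y * algebraMap ℝ E r :=
    Algebra.commutes
  have ha2 : (minpoly ℝ x).coeff 2 ≠ 0 := by
    intro h2
    have ha1 : (minpoly ℝ x).coeff 1 ≠ 0 := by
      intro h1
      rw [h2, h1] at h0
      simp only [map_zero, zero_mul, zero_add] at h0
      have h00 : (minpoly ℝ x).coeff 0 = 0 := by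
        simpa using h0
      exact minpoly.ne_zero hinteg (by rw [hq, h2, h1, h00]; simp)
    refine hx ⟨-(minpoly ℝ x).coeff 0 / (minpoly ℝ x).coeff 1, ?_⟩
    rw [h2, map_zero, zero_mul, zero_add] at h0
    have h3 : algebraMap ℝ E ((minpoly ℝ x).coeff 1) ≠ 0 := by simpa using ha1
    rw [map_div₀, map_neg, div_eq_iff h3, ← hcomm, ← add_eq_zero_iff_eq_neg.1 h0]
  set s : ℝ := (minpoly ℝ x).coeff 1 / (2 * (minpoly ℝ x).coeff 2) with hs
  set t : ℝ := s ^ 2 - (minpoly ℝ x).coeff 0 / (minpoly ℝ x).coeff 2 with ht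
  have hsq : (x + algebraMap ℝ E s) * (x + algebraMap ℝ E s) = algebraMap ℝ E t := by
    have h3 : x ^ 2 + algebraMap ℝ E (2 * s) * x +
        algebraMap ℝ E ((minpoly ℝ x).coeff 0 / (minpoly ℝ x).coeff 2) = 0 := by
      have := congrArg (fun y ↦ algebraMap ℝ E ((minpoly ℝ x).coeff 2)⁻¹ * y) h0
      simp only [mul_add, mul_zero, ← mul_assoc, ← map_mul, inv_mul_cancel₀ ha2, map_one,
        one_mul] at this
      have e1 : 2 * s = ((minpoly ℝ x).coeff 2)⁻¹ * (minpoly ℝ x).coeff 1 := by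
        rw [hs]; field_simp
      have e2 : (minpoly ℝ x).coeff 0 / (minpoly ℝ x).coeff 2 =
        ((minpoly ℝ x).coeff 2)⁻¹ * (minpoly ℝ x).coeff 0 := by field_simp
      rw [← this, e1, e2]
    have h4 : algebraMap ℝ E t = algebraMap ℝ E s * algebraMap ℝ E s -
        algebraMap ℝ E ((minpoly ℝ x).coeff 0 / (minpoly ℝ x).coeff 2) := by
      rw [ht, map_sub, map_pow, pow_two]
    rw [h4, ← sub_eq_zero, ← h3, map_mul, map_ofNat, mul_add, add_mul, add_mul, ← hcomm s x]
    noncomm_ring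
  have hnx : ∀ r : ℝ, x + algebraMap ℝ E r ≠ 0 := fun r h ↦
    hx ⟨-r, by rw [map_neg]; exact (eq_neg_of_add_eq_zero_left h).symm⟩
  have ht0 : t < 0 := by
    by_contra! h
    have h5 : (x + algebraMap ℝ E (s - √t)) * (x + algebraMap ℝ E (s + √t)) = 0 := by
      have h6 : algebraMap ℝ E t = algebraMap ℝ E (√t) * algebraMap ℝ E (√t) := by
        rw [← map_mul, Real.mul_self_sqrt h]
      rw [h6, ← sub_eq_zero] at hsq
      rw [← hsq, map_sub, map_add]
      have := hcomm (√t) x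
      have h7 := hcomm (√t) (algebraMap ℝ E s)
      simp only [mul_add, add_mul, sub_mul, mul_sub, this, h7]
      abel
    rcases mul_eq_zero.1 h5 with h | h
    · exact hnx _ h
    · exact hnx _ h
  have hr0 : √(-t) ≠ 0 := (Real.sqrt_pos.2 (by linarith)).ne'
  refine ⟨algebraMap ℝ E (√(-t))⁻¹ * (x + algebraMap ℝ E s), ?_, -s, √(-t), ?_⟩
  · rw [mul_assoc, ← mul_assoc (x + _), ← hcomm _ (x + _), mul_assoc, hsq, ← map_mul, ← map_mul]
    have : (√(-t))⁻¹ * ((√(-t))⁻¹ * t) = -1 := by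
      have h8 : √(-t) * √(-t) = -t := Real.mul_self_sqrt (by linarith)
      field_simp
      rw [pow_two, h8]; ring
    rw [this, map_neg, map_one]
  · rw [← mul_assoc, ← map_mul, mul_inv_cancel₀ hr0]
    simp

theorem exists_anticommuting [Algebra.IsCentral ℝ E] {i : E} (hi : i * i = -1) :
    ∃ j : E, j ≠ 0 ∧ i * j = -(j * i) := by
  by_contra! h
  have h1 : ∀ x : E, x + i * x * i = 0 := by
    intro x
    by_contra h2
    refine h _ h2 ?_
    have : i * (x + i * x * i) = i * x + (i * i) * x * i := by noncomm_ring
    rw [this, add_mul]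
    have : i * x * i * i = i * x * (i * i) := by noncomm_ring
    rw [this, hi]; noncomm_ring
  have hc : i ∈ Subalgebra.center ℝ E := by
    rw [Subalgebra.mem_center_iff]
    intro x
    have := congrArg (fun y ↦ i * y) (h1 x)
    simp only [mul_add, mul_zero, ← mul_assoc, hi] at this
    have h3 : i * x = x * i := by
      rw [← sub_eq_zero, ← this]; noncomm_ring
    exact h3.symm
  obtain ⟨r, hr⟩ := Algebra.IsCentral.out hc
  have hr' : algebraMap ℝ E r = i := hr
  have : algebraMap ℝ E (r * r) = algebraMap ℝ E (-1) := by
    rw [map_mul, hr', hi, map_neg, map_one]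
  have := (algebraMap ℝ E).injective this
  nlinarith

theorem hasFiniteNormKernel_of_not_surjective [Algebra.IsCentral ℝ E]
    (h : ¬ Function.Surjective (algebraMap ℝ E)) : HasFiniteNormKernel ℝ E := by
  intro k hk
  refine ⟨{1}, Set.finite_singleton _, fun d hd ↦ ⟨1, rfl, ?_⟩⟩
  rw [inv_one, one_mul]
  obtain ⟨i, hi, a, b, hab⟩ : ∃ i : E, i * i = -1 ∧ ∃ a b : ℝ,
      (d : E) = algebraMap ℝ E a + algebraMap ℝ E b * i := by
    by_cases hdr : (d : E) ∈ Set.range (algebraMap ℝ E)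
    · obtain ⟨a, ha⟩ := hdr
      obtain ⟨x, hx⟩ := not_forall.1 h
      obtain ⟨i, hi, -⟩ := exists_imaginary x hx
      exact ⟨i, hi, a, 0, by simp [ha]⟩
    · exact exists_imaginary _ hdr
  obtain ⟨j, hj0, hj⟩ := exists_anticommuting hi
  have hcomm : ∀ (r : ℝ) (y : E), algebraMap ℝ E r * y = y * algebraMap ℝ E r :=
    Algebra.commutes
  set z : ℂ := ⟨a, b⟩ with hz
  let φ : ℂ →ₐ[ℝ] E := Complex.lift ⟨i, hi⟩
  have hφ : ∀ z : ℂ, φ z = algebraMap ℝ E z.re + algebraMap ℝ E z.im * i := by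
    intro z
    simp [φ, Complex.lift, Complex.liftAux_apply, Algebra.smul_def]
  have hφj : ∀ z : ℂ, φ z * j = j * φ (starRingEnd ℂ z) := by
    intro z
    have e1 : j * (algebraMap ℝ E z.im * i) = algebraMap ℝ E z.im * (j * i) := by
      rw [← mul_assoc, ← hcomm, mul_assoc]
    rw [hφ, hφ, Complex.conj_re, Complex.conj_im, add_mul, mul_add, hcomm, mul_assoc, hj,
      map_neg, neg_mul, mul_neg, mul_neg, e1]
  have hz0 : z ≠ 0 := by
    intro h
    have : φ z = 0 := by rw [h, map_zero]
    rw [hφ, ← hab] at this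
    exact d.ne_zero this
  obtain ⟨w, hw⟩ := IsAlgClosed.exists_pow_nat_eq (z / (‖z‖ : ℂ)) (n := 2) (by norm_num)
  have hnz : (‖z‖ : ℂ) ≠ 0 := by simpa using hz0
  have hwn : ‖w‖ = 1 := by
    have : ‖w‖ ^ 2 = 1 := by
      rw [← norm_pow, hw, norm_div, Complex.norm_real, norm_norm, div_self (by simpa using hz0)]
    exact (pow_eq_one_iff_of_nonneg (norm_nonneg _) two_ne_zero).1 this
  have hww : w * starRingEnd ℂ w = 1 := by
    rw [Complex.mul_conj, Complex.normSq_eq_norm_sq, hwn]; simp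
  have hwu : IsUnit (φ w) := (IsUnit.of_mul_eq_one _ hww).map φ
  obtain ⟨u, hu⟩ := hwu
  set v : Eˣ := Units.mk0 j hj0 with hv
  have huv : ((u * v * u⁻¹ * v⁻¹ : Eˣ) : E) = φ (w * w) := by
    have h1 : ((u⁻¹ : Eˣ) : E) = φ (starRingEnd ℂ w) := by
      rw [Units.inv_eq_of_mul_eq_one_right]
      rw [hu, ← map_mul, hww, map_one]
    have h2 : (v : E) * φ (starRingEnd ℂ w) = φ w * v := (hφj w).symm
    rw [Units.val_mul, Units.val_mul, Units.val_mul, h1, mul_assoc (u : E), h2, hu, ← mul_assoc,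
      mul_assoc, Units.mul_inv, mul_one, map_mul]
  have hmem : u * v * u⁻¹ * v⁻¹ ∈ commutator Eˣ := by
    rw [← commutatorElement_def]
    exact Subgroup.commutator_mem_commutator trivial trivial
  have hd1 : (d : E) = algebraMap ℝ E ‖z‖ * ((u * v * u⁻¹ * v⁻¹ : Eˣ) : E) := by
    rw [huv, ← pow_two, hw, hab]
    have : algebraMap ℝ E ‖z‖ = φ (‖z‖ : ℂ) := by rw [hφ]; simp
    rw [this, ← map_mul, mul_div_cancel₀ _ hnz, hφ]
  have hnorm : Algebra.norm ℝ ((u * v * u⁻¹ * v⁻¹ : Eˣ) : E) = 1 := by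
    have := congrArg Units.val ((map_mul (Units.map (Algebra.norm ℝ : E →* ℝ)) (u * v * u⁻¹) v⁻¹))
    simp only [map_mul, map_inv] at this
    rw [← Units.coe_map, map_mul, map_mul, map_mul, map_inv, map_inv,
      mul_comm (Units.map _ u), mul_assoc (Units.map _ v)]
    simp
  rw [hd1, map_mul, hnorm, mul_one, Algebra.norm_algebraMap, ← pow_mul] at hd
  have hr : ‖z‖ = 1 := (pow_eq_one_iff_of_nonneg (norm_nonneg _)
    (mul_ne_zero Module.finrank_pos.ne' hk)).1 hd
  rw [hr, map_one, one_mul] at hd1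
  rw [Units.ext hd1]
  exact hmem

end Real
end FAbCut

namespace FAbCut
open Subgroup

section FAb
variable {X Y : Type*} [Group X] [Group Y]

/-- Property FAb: every subgroup of finite index has finite abelianization. -/
def FAb (X : Type*) [Group X] : Prop :=
  ∀ H : Subgroup X, H.FiniteIndex → Finite (Abelianization H)

theorem finiteIndex_comap (f : Y →* X) (H : Subgroup X) [H.FiniteIndex] :
    (H.comap f).FiniteIndex :=
  ⟨by
    rw [index_comap]
    exact (H.isFiniteRelIndex_of_finiteIndex (K := f.range)).relIndex_ne_zero⟩

theorem finiteIndex_map (f : Y →* X) (H : Subgroup Y) [H.FiniteIndex] [f.range.FiniteIndex] :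
    (H.map f).FiniteIndex :=
  ⟨by
    rw [index_map]
    have := finiteIndex_of_le (le_sup_left : H ≤ H ⊔ f.ker)
    exact mul_ne_zero this.index_ne_zero FiniteIndex.index_ne_zero⟩

theorem finite_abelianization_of_range (f : Y →* X) [f.range.FiniteIndex]
    [Finite (Abelianization Y)] : Finite (Abelianization X) := by
  let g : Abelianization Y →* Abelianization X := Abelianization.map f
  have : (Abelianization.of : X →* Abelianization X).range.FiniteIndex := by
    rw [MonoidHom.range_eq_top.2 (QuotientGroup.mk_surjective)]; infer_instance
  have h1 := finiteIndex_map (Abelianization.of : X →* Abelianization X) f.range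
  have hle : f.range.map (Abelianization.of : X →* Abelianization X) ≤ g.range := by
    rintro _ ⟨_, ⟨y, rfl⟩, rfl⟩
    exact ⟨Abelianization.of y, rfl⟩
  have := finiteIndex_of_le hle
  have : Finite g.range := Set.finite_range g
  exact Finite.of_subgroup_quotient g.range

/-- FAb passes along homomorphisms with finite-index image. -/
theorem FAb.of_range (hY : FAb Y) (f : Y →* X) [f.range.FiniteIndex] : FAb X := by
  intro H hH
  have h1 := finiteIndex_comap f H
  have := hY _ h1
  let g : H.comap f →* H := f.subgroupComap H
  have : g.range.FiniteIndex := by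
    have h2 : g.range = f.range.subgroupOf H := by
      ext ⟨x, hx⟩
      constructor
      · rintro ⟨⟨y, hy⟩, hyx⟩
        exact ⟨y, congrArg Subtype.val hyx⟩
      · rintro ⟨y, hyx⟩
        have hyx' : f y = x := hyx
        exact ⟨⟨y, by simpa [hyx'] using hx⟩, Subtype.ext hyx⟩
    rw [h2]; infer_instance
  exact finite_abelianization_of_range g

theorem FAb.of_surjective (hY : FAb Y) (f : Y →* X) (hf : Function.Surjective f) : FAb X := by
  have : f.range.FiniteIndex := by rw [MonoidHom.range_eq_top.2 hf]; infer_instance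
  exact hY.of_range f

theorem FAb.subgroup (hX : FAb X) (H : Subgroup X) [H.FiniteIndex] : FAb H := by
  intro L hL
  have : H.subtype.range.FiniteIndex := by rw [H.range_subtype]; infer_instance
  have := hX _ (finiteIndex_map H.subtype L)
  exact Finite.of_equiv _
    (L.equivMapOfInjective H.subtype H.subtype_injective).symm.abelianizationCongr.toEquiv

theorem FAb.of_finite [Finite X] : FAb X := fun _ _ =>
  Finite.of_surjective _ QuotientGroup.mk_surjective

/-- FAb can be checked on the finite-index subgroups contained in a fixed finite-index subgroup. -/
theorem FAb.of_le {N : Subgroup X} [N.FiniteIndex]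
    (h : ∀ H : Subgroup X, H.FiniteIndex → H ≤ N → Finite (Abelianization H)) : FAb X := by
  intro H hH
  have := h (H ⊓ N) inferInstance inf_le_right
  have : (Subgroup.inclusion (inf_le_left : H ⊓ N ≤ H)).range.FiniteIndex := by
    rw [inclusion_range]; infer_instance
  exact finite_abelianization_of_range (Subgroup.inclusion (inf_le_left : H ⊓ N ≤ H))

theorem finite_abelianization_pi {ι : Type*} [Finite ι] {Z : ι → Type*} [∀ i, Group (Z i)]
    (h : ∀ i, Finite (Abelianization (Z i))) : Finite (Abelianization (∀ i, Z i)) := by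
  classical
  have := Fintype.ofFinite ι
  let φ : ∀ i, Abelianization (Z i) →* Abelianization (∀ i, Z i) := fun i =>
    Abelianization.map (MonoidHom.mulSingle Z i)
  refine Finite.of_surjective (fun x : ∀ i, Abelianization (Z i) => ∏ i, φ i (x i)) fun y => ?_
  obtain ⟨z, rfl⟩ := QuotientGroup.mk_surjective y
  refine ⟨fun i => Abelianization.of (z i), ?_⟩
  let F : (∀ i, Z i) →* Abelianization (∀ i, Z i) := {
    toFun := fun z => ∏ i, φ i (Abelianization.of (z i))
    map_one' := by simp
    map_mul' := fun a b => by simp [Finset.prod_mul_distrib] }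
  change F z = Abelianization.of z
  refine congrArg (fun f : (∀ i, Z i) →* Abelianization (∀ i, Z i) => f z)
    (MonoidHom.pi_ext fun i x => ?_)
  change ∏ j, φ j (Abelianization.of (Pi.mulSingle i x j)) = Abelianization.of (Pi.mulSingle i x)
  rw [Finset.prod_eq_single i (fun j _ hj => by simp [Pi.mulSingle_eq_of_ne hj]) (by simp)]
  simp [φ]

theorem FAb.pi {ι : Type*} [Finite ι] {Z : ι → Type*} [∀ i, Group (Z i)]
    (h : ∀ i, FAb (Z i)) : FAb (∀ i, Z i) := by
  classical
  intro H hH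
  let L : ∀ i, Subgroup (Z i) := fun i => H.comap (MonoidHom.mulSingle Z i)
  have hL : ∀ i, (L i).FiniteIndex := fun i => finiteIndex_comap _ _
  have := finite_abelianization_pi fun i => h i (L i) (hL i)
  let f : (∀ i, L i) →* H :=
    { toFun := fun x => ⟨fun i => x i, pi_mem_of_mulSingle_mem _ fun i => (x i).2⟩
      map_one' := rfl
      map_mul' := fun _ _ => rfl }
  have hP : (⨅ i, (L i).comap (Pi.evalMonoidHom Z i)).FiniteIndex :=
    finiteIndex_iInf fun i => finiteIndex_comap _ _
  have : f.range.FiniteIndex := by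
    refine finiteIndex_of_le (H := (⨅ i, (L i).comap (Pi.evalMonoidHom Z i)).subgroupOf H) ?_
    rintro ⟨x, hx⟩ hxL
    rw [mem_subgroupOf, mem_iInf] at hxL
    exact ⟨fun i => ⟨x i, hxL i⟩, rfl⟩
  exact finite_abelianization_of_range f

end FAb
end FAbCut

namespace FAbCut
open Matrix

section Norm

theorem isIntegral_det_of_isIntegral {F n : Type*} [Field F] [Fintype n] [DecidableEq n]
    {M : Matrix n n F} (hM : IsIntegral ℤ M) : IsIntegral ℤ M.det := by
  let C := AlgebraicClosure F
  let f : Matrix n n F →ₐ[ℤ] Matrix n n C := (algebraMap F C).toIntAlgHom.mapMatrix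
  have h2 : IsIntegral ℤ (f M) := hM.map f
  obtain ⟨p, hp, hpM⟩ := h2
  have hpM' : Polynomial.aeval (f M) (p.map (algebraMap ℤ C)) = 0 := by
    rw [Polynomial.aeval_map_algebraMap]; exact hpM
  have h3 : IsIntegral ℤ (f M).det := by
    rw [det_eq_prod_roots_charpoly]
    refine IsIntegral.multiset_prod fun x hx => ⟨p, hp, ?_⟩
    have hx' := mem_spectrum_iff_isRoot_charpoly.2 (Polynomial.isRoot_of_mem_roots hx)
    have h4 := spectrum.subset_polynomial_aeval (f M) (p.map (algebraMap ℤ C)) ⟨x, hx', rfl⟩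
    by_contra h5
    rw [hpM'] at h4
    rw [spectrum.mem_iff, sub_zero] at h4
    refine h4 (IsUnit.map _ (isUnit_iff_ne_zero.2 ?_))
    simpa [Polynomial.eval_map] using h5
  have h6 : (f M).det = algebraMap F C M.det := ((algebraMap F C).map_det M).symm
  rw [h6] at h3
  exact (isIntegral_algebraMap_iff (algebraMap F C).injective).1 h3

/-- Norms of integral elements of noncommutative finite-dimensional algebras are integral. -/
theorem isIntegral_norm_of_isIntegral {F A : Type*} [Field F] [Ring A] [Algebra F A]
    [FiniteDimensional F A] {x : A} (hx : IsIntegral ℤ x) : IsIntegral ℤ (Algebra.norm F x) := by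
  classical
  rw [Algebra.norm_eq_matrix_det (Module.finBasis F A)]
  exact isIntegral_det_of_isIntegral
    (hx.map (((Algebra.leftMulMatrix (Module.finBasis F A)).restrictScalars ℤ)))

/-- Norms are compatible with semilinear ring homomorphisms carrying a basis to a basis. -/
theorem norm_map_of_basis {F K A A' κ : Type*} [Field F] [Field K] [Ring A] [Ring A']
    [Algebra F A] [Algebra K A'] [Finite κ] (g : F →+* K) (f : A →+* A')
    (hf : ∀ (r : F) a, f (r • a) = g r • f a) (b : Module.Basis κ F A) (b' : Module.Basis κ K A')
    (hb : ∀ i, b' i = f (b i)) (x : A) : Algebra.norm K (f x) = g (Algebra.norm F x) := by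
  classical
  have := Fintype.ofFinite κ
  rw [Algebra.norm_eq_matrix_det b, Algebra.norm_eq_matrix_det b', g.map_det]
  congr 1
  ext i j
  have h : ∀ a, b'.repr (f a) i = g (b.repr a i) := by
    intro a
    conv_lhs => rw [← b.sum_repr a]
    simp only [map_sum, hf, ← hb, map_smul, Finset.sum_apply', Finsupp.smul_apply,
      Module.Basis.repr_self, Finsupp.single_apply, smul_eq_mul, mul_ite, mul_one, mul_zero]
    simp
  rw [Algebra.leftMulMatrix_eq_repr_mul, hb, ← map_mul, h, RingHom.mapMatrix_apply,
    Matrix.map_apply, Algebra.leftMulMatrix_eq_repr_mul]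

theorem norm_mapMatrix_includeRight {F K D : Type*} [Field F] [Field K] [Algebra F K] [Ring D]
    [Algebra F D] [FiniteDimensional F D] {n : Type*} [Fintype n] [DecidableEq n]
    (x : Matrix n n D) :
    Algebra.norm K ((Algebra.TensorProduct.includeRight : D →ₐ[F] TensorProduct F K D).toRingHom.mapMatrix x)
      = algebraMap F K (Algebra.norm F x) := by
  have c := Module.finBasis F D
  refine norm_map_of_basis (algebraMap F K) _ ?_ (c.matrix n n)
    ((Algebra.TensorProduct.basis K c).matrix n n) ?_ x
  · intro r a
    ext i j
    simp
  · rintro ⟨i, j, k⟩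
    rw [Module.Basis.matrix_apply, Module.Basis.matrix_apply, Algebra.TensorProduct.basis_apply]
    ext i' j'
    by_cases h : i = i' ∧ j = j'
    · obtain ⟨rfl, rfl⟩ := h
      simp
    · simp [Matrix.single_apply_of_ne (h := h)]

theorem norm_diagUnit {K E κ : Type*} [Field K] [DivisionRing E] [Algebra K E]
    [FiniteDimensional K E] [Fintype κ] [DecidableEq κ] (k : κ) (d : Eˣ) :
    Algebra.norm K ((diagUnit k d : (Matrix κ κ E)ˣ) : Matrix κ κ E)
      = Algebra.norm K (d : E) ^ Fintype.card κ := by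
  let c : κ → E := Pi.mulSingle k (d : E)
  let φ : (κ → κ → E) →ₗ[K] (κ → κ → E) := LinearMap.pi fun i =>
    (LinearMap.pi fun j => (LinearMap.mulLeft K (c i)) ∘ₗ LinearMap.proj j) ∘ₗ LinearMap.proj i
  have h1 : LinearMap.det φ = Algebra.norm K (d : E) ^ Fintype.card κ := by
    rw [LinearMap.det_pi, Finset.prod_eq_single k]
    · rw [LinearMap.det_pi]
      simp [c, Algebra.norm_apply, Algebra.lmul]
      rfl
    · intro i _ hi
      rw [LinearMap.det_pi]
      simp [c, Pi.mulSingle_eq_of_ne hi]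
    · simp
  rw [← h1, ← LinearMap.det_conj φ (Matrix.ofLinearEquiv K), Algebra.norm_apply]
  congr 1
  refine LinearMap.ext fun x => ?_
  ext i j
  simp only [val_diagUnit]
  simp [φ, c, Matrix.diagonal_mul]

end Norm
end FAbCut

namespace FAbCut
open Matrix TensorProduct

section
variable {K E κ : Type*} [Field K] [DivisionRing E] [Algebra K E]
  [FiniteDimensional K E] [Fintype κ] [DecidableEq κ]

theorem exists_finite_reps_norm_one (hE : HasFiniteNormKernel K E) (hκ : 3 ≤ Fintype.card κ)
    (k : κ) : ∃ T : Set Eˣ, T.Finite ∧ ∀ g : (Matrix κ κ E)ˣ,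
      Algebra.norm K (g : Matrix κ κ E) = 1 → ∃ t ∈ T,
        (diagUnit k t)⁻¹ * g ∈ (stdUnits κ E).elemSubgroup := by
  have : Nontrivial κ := Fintype.one_lt_card_iff_nontrivial.1 (by omega)
  obtain ⟨T, hT, h⟩ := hE (Fintype.card κ) (by omega)
  refine ⟨T, hT, fun g hg => ?_⟩
  obtain ⟨x, hx, d, rfl⟩ := exists_eq_diagUnit k g
  have hx1 := (stdUnits κ E).map_eq_one_of_mem hκ
    (Units.map (Algebra.norm K : Matrix κ κ E →* K)) hx
  have hx2 : Algebra.norm K (x : Matrix κ κ E) = 1 := congrArg Units.val hx1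
  rw [Units.val_mul, map_mul, hx2, one_mul, norm_diagUnit] at hg
  obtain ⟨t, ht, htd⟩ := h d hg
  refine ⟨t, ht, ?_⟩
  have hn : (stdUnits κ E).elemSubgroup.Normal := stdUnits_normal
  have h1 : diagUnit k (t⁻¹ * d) ∈ (stdUnits κ E).elemSubgroup := by
    have : commutator Eˣ ≤ (stdUnits κ E).elemSubgroup.comap (diagUnit k) := by
      rw [commutator_def, Subgroup.commutator_le]
      intro a _ b _
      exact diagUnit_commutator_mem k a b
    exact this htd
  have h2 : (diagUnit k t)⁻¹ * (x * diagUnit k d) =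
      diagUnit k (t⁻¹ * d) * ((diagUnit k d)⁻¹ * x * ((diagUnit k d)⁻¹)⁻¹) := by
    rw [map_mul, map_inv]; group
  rw [h2]
  exact mul_mem h1 (hn.conj_mem _ hx _)

end

theorem finite_units_of_isIntegral {F : Type*} [Field F] [NumberField F]
    [Finite (NumberField.RingOfIntegers F)ˣ] :
    {u : Fˣ | IsIntegral ℤ (u : F) ∧ IsIntegral ℤ ((u⁻¹ : Fˣ) : F)}.Finite := by
  refine (Set.finite_range
    (Units.map (algebraMap (NumberField.RingOfIntegers F) F).toMonoidHom)).subset ?_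
  rintro u ⟨h1, h2⟩
  refine ⟨⟨⟨u, h1⟩, ⟨(u⁻¹ : Fˣ), h2⟩, ?_, ?_⟩, Units.ext rfl⟩
  · exact NumberField.RingOfIntegers.ext (Units.mul_inv u)
  · exact NumberField.RingOfIntegers.ext (Units.inv_mul u)

theorem isIntegral_of_mem_matrix {D : Type*} [DivisionRing D] (O : Subring D) [Module.Finite ℤ O]
    {n : ℕ} {x : Matrix (Fin n) (Fin n) D} (hx : x ∈ O.matrix) : IsIntegral ℤ x := by
  let y : Matrix (Fin n) (Fin n) O := fun i j => ⟨x i j, hx i j⟩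
  have hf : Module.Finite ℤ (Matrix (Fin n) (Fin n) O) :=
    inferInstanceAs (Module.Finite ℤ (Fin n → Fin n → O))
  have hy : IsIntegral ℤ y := IsIntegral.of_finite ℤ y
  exact hy.map (O.subtype.mapMatrix (m := Fin n)).toIntAlgHom

section
variable {F D K E : Type*} [Field F] [NumberField F] [DivisionRing D] [Algebra F D]
  [FiniteDimensional F D] [Field K] [Algebra F K] [Algebra ℝ K] [FiniteDimensional ℝ K]
  [DivisionRing E] [Algebra K E] [FiniteDimensional K E]

theorem countable_of_finiteDimensional (F V : Type*) [Field F] [AddCommGroup V] [Module F V]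
    [FiniteDimensional F V] [Countable F] : Countable V :=
  (Module.finBasis F V).equivFun.toEquiv.countable_iff.2 inferInstance

/-- `GL n O` has FAb when it sits in a group of real rank large enough for elementary matrices of
size three. -/
theorem fab_glSubring [Finite (NumberField.RingOfIntegers F)ˣ] (hE : HasFiniteNormKernel K E)
    {l n : ℕ} (e : K ⊗[F] D ≃ₐ[K] Matrix (Fin l) (Fin l) E) (hnl : 3 ≤ n * l) (O : Subring D)
    [Module.Finite ℤ O] {κ : Type*} [Finite κ] {b : Module.Basis κ ℝ (K ⊗[F] D)}
    (hb : (Submodule.span ℤ (Set.range b) : Set (K ⊗[F] D)) =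
        (Algebra.TensorProduct.includeRight : D →ₐ[F] K ⊗[F] D) '' O) :
    FAb (glSubring O n) := by
  classical
  have hn0 : NeZero n := ⟨by rintro rfl; simp at hnl⟩
  have hl0 : NeZero l := ⟨by rintro rfl; simp at hnl⟩
  have : Countable F := countable_of_finiteDimensional ℚ F
  have : Countable D := countable_of_finiteDimensional F D
  have : CharZero D := charZero_of_injective_algebraMap (algebraMap F D).injective
  have : FiniteDimensional ℝ (K ⊗[F] D) := b.finiteDimensional_of_finite
  have hnt : Nontrivial (K ⊗[F] D) := e.toRingEquiv.toEquiv.nontrivial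
  let ι : D →+* K ⊗[F] D := (Algebra.TensorProduct.includeRight : D →ₐ[F] K ⊗[F] D).toRingHom
  let f : Matrix (Fin n) (Fin n) (K ⊗[F] D) ≃ₐ[K] Matrix (Fin n × Fin l) (Fin n × Fin l) E :=
    e.mapMatrix.trans (Matrix.compAlgEquiv (Fin n) (Fin l) E K)
  let U := (stdUnits (Fin n × Fin l) E).mapEquiv f.symm.toRingEquiv
  have hcard : 3 ≤ Fintype.card (Fin n × Fin l) := by simpa using hnl
  have hUn : U.elemSubgroup.Normal := (stdUnits _ E).normal_mapEquiv _ stdUnits_normal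
  obtain ⟨T, hT, hTg⟩ := exists_finite_reps_norm_one (κ := Fin n × Fin l) hE hcard (0, 0)
  let ψ : glSubring O n →* Fˣ :=
    (Units.map (Algebra.norm F : Matrix (Fin n) (Fin n) D →* F)).comp (glSubring O n).subtype
  have hψ : Finite ψ.range := by
    refine (finite_units_of_isIntegral (F := F)).subset ?_
    rintro _ ⟨γ, rfl⟩
    have hγ := Submonoid.mem_units_iff _ _ |>.1 γ.2
    exact ⟨isIntegral_norm_of_isIntegral (isIntegral_of_mem_matrix O hγ.1),
      isIntegral_norm_of_isIntegral (isIntegral_of_mem_matrix O hγ.2)⟩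
  have hN : ψ.ker.FiniteIndex := inferInstance
  let μ : glSubring O n →* (Matrix (Fin n × Fin l) (Fin n × Fin l) E)ˣ :=
    (Units.map (f : _ →* _)).comp ((glMap ι n).comp (glSubring O n).subtype)
  have hstd : (stdUnits (Fin n × Fin l) E).elemSubgroup.Normal := stdUnits_normal
  let φ : ψ.ker →* _ ⧸ (stdUnits (Fin n × Fin l) E).elemSubgroup :=
    (QuotientGroup.mk' _).comp (μ.comp ψ.ker.subtype)
  have hφ : Finite φ.range := by
    refine (hT.image fun t => QuotientGroup.mk' _ (diagUnit (0, 0) t)).subset ?_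
    rintro _ ⟨γ, rfl⟩
    have h1 : Algebra.norm F ((γ.1.1 : (Matrix (Fin n) (Fin n) D)ˣ) : Matrix (Fin n) (Fin n) D)
        = 1 := congrArg Units.val γ.2
    obtain ⟨t, ht, h2⟩ := hTg (μ γ) (by
      change Algebra.norm K (f (ι.mapMatrix
        ((γ.1.1 : (Matrix (Fin n) (Fin n) D)ˣ) : Matrix (Fin n) (Fin n) D))) = 1
      rw [Algebra.norm_eq_of_algEquiv, norm_mapMatrix_includeRight, h1, map_one])
    exact ⟨t, ht, QuotientGroup.eq.2 h2⟩
  have hφk : φ.ker.FiniteIndex := inferInstance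
  have : ψ.ker.subtype.range.FiniteIndex := by rw [Subgroup.range_subtype]; exact hN
  have hΓ0 := finiteIndex_map ψ.ker.subtype φ.ker
  refine FAb.of_le (N := φ.ker.map ψ.ker.subtype) fun H hH hle => ?_
  have h1 : Finite (Abelianization (H.map (glSubring O n).subtype)) := by
    refine finite_abelianization_gl hb U hcard hUn ?_ ?_ ?_
    · exact Subgroup.map_subtype_le H
    · rw [Subgroup.subgroupOf, Subgroup.comap_map_eq_self_of_injective
        (Subgroup.subtype_injective _)]
      exact hH
    · rintro _ ⟨_, ⟨γ, hγ, rfl⟩, rfl⟩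
      obtain ⟨γ', hγ', rfl⟩ := hle hγ
      rw [MatrixUnits.mem_elemSubgroup_mapEquiv]
      have h3 := (QuotientGroup.eq_one_iff _).1 hγ'
      exact h3
  exact Finite.of_equiv _ (H.equivMapOfInjective (glSubring O n).subtype
    (Subgroup.subtype_injective _)).symm.abelianizationCongr.toEquiv

end
end FAbCut

namespace FAbCut
open Matrix TensorProduct

section
variable {B D κ : Type*} [Ring B] [Algebra ℝ B] [Nontrivial B] [DivisionRing D] {ι : D →+* B}
  {O : Subring D} [Finite κ] {b : Module.Basis κ ℝ B}

theorem exists_repr_eq_intCast (hb : (Submodule.span ℤ (Set.range b) : Set B) = ι '' O) {x : D}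
    (hx : x ∈ O) (i : κ) : ∃ z : ℤ, (z : ℝ) = b.repr (ι x) i := by
  have h : ι x ∈ Submodule.span ℤ (Set.range b) := by
    rw [← SetLike.mem_coe, hb]; exact ⟨x, hx, rfl⟩
  obtain ⟨z, hz⟩ := (b.mem_span_iff_repr_mem ℤ _).1 h i
  exact ⟨z, hz⟩

theorem exists_norm_eq_intCast (hb : (Submodule.span ℤ (Set.range b) : Set B) = ι '' O) {x : D}
    (hx : x ∈ O) : ∃ z : ℤ, (z : ℝ) = Algebra.norm ℝ (ι x) := by
  classical
  have := Fintype.ofFinite κ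
  have h : ∀ i j, ∃ z : ℤ, (z : ℝ) = Algebra.leftMulMatrix b (ι x) i j := by
    intro i j
    have hj : b j ∈ ι '' O := by rw [← hb]; exact Submodule.subset_span ⟨j, rfl⟩
    obtain ⟨y, hy, hyj⟩ := hj
    rw [Algebra.leftMulMatrix_eq_repr_mul, ← hyj, ← map_mul]
    exact exists_repr_eq_intCast hb (mul_mem hx hy) i
  choose M hM using h
  refine ⟨(Matrix.of M).det, ?_⟩
  rw [Algebra.norm_eq_matrix_det b]
  have := (Int.castRingHom ℝ).map_det (Matrix.of M)
  rw [eq_intCast] at this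
  rw [this]
  congr 1
  ext i j
  exact hM i j

theorem abs_norm_eq_one (hb : (Submodule.span ℤ (Set.range b) : Set B) = ι '' O) (u : Oˣ) :
    |Algebra.norm ℝ (ι (u : O))| = 1 := by
  obtain ⟨z, hz⟩ := exists_norm_eq_intCast hb (u : O).2
  obtain ⟨w, hw⟩ := exists_norm_eq_intCast hb (↑u⁻¹ : O).2
  have h : z * w = 1 := by
    have : ((z * w : ℤ) : ℝ) = 1 := by
      rw [Int.cast_mul, hz, hw, ← map_mul, ← map_mul]
      have h2 : ((u : O) : D) * ((↑u⁻¹ : O) : D) = 1 := congrArg Subtype.val u.mul_inv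
      rw [h2, map_one, map_one]
    exact_mod_cast this
  rw [← hz]
  exact_mod_cast Int.isUnit_iff_abs_eq.1 (IsUnit.of_mul_eq_one w h)

theorem exists_bound_of_abs_norm_eq_one [Fintype κ] [NoZeroDivisors B] (b : Module.Basis κ ℝ B) :
    ∃ R : ℝ, ∀ v : κ → ℝ, |Algebra.norm ℝ (b.equivFun.symm v)| = 1 → ‖v‖ ≤ R := by
  classical
  have : FiniteDimensional ℝ B := b.finiteDimensional_of_finite
  let N : (κ → ℝ) → ℝ := fun v => |Algebra.norm ℝ (b.equivFun.symm v)|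
  have hN : Continuous N := by
    refine continuous_abs.comp ?_
    simp only [Algebra.norm_eq_matrix_det b]
    refine Continuous.matrix_det ?_
    exact ((Algebra.leftMulMatrix b).toLinearMap ∘ₗ
      b.equivFun.symm.toLinearMap).continuous_of_finiteDimensional
  have hN0 : ∀ v, v ≠ 0 → 0 < N v := by
    intro v hv
    refine abs_pos.2 fun h0 => ?_
    rw [Algebra.norm_apply] at h0
    obtain ⟨y, hy, hy0⟩ := (Submodule.ne_bot_iff _).1 (LinearMap.bot_lt_ker_of_det_eq_zero h0).ne'
    rcases mul_eq_zero.1 (LinearMap.mem_ker.1 hy) with h | h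
    · exact hv (b.equivFun.symm.map_eq_zero_iff.1 h)
    · exact hy0 h
  have hκ : Nonempty κ := by
    by_contra h
    rw [not_nonempty_iff] at h
    have : Subsingleton B := b.equivFun.toEquiv.subsingleton
    exact not_subsingleton B this
  have hnt : Nontrivial (κ → ℝ) := inferInstance
  obtain ⟨v₀, hv₀, hmin⟩ := (isCompact_sphere (0 : κ → ℝ) 1).exists_isMinOn
    (NormedSpace.sphere_nonempty.2 zero_le_one) hN.continuousOn
  have hv₀' : v₀ ≠ 0 := by
    rintro rfl; simp at hv₀
  set d := Module.finrank ℝ B with hd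
  have hd0 : d ≠ 0 := Module.finrank_pos.ne'
  have hhom : ∀ (c : ℝ) v, N (c • v) = |c| ^ d * N v := by
    intro c v
    simp only [N, map_smul]
    rw [Algebra.smul_def, map_mul, Algebra.norm_algebraMap, abs_mul, abs_pow]
  refine ⟨max 1 (N v₀)⁻¹, fun v hv => ?_⟩
  by_cases h1 : ‖v‖ ≤ 1
  · exact h1.trans (le_max_left _ _)
  refine le_trans ?_ (le_max_right _ _)
  push Not at h1
  have hv0 : 0 < ‖v‖ := by linarith
  have h2 : N v₀ ≤ N (‖v‖⁻¹ • v) := hmin (by simp [norm_smul, hv0.ne'])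
  have h3 : N v = 1 := hv
  rw [hhom, h3, abs_inv, abs_norm, mul_one] at h2
  have h4 : (‖v‖⁻¹) ^ d ≤ ‖v‖⁻¹ :=
    pow_le_of_le_one (inv_nonneg.2 hv0.le) (inv_le_one_of_one_le₀ h1.le) hd0
  exact (le_inv_comm₀ (hN0 _ hv₀') hv0).1 (h2.trans h4)

/-- An order in a rational division algebra whose real completion is a division algebra has only
finitely many units. -/
theorem finite_units_of_noZeroDivisors [NoZeroDivisors B]
    (hb : (Submodule.span ℤ (Set.range b) : Set B) = ι '' O) : Finite Oˣ := by
  classical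
  have := Fintype.ofFinite κ
  obtain ⟨R, hR⟩ := exists_bound_of_abs_norm_eq_one b
  choose z hz using fun (u : Oˣ) (i : κ) => exists_repr_eq_intCast hb (u : O).2 i
  have hinj : Function.Injective z := by
    intro u v huv
    have h : b.repr (ι (u : O)) = b.repr (ι (v : O)) := by
      ext i; rw [← hz, ← hz, huv]
    exact Units.ext (Subtype.ext (ι.injective (b.repr.injective h)))
  have hfin : (Set.Icc (fun _ : κ => -⌈R⌉) (fun _ => ⌈R⌉)).Finite := Set.finite_Icc _ _
  have hmem : ∀ u, z u ∈ Set.Icc (fun _ : κ => -⌈R⌉) (fun _ => ⌈R⌉) := by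
    intro u
    have h1 : ‖b.equivFun (ι (u : O))‖ ≤ R :=
      hR _ (by rw [LinearEquiv.symm_apply_apply]; exact abs_norm_eq_one hb u)
    have h2 : ∀ i, |z u i| ≤ ⌈R⌉ := by
      intro i
      have h3 := (norm_le_pi_norm (b.equivFun (ι (u : O))) i).trans h1
      rw [Module.Basis.equivFun_apply, ← hz, Real.norm_eq_abs] at h3
      have h4 := h3.trans (Int.le_ceil R)
      exact_mod_cast h4
    exact ⟨fun i => (abs_le.1 (h2 i)).1, fun i => (abs_le.1 (h2 i)).2⟩
  have := hfin.to_subtype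
  exact Finite.of_injective (fun u => (⟨z u, hmem u⟩ : Set.Icc (fun _ : κ => -⌈R⌉) (fun _ => ⌈R⌉)))
    fun u v h => hinj (congrArg Subtype.val h)

end

section
open NumberField InfinitePlace

theorem finrank_int_of_finite (M : Type*) [AddCommGroup M] [Finite M] :
    Module.finrank ℤ M = 0 := by
  refine Module.finrank_eq_zero_of_rank_eq_zero (rank_eq_zero_iff.2 fun x => ?_)
  exact ⟨Nat.card M, by exact_mod_cast Nat.card_pos.ne', by
    rw [natCast_zsmul]; exact card_nsmul_eq_zero'⟩

theorem card_infinitePlace_eq_one (F : Type*) [Field F] [NumberField F] [Finite (𝓞 F)ˣ] :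
    Fintype.card (InfinitePlace F) = 1 := by
  have h := Units.finrank_modTorsion F
  have : Finite (Additive ((𝓞 F)ˣ ⧸ Units.torsion F)) :=
    Finite.of_surjective (fun u : (𝓞 F)ˣ => Additive.ofMul (QuotientGroup.mk u))
      (fun y => QuotientGroup.mk_surjective y)
  have h0 := finrank_int_of_finite (Additive ((𝓞 F)ˣ ⧸ Units.torsion F))
  have h1 : Fintype.card (InfinitePlace F) - 1 = 0 := h.symm.trans h0
  have := Fintype.card_pos (α := InfinitePlace F)
  omega

theorem rat_or_imaginary_quadratic (F : Type*) [Field F] [NumberField F] [Finite (𝓞 F)ˣ] :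
    Module.finrank ℚ F = 1 ∨ Module.finrank ℚ F = 2 ∧
      ∃ φ : F →+* ℂ, Submodule.span ℝ (Set.range φ) = ⊤ := by
  have h1 := card_infinitePlace_eq_one F
  have h2 := InfinitePlace.card_add_two_mul_card_eq_rank F
  rw [card_eq_nrRealPlaces_add_nrComplexPlaces] at h1
  by_cases hc : nrComplexPlaces F = 0
  · left; omega
  right
  refine ⟨by omega, ?_⟩
  have : Nonempty {w : InfinitePlace F // w.IsComplex} := by
    classical
    exact Fintype.card_pos_iff.1 (Nat.pos_of_ne_zero (by convert hc))
  obtain ⟨w, hw⟩ := this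
  rw [isComplex_iff, ComplexEmbedding.isReal_iff] at hw
  refine ⟨w.embedding, ?_⟩
  obtain ⟨x, hx⟩ : ∃ x, (starRingEnd ℂ) (w.embedding x) ≠ w.embedding x := by
    by_contra! h
    exact hw (RingHom.ext h)
  rw [Ne, Complex.conj_eq_iff_im] at hx
  rw [eq_top_iff]
  intro z _
  have h3 : z = (z.re - z.im / (w.embedding x).im * (w.embedding x).re) • w.embedding 1 +
      (z.im / (w.embedding x).im) • w.embedding x := by
    apply Complex.ext
    · simp
    · simp [hx]
  rw [h3]
  exact add_mem (Submodule.smul_mem _ _ (Submodule.subset_span ⟨1, rfl⟩))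
    (Submodule.smul_mem _ _ (Submodule.subset_span ⟨x, rfl⟩))

end
end FAbCut

namespace FAbCut

section
variable {B H : Type*} [Ring B] [Algebra ℝ B] [FiniteDimensional ℝ B] [Nontrivial B]
  [Group H] [Finite H]

theorem exists_invariant_form (ρ : H →* B) : ∃ q : B →ₗ[ℝ] B →ₗ[ℝ] ℝ,
    (∀ u, u ≠ 0 → 0 < q u u) ∧ ∀ h u w, q (ρ h * u) (ρ h * w) = q u w := by
  have := Fintype.ofFinite H
  let b := Module.finBasis ℝ B
  let c : H → Fin (Module.finrank ℝ B) → B →ₗ[ℝ] ℝ := fun h i =>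
    b.coord i ∘ₗ LinearMap.mulLeft ℝ (ρ h)
  let q : B →ₗ[ℝ] B →ₗ[ℝ] ℝ := ∑ h, ∑ i, (LinearMap.mul ℝ ℝ).compl₁₂ (c h i) (c h i)
  have hq : ∀ u w, q u w = ∑ h, ∑ i, c h i u * c h i w := by
    intro u w
    simp [q, LinearMap.sum_apply]
  refine ⟨q, fun u hu => ?_, fun h u w => ?_⟩
  · rw [hq]
    have h0 : ∀ h, 0 ≤ ∑ i, c h i u * c h i u := fun h =>
      Finset.sum_nonneg fun i _ => mul_self_nonneg _
    refine Finset.sum_pos' (fun h _ => h0 h) ⟨1, Finset.mem_univ _, ?_⟩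
    refine lt_of_le_of_ne (h0 1) fun h1 => hu ?_
    have h2 := (Finset.sum_eq_zero_iff_of_nonneg fun i _ => mul_self_nonneg _).1 h1.symm
    refine b.ext_elem fun i => ?_
    simpa [c] using h2 i (Finset.mem_univ i)
  · rw [hq, hq]
    refine Fintype.sum_equiv (Equiv.mulRight h) _ _ fun k => ?_
    simp [c, mul_assoc]

theorem isUnit_of_real_traces (ρ : H →* B)
    (hspan : Submodule.span ℝ (Set.range ρ) = ⊤)
    (hr : ∀ x, ∃ r : ℝ, ρ x + ρ x⁻¹ = algebraMap ℝ B r) {y : B} (hy : y ≠ 0) : IsUnit y := by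
  classical
  have := Fintype.ofFinite H
  obtain ⟨q, hpos, hinv⟩ := exists_invariant_form ρ
  let v : (H → ℝ) → B := fun a => ∑ x, a x • (ρ x - ρ x⁻¹)
  have hρ : ∀ x, ρ x * ρ x⁻¹ = 1 := fun x => by rw [← map_mul, mul_inv_cancel, map_one]
  have hskew : ∀ a u w, q (v a * u) w = - q u (v a * w) := by
    intro a u w
    simp only [v, Finset.sum_mul, map_sum, LinearMap.sum_apply, smul_mul_assoc, map_smul,
      LinearMap.smul_apply, ← Finset.sum_neg_distrib, ← smul_neg]
    refine Finset.sum_congr rfl fun x _ => ?_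
    congr 1
    have h1 : ∀ x, q (ρ x * u) w = q u (ρ x⁻¹ * w) := by
      intro x
      rw [← hinv x u, ← mul_assoc, hρ, one_mul]
    rw [sub_mul, sub_mul, map_sub, LinearMap.sub_apply, map_sub, h1, h1, inv_inv]
    ring
  choose t ht using hr
  have hmul : ∀ x y, ρ x * ρ y = ρ (x * y) := fun x y => (map_mul ρ x y).symm
  have hsq : ∀ a, ∃ r : ℝ, v a * v a = algebraMap ℝ B r := by
    intro a
    have h1 : v a * v a + v a * v a = ∑ x, ∑ y, (a x * a y) •
        ((ρ x - ρ x⁻¹) * (ρ y - ρ y⁻¹) + (ρ y - ρ y⁻¹) * (ρ x - ρ x⁻¹)) := by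
      simp only [smul_add, Finset.sum_add_distrib]
      congr 1
      · simp only [v, Finset.sum_mul_sum, smul_mul_smul_comm]
      · rw [Finset.sum_comm]
        simp only [v, Finset.sum_mul_sum, smul_mul_smul_comm, mul_comm (a _) (a _)]
    have h2 : ∀ x y, (ρ x - ρ x⁻¹) * (ρ y - ρ y⁻¹) + (ρ y - ρ y⁻¹) * (ρ x - ρ x⁻¹) =
        algebraMap ℝ B (t (x * y) + t (y * x) - t (x * y⁻¹) - t (x⁻¹ * y)) := by
      intro x y
      simp only [map_sub, map_add, ← ht, mul_sub, sub_mul, hmul, mul_inv_rev, inv_inv]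
      abel
    simp only [h2, Algebra.smul_def, ← map_mul, ← map_sum] at h1
    refine ⟨2⁻¹ * ∑ x, ∑ y, a x * a y * (t (x * y) + t (y * x) - t (x * y⁻¹) - t (x⁻¹ * y)), ?_⟩
    rw [map_mul, ← h1, ← two_mul, ← mul_assoc]
    have h3 : algebraMap ℝ B 2⁻¹ * 2 = 1 := by
      rw [← map_ofNat (algebraMap ℝ B) 2, ← map_mul]; norm_num
    rw [h3, one_mul]
  have hdec : ∃ (s : ℝ) (a : H → ℝ), y = algebraMap ℝ B s + v a := by
    have hy' : y ∈ Submodule.span ℝ (Set.range ρ) := hspan ▸ Submodule.mem_top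
    obtain ⟨c, rfl⟩ := (Submodule.mem_span_range_iff_exists_fun ℝ).1 hy'
    refine ⟨∑ x, c x * (t x / 2), fun x => c x / 2, ?_⟩
    simp only [v, map_sum, ← Finset.sum_add_distrib]
    refine Finset.sum_congr rfl fun x _ => ?_
    have h4 : algebraMap ℝ B (c x * (t x / 2)) = (c x / 2) • (ρ x + ρ x⁻¹) := by
      rw [ht, Algebra.smul_def, ← map_mul]; congr 1; ring
    rw [h4, ← smul_add]
    have h5 : ρ x + ρ x⁻¹ + (ρ x - ρ x⁻¹) = (2 : ℝ) • ρ x := by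
      rw [two_smul]; abel
    rw [h5, smul_smul]
    congr 1; ring
  obtain ⟨s, a, rfl⟩ := hdec
  obtain ⟨r, hr⟩ := hsq a
  have h1 : q (v a) (v a) = -(r * q 1 1) := by
    have := hskew a 1 (v a)
    rw [mul_one, hr] at this
    rw [this, Algebra.algebraMap_eq_smul_one, map_smul, smul_eq_mul]
  have h11 := hpos 1 one_ne_zero
  have hne : s * s - r ≠ 0 := by
    by_cases hv : v a = 0
    · have hr0 : r = 0 := by
        rw [hv, mul_zero] at hr
        exact ((map_eq_zero_iff _ (algebraMap ℝ B).injective).1 hr.symm)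
      have hs : s ≠ 0 := by
        rintro rfl; exact hy (by simp [hv])
      rw [hr0, sub_zero]; exact mul_ne_zero hs hs
    · have := hpos _ hv
      have hr0 : r < 0 := by
        by_contra h; push Not at h
        nlinarith [mul_nonneg h h11.le]
      nlinarith [mul_self_nonneg s]
  have hc := Algebra.commutes s (v a)
  have h2 : (algebraMap ℝ B s + v a) * (algebraMap ℝ B s - v a) = algebraMap ℝ B (s * s - r) := by
    rw [map_sub, ← hr, map_mul, add_mul, mul_sub, mul_sub, hc]; abel
  have h3 : (algebraMap ℝ B s - v a) * (algebraMap ℝ B s + v a) = algebraMap ℝ B (s * s - r) := by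
    rw [map_sub, ← hr, map_mul, sub_mul, mul_add, mul_add, hc]; abel
  refine ⟨⟨algebraMap ℝ B s + v a, (s * s - r)⁻¹ • (algebraMap ℝ B s - v a), ?_, ?_⟩, rfl⟩
  · rw [mul_smul_comm, h2, Algebra.smul_def, ← map_mul, inv_mul_cancel₀ hne, map_one]
  · rw [smul_mul_assoc, h3, Algebra.smul_def, ← map_mul, inv_mul_cancel₀ hne, map_one]

theorem noZeroDivisors_of_real_traces (ρ : H →* B)
    (hspan : Submodule.span ℝ (Set.range ρ) = ⊤)
    (hr : ∀ x, ∃ r : ℝ, ρ x + ρ x⁻¹ = algebraMap ℝ B r) : NoZeroDivisors B where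
  eq_zero_or_eq_zero_of_mul_eq_zero {x y} hxy := by
    by_contra! h
    exact h.2 ((isUnit_of_real_traces ρ hspan hr h.1).mul_right_eq_zero.1 hxy)

end
end FAbCut

namespace FAbCut
open Matrix TensorProduct NumberField

theorem isCentral_of_isCentral_matrix (K E n : Type*) [Field K] [DivisionRing E] [Algebra K E]
    [Fintype n] [DecidableEq n] [Nonempty n] [Algebra.IsCentral K (Matrix n n E)] :
    Algebra.IsCentral K E where
  out := by
    intro z hz
    have h1 : scalarAlgHom n K z ∈ Subalgebra.center K (Matrix n n E) := by
      rw [subalgebraCenter_eq_scalarAlgHom_map]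
      exact ⟨z, hz, rfl⟩
    obtain ⟨c, hc⟩ := Algebra.IsCentral.out h1
    refine ⟨c, ?_⟩
    have i := Classical.arbitrary n
    have := congrFun (congrFun hc i) i
    simpa [Matrix.algebraMap_matrix_apply] using this

theorem hasFiniteNormKernel_real (E : Type*) [DivisionRing E] [Algebra ℝ E]
    [FiniteDimensional ℝ E] [Algebra.IsCentral ℝ E] : HasFiniteNormKernel ℝ E := by
  by_cases h : Function.Surjective (algebraMap ℝ E)
  · exact hasFiniteNormKernel_of_surjective h
  · exact hasFiniteNormKernel_of_not_surjective h

theorem hasFiniteNormKernel_complex (E : Type*) [DivisionRing E] [Algebra ℂ E]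
    [FiniteDimensional ℂ E] : HasFiniteNormKernel ℂ E :=
  hasFiniteNormKernel_of_surjective IsAlgClosed.algebraMap_bijective_of_isIntegral.2

/-- The properties of the unit groups of matrix rings over an order in a division algebra whose
center has only one infinite place. -/
structure UnitProperties {D : Type*} [DivisionRing D] [Algebra ℚ D] (O : Subring D) (l : ℕ) :
    Prop where
  pos : 0 < l
  fab : ∀ n, 3 ≤ n * l → FAb (glSubring O n)
  finite_units : l = 1 → Finite Oˣ
  finite_units_of_traces : ∀ {H : Type} [Group H] [Finite H] (ρ : H →* D),
    Submodule.span ℚ (Set.range ρ) = ⊤ →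
    (∀ x, ∃ r : ℚ, ρ x + ρ x⁻¹ = algebraMap ℚ D r) → Finite Oˣ

section
variable {F D : Type} [Field F] [NumberField F] [DivisionRing D] [Algebra F D]
  [FiniteDimensional F D] [Algebra.IsCentral F D] [Algebra ℚ D]

theorem unitProperties_of_completion [Finite (𝓞 F)ˣ] (O : Subring D)
    [Module.Finite ℤ O] (hO : Submodule.span ℚ (O : Set D) = ⊤) (K : Type)
    [Field K] [Algebra F K] [Algebra ℝ K] [FiniteDimensional ℝ K]
    (hK : Submodule.span ℝ (Set.range (algebraMap F K)) = ⊤)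
    (hKF : Module.finrank ℝ K = Module.finrank ℚ F)
    (hE : ∀ (E : Type) [DivisionRing E] [Algebra K E] [FiniteDimensional K E]
      [Algebra.IsCentral K E], HasFiniteNormKernel K E) :
    ∃ l, UnitProperties O l := by
  obtain ⟨b, hb⟩ := exists_real_basis (F := F) (K := K) O hO hK hKF
  have : IsSimpleRing (K ⊗[F] D) := isSimpleRing_tensor F D K
  have : Algebra.IsCentral K (K ⊗[F] D) := isCentral_tensor F D K
  have : IsArtinianRing (K ⊗[F] D) := IsArtinianRing.of_finite K _
  obtain ⟨l, hl, E, _, _, _, ⟨e⟩⟩ :=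
    IsSimpleRing.exists_algEquiv_matrix_divisionRing_finite K (K ⊗[F] D)
  have : Algebra.IsCentral K (Matrix (Fin l) (Fin l) E) := Algebra.IsCentral.of_algEquiv _ _ _ e
  have : Algebra.IsCentral K E := isCentral_of_isCentral_matrix K E (Fin l)
  have : FiniteDimensional ℝ (K ⊗[F] D) := b.finiteDimensional_of_finite
  have hb' : (Submodule.span ℤ (Set.range b) : Set (K ⊗[F] D)) =
      (Algebra.TensorProduct.includeRight : D →ₐ[F] K ⊗[F] D).toRingHom '' O := hb
  refine ⟨l, Nat.pos_of_ne_zero hl.out, fun n hn => fab_glSubring (hE E) e hn O hb, ?_, ?_⟩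
  · rintro rfl
    have : NoZeroDivisors (K ⊗[F] D) := by
      let e' := e.toRingEquiv.trans (Matrix.uniqueRingEquiv (m := Fin 1) (A := E))
      exact e'.injective.noZeroDivisors _ (map_zero e') (map_mul e')
    exact finite_units_of_noZeroDivisors hb'
  · intro H _ _ ρ hρ hr
    let ι : D →+* K ⊗[F] D := (Algebra.TensorProduct.includeRight : D →ₐ[F] K ⊗[F] D).toRingHom
    have hq : ∀ q : ℚ, ι (algebraMap ℚ D q) = algebraMap ℝ _ (q : ℝ) := by
      intro q
      exact RingHom.congr_fun (Subsingleton.elim (ι.comp (algebraMap ℚ D))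
        ((algebraMap ℝ _).comp (algebraMap ℚ ℝ))) q
    have hspan : Submodule.span ℝ (Set.range (ι.toMonoidHom.comp ρ)) = ⊤ := by
      rw [eq_top_iff, ← b.span_eq, Submodule.span_le]
      rintro _ ⟨j, rfl⟩
      have hj : b j ∈ ι '' O := by rw [← hb']; exact Submodule.subset_span ⟨j, rfl⟩
      obtain ⟨y, -, hy⟩ := hj
      rw [← hy]
      clear hy
      have hy' : y ∈ Submodule.span ℚ (Set.range ρ) := hρ ▸ Submodule.mem_top
      induction hy' using Submodule.span_induction with
      | mem x hx =>
        obtain ⟨h, rfl⟩ := hx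
        exact Submodule.subset_span ⟨h, rfl⟩
      | zero => rw [map_zero]; exact zero_mem _
      | add x y _ _ h1 h2 => rw [map_add]; exact add_mem h1 h2
      | smul q x _ h1 =>
        rw [Algebra.smul_def, map_mul, hq, ← Algebra.smul_def]
        exact Submodule.smul_mem _ _ h1
    have : NoZeroDivisors (K ⊗[F] D) := by
      refine noZeroDivisors_of_real_traces (ι.toMonoidHom.comp ρ) hspan fun x => ?_
      obtain ⟨r, h⟩ := hr x
      exact ⟨r, by rw [← hq, ← h, map_add]; rfl⟩
    exact finite_units_of_noZeroDivisors hb'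

theorem exists_unitProperties [Finite (𝓞 F)ˣ] (O : Subring D)
    [Module.Finite ℤ O] (hO : Submodule.span ℚ (O : Set D) = ⊤) : ∃ l, UnitProperties O l := by
  rcases rat_or_imaginary_quadratic F with h | ⟨h, φ, hφ⟩
  · have hbij : Function.Bijective (algebraMap ℚ F) :=
      Algebra.finrank_eq_one_iff_bijective_algebraMap.1 h
    let _ : Algebra F ℝ := ((algebraMap ℚ ℝ).comp
      (RingEquiv.ofBijective _ hbij).symm.toRingHom).toAlgebra
    refine unitProperties_of_completion (F := F) O hO ℝ ?_ ?_ ?_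
    · rw [eq_top_iff]
      intro r _
      have : r = r • algebraMap F ℝ 1 := by simp
      rw [this]
      exact Submodule.smul_mem _ _ (Submodule.subset_span ⟨1, rfl⟩)
    · rw [h, Module.finrank_self]
    · intro E _ _ _ _
      exact hasFiniteNormKernel_real E
  · let _ : Algebra F ℂ := φ.toAlgebra
    refine unitProperties_of_completion (F := F) O hO ℂ hφ ?_ ?_
    · rw [h, Complex.finrank_real_complex]
    · intro E _ _ _ _
      exact hasFiniteNormKernel_complex E

end
end FAbCut

namespace FAbCut

section
variable {A : Type*} [Ring A] [Algebra ℚ A]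

theorem exists_nsmul_mem_of_mem_span (S : AddSubgroup A) {x : A}
    (hx : x ∈ Submodule.span ℚ (S : Set A)) : ∃ N : ℕ, N ≠ 0 ∧ N • x ∈ S := by
  induction hx using Submodule.span_induction with
  | mem x hx => exact ⟨1, one_ne_zero, by simpa using hx⟩
  | zero => exact ⟨1, one_ne_zero, by simp [zero_mem]⟩
  | add x y _ _ h1 h2 =>
    obtain ⟨N, hN, h1⟩ := h1
    obtain ⟨M, hM, h2⟩ := h2
    refine ⟨M * N, mul_ne_zero hM hN, ?_⟩
    rw [smul_add]
    refine add_mem ?_ ?_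
    · rw [mul_smul]; exact nsmul_mem h1 _
    · rw [mul_comm, mul_smul]; exact nsmul_mem h2 _
  | smul q x _ h1 =>
    obtain ⟨N, hN, h1⟩ := h1
    refine ⟨q.den * N, mul_ne_zero q.den_ne_zero hN, ?_⟩
    have : (q.den * N) • (q • x) = q.num • (N • x) := by
      rw [← Nat.cast_smul_eq_nsmul ℚ, ← Int.cast_smul_eq_zsmul ℚ, ← Nat.cast_smul_eq_nsmul ℚ N,
        smul_smul, smul_smul]
      congr 1
      push_cast
      rw [mul_right_comm, mul_comm (q.den : ℚ), Rat.mul_den_eq_num]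
    rw [this]
    exact zsmul_mem h1 _

theorem exists_nsmul_mem_of_fg {M : Type*} [AddCommGroup M] [Module.Finite ℤ M] (f : M →+ A)
    (S : AddSubgroup A) (hS : Submodule.span ℚ (S : Set A) = ⊤) :
    ∃ N : ℕ, N ≠ 0 ∧ ∀ x : M, N • f x ∈ S := by
  classical
  obtain ⟨s, hs⟩ := Module.Finite.fg_top (R := ℤ) (M := M)
  have h : ∀ x : M, ∃ N : ℕ, N ≠ 0 ∧ N • f x ∈ S := fun x =>
    exists_nsmul_mem_of_mem_span S (hS ▸ Submodule.mem_top)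
  choose N hN hNx using h
  refine ⟨∏ x ∈ s, N x, Finset.prod_ne_zero_iff.2 fun x _ => hN x, fun x => ?_⟩
  have hx : x ∈ Submodule.span ℤ (s : Set M) := hs ▸ Submodule.mem_top
  induction hx using Submodule.span_induction with
  | mem x hx =>
    rw [← Finset.prod_erase_mul s N hx, mul_smul]
    exact nsmul_mem (hNx x) _
  | zero => simp [zero_mem]
  | add x y _ _ h1 h2 => rw [map_add, smul_add]; exact add_mem h1 h2
  | smul q x _ h1 =>
    rw [map_zsmul, smul_comm]
    exact zsmul_mem h1 _

theorem finite_quotient_range_nsmul (M : Type*) [AddCommGroup M] [Module.Finite ℤ M] {N : ℕ}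
    (hN : N ≠ 0) : Finite (M ⧸ LinearMap.range (LinearMap.lsmul ℤ M (N : ℤ))) := by
  refine Module.finite_of_fg_torsion _ ?_
  intro x
  obtain ⟨y, rfl⟩ := Submodule.Quotient.mk_surjective _ x
  refine ⟨⟨N, mem_nonZeroDivisors_of_ne_zero (by exact_mod_cast hN)⟩, ?_⟩
  have : (N : ℤ) • y ∈ LinearMap.range (LinearMap.lsmul ℤ M (N : ℤ)) := ⟨y, rfl⟩
  have h := (Submodule.Quotient.mk_eq_zero _).2 this
  rw [Submodule.Quotient.mk_smul] at h
  exact h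

theorem finite_kernel_index {R : Type*} [Ring R] [Module.Finite ℤ R] {N : ℕ} (hN : N ≠ 0)
    (H : Subgroup Rˣ) (hH : ∀ u : Rˣ, (∃ y : R, (u : R) = 1 + N * y) → u ∈ H) :
    H.FiniteIndex := by
  have := finite_quotient_range_nsmul R hN
  let P := LinearMap.range (LinearMap.lsmul ℤ R (N : ℤ))
  let f : Rˣ ⧸ H → R ⧸ P := fun q => Submodule.Quotient.mk (q.out : R)
  have hf : Function.Injective f := by
    intro a b hab
    obtain ⟨y, hy⟩ := (Submodule.Quotient.eq P).1 hab
    rw [← a.out_eq', ← b.out_eq', eq_comm]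
    refine QuotientGroup.eq.2 (hH _ ⟨↑(b.out⁻¹) * y, ?_⟩)
    have hy' : (N : R) * y = (a.out : R) - b.out := by
      rw [← hy]; simp
    rw [← mul_assoc, Nat.cast_comm, mul_assoc, hy', mul_sub, Units.inv_mul, Units.val_mul]
    abel
  have : Finite (Rˣ ⧸ H) := Finite.of_injective f hf
  exact Subgroup.finiteIndex_of_finite_quotient

theorem exists_unit_lift {R S : Type*} [Ring R] [Ring S] (f : R →+* A) (g : S →+* A)
    (hg : Function.Injective g) {N : ℕ} (h : ∀ x, ∃ y, g y = N • f x)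
    (u : Rˣ) (hu : ∃ y : R, (u : R) = 1 + N * y) : ∃ v : Sˣ, g v = f u := by
  obtain ⟨y, hy⟩ := hu
  have hy' : ((u⁻¹ : Rˣ) : R) = 1 + N * (-(↑u⁻¹ * y)) := by
    have : (↑u⁻¹ : R) * u = ↑u⁻¹ * (1 + N * y) := by rw [hy]
    rw [Units.inv_mul, mul_add, mul_one, ← mul_assoc, ← Nat.cast_comm, mul_assoc] at this
    rw [mul_neg, this]; abel
  obtain ⟨a, ha⟩ := h y
  obtain ⟨b, hb⟩ := h (-(↑u⁻¹ * y))
  have ea : g (1 + a) = f u := by rw [hy]; simp [ha]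
  have eb : g (1 + b) = f ↑u⁻¹ := by
    rw [hy', map_add, hb]; simp
  exact ⟨⟨1 + a, 1 + b, hg (by rw [map_mul, ea, eb, ← map_mul]; simp),
    hg (by rw [map_mul, ea, eb, ← map_mul]; simp)⟩, ea⟩

/-- Unit groups of orders are commensurable; hence `FAb` does not depend on the order. -/
theorem FAb.of_order {R S : Type*} [Ring R] [Ring S] [Module.Finite ℤ R] [Module.Finite ℤ S]
    (f : R →+* A) (hf : Function.Injective f) (g : S →+* A) (hg : Function.Injective g)
    (hfs : Submodule.span ℚ (Set.range f) = ⊤) (hgs : Submodule.span ℚ (Set.range g) = ⊤)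
    (hR : FAb Rˣ) : FAb Sˣ := by
  obtain ⟨N, hN, h1⟩ := exists_nsmul_mem_of_fg (f : R →+ A) (g.range.toAddSubgroup) hgs
  obtain ⟨M, hM, h2⟩ := exists_nsmul_mem_of_fg (g : S →+ A) (f.range.toAddSubgroup) hfs
  let H : Subgroup Rˣ := (Units.map (g : S →* A)).range.comap (Units.map (f : R →* A))
  let L : Subgroup Sˣ := (Units.map (f : R →* A)).range.comap (Units.map (g : S →* A))
  have hHf : H.FiniteIndex := finite_kernel_index hN H fun u hu => by
    obtain ⟨v, hv⟩ := exists_unit_lift f g hg (fun x => h1 x) u hu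
    exact ⟨v, Units.ext hv⟩
  have hLf : L.FiniteIndex := finite_kernel_index hM L fun u hu => by
    obtain ⟨v, hv⟩ := exists_unit_lift g f hf (fun x => h2 x) u hu
    exact ⟨v, Units.ext hv⟩
  have hH := hR.subgroup H
  have hx : ∀ x : H, ∃ v : Sˣ, Units.map (g : S →* A) v = Units.map (f : R →* A) x := fun x => x.2
  have hg' : Function.Injective (Units.map (g : S →* A)) := Units.map_injective hg
  choose φ hφ using hx
  let ψ : H →* Sˣ := MonoidHom.mk' φ fun a b => hg' (by rw [map_mul, hφ, hφ, hφ, ← map_mul]; rfl)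
  have : ψ.range.FiniteIndex := by
    refine Subgroup.finiteIndex_of_le (H := L) ?_
    rintro v ⟨u, hu⟩
    exact ⟨⟨u, v, hu.symm⟩, hg' ((hφ _).trans hu)⟩
  exact hH.of_range ψ

end
end FAbCut

namespace FAbCut
open MonoidAlgebra

/-- The inclusion of the integral group ring into the rational group algebra. -/
noncomputable abbrev intCoe (G : Type*) [Group G] : MonoidAlgebra ℤ G →+* MonoidAlgebra ℚ G :=
  mapRingHom G (Int.castRingHom ℚ)

section
variable {G : Type*} [Group G]

theorem intCoe_injective : Function.Injective (intCoe G) := by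
  intro a b h
  ext g
  have := congrArg (fun x => x.coeff g) h
  simpa using this

theorem span_range_intCoe : Submodule.span ℚ (Set.range (intCoe G)) = ⊤ := by
  rw [eq_top_iff]
  intro x _
  induction x using MonoidAlgebra.induction_on with
  | of g => exact Submodule.subset_span ⟨MonoidAlgebra.of ℤ G g, by simp⟩
  | add x y hx hy => exact add_mem (hx trivial) (hy trivial)
  | smul r x hx => exact Submodule.smul_mem _ _ (hx trivial)

variable {A : Type*} [Ring A] [Algebra ℚ A]

theorem span_eq_top_of_nsmul_mem (S : Set A) (h : ∀ x, ∃ N : ℕ, N ≠ 0 ∧ N • x ∈ S) :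
    Submodule.span ℚ S = ⊤ := by
  rw [eq_top_iff]
  intro x _
  obtain ⟨N, hN, hx⟩ := h x
  have : x = (N : ℚ)⁻¹ • (N • x) := by
    rw [← Nat.cast_smul_eq_nsmul ℚ, smul_smul, inv_mul_cancel₀ (by exact_mod_cast hN), one_smul]
  rw [this]
  exact Submodule.smul_mem _ _ (Submodule.subset_span hx)

theorem span_image_eq_top (f : MonoidAlgebra ℚ G →ₐ[ℚ] A) (hf : Function.Surjective f) :
    Submodule.span ℚ (Set.range ((f : MonoidAlgebra ℚ G →+* A).comp (intCoe G))) = ⊤ := by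
  have := congrArg (Submodule.map f.toLinearMap) (span_range_intCoe (G := G))
  rw [Submodule.map_span, Submodule.map_top, LinearMap.range_eq_top.2 hf] at this
  rw [← this, ← Set.range_comp]
  rfl

variable [Finite G]

/-- A division algebra occurring in `ℚG` contains an order. -/
theorem exists_order {D : Type*} [DivisionRing D] [Algebra ℚ D] {n : ℕ} [NeZero n]
    (π : MonoidAlgebra ℚ G →ₐ[ℚ] Matrix (Fin n) (Fin n) D) (hπ : Function.Surjective π) :
    ∃ O : Subring D, Module.Finite ℤ O ∧ Submodule.span ℚ (O : Set D) = ⊤ := by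
  let f : MonoidAlgebra ℤ G →+* Matrix (Fin n) (Fin n) D := (π : _ →+* _).comp (intCoe G)
  let O : Subring D := f.range.comap (Matrix.scalar (Fin n))
  refine ⟨O, ?_, ?_⟩
  · have hfin : Module.Finite ℤ f.range := by
      refine Module.Finite.of_surjective (f.rangeRestrict.toAddMonoidHom.toIntLinearMap) ?_
      exact f.rangeRestrict_surjective
    have : IsNoetherian ℤ f.range := isNoetherian_of_isNoetherianRing_of_finite ℤ _
    let j : O →ₗ[ℤ] f.range := AddMonoidHom.toIntLinearMap
      { toFun := fun x => ⟨Matrix.scalar (Fin n) (x : D), x.2⟩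
        map_zero' := by ext1; simp
        map_add' := fun x y => by ext1; simp }
    refine Module.Finite.of_injective j fun x y hxy => ?_
    exact Subtype.ext (Matrix.scalar_inj.1 (congrArg Subtype.val hxy))
  · refine span_eq_top_of_nsmul_mem _ fun d => ?_
    obtain ⟨N, hN, h⟩ := exists_nsmul_mem_of_mem_span f.range.toAddSubgroup
      (x := Matrix.scalar (Fin n) d) (by
        have := span_image_eq_top π hπ
        have h2 : ((f.range.toAddSubgroup : AddSubgroup _) : Set (Matrix (Fin n) (Fin n) D)) =
          Set.range f := rfl
        rw [h2, this]; trivial)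
    refine ⟨N, hN, Subring.mem_comap.2 ?_⟩
    rw [map_nsmul]
    exact h

theorem finite_matrix_subring {D : Type*} [DivisionRing D] (O : Subring D) [Module.Finite ℤ O]
    (n : ℕ) : Module.Finite ℤ (O.matrix (n := Fin n)) := by
  have : Module.Finite ℤ (Fin n → Fin n → O) := inferInstance
  let j : (Fin n → Fin n → O) →ₗ[ℤ] O.matrix (n := Fin n) := AddMonoidHom.toIntLinearMap
    { toFun := fun x => ⟨Matrix.of fun a b => (x a b : D), fun a b => (x a b).2⟩
      map_zero' := by ext1; rfl
      map_add' := fun x y => by ext1; rfl }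
  refine Module.Finite.of_surjective j fun x => ?_
  exact ⟨fun a b => ⟨(x : Matrix (Fin n) (Fin n) D) a b, x.2 a b⟩, rfl⟩

theorem fab_units_of_forall_fab {ι : Type*} [Finite ι] {n : ι → ℕ} {D : ι → Type*}
    [∀ i, DivisionRing (D i)] [∀ i, Algebra ℚ (D i)]
    (e : MonoidAlgebra ℚ G ≃ₐ[ℚ] Π i, Matrix (Fin (n i)) (Fin (n i)) (D i))
    (O : ∀ i, Subring (D i)) (hfin : ∀ i, Module.Finite ℤ (O i))
    (hspan : ∀ i, Submodule.span ℚ (O i : Set (D i)) = ⊤)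
    (hfab : ∀ i, FAb (glSubring (O i) (n i))) : FAb (MonoidAlgebra ℤ G)ˣ := by
  classical
  have := Fintype.ofFinite ι
  let R := Π i, (O i).matrix (n := Fin (n i))
  have : ∀ i, Module.Finite ℤ ((O i).matrix (n := Fin (n i))) :=
    fun i => finite_matrix_subring (O i) (n i)
  have hR : Module.Finite ℤ R := Module.Finite.pi
  let f : R →+* Π i, Matrix (Fin (n i)) (Fin (n i)) (D i) :=
    Pi.ringHom fun i => ((O i).matrix (n := Fin (n i))).subtype.comp (Pi.evalRingHom _ i)
  let g : MonoidAlgebra ℤ G →+* Π i, Matrix (Fin (n i)) (Fin (n i)) (D i) :=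
    (e.toAlgHom : MonoidAlgebra ℚ G →+* _).comp (intCoe G)
  have hg : Function.Injective g := e.injective.comp intCoe_injective
  refine FAb.of_order f ?_ g hg ?_ (span_image_eq_top e.toAlgHom e.surjective) ?_
  · intro a b h
    funext i
    exact Subtype.ext (congrFun h i)
  · refine span_eq_top_of_nsmul_mem _ fun x => ?_
    have h : ∀ p : Σ i, Fin (n i) × Fin (n i), ∃ N : ℕ, N ≠ 0 ∧
        N • (x p.1 p.2.1 p.2.2) ∈ (O p.1).toAddSubgroup := fun p =>
      exists_nsmul_mem_of_mem_span (O p.1).toAddSubgroup (by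
        have := hspan p.1
        have h2 : (((O p.1).toAddSubgroup : AddSubgroup _) : Set (D p.1)) = O p.1 := rfl
        rw [h2, this]; trivial)
    choose N hN hNx using h
    refine ⟨∏ p, N p, Finset.prod_ne_zero_iff.2 fun p _ => hN p, ?_⟩
    refine ⟨fun i => ⟨(∏ p, N p) • x i, fun a b => ?_⟩, rfl⟩
    have hp := Finset.prod_erase_mul Finset.univ N (Finset.mem_univ ⟨i, a, b⟩)
    rw [← hp, mul_smul]
    exact nsmul_mem (hNx ⟨i, a, b⟩) _
  · have h1 : FAb (Π i, glSubring (O i) (n i)) := FAb.pi hfab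
    let φ : (Π i, glSubring (O i) (n i)) ≃* Rˣ :=
      (MulEquiv.piCongrRight fun i =>
        ((O i).matrix (n := Fin (n i))).toSubmonoid.unitsEquivUnitsType).trans
        MulEquiv.piUnits.symm
    exact h1.of_surjective φ.toMonoidHom φ.surjective

end
end FAbCut

namespace FAbCut
open MonoidAlgebra NumberField

section
variable {G : Type*} [Group G] {ι : Type*} [DecidableEq ι] {n : ι → ℕ} {D : ι → Type*}
  [∀ i, DivisionRing (D i)] [∀ i, Algebra ℚ (D i)]

/-- A central element of the `i`-th division algebra, viewed as a scalar in the `i`-th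
component of `ℚG`. -/
noncomputable def componentScalar
    (e : MonoidAlgebra ℚ G ≃ₐ[ℚ] Π i, Matrix (Fin (n i)) (Fin (n i)) (D i)) (i : ι) :
    Subring.center (D i) →ₙ+* MonoidAlgebra ℚ G where
  toFun d := e.symm (Pi.single i (Matrix.scalar (Fin (n i)) (d : D i)))
  map_zero' := by simp
  map_add' x y := by
    rw [← map_add, ← Pi.single_add, ← map_add]; rfl
  map_mul' x y := by
    rw [← map_mul, ← Pi.single_mul, ← map_mul]; rfl

variable (e : MonoidAlgebra ℚ G ≃ₐ[ℚ] Π i, Matrix (Fin (n i)) (Fin (n i)) (D i)) (i : ι)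

theorem apply_componentScalar (d : Subring.center (D i)) :
    e (componentScalar e i d) = Pi.single i (Matrix.scalar (Fin (n i)) (d : D i)) :=
  e.apply_symm_apply _

theorem componentScalar_injective [∀ i, NeZero (n i)] :
    Function.Injective (componentScalar e i) := fun x y h => by
  have h1 := Pi.single_injective i (e.symm.injective h)
  exact Subtype.ext (Matrix.scalar_inj.1 h1)

theorem commute_componentScalar (d : Subring.center (D i)) (x : MonoidAlgebra ℚ G) :
    Commute (componentScalar e i d) x := by
  refine e.injective ?_
  rw [map_mul, map_mul, apply_componentScalar]
  funext j
  by_cases hj : j = i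
  · subst hj
    simp only [Pi.mul_apply, Pi.single_eq_same]
    exact Matrix.scalar_commute (d : D j) (fun r => (Subring.mem_center_iff.1 d.2 r).symm) _
  · simp [Pi.single_eq_of_ne hj]

/-- The map which is `componentScalar` on the `i`-th component and `1` on the others. -/
noncomputable def componentUnit : Subring.center (D i) →* MonoidAlgebra ℚ G where
  toFun d := 1 + componentScalar e i (d - 1)
  map_one' := by simp
  map_mul' x y := by
    have h : x * y - 1 = (x - 1) + (y - 1) + (x - 1) * (y - 1) := by ring
    rw [h, map_add, map_add, map_mul]
    noncomm_ring

theorem finite_units_center_integers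
    (e : MonoidAlgebra ℚ G ≃ₐ[ℚ] Π i, Matrix (Fin (n i)) (Fin (n i)) (D i)) (i : ι) [Finite G] [∀ i, NeZero (n i)]
    [NumberField (Subring.center (D i))] [Finite (Subring.center (MonoidAlgebra ℤ G))ˣ] :
    Finite (𝓞 (Subring.center (D i)))ˣ := by
  set F := Subring.center (D i)
  let s : 𝓞 F →+ MonoidAlgebra ℚ G :=
    ((componentScalar e i : F →ₙ+* _) : F →+ _).comp (algebraMap (𝓞 F) F : 𝓞 F →+ F)
  obtain ⟨N, hN, h⟩ := exists_nsmul_mem_of_fg s (intCoe G).range.toAddSubgroup span_range_intCoe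
  let c : 𝓞 F →* MonoidAlgebra ℚ G := (componentUnit e i).comp (algebraMap (𝓞 F) F : 𝓞 F →* F)
  have hc : Function.Injective c := fun x y hxy => by
    have h1 : componentScalar e i (algebraMap (𝓞 F) F x - 1) =
      componentScalar e i (algebraMap (𝓞 F) F y - 1) := add_left_cancel hxy
    exact FaithfulSMul.algebraMap_injective _ _
      (sub_left_injective (componentScalar_injective e i h1))
  have hcc : ∀ x y, c x * y = y * c x := fun x y => by
    change (1 + _) * y = y * (1 + _)
    rw [add_mul, mul_add, one_mul, mul_one, (commute_componentScalar e i _ y).eq]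
  let j : (Subring.center (MonoidAlgebra ℤ G))ˣ →* (MonoidAlgebra ℚ G)ˣ :=
    Units.map ((intCoe G).comp (Subring.center (MonoidAlgebra ℤ G)).subtype : _ →* _)
  let H : Subgroup (𝓞 F)ˣ := j.range.comap (Units.map c)
  have hlift : ∀ x y : 𝓞 F, x = 1 + N * y →
      ∃ a : Subring.center (MonoidAlgebra ℤ G), intCoe G a = c x := by
    intro x y hx
    obtain ⟨a, ha⟩ := h y
    have ha' : intCoe G (1 + a) = c x := by
      rw [map_add, map_one, ha, hx]
      change 1 + N • componentScalar e i (algebraMap (𝓞 F) F y) =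
        1 + componentScalar e i (algebraMap (𝓞 F) F (1 + N * y) - 1)
      rw [← map_nsmul, map_add, map_mul, map_one, map_natCast, add_sub_cancel_left, nsmul_eq_mul]
    refine ⟨⟨1 + a, Subring.mem_center_iff.2 fun z => intCoe_injective ?_⟩, ha'⟩
    rw [map_mul, map_mul, ha', hcc]
  have hH : H.FiniteIndex := by
    refine finite_kernel_index hN H fun u ⟨y, hy⟩ => ?_
    have hy' : ((u⁻¹ : (𝓞 F)ˣ) : 𝓞 F) = 1 + N * (-(↑u⁻¹ * y)) := by
      have : (↑u⁻¹ : 𝓞 F) * u = ↑u⁻¹ * (1 + N * y) := by rw [hy]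
      rw [Units.inv_mul] at this
      linear_combination -this
    obtain ⟨a, ha⟩ := hlift _ _ hy
    obtain ⟨b, hb⟩ := hlift _ _ hy'
    have hinj : Function.Injective
        ((intCoe G).comp (Subring.center (MonoidAlgebra ℤ G)).subtype) :=
      intCoe_injective.comp Subtype.val_injective
    have hab : a * b = 1 := hinj (by
      rw [map_mul, map_one]
      change intCoe G a * intCoe G b = 1
      rw [ha, hb, ← map_mul, Units.mul_inv, map_one])
    exact ⟨⟨a, b, hab, by rw [mul_comm, hab]⟩, Units.ext ha⟩
  have hHf : Finite H := by
    have hj : Finite j.range := Set.finite_range j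
    refine Finite.of_injective (fun u : H => (⟨Units.map c u, u.2⟩ : j.range)) fun u v huv => ?_
    exact Subtype.ext (Units.map_injective hc (congrArg Subtype.val huv))
  exact Finite.of_subgroup_quotient H

end
end FAbCut

namespace FAbCut
open MonoidAlgebra NumberField

theorem rational_or_sq_neg {F : Type*} [Field F] [NumberField F] [Finite (𝓞 F)ˣ] (d : F) :
    (∃ κ : ℚ, d = κ) ∨ ∃ t q : ℚ, q < 0 ∧ (d - t) ^ 2 = q := by
  by_cases hd : d ∈ (algebraMap ℚ F).range
  · obtain ⟨κ, hκ⟩ := hd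
    exact Or.inl ⟨κ, by rw [← hκ]; simp⟩
  rcases rat_or_imaginary_quadratic F with h | ⟨h, φ, hφ⟩
  · obtain ⟨κ, hκ⟩ := (Algebra.finrank_eq_one_iff_bijective_algebraMap.1 h).2 d
    exact Or.inl ⟨κ, by rw [← hκ]; simp⟩
  refine Or.inr ?_
  have hinteg : IsIntegral ℚ d := Algebra.IsIntegral.isIntegral d
  have hdeg : (minpoly ℚ d).natDegree = 2 :=
    le_antisymm (h ▸ minpoly.natDegree_le d) ((minpoly.two_le_natDegree_iff hinteg).2 hd)
  have h1 := minpoly.aeval ℚ d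
  have h2 : (minpoly ℚ d).coeff 2 = 1 := hdeg ▸ (minpoly.monic hinteg).coeff_natDegree
  rw [Polynomial.aeval_eq_sum_range, hdeg] at h1
  simp only [Finset.sum_range_succ, Finset.sum_range_zero, h2, Algebra.smul_def] at h1
  set b := (minpoly ℚ d).coeff 1
  set c := (minpoly ℚ d).coeff 0
  have hq : (d - ((-b / 2 : ℚ) : F)) ^ 2 = ((b ^ 2 / 4 - c : ℚ) : F) := by
    simp only [eq_ratCast, pow_zero, mul_one, pow_one, zero_add, Rat.cast_one, one_mul] at h1
    push_cast
    linear_combination h1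
  refine ⟨-b / 2, b ^ 2 / 4 - c, ?_, hq⟩
  by_contra hneg
  push Not at hneg
  have hφq := congrArg φ hq
  rw [map_pow, map_sub, map_ratCast, map_ratCast] at hφq
  set w := φ d - ((-b / 2 : ℚ) : ℂ) with hw
  rw [pow_two w] at hφq
  have hwim : w.im = 0 := by
    have hre := congrArg Complex.re hφq
    have him := congrArg Complex.im hφq
    simp only [Complex.mul_re, Complex.mul_im, Complex.ratCast_re,
      Complex.ratCast_im] at hre him
    have hq0 : (0 : ℝ) ≤ ((b ^ 2 / 4 - c : ℚ) : ℝ) := by exact_mod_cast hneg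
    by_contra h0
    have hr : w.re = 0 := by
      have : w.re * w.im = 0 := by linarith
      exact (mul_eq_zero.1 this).resolve_right h0
    rw [hr] at hre
    have := mul_self_pos.2 h0
    linarith
  have hdim : (φ d).im = 0 := by
    have : (φ d).im = w.im := by simp [hw]
    rw [this, hwim]
  let S : Subalgebra ℚ F := Subalgebra.comap (φ.toRatAlgHom)
    ((Algebra.ofId ℝ ℂ).range.restrictScalars ℚ)
  have hmem : ∀ x : F, x ∈ S ↔ (φ x).im = 0 := by
    intro x
    constructor
    · rintro ⟨r, hr⟩
      have hr' : (r : ℂ) = φ x := hr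
      rw [← hr', Complex.ofReal_im]
    · intro hx
      exact ⟨(φ x).re, Complex.ext rfl hx.symm⟩
  have := Subalgebra.isSimpleOrder_of_finrank_prime ℚ F (h ▸ Nat.prime_two)
  rcases eq_bot_or_eq_top S with hS | hS
  · have : d ∈ S := (hmem d).2 hdim
    rw [hS, Algebra.mem_bot] at this
    exact hd this
  · have hsub : Submodule.span ℝ (Set.range φ) ≤ Submodule.span ℝ {(1 : ℂ)} := by
      rw [Submodule.span_le]
      rintro _ ⟨x, rfl⟩
      have hx : (φ x).im = 0 := (hmem x).1 (hS ▸ trivial)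
      exact Submodule.mem_span_singleton.2 ⟨(φ x).re, Complex.ext (by simp) (by simp [hx])⟩
    have hI : Complex.I ∈ Submodule.span ℝ {(1 : ℂ)} := hsub (hφ ▸ trivial)
    obtain ⟨r, hr⟩ := Submodule.mem_span_singleton.1 hI
    have := congrArg Complex.im hr
    simp at this

section
variable {G : Type*} [Group G] [Fintype G] {R : Type*} [CommRing R]

theorem coeff_mul_eq_sum (x y : MonoidAlgebra R G) (g : G) :
    (x * y).coeff g = ∑ h, x.coeff (g * h⁻¹) * y.coeff h := by
  rw [coeff_mul_apply_right, Finsupp.sum_fintype]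
  simp

/-- The matrix of left multiplication on the group algebra. -/
noncomputable def regMatrix (x : MonoidAlgebra R G) : Matrix G G R :=
  Matrix.of fun g h => x.coeff (g * h⁻¹)

variable [DecidableEq G]

theorem regMatrix_mul (x y : MonoidAlgebra R G) :
    regMatrix (x * y) = regMatrix x * regMatrix y := by
  ext g h
  rw [Matrix.mul_apply]
  simp only [regMatrix, Matrix.of_apply]
  rw [coeff_mul_eq_sum, ← Equiv.sum_comp (Equiv.mulRight h⁻¹)]
  refine Finset.sum_congr rfl fun k _ => ?_
  simp

theorem regMatrix_pow (x : MonoidAlgebra R G) {k : ℕ} (hk : k ≠ 0) :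
    regMatrix (x ^ k) = regMatrix x ^ k := by
  induction k with
  | zero => exact absurd rfl hk
  | succ k ih =>
    rcases eq_or_ne k 0 with rfl | h
    · simp
    · rw [pow_succ, regMatrix_mul, ih h, pow_succ]

theorem trace_regMatrix (x : MonoidAlgebra R G) :
    (regMatrix x).trace = Fintype.card G * x.coeff 1 := by
  simp [Matrix.trace, regMatrix]

theorem coeff_pow_prime (x : MonoidAlgebra ℤ G) (p : ℕ) [Fact p.Prime] :
    ((Fintype.card G * (x ^ p).coeff 1 : ℤ) : ZMod p) =
      ((Fintype.card G * x.coeff 1 : ℤ) : ZMod p) := by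
  have h := ZMod.trace_pow_card ((regMatrix x).map (Int.castRingHom (ZMod p)))
  rw [ZMod.pow_card] at h
  have h1 : ((regMatrix x).map (Int.castRingHom (ZMod p))) ^ p =
      (regMatrix (x ^ p)).map (Int.castRingHom (ZMod p)) := by
    rw [regMatrix_pow _ (Fact.out : p.Prime).ne_zero]
    exact (map_pow (Int.castRingHom (ZMod p)).mapMatrix (regMatrix x) p).symm
  rw [h1] at h
  have htr : ∀ M : Matrix G G ℤ, (M.map (Int.castRingHom (ZMod p))).trace =
      ((M.trace : ℤ) : ZMod p) := by
    intro M
    simp [Matrix.trace]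
  rw [htr, htr, trace_regMatrix, trace_regMatrix] at h
  exact_mod_cast h

end

/-- The coefficients of a rational central idempotent are constant on generators of the same
cyclic group. -/
theorem coeff_pow_eq_of_idempotent {G : Type*} [Group G] [Finite G] (P : MonoidAlgebra ℚ G)
    (hP : P * P = P) (hc : ∀ x, Commute P x) (y : G) {j : ℕ} (hj : j.Coprime (orderOf y)) :
    P.coeff (y ^ j) = P.coeff y := by
  classical
  have := Fintype.ofFinite G
  obtain ⟨N, hN, b, hb⟩ := exists_nsmul_mem_of_mem_span (intCoe G).range.toAddSubgroup (x := P)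
    (by
      have h : (((intCoe G).range.toAddSubgroup : AddSubgroup _) : Set (MonoidAlgebra ℚ G)) =
        Set.range (intCoe G) := rfl
      rw [h, span_range_intCoe]; trivial)
  have hb' : intCoe G b = N • P := hb
  have hbb : b * b = N • b := intCoe_injective (by
    rw [map_mul, map_nsmul, hb', smul_mul_smul_comm, hP, smul_smul])
  have hbc : ∀ x, Commute b x := fun x => intCoe_injective (by
    rw [map_mul, map_mul, hb', smul_mul_assoc, mul_smul_comm, (hc _).eq])
  have hbpow : ∀ k : ℕ, b ^ (k + 1) = N ^ k • b := by
    intro k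
    induction k with
    | zero => simp
    | succ k ih => rw [pow_succ, ih, smul_mul_assoc, hbb, smul_smul, pow_succ]
  have hcoeff : ∀ g, ((b.coeff g : ℤ) : ℚ) = N * P.coeff g := fun g => by
    have h : (intCoe G b).coeff g = (N • P).coeff g := by rw [hb']
    rw [coeff_mapRingHom, coeff_smul, Finsupp.smul_apply, nsmul_eq_mul] at h
    exact h
  suffices h : b.coeff (y ^ j) = b.coeff y by
    have h1 := hcoeff (y ^ j)
    rw [h, hcoeff] at h1
    exact (mul_left_cancel₀ (by exact_mod_cast hN) h1).symm
  have : NeZero (orderOf y) := ⟨(orderOf_pos y).ne'⟩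
  have hinf := Nat.infinite_setOfPred_prime_and_eq_mod (q := orderOf y) (a := (j : ZMod (orderOf y)))
    ((ZMod.isUnit_iff_coprime j _).2 hj)
  set m : ℤ := Fintype.card G * N * (b.coeff (y ^ j) - b.coeff y) with hm
  have hdvd : ∀ p : ℕ, p.Prime → (p : ZMod (orderOf y)) = j → (p : ℤ) ∣ m := by
    intro p hp hpj
    have := Fact.mk hp
    have hyp : y ^ p = y ^ j :=
      pow_eq_pow_iff_modEq.2 ((ZMod.natCast_eq_natCast_iff _ _ _).1 hpj)
    have h := coeff_pow_prime (b * MonoidAlgebra.single y⁻¹ 1) p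
    obtain ⟨k, rfl⟩ : ∃ k, p = k + 1 := ⟨p - 1, by have := hp.pos; omega⟩
    rw [(hbc _).mul_pow, hbpow, single_pow, one_pow, inv_pow, hyp, smul_mul_assoc] at h
    simp only [coeff_smul, Finsupp.smul_apply, coeff_mul_single_apply, inv_inv, one_mul,
      mul_one] at h
    rw [← ZMod.intCast_zmod_eq_zero_iff_dvd]
    have hNp := ZMod.pow_card (N : ZMod (k + 1))
    push_cast at h ⊢
    rw [pow_succ] at hNp
    rw [nsmul_eq_mul] at h
    push_cast at h
    rw [hm]
    push_cast
    linear_combination (N : ZMod (k + 1)) * h -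
      (Fintype.card G : ZMod (k + 1)) * (b.coeff (y ^ j) : ZMod (k + 1)) * hNp
  have hm0 : m = 0 := by
    by_contra hne
    obtain ⟨p, ⟨hp, hpj⟩, hlt⟩ := hinf.exists_gt m.natAbs
    have := Nat.le_of_dvd (Int.natAbs_pos.2 hne) (Int.natCast_dvd.1 (hdvd p hp hpj))
    omega
  have hcard : (Fintype.card G : ℤ) ≠ 0 := by exact_mod_cast Fintype.card_ne_zero
  have hN' : (N : ℤ) ≠ 0 := by exact_mod_cast hN
  have := (mul_eq_zero.1 hm0).resolve_left (mul_ne_zero hcard hN')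
  linarith

end FAbCut

namespace FAbCut
open MonoidAlgebra NumberField

section
variable {G : Type*} [Group G] [Fintype G]

/-- The standard inner product on the rational group algebra. -/
noncomputable def groupInner (x y : MonoidAlgebra ℚ G) : ℚ := ∑ g, x.coeff g * y.coeff g

theorem groupInner_self_nonneg (x : MonoidAlgebra ℚ G) : 0 ≤ groupInner x x :=
  Finset.sum_nonneg fun _ _ => mul_self_nonneg _

theorem groupInner_self_pos {x : MonoidAlgebra ℚ G} (hx : x ≠ 0) : 0 < groupInner x x := by
  obtain ⟨g, hg⟩ : ∃ g, x.coeff g ≠ 0 := by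
    by_contra h
    push Not at h
    exact hx (MonoidAlgebra.ext (Finsupp.ext h))
  exact Finset.sum_pos' (fun _ _ => mul_self_nonneg _) ⟨g, Finset.mem_univ _, mul_self_pos.2 hg⟩

theorem groupInner_mul_left {a : MonoidAlgebra ℚ G} (ha : ∀ g, a.coeff g⁻¹ = a.coeff g)
    (x y : MonoidAlgebra ℚ G) : groupInner (a * x) y = groupInner x (a * y) := by
  simp only [groupInner, coeff_mul_eq_sum, Finset.sum_mul, Finset.mul_sum]
  rw [Finset.sum_comm]
  refine Finset.sum_congr rfl fun g _ => Finset.sum_congr rfl fun h _ => ?_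
  rw [← ha (g * h⁻¹), mul_inv_rev, inv_inv]
  ring

theorem groupInner_smul_left (q : ℚ) (x y : MonoidAlgebra ℚ G) :
    groupInner (q • x) y = q * groupInner x y := by
  simp [groupInner, Finset.mul_sum, mul_assoc]

end

section
variable {G : Type*} [Group G] [Finite G] {ι : Type*} {n : ι → ℕ} {D : ι → Type*}
  [∀ i, DivisionRing (D i)] [∀ i, Algebra ℚ (D i)] [∀ i, NeZero (n i)]

theorem exists_scalar_of_commute
    (e : MonoidAlgebra ℚ G ≃ₐ[ℚ] Π i, Matrix (Fin (n i)) (Fin (n i)) (D i)) (i : ι)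
    {z : MonoidAlgebra ℚ G} (hz : ∀ x, Commute z x) :
    ∃ d : Subring.center (D i), e z i = Matrix.scalar (Fin (n i)) (d : D i) := by
  classical
  have h : e z i ∈ Set.center (Matrix (Fin (n i)) (Fin (n i)) (D i)) := by
    rw [Semigroup.mem_center_iff]
    intro M
    have := congrFun (congrArg e (hz (e.symm (Pi.single i M))).eq) i
    rw [map_mul, map_mul, e.apply_symm_apply] at this
    simpa using this.symm
  rw [Matrix.center_eq_scalar_image] at h
  obtain ⟨d, hd, hdz⟩ := h
  exact ⟨⟨d, hd⟩, hdz.symm⟩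

theorem exists_rational_of_symmetric
    (e : MonoidAlgebra ℚ G ≃ₐ[ℚ] Π i, Matrix (Fin (n i)) (Fin (n i)) (D i)) (i : ι)
    [NumberField (Subring.center (D i))] [Finite (𝓞 (Subring.center (D i)))ˣ]
    {z : MonoidAlgebra ℚ G} (hz : ∀ x, Commute z x) (hs : ∀ g, z.coeff g⁻¹ = z.coeff g) :
    ∃ κ : ℚ, e z i = algebraMap ℚ _ κ := by
  classical
  have := Fintype.ofFinite G
  have hsc : ∀ q : ℚ, Matrix.scalar (Fin (n i)) (((q : Subring.center (D i)) : D i)) =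
      algebraMap ℚ _ q := fun q =>
    RingHom.congr_fun (Subsingleton.elim (((Matrix.scalar (Fin (n i))).comp
      (Subring.center (D i)).subtype).comp (Rat.castHom _)) (algebraMap ℚ _)) q
  obtain ⟨d, hd⟩ := exists_scalar_of_commute e i hz
  rcases rational_or_sq_neg d with ⟨κ, hκ⟩ | ⟨t, q, hq, hdt⟩
  · exact ⟨κ, by rw [hd, hκ, hsc]⟩
  exfalso
  set a := z - algebraMap ℚ _ t with ha
  set v : MonoidAlgebra ℚ G := e.symm (Pi.single i 1) with hv
  have hv0 : v ≠ 0 := by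
    rw [hv, Ne, EmbeddingLike.map_eq_zero_iff, Pi.single_eq_zero_iff]
    exact one_ne_zero
  have hav : a * (a * v) = q • v := by
    refine e.injective ?_
    rw [map_mul, map_mul, map_smul, hv, e.apply_symm_apply, ha, map_sub, AlgEquiv.commutes]
    funext j
    by_cases hj : j = i
    · subst hj
      simp only [Pi.mul_apply, Pi.sub_apply, Pi.single_eq_same, mul_one, Pi.smul_apply, hd,
        Pi.algebraMap_apply]
      rw [← hsc t, ← map_sub, ← map_mul, Algebra.smul_def, mul_one, ← hsc q, ← hdt, pow_two]
      rfl
    · simp [Pi.single_eq_of_ne hj]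
  have hsa : ∀ g, a.coeff g⁻¹ = a.coeff g := by
    intro g
    simp only [ha, coeff_sub, Finsupp.sub_apply, hs, Algebra.algebraMap_eq_smul_one, coeff_smul,
      Finsupp.smul_apply, one_def, coeff_single, Finsupp.single_apply]
    simp [eq_comm]
  have h1 := groupInner_mul_left hsa (a * v) v
  rw [hav, groupInner_smul_left] at h1
  have h2 := groupInner_self_nonneg (a * v)
  have h3 := groupInner_self_pos hv0
  nlinarith

/-- In a cut group every generator of `⟨x⟩` is conjugate to `x` or to `x⁻¹`. -/
theorem exists_conj_of_coprime
    (e : MonoidAlgebra ℚ G ≃ₐ[ℚ] Π i, Matrix (Fin (n i)) (Fin (n i)) (D i)) [Finite ι]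
    [∀ i, NumberField (Subring.center (D i))] [∀ i, Finite (𝓞 (Subring.center (D i)))ˣ]
    (x : G) {j : ℕ} (hj : j.Coprime (orderOf x)) :
    ∃ g : G, g * x * g⁻¹ = x ^ j ∨ g * x * g⁻¹ = (x ^ j)⁻¹ := by
  classical
  have := Fintype.ofFinite G
  have := Fintype.ofFinite ι
  set z : MonoidAlgebra ℚ G := ∑ g : G, (single (g * x * g⁻¹) 1 + single (g * x⁻¹ * g⁻¹) 1) with hz
  have hzg : ∀ w, z.coeff w = ∑ g : G, ((if g * x * g⁻¹ = w then (1 : ℚ) else 0) +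
      if g * x⁻¹ * g⁻¹ = w then 1 else 0) := by
    intro w
    rw [hz, coeff_sum, Finsupp.finset_sum_apply]
    simp [Finsupp.single_apply]
  have hzs : ∀ g, z.coeff g⁻¹ = z.coeff g := by
    intro w
    rw [hzg, hzg]
    refine Finset.sum_congr rfl fun g _ => ?_
    rw [add_comm]
    have h1 : g * x⁻¹ * g⁻¹ = w⁻¹ ↔ g * x * g⁻¹ = w := by
      rw [← inv_inj]; simp [mul_assoc]
    have h2 : g * x * g⁻¹ = w⁻¹ ↔ g * x⁻¹ * g⁻¹ = w := by
      rw [← inv_inj]; simp [mul_assoc]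
    simp only [h1, h2]
  have hzc : ∀ y, Commute z y := by
    intro y
    induction y using MonoidAlgebra.induction_on with
    | of h =>
      rw [of_apply, Commute, SemiconjBy, hz, Finset.sum_mul, Finset.mul_sum,
        ← Equiv.sum_comp (Equiv.mulLeft h)]
      refine Finset.sum_congr rfl fun g _ => ?_
      simp [add_mul, mul_add, single_mul_single, mul_assoc]
    | add a b ha hb => exact ha.add_right hb
    | smul r a ha => exact ha.smul_right r
  have hκ : ∀ i, ∃ κ : ℚ, e z i = algebraMap ℚ _ κ := fun i =>
    exists_rational_of_symmetric e i hzc hzs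
  choose κ hκ using hκ
  let P : ι → MonoidAlgebra ℚ G := fun i => e.symm (Pi.single i 1)
  have hP : ∀ i, P i * P i = P i := fun i => e.injective (by
    simp only [P, map_mul, e.apply_symm_apply, ← Pi.single_mul, mul_one])
  have hPc : ∀ i y, Commute (P i) y := fun i y => e.injective (by
    rw [map_mul, map_mul, e.apply_symm_apply]
    funext k
    by_cases hk : k = i
    · subst hk; simp
    · simp [Pi.single_eq_of_ne hk])
  have hzP : z = ∑ i, κ i • P i := by
    have hsum : e (∑ i, κ i • P i) = ∑ i, e (κ i • P i) := map_sum _ _ _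
    refine e.injective ?_
    rw [hsum]
    simp only [map_smul, P, e.apply_symm_apply]
    funext k
    rw [hκ, Finset.sum_apply, Finset.sum_eq_single k]
    · simp [Algebra.algebraMap_eq_smul_one]
    · intro b _ hb
      simp [Pi.single_eq_of_ne hb.symm]
    · simp
  have hzj : z.coeff (x ^ j) = z.coeff x := by
    rw [hzP]
    simp only [coeff_sum, Finsupp.finset_sum_apply, coeff_smul, Finsupp.smul_apply]
    exact Finset.sum_congr rfl fun i _ => by
      rw [coeff_pow_eq_of_idempotent (P i) (hP i) (hPc i) x hj]
  have hpos : 0 < z.coeff x := by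
    rw [hzg]
    refine Finset.sum_pos' (fun g _ => by positivity) ⟨1, Finset.mem_univ _, ?_⟩
    simp only [one_mul, inv_one, mul_one, if_true]
    positivity
  rw [← hzj, hzg] at hpos
  obtain ⟨g, -, hg⟩ := Finset.exists_ne_zero_of_sum_ne_zero hpos.ne'
  refine ⟨g, ?_⟩
  by_contra hne
  push Not at hne
  refine hg ?_
  rw [if_neg hne.1, if_neg, add_zero]
  intro h
  refine hne.2 ?_
  rw [← h]
  simp [mul_assoc]

end
end FAbCut

namespace FAbCut

section
variable {H D : Type*} [Group H] [DivisionRing D] {ρ : H →* D}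

theorem exists_eq_pow_of_commute [Finite H] (hρ : Function.Injective ρ) {x y : H}
    (h : Commute x y) (hy : y ^ orderOf x = 1) : ∃ i : ℕ, y = x ^ i := by
  have hc : ∀ a ∈ ({ρ x, ρ y} : Set D), ∀ b ∈ ({ρ x, ρ y} : Set D), a * b = b * a := by
    have := (h.map ρ).eq
    rintro a (rfl | rfl) b (rfl | rfl)
    exacts [rfl, this, this.symm, rfl]
  let R := Subring.closure ({ρ x, ρ y} : Set D)
  let _ : CommRing R := Subring.closureCommRingOfComm hc
  have hx : ρ x ∈ R := Subring.subset_closure (by simp)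
  have hy' : ρ y ∈ R := Subring.subset_closure (by simp)
  have : NeZero (orderOf x) := ⟨(orderOf_pos x).ne'⟩
  have hinj : Function.Injective (R.subtype : R →* D) := Subtype.val_injective
  have hp : IsPrimitiveRoot (⟨ρ x, hx⟩ : R) (orderOf x) := by
    have h := IsPrimitiveRoot.orderOf (⟨ρ x, hx⟩ : R)
    rwa [← orderOf_injective (R.subtype : R →* D) hinj,
      show (R.subtype : R →* D) ⟨ρ x, hx⟩ = ρ x from rfl, orderOf_injective ρ hρ] at h
  have hy1 : (⟨ρ y, hy'⟩ : R) ^ orderOf x = 1 := by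
    refine hinj ?_
    rw [map_pow, map_one]
    change ρ y ^ _ = 1
    rw [← map_pow, hy, map_one]
  obtain ⟨i, -, hi⟩ := hp.eq_pow_of_pow_eq_one hy1
  refine ⟨i, hρ ?_⟩
  have := congrArg (R.subtype : R →* D) hi
  rw [map_pow] at this
  rw [map_pow]
  exact this.symm

theorem map_eq_neg_one (hρ : Function.Injective ρ) {y : H} (hy : y ^ 2 = 1) (h1 : y ≠ 1) :
    ρ y = -1 := by
  have h : ρ y * ρ y = 1 := by rw [← pow_two, ← map_pow, hy, map_one]
  rcases mul_self_eq_one_iff.1 h with h | h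
  · exact absurd (hρ (h.trans (map_one ρ).symm)) h1
  · exact h

theorem commute_of_sq_eq_one (hρ : Function.Injective ρ) {y : H} (hy : y ^ 2 = 1) (g : H) :
    Commute y g := by
  by_cases h1 : y = 1
  · rw [h1]; exact Commute.one_left g
  · refine hρ ?_
    rw [map_mul, map_mul, map_eq_neg_one hρ hy h1, neg_one_mul, mul_neg_one]

theorem eq_of_sq_eq_one (hρ : Function.Injective ρ) {y w : H} (hy : y ^ 2 = 1) (hw : w ^ 2 = 1)
    (hw1 : w ≠ 1) : y = 1 ∨ y = w := by
  by_cases h1 : y = 1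
  · exact Or.inl h1
  · exact Or.inr (hρ (by rw [map_eq_neg_one hρ hy h1, map_eq_neg_one hρ hw hw1]))

theorem powers_of_commute [Finite H] (hρ : Function.Injective ρ) {q a b : ℕ} [hq : Fact q.Prime]
    {x y : H} (h : Commute x y) (hx : x ^ q ^ a = 1) (hy : y ^ q ^ b = 1) :
    (∃ i : ℕ, y = x ^ i) ∨ ∃ i : ℕ, x = y ^ i := by
  obtain ⟨c, -, hc⟩ := (Nat.dvd_prime_pow hq.out).1 (orderOf_dvd_of_pow_eq_one hx)
  obtain ⟨d, -, hd⟩ := (Nat.dvd_prime_pow hq.out).1 (orderOf_dvd_of_pow_eq_one hy)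
  rcases le_total d c with hdc | hdc
  · exact Or.inl (exists_eq_pow_of_commute hρ h
      (orderOf_dvd_iff_pow_eq_one.1 (by rw [hc, hd]; exact pow_dvd_pow q hdc)))
  · exact Or.inr (exists_eq_pow_of_commute hρ h.symm
      (orderOf_dvd_iff_pow_eq_one.1 (by rw [hc, hd]; exact pow_dvd_pow q hdc)))

theorem semiconjBy_pow_left {g x : H} {j : ℕ} (h : SemiconjBy g x (x ^ j)) (k : ℕ) :
    SemiconjBy (g ^ k) x (x ^ j ^ k) := by
  induction k with
  | zero => simp
  | succ k ih =>
    have := ih.pow_right j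
    rw [← pow_mul, ← pow_succ] at this
    rw [pow_succ g]
    exact this.mul_left h

theorem pow_pow_eq_self {x : H} {j : ℕ} (h : x ^ j = x) (k : ℕ) : x ^ j ^ k = x := by
  induction k with
  | zero => simp
  | succ k ih => rw [pow_succ, pow_mul, ih, h]

/-- An action of `q`-power order on a cyclic group is realised by a `q`-element. -/
theorem exists_semiconjBy_of_prime [Finite H] (q : ℕ) [hq : Fact q.Prime] {g x : H} {j t : ℕ}
    (h : SemiconjBy g x (x ^ j)) (hj : x ^ j ^ q ^ t = x) :
    ∃ (g' : H) (s : ℕ), SemiconjBy g' x (x ^ j) ∧ g' ^ q ^ s = 1 := by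
  obtain ⟨s, m, hm, hn⟩ := Nat.exists_eq_pow_mul_and_not_dvd (orderOf_pos g).ne' q hq.out.ne_one
  have hco : Nat.Coprime m (q ^ t) :=
    ((Nat.Prime.coprime_iff_not_dvd hq.out).2 hm).symm.pow_right t
  obtain ⟨M, hM0, hM1⟩ := Nat.chineseRemainder hco 0 1
  obtain ⟨c, rfl⟩ := (Nat.modEq_zero_iff_dvd).1 hM0
  refine ⟨g ^ (m * c), s, ?_, ?_⟩
  · have h1 := semiconjBy_pow_left h (m * c)
    have h2 : x ^ j ^ (m * c) = x ^ j := by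
      rcases Nat.eq_zero_or_pos (m * c) with h0 | hpos
      · have : q ^ t = 1 := by
          rw [h0] at hM1
          exact Nat.dvd_one.1 ((Nat.modEq_iff_dvd' (Nat.zero_le 1)).1 hM1)
        rw [this, pow_one] at hj
        rw [h0, pow_zero, pow_one, hj]
      · obtain ⟨e, he⟩ := (Nat.modEq_iff_dvd' hpos).1 hM1.symm
        have : m * c = 1 + q ^ t * e := by omega
        rw [this, pow_add, pow_one, mul_comm, pow_mul, pow_mul, pow_pow_eq_self hj]
    rwa [h2] at h1
  · rw [← pow_mul]
    refine orderOf_dvd_iff_pow_eq_one.1 ?_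
    rw [hn]
    exact ⟨c, by ring⟩

end
end FAbCut

namespace FAbCut

section
variable {H D : Type*} [Group H] [DivisionRing D] {ρ : H →* D}

theorem eq_of_semiconjBy_of_commute {g a b : H} (h : SemiconjBy g a b) (hc : Commute g a) :
    b = a := by
  have := h.eq.symm.trans hc.eq
  exact mul_right_cancel this

/-- Every automorphism of a cyclic subgroup is, up to inversion, induced by conjugation. -/
def ConjugationRich (H : Type*) [Group H] : Prop :=
  ∀ (x : H) (j : ℕ), j.Coprime (orderOf x) →
    ∃ g : H, SemiconjBy g x (x ^ j) ∨ SemiconjBy g x (x ^ j)⁻¹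

theorem not_semiconjBy_cube [Finite H] (hρ : Function.Injective ρ) {x g : H}
    (hx : orderOf x = 8) {s : ℕ} (hg : g ^ 2 ^ s = 1) : ¬ SemiconjBy g x (x ^ 3) := by
  intro h
  have hpow : ∀ {a b : ℕ}, x ^ a = x ^ b ↔ a ≡ b [MOD 8] := by
    intro a b; rw [pow_eq_pow_iff_modEq, hx]
  have hnc : ¬ Commute g x := fun hc => by
    have := eq_of_semiconjBy_of_commute h hc
    rw [← pow_one x, ← pow_mul, hpow] at this
    exact absurd this (by decide)
  have hc2 : Commute x (g ^ 2) := by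
    have := semiconjBy_pow_left h 2
    rw [hpow.2 (show 3 ^ 2 ≡ 1 [MOD 8] by decide), pow_one] at this
    exact Commute.symm this
  have hx8 : x ^ 2 ^ 3 = 1 := by rw [← orderOf_dvd_iff_pow_eq_one, hx]; decide
  have hg2 : (g ^ 2) ^ 2 ^ s = 1 := by rw [← pow_mul, mul_comm, pow_mul, hg, one_pow]
  have : Fact (Nat.Prime 2) := ⟨Nat.prime_two⟩
  rcases powers_of_commute hρ hc2 hx8 hg2 with ⟨i, hi⟩ | ⟨i, hi⟩
  · have h1 := h.pow_right i
    have h2 := eq_of_semiconjBy_of_commute h1 (by rw [← hi]; exact Commute.self_pow g 2)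
    have h3 : (g ^ 2) ^ 2 = 1 := by
      rw [hi]
      rw [← pow_mul, mul_comm, pow_mul, pow_succ] at h2
      exact mul_eq_right.1 h2
    have h4 : (x ^ 4) ^ 2 = 1 := by rw [← pow_mul]; exact hx8
    have h5 : x ^ 4 ≠ 1 := fun h => by
      rw [← pow_zero x, hpow] at h; exact absurd h (by decide)
    rcases eq_of_sq_eq_one hρ h3 h4 h5 with h6 | h6
    · exact hnc (commute_of_sq_eq_one hρ h6 x)
    · have h7 : (g * x) ^ 2 = 1 := by
        rw [pow_two, ← mul_assoc, h.eq, mul_assoc (x ^ 3), ← pow_two, h6, ← pow_add, ← pow_succ]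
        exact hx8
      have h8 := commute_of_sq_eq_one hρ h7 x
      refine hnc ?_
      have := h8.mul_left (Commute.refl x).inv_left
      rwa [mul_inv_cancel_right] at this
  · refine hnc ?_
    rw [hi, ← pow_mul]
    exact Commute.self_pow g _

theorem not_semiconjBy_pow_five [Finite H] (hρ : Function.Injective ρ) {x g : H}
    (hx : orderOf x = 8) {s : ℕ} (hg : g ^ 2 ^ s = 1) : ¬ SemiconjBy g x (x ^ 5) := by
  intro h
  have hpow : ∀ {a b : ℕ}, x ^ a = x ^ b ↔ a ≡ b [MOD 8] := by
    intro a b; rw [pow_eq_pow_iff_modEq, hx]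
  have hnc : ¬ Commute x g := fun hc => by
    have := eq_of_semiconjBy_of_commute h hc.symm
    rw [← pow_one x, ← pow_mul, hpow] at this
    exact absurd this (by decide)
  have hc2 : Commute x (g ^ 2) := by
    have := semiconjBy_pow_left h 2
    rw [hpow.2 (show 5 ^ 2 ≡ 1 [MOD 8] by decide), pow_one] at this
    exact Commute.symm this
  have hx8 : x ^ 8 = 1 := by rw [← hx, pow_orderOf_eq_one]
  have hg2 : (g ^ 2) ^ 2 ^ s = 1 := by rw [← pow_mul, mul_comm, pow_mul, hg, one_pow]
  have hx2g : Commute (x ^ 2) g := by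
    have := h.pow_right 2
    rw [← pow_mul, hpow.2 (show 5 * 2 ≡ 2 [MOD 8] by decide)] at this
    exact Commute.symm this
  have ho : orderOf (x ^ 2) = 4 := by
    rw [orderOf_pow, hx]; decide
  have key : ∀ y : H, Commute (x ^ 2) y → y ^ 4 = 1 → Commute x y := by
    intro y hy h4
    obtain ⟨i, hi⟩ := exists_eq_pow_of_commute hρ hy (by rw [ho, h4])
    rw [hi, ← pow_mul]
    exact Commute.self_pow x _
  have : Fact (Nat.Prime 2) := ⟨Nat.prime_two⟩
  rcases powers_of_commute hρ (a := 3) hc2 hx8 hg2 with ⟨i, hi⟩ | ⟨i, hi⟩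
  · have h1 := h.pow_right i
    have h2 := eq_of_semiconjBy_of_commute h1 (by rw [← hi]; exact Commute.self_pow g 2)
    rw [← pow_mul, hpow] at h2
    have hi2 : i % 2 = 0 := by
      unfold Nat.ModEq at h2; omega
    have hcases : i % 4 = 0 ∨ i % 4 = 2 := by omega
    rcases hcases with hi4 | hi4
    · refine hnc (key g hx2g ?_)
      rw [show 4 = 2 * 2 from rfl, pow_mul, hi, ← pow_mul, ← pow_zero x, hpow]
      unfold Nat.ModEq; omega
    · have hgx : (x * g) ^ 2 = x ^ (6 + i) := by
        rw [pow_two, mul_assoc, ← mul_assoc g, h.eq, mul_assoc, ← pow_two, hi, ← pow_add,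
          ← pow_succ']
        congr 1; omega
      have h4 : (x * g) ^ 4 = 1 := by
        rw [show 4 = 2 * 2 from rfl, pow_mul, hgx, ← pow_mul, ← pow_zero x, hpow]
        unfold Nat.ModEq; omega
      have h8 := key (x * g) ((Commute.pow_self x 2).mul_right hx2g) h4
      refine hnc ?_
      have := (Commute.refl x).inv_right.mul_right h8
      rwa [inv_mul_cancel_left] at this
  · refine hnc ?_
    rw [hi, ← pow_mul]
    exact Commute.pow_self g _

theorem orderOf_ne_eight [Finite H] (hρ : Function.Injective ρ) (hC : ConjugationRich H) (x : H) :
    orderOf x ≠ 8 := by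
  intro hx
  have hpow : ∀ {a b : ℕ}, x ^ a = x ^ b ↔ a ≡ b [MOD 8] := by
    intro a b; rw [pow_eq_pow_iff_modEq, hx]
  have : Fact (Nat.Prime 2) := ⟨Nat.prime_two⟩
  obtain ⟨g, hg | hg⟩ := hC x 3 (by rw [hx]; decide)
  · obtain ⟨g', s, h1, h2⟩ := exists_semiconjBy_of_prime 2 (t := 1) hg (by
      rw [← pow_one x, ← pow_mul, one_mul, hpow]; decide)
    exact not_semiconjBy_cube hρ hx h2 h1
  · have : (x ^ 3)⁻¹ = x ^ 5 := by
      rw [inv_eq_iff_mul_eq_one, ← pow_add, ← pow_zero x, hpow]; decide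
    rw [this] at hg
    obtain ⟨g', s, h1, h2⟩ := exists_semiconjBy_of_prime 2 (t := 1) hg (by
      rw [← pow_one x, ← pow_mul, one_mul, hpow]; decide)
    exact not_semiconjBy_pow_five hρ hx h2 h1

theorem pow_four_eq_one_of_pow_two_pow [Finite H] (hρ : Function.Injective ρ)
    (hC : ConjugationRich H) {g : H} {s : ℕ} (hg : g ^ 2 ^ s = 1) : g ^ 4 = 1 := by
  obtain ⟨c, -, hc⟩ := (Nat.dvd_prime_pow Nat.prime_two).1 (orderOf_dvd_of_pow_eq_one hg)
  rw [← orderOf_dvd_iff_pow_eq_one, hc]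
  by_contra hn
  have h3 : 3 ≤ c := by
    by_contra h
    exact hn (pow_dvd_pow 2 (by omega : c ≤ 2))
  refine orderOf_ne_eight hρ hC (g ^ 2 ^ (c - 3)) ?_
  rw [orderOf_pow_of_dvd (by positivity) (by rw [hc]; exact pow_dvd_pow 2 (by omega)), hc,
    Nat.pow_div (by omega) (by norm_num), show c - (c - 3) = 3 by omega]

theorem orderOf_ne_nine [Finite H] (hρ : Function.Injective ρ) (hC : ConjugationRich H) (x : H) :
    orderOf x ≠ 9 := by
  intro hx
  have hpow : ∀ {a b : ℕ}, x ^ a = x ^ b ↔ a ≡ b [MOD 9] := by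
    intro a b; rw [pow_eq_pow_iff_modEq, hx]
  have : Fact (Nat.Prime 3) := ⟨by norm_num⟩
  have hg : ∃ g, SemiconjBy g x (x ^ 4) := by
    obtain ⟨g, hg | hg⟩ := hC x 4 (by rw [hx]; decide)
    · exact ⟨g, hg⟩
    · have h5 : (x ^ 4)⁻¹ = x ^ 5 := by
        rw [inv_eq_iff_mul_eq_one, ← pow_add, ← pow_zero x, hpow]; decide
      rw [h5] at hg
      have := semiconjBy_pow_left hg 4
      rw [hpow.2 (show 5 ^ 4 ≡ 4 [MOD 9] by decide)] at this
      exact ⟨_, this⟩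
  obtain ⟨g₀, hg₀⟩ := hg
  obtain ⟨g, s, h, hgs⟩ := exists_semiconjBy_of_prime 3 (t := 1) hg₀ (by
      rw [← pow_one x, ← pow_mul, one_mul, hpow]; decide)
  have hnc : ¬ Commute x g := fun hc => by
    have := eq_of_semiconjBy_of_commute h hc.symm
    rw [← pow_one x, ← pow_mul, hpow] at this
    exact absurd this (by decide)
  have hc3 : Commute x (g ^ 3) := by
    have := semiconjBy_pow_left h 3
    rw [hpow.2 (show 4 ^ 3 ≡ 1 [MOD 9] by decide), pow_one] at this
    exact Commute.symm this
  have hx9 : x ^ 9 = 1 := by rw [← hx, pow_orderOf_eq_one]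
  have hg3 : (g ^ 3) ^ 3 ^ s = 1 := by rw [← pow_mul, mul_comm, pow_mul, hgs, one_pow]
  have hx3g : Commute (x ^ 3) g := by
    have := h.pow_right 3
    rw [← pow_mul, hpow.2 (show 4 * 3 ≡ 3 [MOD 9] by decide)] at this
    exact Commute.symm this
  have ho : orderOf (x ^ 3) = 3 := by
    rw [orderOf_pow, hx]; decide
  rcases powers_of_commute hρ (a := 2) hc3 hx9 hg3 with ⟨i, hi⟩ | ⟨i, hi⟩
  · have h1 := h.pow_right i
    have h2 := eq_of_semiconjBy_of_commute h1 (by rw [← hi]; exact Commute.self_pow g 3)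
    rw [← pow_mul, hpow] at h2
    have hi3 : i % 3 = 0 := by
      unfold Nat.ModEq at h2; omega
    obtain ⟨a, rfl⟩ : ∃ a, i = 3 * a := ⟨i / 3, by omega⟩
    set b := 8 * a with hb
    have hyb : (x ^ b * g) ^ 3 = 1 := by
      have e1 : ∀ k, g * x ^ k = x ^ (4 * k) * g := fun k => by
        have := (h.pow_right k).eq
        rwa [← pow_mul] at this
      have : (x ^ b * g) ^ 3 = x ^ (21 * b) * g ^ 3 := by
        calc (x ^ b * g) ^ 3 = x ^ b * (g * x ^ b) * (g * x ^ b) * g := by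
              simp only [pow_succ, pow_zero, one_mul, mul_assoc]
          _ = x ^ b * x ^ (4 * b) * (g * x ^ (4 * b)) * (g * g) := by
              rw [e1]; simp only [mul_assoc]
          _ = x ^ (21 * b) * g ^ 3 := by
              rw [e1, show 21 * b = b + 4 * b + 4 * (4 * b) by ring, pow_add, pow_add, pow_succ' g,
                pow_two]
              simp only [mul_assoc]
      rw [this, hi, ← pow_add, ← pow_zero x, hpow]
      unfold Nat.ModEq; omega
    obtain ⟨k, hk⟩ := exists_eq_pow_of_commute hρ
      (((Commute.refl x).pow_pow 3 b).mul_right hx3g) (by rw [ho, hyb])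
    refine hnc ?_
    have h8 : Commute x (x ^ b * g) := by
      rw [hk, ← pow_mul]; exact Commute.self_pow x _
    have := (Commute.self_pow x b).inv_right.mul_right h8
    rwa [inv_mul_cancel_left] at this
  · refine hnc ?_
    rw [hi, ← pow_mul]
    exact Commute.pow_self g _

end
end FAbCut

namespace FAbCut

section
variable {H D : Type*} [Group H] [DivisionRing D] {ρ : H →* D}

theorem exists_orderOf_eq_of_dvd [Finite H] {x : H} {d : ℕ} (hd : d ∣ orderOf x) :
    ∃ y : H, orderOf y = d := by
  obtain ⟨c, hc⟩ := hd
  have hpos := orderOf_pos x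
  have hc0 : c ≠ 0 := by rintro rfl; omega
  refine ⟨x ^ c, ?_⟩
  rw [orderOf_pow_of_dvd hc0 (hc ▸ Dvd.intro_left d rfl), hc, Nat.mul_div_cancel _ (by omega)]

theorem orderOf_ne_twelve [Finite H] (hρ : Function.Injective ρ) (hC : ConjugationRich H) (x : H) :
    orderOf x ≠ 12 := by
  intro hx
  have hpow : ∀ {a b : ℕ}, x ^ a = x ^ b ↔ a ≡ b [MOD 12] := by
    intro a b; rw [pow_eq_pow_iff_modEq, hx]
  have : Fact (Nat.Prime 2) := ⟨Nat.prime_two⟩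
  have hx1 : ∀ {a : ℕ}, x ^ a = x ↔ a ≡ 1 [MOD 12] := by
    intro a; rw [← hpow, pow_one]
  have hord : ∀ {g : H} {j : ℕ}, SemiconjBy g x (x ^ j) → j ^ 2 ≡ 1 [MOD 12] →
      ∃ g : H, SemiconjBy g x (x ^ j) ∧ g ^ 4 = 1 := by
    intro g j hg hj
    obtain ⟨g', s, h1, h2⟩ := exists_semiconjBy_of_prime 2 (t := 1) hg (by rwa [hx1, pow_one])
    exact ⟨g', h1, pow_four_eq_one_of_pow_two_pow hρ hC h2⟩
  have hι : (x ^ 3) ^ 4 = 1 := by rw [← pow_mul, ← pow_zero x, hpow]; decide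
  have ho : orderOf (x ^ 3) = 4 := by rw [orderOf_pow, hx]; decide
  obtain ⟨g, hg | hg⟩ := hC x 5 (by rw [hx]; decide)
  · obtain ⟨g, h, hg4⟩ := hord hg (by decide)
    have hc : Commute (x ^ 3) g := by
      have := h.pow_right 3
      rw [← pow_mul, hpow.2 (show 5 * 3 ≡ 3 [MOD 12] by decide)] at this
      exact Commute.symm this
    obtain ⟨i, hi⟩ := exists_eq_pow_of_commute hρ hc (by rw [ho, hg4])
    have h1 := eq_of_semiconjBy_of_commute h (by
      rw [hi, ← pow_mul]; exact Commute.pow_self x _)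
    rw [hx1] at h1
    exact absurd h1 (by decide)
  · have h7 : (x ^ 5)⁻¹ = x ^ 7 := by
      rw [inv_eq_iff_mul_eq_one, ← pow_add, ← pow_zero x, hpow]; decide
    rw [h7] at hg
    obtain ⟨g, h, hg4⟩ := hord hg (by decide)
    have hnc : ¬ Commute g x := fun hc => by
      have := eq_of_semiconjBy_of_commute h hc
      rw [hx1] at this
      exact absurd this (by decide)
    have hg2 : ρ g ^ 2 = -1 := by
      rw [← map_pow]
      refine map_eq_neg_one hρ (by rw [← pow_mul]; exact hg4) fun h0 => ?_
      exact hnc (commute_of_sq_eq_one hρ h0 x)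
    have hx6 : ρ x ^ 6 = -1 := by
      rw [← map_pow]
      refine map_eq_neg_one hρ (by rw [← pow_mul, ← pow_zero x, hpow]; decide) fun h0 => ?_
      rw [← pow_zero x, hpow] at h0
      exact absurd h0 (by decide)
    have hgx : ρ g * ρ x = ρ x ^ 7 * ρ g := by rw [← map_mul, h.eq, map_mul, map_pow]
    set a := ρ x with ha
    set b := ρ g with hb
    have hba : b * a = -(a * b) := by
      rw [hgx, pow_succ, hx6]; simp
    have ha12 : a ^ 12 = 1 := by rw [show 12 = 6 * 2 from rfl, pow_mul, hx6]; simp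
    have ha0 : a ≠ 0 := fun h0 => by rw [h0] at ha12; simp at ha12
    have hω : a ^ 8 + a ^ 4 + 1 = 0 := by
      have h4 : a ^ 4 - 1 ≠ 0 := by
        rw [sub_ne_zero, ha, ← map_pow, ← map_one ρ]
        intro h0
        have := hρ h0
        rw [← pow_zero x, hpow] at this
        exact absurd this (by decide)
      refine (mul_eq_zero.1 (?_ : (a ^ 4 - 1) * (a ^ 8 + a ^ 4 + 1) = 0)).resolve_left h4
      have : (a ^ 4 - 1) * (a ^ 8 + a ^ 4 + 1) = a ^ 12 - 1 := by
        simp only [mul_add, sub_mul, ← pow_add]; simp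
      rw [this, ha12, sub_self]
    have hb8 : b * a ^ 8 = a ^ 8 * b := by
      have : Commute b (a ^ 2) := by
        rw [Commute, SemiconjBy, pow_two, ← mul_assoc, hba, neg_mul, mul_assoc, hba]; simp [mul_assoc]
      have h8 := this.pow_right 4
      rw [← pow_mul] at h8
      exact h8
    have hb7 : b * a ^ 7 = -(a ^ 7 * b) := by
      have h7 : a ^ 8 = a ^ 7 * a := pow_succ a 7
      have : b * a ^ 7 * a = -(a ^ 7 * b) * a := by
        rw [mul_assoc, ← h7, hb8, neg_mul, mul_assoc, hba, h7]; simp [mul_assoc]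
      exact mul_right_cancel₀ ha0 this
    have hsq : (a ^ 7 + a ^ 8 * b) * (a ^ 7 + a ^ 8 * b) = 1 := by
      have e1 : (a ^ 8 * b) * (a ^ 8 * b) = - a ^ 16 := by
        rw [mul_assoc, ← mul_assoc b, hb8, mul_assoc, ← pow_two b, hg2, ← mul_assoc, ← pow_add]
        simp
      have e2 : (a ^ 8 * b) * a ^ 7 = -(a ^ 7 * (a ^ 8 * b)) := by
        rw [mul_assoc, hb7, mul_neg, ← mul_assoc, ← mul_assoc, ← pow_add, ← pow_add]
      rw [mul_add, add_mul, add_mul, e1, e2, ← pow_add, show a ^ 16 = a ^ 12 * a ^ 4 by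
        rw [← pow_add], ha12, show a ^ (7 + 7) = a ^ 12 * a ^ 2 by rw [← pow_add], ha12,
        show a ^ 2 = - a ^ 8 by rw [show a ^ 8 = a ^ 6 * a ^ 2 by rw [← pow_add], hx6]; simp]
      rw [one_mul, one_mul]
      rw [← sub_eq_zero, ← neg_eq_zero, ← hω]
      abel
    have hcomm : Commute a (a ^ 8 * b) := by
      rcases mul_self_eq_one_iff.1 hsq with h0 | h0
      · rw [← eq_sub_iff_add_eq'] at h0
        rw [h0]
        exact (Commute.one_right a).sub_right (Commute.self_pow a 7)
      · rw [← eq_sub_iff_add_eq'] at h0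
        rw [h0]
        exact (Commute.one_right a).neg_right.sub_right (Commute.self_pow a 7)
    have hcab : Commute a b := by
      have h1 := (Commute.self_pow a 8).inv_right₀.mul_right hcomm
      rwa [inv_mul_cancel_left₀ (pow_ne_zero 8 ha0)] at h1
    refine hnc (Commute.symm (hρ ?_))
    rw [map_mul, map_mul]
    exact hcab.eq

theorem pow_three_eq_one_of_pow_three_pow [Finite H] (hρ : Function.Injective ρ)
    (hC : ConjugationRich H) {g : H} {s : ℕ} (hg : g ^ 3 ^ s = 1) : g ^ 3 = 1 := by
  obtain ⟨c, -, hc⟩ := (Nat.dvd_prime_pow Nat.prime_three).1 (orderOf_dvd_of_pow_eq_one hg)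
  rw [← orderOf_dvd_iff_pow_eq_one, hc]
  by_contra hn
  have h2 : 2 ≤ c := by
    by_contra h
    exact hn (pow_dvd_pow 3 (by omega : c ≤ 1))
  obtain ⟨y, hy⟩ := exists_orderOf_eq_of_dvd (x := g) (d := 9)
    (by rw [hc]; exact pow_dvd_pow 3 h2)
  exact orderOf_ne_nine hρ hC y hy

theorem orderOf_ne_of_mod_four_eq_one [Finite H] (hρ : Function.Injective ρ)
    (hC : ConjugationRich H) {p : ℕ} (hp : p.Prime) (h1 : p % 4 = 1) (x : H) : orderOf x ≠ p := by
  intro hx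
  have : Fact p.Prime := ⟨hp⟩
  have : Fact (Nat.Prime 2) := ⟨Nat.prime_two⟩
  have hpow : ∀ {a : ℕ}, x ^ a = 1 ↔ p ∣ a := by
    intro a; rw [← orderOf_dvd_iff_pow_eq_one, hx]
  obtain ⟨y, hy⟩ := (ZMod.exists_sq_eq_neg_one_iff (p := p)).2 (by omega)
  have hj : p ∣ y.val ^ 2 + 1 := by
    rw [← ZMod.natCast_eq_zero_iff]
    push_cast
    rw [ZMod.natCast_zmod_val, pow_two, ← hy]; ring
  set j := y.val
  have hco : j.Coprime p := by
    rw [Nat.coprime_comm, hp.coprime_iff_not_dvd]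
    intro h
    have : p ∣ 1 := (Nat.dvd_add_right (dvd_pow h two_ne_zero)).1 hj
    exact hp.one_lt.ne' (Nat.dvd_one.1 this)
  have hex : ∃ (g : H) (k : ℕ), SemiconjBy g x (x ^ k) ∧ p ∣ k ^ 2 + 1 := by
    obtain ⟨g, hg | hg⟩ := hC x j (by rwa [hx])
    · exact ⟨g, j, hg, hj⟩
    · refine ⟨g, j ^ 3, ?_, hj.trans ⟨j ^ 4 + 1 - j ^ 2, ?_⟩⟩
      · rwa [inv_eq_of_mul_eq_one_right (b := x ^ j ^ 3)] at hg
        rw [← pow_add, hpow]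
        exact hj.trans ⟨j, by ring⟩
      · have : j ^ 2 ≤ j ^ 4 + 1 := by nlinarith [sq_nonneg ((j : ℤ) ^ 2), sq_nonneg (j ^ 2 - 1), Nat.le_self_pow (n := 2) two_ne_zero (j ^ 2)]
        zify [this]; ring
  obtain ⟨g₀, k, hg₀, hk⟩ := hex
  have hkinv : x ^ k ^ 2 = x⁻¹ := by
    rw [eq_inv_iff_mul_eq_one, ← pow_succ, hpow]; exact hk
  obtain ⟨g, s, h, hgs⟩ := exists_semiconjBy_of_prime 2 (t := 2) hg₀ (by
    rw [show 2 ^ 2 = 2 * 2 from rfl, pow_mul, pow_two (k ^ 2), pow_mul, hkinv, inv_pow, hkinv,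
      inv_inv])
  have hg4 := pow_four_eq_one_of_pow_two_pow hρ hC hgs
  have h2 := eq_of_semiconjBy_of_commute (semiconjBy_pow_left h 2)
    (commute_of_sq_eq_one hρ (by rw [← pow_mul]; exact hg4) x)
  rw [hkinv] at h2
  have h3 : x ^ 2 = 1 := by
    rw [pow_two]; nth_rw 1 [← h2]; exact inv_mul_cancel x
  have h4 := Nat.le_of_dvd (by norm_num) (hpow.1 h3)
  have := hp.two_le
  have : p = 2 := by omega
  omega

end
end FAbCut

namespace FAbCut

section
variable {H D : Type*} [Group H] [DivisionRing D] {ρ : H →* D}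

theorem sq_add_self_add_one_eq_zero (hρ : Function.Injective ρ) {g : H} (hg : g ^ 3 = 1)
    (h1 : g ≠ 1) : ρ g ^ 2 + ρ g + 1 = 0 := by
  have h0 : ρ g - 1 ≠ 0 := by
    rw [sub_ne_zero, ← map_one ρ]
    exact fun h => h1 (hρ h)
  refine (mul_eq_zero.1 (?_ : (ρ g - 1) * (ρ g ^ 2 + ρ g + 1) = 0)).resolve_left h0
  have : (ρ g - 1) * (ρ g ^ 2 + ρ g + 1) = ρ g ^ 3 - 1 := by
    simp only [mul_add, sub_mul, pow_succ, pow_zero, one_mul, mul_one, mul_assoc]; abel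
  rw [this, ← map_pow, hg, map_one, sub_self]

/-- An element of order three acting on a cyclic group by an automorphism of order three. -/
theorem eq_of_semiconjBy_of_pow_three (hρ : Function.Injective ρ) {x g : H} {J : ℕ}
    (h : SemiconjBy g x (x ^ J)) (hg : g ^ 3 = 1) (hJ : x ^ (1 + J + J ^ 2) = 1) : x ^ J = x := by
  by_contra hne
  have hnc : ¬ Commute g x := fun hc => hne (eq_of_semiconjBy_of_commute h hc)
  have hg1 : g ≠ 1 := fun h0 => hnc (h0 ▸ Commute.one_left x)
  have hxg1 : x * g ≠ 1 := fun h0 => hnc (by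
    rw [eq_inv_of_mul_eq_one_right h0]; exact (Commute.refl x).inv_left)
  have hgx2 : g * x ^ J = x ^ J ^ 2 * g := by
    rw [(h.pow_right J).eq, ← pow_mul, pow_two]
  have hxg3 : (x * g) ^ 3 = 1 := by
    calc (x * g) ^ 3 = x * (g * x) * (g * x) * g := by
          simp only [pow_succ, pow_zero, one_mul, mul_assoc]
      _ = x * x ^ J * (g * x ^ J) * (g * g) := by rw [h.eq]; simp only [mul_assoc]
      _ = x ^ (1 + J + J ^ 2) * g ^ 3 := by
          rw [hgx2, pow_add, pow_add, pow_one]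
          simp only [pow_succ, pow_zero, one_mul, mul_assoc]
      _ = 1 := by rw [hJ, hg, one_mul]
  have e1 := sq_add_self_add_one_eq_zero hρ hg hg1
  have e2 := sq_add_self_add_one_eq_zero hρ hxg3 hxg1
  have hba : ρ g * ρ x = ρ x ^ J * ρ g := by rw [← map_mul, h.eq, map_mul, map_pow]
  have hne' : ρ x ^ (J + 1) - ρ x ≠ 0 := by
    rw [sub_ne_zero, ← map_pow, pow_succ]
    intro h0
    have h2 := hρ h0
    refine hnc ?_
    rw [mul_eq_right] at h2
    have h3 := h.eq
    rw [h2, one_mul, mul_eq_left] at h3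
    rw [h3]; exact Commute.one_right g
  rw [map_mul] at e2
  set a := ρ x
  set b := ρ g
  have e3 : (a * b) ^ 2 = a ^ (J + 1) * b ^ 2 := by
    rw [pow_two, mul_assoc, ← mul_assoc b, hba, pow_succ' a J, pow_two]
    simp only [mul_assoc]
  have e4 : (a ^ (J + 1) - a) * b = 1 - a ^ (J + 1) := by
    have hb2 : b ^ 2 = -b - 1 := by
      rw [← sub_eq_zero, ← e1]; abel
    rw [e3, hb2, mul_sub, mul_neg, mul_one] at e2
    rw [← sub_eq_zero, ← neg_eq_zero, ← e2, sub_mul]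
    abel
  have hcab : Commute a b := by
    have hA : Commute a (a ^ (J + 1) - a) := (Commute.self_pow a _).sub_right (Commute.refl a)
    have h5 : Commute a ((a ^ (J + 1) - a) * b) := by
      rw [e4]; exact (Commute.one_right a).sub_right (Commute.self_pow a _)
    have := hA.inv_right₀.mul_right h5
    rwa [inv_mul_cancel_left₀ hne'] at this
  refine hnc (Commute.symm (hρ ?_))
  rw [map_mul, map_mul]
  exact hcab.eq

theorem orderOf_ne_prime [Finite H] (hρ : Function.Injective ρ) (hC : ConjugationRich H) (p : ℕ) :
    ∀ (_ : p.Prime) (_ : 5 ≤ p) (x : H), orderOf x ≠ p := by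
  induction p using Nat.strong_induction_on with
  | _ p ih =>
  intro hp h5 x hx
  have : Fact p.Prime := ⟨hp⟩
  have hodd := hp.eq_two_or_odd
  have h3 : p % 4 = 3 := by
    have h1 : p % 4 ≠ 1 := fun h => orderOf_ne_of_mod_four_eq_one hρ hC hp h x hx
    omega
  have hpow : ∀ {a : ℕ}, x ^ a = 1 ↔ p ∣ a := by
    intro a; rw [← orderOf_dvd_iff_pow_eq_one, hx]
  have hcast : ∀ {a : ℕ}, (a : ZMod p) = 1 → x ^ a = x := by
    intro a ha
    have : x ^ a = x ^ 1 := by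
      rw [pow_eq_pow_iff_modEq, hx, ← ZMod.natCast_eq_natCast_iff, ha, Nat.cast_one]
    rwa [pow_one] at this
  obtain ⟨q, hq, hqd⟩ := Nat.exists_prime_and_dvd (n := (p - 1) / 2) (by omega)
  have : Fact q.Prime := ⟨hq⟩
  have hq2 : q ≠ 2 := by rintro rfl; omega
  have hqp : q < p := (Nat.le_of_dvd (by omega) hqd).trans_lt (by omega)
  obtain ⟨u, hu⟩ := exists_prime_orderOf_dvd_card q (G := (ZMod p)ˣ) (by
    rw [ZMod.card_units]
    exact hqd.trans (Nat.div_dvd_of_dvd (by omega)))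
  have hcoe : ((u : ZMod p).val : ZMod p) = u := ZMod.natCast_zmod_val _
  set j := (u : ZMod p).val with hj
  have hco : j.Coprime p := ZMod.val_coe_unit_coprime u
  have hJq : x ^ (j ^ 2) ^ q = x := hcast (by
    push_cast
    rw [hcoe, ← pow_mul, mul_comm, pow_mul, ← Units.val_pow_eq_pow_val, ← hu, pow_orderOf_eq_one]
    simp)
  have hu2 : u ^ 2 ≠ 1 := fun h => by
    have := orderOf_dvd_of_pow_eq_one h
    rw [hu, Nat.prime_dvd_prime_iff_eq hq Nat.prime_two] at this
    exact hq2 this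
  have hJ1 : x ^ j ^ 2 ≠ x := fun h => by
    have h1 : x ^ j ^ 2 = x ^ 1 := by rw [h, pow_one]
    rw [pow_eq_pow_iff_modEq, hx, ← ZMod.natCast_eq_natCast_iff] at h1
    push_cast at h1
    rw [hcoe] at h1
    exact hu2 (Units.ext (by push_cast; exact h1))
  have hg : ∃ g, SemiconjBy g x (x ^ j ^ 2) := by
    obtain ⟨g, hg | hg⟩ := hC x j (by rwa [hx])
    · exact ⟨_, semiconjBy_pow_left hg 2⟩
    · refine ⟨g ^ 2, ?_⟩
      rw [pow_two, pow_two, pow_mul]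
      have := (hg.pow_right j).inv_right
      rw [inv_pow, inv_inv] at this
      exact this.mul_left hg
  obtain ⟨g₀, hg₀⟩ := hg
  obtain ⟨g, s, h, hgs⟩ := exists_semiconjBy_of_prime q (t := 1) hg₀ (by rwa [pow_one])
  have hg1 : g ≠ 1 := fun h0 => hJ1 (eq_of_semiconjBy_of_commute h (h0 ▸ Commute.one_left x))
  by_cases hq5 : 5 ≤ q
  · obtain ⟨c, -, hc⟩ := (Nat.dvd_prime_pow hq).1 (orderOf_dvd_of_pow_eq_one hgs)
    have hc0 : c ≠ 0 := by
      rintro rfl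
      exact hg1 (orderOf_eq_one_iff.1 hc)
    obtain ⟨y, hy⟩ := exists_orderOf_eq_of_dvd (x := g) (d := q) (by
      rw [hc]; exact dvd_pow_self q hc0)
    exact ih q hqp hq hq5 y hy
  · have hq3 : q = 3 := by
      have := hq.two_le
      have : q ≠ 4 := by rintro rfl; exact absurd hq (by norm_num)
      omega
    subst hq3
    refine hJ1 (eq_of_semiconjBy_of_pow_three hρ h (pow_three_eq_one_of_pow_three_pow hρ hC hgs) ?_)
    rw [hpow, ← ZMod.natCast_eq_zero_iff]
    push_cast
    rw [hcoe]
    have h6 : (u : ZMod p) ^ 3 = 1 := by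
      rw [← Units.val_pow_eq_pow_val, ← hu, pow_orderOf_eq_one, Units.val_one]
    have h7 : (u : ZMod p) ^ 2 - 1 ≠ 0 := by
      rw [sub_ne_zero]
      exact fun h => hu2 (Units.ext (by push_cast; exact h))
    refine (mul_eq_zero.1 (?_ : ((u : ZMod p) ^ 2 - 1) * _ = 0)).resolve_left h7
    linear_combination ((u : ZMod p) ^ 3 + 1) * h6

theorem orderOf_mem [Finite H] (hρ : Function.Injective ρ) (hC : ConjugationRich H) (x : H) :
    orderOf x ∈ ({1, 2, 3, 4, 6} : Set ℕ) := by
  have hno : ∀ {d : ℕ}, (∀ y : H, orderOf y ≠ d) → ¬ d ∣ orderOf x := fun hd h =>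
    let ⟨y, hy⟩ := exists_orderOf_eq_of_dvd h
    hd y hy
  have h8 := hno (orderOf_ne_eight hρ hC)
  have h9 := hno (orderOf_ne_nine hρ hC)
  have h12 := hno (orderOf_ne_twelve hρ hC)
  have hp : ∀ p : ℕ, p.Prime → 5 ≤ p → ¬ p ∣ orderOf x := fun p hp h5 =>
    hno (orderOf_ne_prime hρ hC p hp h5)
  have hpos := orderOf_pos x
  generalize orderOf x = n at *
  obtain ⟨a, m, hm, rfl⟩ := Nat.exists_eq_pow_mul_and_not_dvd hpos.ne' 2 (by norm_num)
  have hm0 : m ≠ 0 := by rintro rfl; simp at hm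
  obtain ⟨b, k, hk, rfl⟩ := Nat.exists_eq_pow_mul_and_not_dvd hm0 3 (by norm_num)
  have hk1 : k = 1 := by
    by_contra hk1
    obtain ⟨p, hpp, hpk⟩ := Nat.exists_prime_and_dvd hk1
    refine hp p hpp ?_ ((hpk.mul_left _).mul_left _)
    have h2 : p ≠ 2 := by rintro rfl; exact hm (hpk.mul_left _)
    have h3 : p ≠ 3 := by rintro rfl; exact hk hpk
    have h4 : p ≠ 4 := by rintro rfl; exact absurd hpp (by norm_num)
    have := hpp.two_le
    omega
  subst hk1
  have ha : a < 3 := by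
    by_contra h
    exact h8 ((pow_dvd_pow 2 (by omega : 3 ≤ a)).mul_right _)
  have hb : b < 2 := by
    by_contra h
    exact h9 (((pow_dvd_pow 3 (by omega : 2 ≤ b)).mul_right _).mul_left _)
  interval_cases a <;> interval_cases b <;> simp at h12 ⊢

/-- In a division ring, elements of order `1, 2, 3, 4, 6` have rational trace. -/
theorem exists_map_add_map_inv [Finite H] [Algebra ℚ D] (hρ : Function.Injective ρ)
    (hC : ConjugationRich H) (x : H) :
    ∃ r : ℚ, ρ x + ρ x⁻¹ = algebraMap ℚ D r := by
  have hx := orderOf_mem hρ hC x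
  have hpow := pow_orderOf_eq_one x
  have hlt : ∀ d : ℕ, 0 < d → d < orderOf x → x ^ d ≠ 1 := fun d h0 h1 =>
    pow_ne_one_of_lt_orderOf h0.ne' h1
  simp only [Set.mem_insert_iff, Set.mem_singleton_iff] at hx
  rcases hx with h | h | h | h | h <;> rw [h] at hpow hlt
  · refine ⟨2, ?_⟩
    rw [pow_one] at hpow
    rw [hpow, inv_one, map_one, map_ofNat, one_add_one_eq_two]
  · refine ⟨-2, ?_⟩
    have h1 : x ≠ 1 := by have := hlt 1 (by norm_num) (by norm_num); rwa [pow_one] at this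
    rw [inv_eq_of_mul_eq_one_right (b := x) (by rw [← pow_two, hpow]), map_eq_neg_one hρ hpow h1,
      map_neg, map_ofNat, ← one_add_one_eq_two]
    abel
  · refine ⟨-1, ?_⟩
    have h1 : x ≠ 1 := by have := hlt 1 (by norm_num) (by norm_num); rwa [pow_one] at this
    have h2 := sq_add_self_add_one_eq_zero hρ hpow h1
    rw [inv_eq_of_mul_eq_one_right (b := x ^ 2) (by rw [← pow_succ', hpow]), map_pow, map_neg,
      map_one, ← sub_eq_zero, ← h2]
    abel
  · refine ⟨0, ?_⟩
    have h2 := map_eq_neg_one hρ (y := x ^ 2) (by rw [← pow_mul, hpow]) (hlt 2 (by norm_num) (by norm_num))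
    rw [inv_eq_of_mul_eq_one_right (b := x ^ 2 * x) (by rw [← pow_succ, ← pow_succ', hpow]), map_mul,
      h2, map_zero]
    simp
  · refine ⟨1, ?_⟩
    have h2 := map_eq_neg_one hρ (y := x ^ 3) (by rw [← pow_mul, hpow]) (hlt 3 (by norm_num) (by norm_num))
    have h3 := sq_add_self_add_one_eq_zero hρ (g := x ^ 2) (by rw [← pow_mul, hpow])
      (hlt 2 (by norm_num) (by norm_num))
    rw [← map_pow, ← pow_mul, show 2 * 2 = 3 + 1 from rfl, pow_succ, map_mul, h2] at h3
    rw [inv_eq_of_mul_eq_one_right (b := x ^ 3 * x ^ 2) (by rw [← pow_add, ← pow_succ', hpow]), map_mul,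
      h2, map_one, ← sub_eq_zero, ← neg_eq_zero, ← h3]
    simp only [neg_mul, one_mul]
    abel

end
end FAbCut

namespace FAbCut
open MonoidAlgebra NumberField

section
variable {D : Type*} [DivisionRing D] [Algebra ℚ D]

instance charZero_center : CharZero (Subring.center D) := by
  have : CharZero D := algebraRat.charZero D
  exact ⟨fun a b h => Nat.cast_injective (R := D) (by
    have := congrArg (Subring.center D).subtype h
    simpa using this)⟩

instance finiteDimensional_center [FiniteDimensional ℚ D] :
    FiniteDimensional ℚ (Subring.center D) := by
  let f : Subring.center D →ₗ[ℚ] D :=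
    ((Subring.center D).subtype : Subring.center D →+ D).toRatLinearMap
  exact FiniteDimensional.of_injective f Subtype.val_injective

instance numberField_center [FiniteDimensional ℚ D] : NumberField (Subring.center D) where
  to_charZero := inferInstance
  to_finiteDimensional := inferInstance

instance finiteDimensional_over_center [FiniteDimensional ℚ D] :
    FiniteDimensional (Subring.center D) D :=
  Module.Finite.of_restrictScalars_finite ℚ (Subring.center D) D

instance isCentral_over_center : Algebra.IsCentral (Subring.center D) D where
  out x hx := ⟨⟨x, Subring.mem_center_iff.2 (Subalgebra.mem_center_iff.1 hx)⟩, rfl⟩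

end

section
variable {G : Type*} [Group G] [Finite G] {ι : Type*} [Finite ι] {n : ι → ℕ} [∀ i, NeZero (n i)]
  {D : ι → Type*} [∀ i, DivisionRing (D i)] [∀ i, Algebra ℚ (D i)] [∀ i, FiniteDimensional ℚ (D i)]

theorem commute_intCoe_of_mem_center {a : MonoidAlgebra ℤ G}
    (ha : a ∈ Subring.center (MonoidAlgebra ℤ G)) (y : MonoidAlgebra ℚ G) :
    Commute (intCoe G a) y := by
  induction y using MonoidAlgebra.induction_on with
  | of h =>
    have := congrArg (intCoe G) (Subring.mem_center_iff.1 ha (MonoidAlgebra.of ℤ G h))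
    rw [map_mul, map_mul] at this
    have hh : intCoe G (MonoidAlgebra.of ℤ G h) = MonoidAlgebra.of ℚ G h := by simp
    rw [hh] at this
    exact this.symm
  | add a b ha hb => exact ha.add_right hb
  | smul r a ha => exact ha.smul_right r

/-- Central units are detected, up to a finite group, by the reduced norms, which factor through
the abelianization. -/
theorem finite_units_center_of_finite_abelianization
    (e : MonoidAlgebra ℚ G ≃ₐ[ℚ] Π i, Matrix (Fin (n i)) (Fin (n i)) (D i))
    [Finite (Abelianization (MonoidAlgebra ℤ G)ˣ)] :
    Finite (Subring.center (MonoidAlgebra ℤ G))ˣ := by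
  let comp : ∀ i, MonoidAlgebra ℤ G →* Subring.center (D i) := fun i =>
    (Algebra.norm (Subring.center (D i)) (S := Matrix (Fin (n i)) (Fin (n i)) (D i))).comp
      (((Pi.evalRingHom _ i).comp (e : _ →+* Π i, Matrix (Fin (n i)) (Fin (n i)) (D i))).comp
        (intCoe G) : _ →* _)
  let N : (MonoidAlgebra ℤ G)ˣ →* Π i, (Subring.center (D i))ˣ :=
    Pi.monoidHom fun i => Units.map (comp i)
  let c : (Subring.center (MonoidAlgebra ℤ G))ˣ →* (MonoidAlgebra ℤ G)ˣ :=
    Units.map ((Subring.center (MonoidAlgebra ℤ G)).subtype : _ →* _)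
  let f := N.comp c
  have hsc : ∀ (u : (Subring.center (MonoidAlgebra ℤ G))ˣ) i, ∃ d : Subring.center (D i),
      e (intCoe G (u : Subring.center (MonoidAlgebra ℤ G))) i =
        Matrix.scalar (Fin (n i)) (d : D i) := fun u i =>
    exists_scalar_of_commute e i (commute_intCoe_of_mem_center u.1.2)
  choose s hs using hsc
  have hsinj : Function.Injective s := fun u v h => by
    refine Units.ext (Subtype.ext (intCoe_injective (e.injective (funext fun i => ?_))))
    rw [hs, hs, h]
  have hrange : Finite f.range := by
    have hN : Finite N.range := by
      refine Set.Finite.subset (Set.finite_range (Abelianization.lift N)) ?_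
      rintro _ ⟨u, rfl⟩
      exact ⟨Abelianization.of u, Abelianization.lift_apply_of N u⟩
    refine Set.Finite.subset hN ?_
    rintro _ ⟨u, rfl⟩
    exact ⟨c u, rfl⟩
  let k : ι → ℕ := fun i =>
    Module.finrank (Subring.center (D i)) (Matrix (Fin (n i)) (Fin (n i)) (D i))
  have hk : ∀ i, 0 < k i := fun i => Module.finrank_pos
  have hker : Finite f.ker := by
    have hroots : ∀ i, {z : Subring.center (D i) | z ^ k i = 1}.Finite := fun i => by
      refine (Polynomial.nthRootsFinset (k i) (1 : Subring.center (D i))).finite_toSet.subset ?_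
      intro z hz
      exact (Polynomial.mem_nthRootsFinset (hk i) _).2 hz
    have hmem : ∀ (u : f.ker) i, s u i ∈ {z : Subring.center (D i) | z ^ k i = 1} := by
      intro u i
      have h1 := congrArg (fun x : Π i, (Subring.center (D i))ˣ => (x i : Subring.center (D i))) u.2
      change Algebra.norm (Subring.center (D i)) (e (intCoe G
        ((u : (Subring.center (MonoidAlgebra ℤ G))ˣ) : Subring.center (MonoidAlgebra ℤ G))) i) = 1
        at h1
      rw [hs] at h1
      have h2 := Algebra.norm_algebraMap (S := Matrix (Fin (n i)) (Fin (n i)) (D i)) (s u i)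
      exact h2.symm.trans h1
    have := fun i => (hroots i).to_subtype
    refine Finite.of_injective (fun (u : f.ker) i =>
      (⟨s u i, hmem u i⟩ : {z : Subring.center (D i) | z ^ k i = 1})) fun u v huv => ?_
    refine Subtype.ext (hsinj (funext fun i => ?_))
    exact congrArg Subtype.val (congrFun huv i)
  have : Finite ((Subring.center (MonoidAlgebra ℤ G))ˣ ⧸ f.ker) :=
    Finite.of_equiv _ (QuotientGroup.quotientKerEquivRange f).symm.toEquiv
  exact Finite.of_subgroup_quotient f.ker

end
end FAbCut

namespace FAbCut
open MonoidAlgebra NumberField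

theorem ConjugationRich.of_surjective {G H : Type*} [Group G] [Finite G] [Group H]
    (hG : ConjugationRich G) (f : G →* H) (hf : Function.Surjective f) : ConjugationRich H := by
  intro y j hj
  obtain ⟨x, rfl⟩ := hf y
  have hd := orderOf_map_dvd f x
  have : NeZero (orderOf x) := ⟨(orderOf_pos x).ne'⟩
  obtain ⟨v, hv⟩ := ZMod.unitsMap_surjective hd (ZMod.unitOfCoprime j hj)
  obtain ⟨g, hg⟩ := hG x (v : ZMod (orderOf x)).val (ZMod.val_coe_unit_coprime v)
  have hpow : f x ^ (v : ZMod (orderOf x)).val = f x ^ j := by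
    rw [pow_eq_pow_iff_modEq, ← ZMod.natCast_eq_natCast_iff, ZMod.natCast_val]
    have := congrArg Units.val hv
    rwa [ZMod.unitsMap_val, ZMod.coe_unitOfCoprime] at this
  refine ⟨f g, hg.imp (fun h => ?_) fun h => ?_⟩
  · have := h.map f
    rwa [map_pow, hpow] at this
  · have := h.map f
    rwa [map_inv, map_pow, hpow] at this

theorem span_range_of {G : Type*} [Group G] {D : Type*} [Ring D] [Algebra ℚ D]
    (π : MonoidAlgebra ℚ G →ₐ[ℚ] D) (hπ : Function.Surjective π) :
    Submodule.span ℚ (Set.range fun g : G => π (MonoidAlgebra.of ℚ G g)) = ⊤ := by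
  rw [eq_top_iff]
  intro y _
  obtain ⟨x, rfl⟩ := hπ y
  induction x using MonoidAlgebra.induction_on with
  | of g => exact Submodule.subset_span ⟨g, rfl⟩
  | add a b ha hb => rw [map_add]; exact add_mem (ha trivial) (hb trivial)
  | smul r a ha => rw [map_smul]; exact Submodule.smul_mem _ _ (ha trivial)

theorem finite_glSubring_one {D : Type*} [DivisionRing D] (O : Subring D) [Finite Oˣ] :
    Finite (glSubring O 1) := by
  have h00 : ∀ x y : Matrix (Fin 1) (Fin 1) D, x * y = 1 → x 0 0 * y 0 0 = 1 := fun x y h => by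
    have := congrFun (congrFun h 0) 0
    rwa [Matrix.mul_apply, Fin.sum_univ_one, Matrix.one_apply_eq] at this
  refine Finite.of_injective (β := Oˣ) (fun u =>
    ⟨⟨(u : (Matrix (Fin 1) (Fin 1) D)ˣ).val 0 0, u.2.1 0 0⟩,
      ⟨(u : (Matrix (Fin 1) (Fin 1) D)ˣ).inv 0 0, u.2.2 0 0⟩,
      Subtype.ext (h00 _ _ u.1.val_inv), Subtype.ext (h00 _ _ u.1.inv_val)⟩) ?_
  intro u v h
  refine Subtype.ext (Units.ext (Matrix.ext fun i j => ?_))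
  rw [Subsingleton.elim i 0, Subsingleton.elim j 0]
  exact congrArg (fun w : Oˣ => ((w : O) : D)) h

section
variable {G : Type} [Group G] [Finite G] {D : Type} [DivisionRing D] [Algebra ℚ D]
  [FiniteDimensional ℚ D]

theorem finite_units_of_conjugationRich (hG : ConjugationRich G) {O : Subring D} {l : ℕ}
    (hO : UnitProperties O l) (π : MonoidAlgebra ℚ G →ₐ[ℚ] D) (hπ : Function.Surjective π) :
    Finite Oˣ := by
  let f : G →* Dˣ := MonoidHom.toHomUnits ((π : _ →* D).comp (MonoidAlgebra.of ℚ G))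
  have : Finite f.range := Set.finite_range f
  let ρ : f.range →* D := (Units.coeHom D).comp f.range.subtype
  have hρ : Function.Injective ρ := Units.val_injective.comp Subtype.val_injective
  have hC : ConjugationRich f.range := hG.of_surjective f.rangeRestrict f.rangeRestrict_surjective
  refine hO.finite_units_of_traces ρ ?_ (exists_map_add_map_inv hρ hC)
  rw [eq_top_iff, ← span_range_of π hπ]
  refine Submodule.span_mono ?_
  rintro _ ⟨g, rfl⟩
  exact ⟨⟨f g, g, rfl⟩, rfl⟩

/-- Each simple component of the rational group algebra of a cut group without exceptional
components of type (II) has an order with property FAb. -/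
theorem exists_order_fab_glSubring (hG : ConjugationRich G)
    [Finite (𝓞 (Subring.center D))ˣ] {n : ℕ} [NeZero n]
    (hnoexc : ¬ (n = 2 ∧ ∃ O : Subring D, Module.Finite ℤ O ∧
      Submodule.span ℚ (O : Set D) = ⊤ ∧ Finite Oˣ))
    (π : MonoidAlgebra ℚ G →ₐ[ℚ] Matrix (Fin n) (Fin n) D) (hπ : Function.Surjective π) :
    ∃ O : Subring D, Module.Finite ℤ O ∧ Submodule.span ℚ (O : Set D) = ⊤ ∧
      FAb (glSubring O n) := by
  obtain ⟨O, hfin, hspan⟩ := exists_order π hπ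
  obtain ⟨l, hl⟩ := exists_unitProperties (F := Subring.center D) O hspan
  refine ⟨O, hfin, hspan, ?_⟩
  by_cases hnl : 3 ≤ n * l
  · exact hl.fab n hnl
  have hn := NeZero.pos n
  have hlpos := hl.pos
  have hcases : n = 1 ∨ n = 2 ∧ l = 1 := by
    have h1 : n ≤ n * l := Nat.le_mul_of_pos_right n hlpos
    rcases (by omega : n = 1 ∨ n = 2) with h | h
    · exact Or.inl h
    · subst h; exact Or.inr ⟨rfl, by omega⟩
  rcases hcases with rfl | ⟨h2, h1⟩
  · let entry : Matrix (Fin 1) (Fin 1) D →ₐ[ℚ] D :=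
      { toFun := fun A => A 0 0
        map_one' := rfl
        map_mul' := fun A B => by rw [Matrix.mul_apply, Fin.sum_univ_one]
        map_zero' := rfl
        map_add' := fun _ _ => rfl
        commutes' := fun _ => rfl }
    have hentry : Function.Surjective entry := fun d => ⟨fun _ _ => d, rfl⟩
    have : Finite Oˣ :=
      finite_units_of_conjugationRich hG hl (entry.comp π) (hentry.comp hπ)
    have := finite_glSubring_one O
    exact FAb.of_finite
  · exact absurd ⟨h2, O, hfin, hspan, hl.finite_units h1⟩ hnoexc

/-- The main theorem in universe zero. -/
theorem tfae_of_no_exceptional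
    (hnoexc : ¬ ∃ (D : Type) (_ : DivisionRing D) (_ : Algebra ℚ D) (_ : FiniteDimensional ℚ D),
      (∃ O : Subring D, Module.Finite ℤ O ∧ Submodule.span ℚ (O : Set D) = ⊤ ∧ Finite Oˣ) ∧
      ∃ π : MonoidAlgebra ℚ G →ₐ[ℚ] Matrix (Fin 2) (Fin 2) D, Function.Surjective π) :
    [FAb (MonoidAlgebra ℤ G)ˣ, Finite (Abelianization (MonoidAlgebra ℤ G)ˣ),
      Finite (Subring.center (MonoidAlgebra ℤ G))ˣ].TFAE := by
  have := Fintype.ofFinite G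
  obtain ⟨m, D, n, _, _, _, hn, ⟨e⟩⟩ :=
    IsSemisimpleRing.exists_algEquiv_pi_matrix_divisionRing_finite ℚ (MonoidAlgebra ℚ G)
  tfae_have 1 → 2 := fun h => by
    have := h ⊤ inferInstance
    exact Finite.of_equiv _ (MulEquiv.abelianizationCongr Subgroup.topEquiv).toEquiv
  tfae_have 2 → 3 := fun h => finite_units_center_of_finite_abelianization e
  tfae_have 3 → 1 := fun h => by
    have hu : ∀ i, Finite (𝓞 (Subring.center (D i)))ˣ := fun i =>
      finite_units_center_integers e i
    have hG : ConjugationRich G := fun x j hj => by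
      obtain ⟨g, hg⟩ := exists_conj_of_coprime e x hj
      exact ⟨g, hg.imp (fun h => mul_inv_eq_iff_eq_mul.1 h) fun h => mul_inv_eq_iff_eq_mul.1 h⟩
    have hO : ∀ i, ∃ O : Subring (D i), Module.Finite ℤ O ∧
        Submodule.span ℚ (O : Set (D i)) = ⊤ ∧ FAb (glSubring O (n i)) := fun i => by
      let π := (Pi.evalAlgHom ℚ (fun i => Matrix (Fin (n i)) (Fin (n i)) (D i)) i).comp e.toAlgHom
      have hπ : Function.Surjective π := (Function.surjective_eval i).comp e.surjective
      refine exists_order_fab_glSubring hG ?_ π hπ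
      rintro ⟨h2, hO⟩
      refine hnoexc ⟨D i, inferInstance, inferInstance, inferInstance, hO, ?_⟩
      rw [← h2]
      exact ⟨π, hπ⟩
    choose O h1 h2 h3 using hO
    exact fab_units_of_forall_fab e O h1 h2 h3
  tfae_finish

end

end FAbCut

/-- Let `G` be a finite group such that `ℚG` has no exceptional
components of type (II): there is no surjective `ℚ`-algebra homomorphism from `ℚG` onto
`M₂(D)` for a finite-dimensional division `ℚ`-algebra `D` containing an order with finite
unit group. Then the following are equivalent: (1) `(ℤG)ˣ` has property FAb (every
finite-index subgroup has finite abelianization); (2) the abelianization of `(ℤG)ˣ` is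
finite; (3) `G` is a cut group. -/
theorem FAb_iff_finite_abelianization_iff_cut
    (G : Type*) [Group G] [Finite G]
    (hnoexc : ¬ ∃ (D : Type) (_ : DivisionRing D) (_ : Algebra ℚ D)
        (_ : FiniteDimensional ℚ D),
        (∃ O : Subring D, Module.Finite ℤ ↥O ∧ Submodule.span ℚ (O : Set D) = ⊤ ∧
          Finite (↥O)ˣ) ∧
        ∃ π : MonoidAlgebra ℚ G →ₐ[ℚ] Matrix (Fin 2) (Fin 2) D, Function.Surjective π) :
    [ (∀ H : Subgroup (MonoidAlgebra ℤ G)ˣ, H.FiniteIndex → Finite (Abelianization ↥H)),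
      Finite (Abelianization (MonoidAlgebra ℤ G)ˣ),
      Finite (↥(Subring.center (MonoidAlgebra ℤ G)))ˣ ].TFAE := by
  let f : Shrink.{0} G ≃* G := Shrink.mulEquiv
  let eQ := MonoidAlgebra.domCongr ℚ ℚ f
  let eZ := (MonoidAlgebra.domCongr ℤ ℤ f).toRingEquiv
  let eU := Units.mapEquiv eZ.toMulEquiv
  have key := FAbCut.tfae_of_no_exceptional (G := Shrink.{0} G) (by
    rintro ⟨D, _, _, _, hO, π, hπ⟩
    exact hnoexc ⟨D, inferInstance, inferInstance, inferInstance, hO,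
      π.comp eQ.symm.toAlgHom, hπ.comp eQ.symm.surjective⟩)
  have h1 : FAbCut.FAb (MonoidAlgebra ℤ (Shrink.{0} G))ˣ ↔ FAbCut.FAb (MonoidAlgebra ℤ G)ˣ :=
    ⟨fun h => h.of_surjective (eU : _ →* _) eU.surjective,
      fun h => h.of_surjective (eU.symm : _ →* _) eU.symm.surjective⟩
  have h2 := (MulEquiv.abelianizationCongr eU).toEquiv.finite_iff
  have h3 := (Units.mapEquiv (Subring.centerCongr eZ).toMulEquiv).toEquiv.finite_iff
  rw [h1, h2, h3] at key
  exact key
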